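/- Freeness over a one-dimensional base: for any integrable Lagrangian deformation F : (ℂ×ℂ^{2n},0) → (ℂⁿ,0), over a one-dimensional base, of a moment map germ defining a pyramidal reduced Lagrangian complete intersection, the first Lagrangian cohomology H¹(C·_F) is a free 𝒪₁ = ℂ{t}-module. -/

import Mathlib

open Filter Topology
open scoped Classical

/-- The ring of germs at `0` of holomorphic (analytic) functions on `E`. -/
def Og (E : Type*) [NormedAddCommGroup E] [NormedSpace ℂ E] :
    Subring (Germ (𝓝 (0 : E)) ℂ) where
  carrier := {F | ∃ g : E → ℂ, AnalyticAt ℂ g 0 ∧ F = ↑g}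
  one_mem' := ⟨fun _ => 1, analyticAt_const, rfl⟩
  zero_mem' := ⟨fun _ => 0, analyticAt_const, rfl⟩
  mul_mem' := by
    rintro F G ⟨f, hf, rfl⟩ ⟨g, hg, rfl⟩
    exact ⟨f * g, hf.mul hg, (Germ.coe_mul _ _).symm⟩
  add_mem' := by
    rintro F G ⟨f, hf, rfl⟩ ⟨g, hg, rfl⟩
    exact ⟨f + g, hf.add hg, (Germ.coe_add _ _).symm⟩
  neg_mem' := by
    rintro F ⟨f, hf, rfl⟩
    exact ⟨-f, hf.neg, (Germ.coe_neg _).symm⟩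

variable {E F G : Type*} [NormedAddCommGroup E] [NormedSpace ℂ E]
  [NormedAddCommGroup F] [NormedSpace ℂ F] [NormedAddCommGroup G] [NormedSpace ℂ G]

/-- A canonical analytic representative of a germ in `Og E`. -/
noncomputable def Og.rep (f : Og E) : E → ℂ :=
  Classical.choose (f.2 : ∃ g : E → ℂ, AnalyticAt ℂ g 0 ∧ f.1 = ↑g)

lemma Og.rep_spec (f : Og E) : AnalyticAt ℂ (Og.rep f) 0 ∧ f.1 = ↑(Og.rep f) :=
  Classical.choose_spec (f.2 : ∃ g : E → ℂ, AnalyticAt ℂ g 0 ∧ f.1 = ↑g)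

/-- Evaluation at the origin. -/
noncomputable def Og.ev0 (f : Og E) : ℂ := Og.rep f 0

/-- The germ of an analytic function (junk value `0` if not analytic at `0`). -/
noncomputable def Og.mk (g : E → ℂ) : Og E :=
  if h : AnalyticAt ℂ g 0 then ⟨↑g, g, h, rfl⟩ else 0

/-- The constant germ. -/
noncomputable def Og.const (c : ℂ) : Og E := Og.mk (fun _ => c)

/-- Directional derivative of a germ along the vector `v`. -/
noncomputable def Og.pd (v : E) (f : Og E) : Og E :=
  ⟨↑(fun z => fderiv ℂ (Og.rep f) z v),
   fun z => fderiv ℂ (Og.rep f) z v,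
   ((ContinuousLinearMap.apply ℂ ℂ v).analyticAt _).comp (Og.rep_spec f).1.fderiv, rfl⟩

/-- Pull-back of a germ under an analytic map preserving the origin
(junk value `0` otherwise). -/
noncomputable def Og.pull (u : E → F) (f : Og F) : Og E :=
  if h : AnalyticAt ℂ u 0 ∧ u 0 = 0 then
    ⟨↑(fun z => Og.rep f (u z)), fun z => Og.rep f (u z),
      ((h.2.symm ▸ (Og.rep_spec f).1 : AnalyticAt ℂ (Og.rep f) (u 0))).comp h.1, rfl⟩
  else 0

/-- Composition `ψ ∘ f` of a one-variable germ `ψ` with a germ `f` such that `f(0) = 0`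
(junk value `0` if `f(0) ≠ 0`). -/
noncomputable def Og.comp (ψ : Og ℂ) (f : Og E) : Og E :=
  if h : Og.ev0 f = 0 then
    have hψ0 : AnalyticAt ℂ (Og.rep ψ) (0 : ℂ) := (Og.rep_spec ψ).1
    ⟨↑(fun z => Og.rep ψ (Og.rep f z)), fun z => Og.rep ψ (Og.rep f z),
      (by
        have : Og.rep f 0 = 0 := h
        rw [← this] at hψ0
        exact hψ0.comp (Og.rep_spec f).1 : AnalyticAt ℂ (fun z => Og.rep ψ (Og.rep f z)) 0),
      rfl⟩
  else 0

/-! ### Lagrangian deformation theory -/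

/-- The phase space `ℂ^{2n}` with coordinates `(q,p)`. -/
abbrev PhaseC (n : ℕ) := (Fin n → ℂ) × (Fin n → ℂ)

/-- The `∂_{q_i}` direction. -/
noncomputable def qdir {n : ℕ} (i : Fin n) : PhaseC n := (Pi.single i 1, 0)
/-- The `∂_{p_i}` direction. -/
noncomputable def pdir {n : ℕ} (i : Fin n) : PhaseC n := (0, Pi.single i 1)

/-- The Poisson bracket `{g,h} = Σ_i (∂_{q_i}g ∂_{p_i}h - ∂_{p_i}g ∂_{q_i}h)` on germs
on `ℂ^{2n}`. -/
noncomputable def poisG {n : ℕ} (g h : Og (PhaseC n)) : Og (PhaseC n) :=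
  ∑ i, (Og.pd (qdir i) g * Og.pd (pdir i) h - Og.pd (pdir i) g * Og.pd (qdir i) h)

/-- The relative Poisson bracket on germs on `Λ × ℂ^{2n}`, the derivatives being taken
in the `(q,p)`-variables only. -/
noncomputable def poisP {Λ : Type*} [NormedAddCommGroup Λ] [NormedSpace ℂ Λ] {n : ℕ}
    (g h : Og (Λ × PhaseC n)) : Og (Λ × PhaseC n) :=
  ∑ i, (Og.pd (0, qdir i) g * Og.pd (0, pdir i) h -
        Og.pd (0, pdir i) g * Og.pd (0, qdir i) h)

/-- A moment map germ `(ℂ^{2n},0) → (ℂⁿ,0)`: `n` Poisson-commuting germs vanishing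
at the origin. -/
def IsMomentMap {n : ℕ} (H : Fin n → Og (PhaseC n)) : Prop :=
  (∀ i, Og.ev0 (H i) = 0) ∧ ∀ i j, poisG (H i) (H j) = 0

/-- The ideal `(H₁, …, H_n)`. -/
noncomputable def momentIdeal {n : ℕ} (H : Fin n → Og (PhaseC n)) : Ideal (Og (PhaseC n)) :=
  Ideal.span (Set.range H)

/-- `H` defines a reduced Lagrangian complete intersection:
`𝒪_{2n}/(H₁,…,H_n)` is reduced of Krull dimension `n`. -/
def IsReducedLagrangianCI {n : ℕ} (H : Fin n → Og (PhaseC n)) : Prop :=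
  IsReduced (Og (PhaseC n) ⧸ momentIdeal H) ∧
    ringKrullDim (Og (PhaseC n) ⧸ momentIdeal H) = (n : WithBot (WithTop ℕ))

/-- The standard basis directions of `ℂ^{2n}`. -/
noncomputable def phaseDir {n : ℕ} : Fin n ⊕ Fin n → PhaseC n := Sum.elim qdir pdir

/-- The ideal `I_m(DH)` of `m × m` minors of the Jacobian matrix of `H`. -/
noncomputable def minorsIdeal {n : ℕ} (H : Fin n → Og (PhaseC n)) (m : ℕ) :
    Ideal (Og (PhaseC n)) :=
  Ideal.span {x | ∃ (r : Fin m → Fin n) (c : Fin m → (Fin n ⊕ Fin n)),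
    x = Matrix.det (Matrix.of fun a b => Og.pd (phaseDir (c b)) (H (r a)))}

/-- `H` is pyramidal: for every `k < n` the Krull dimension of
`𝒪_{2n}/((H) + I_{k+1}(DH))` is at most `k`. -/
def IsPyramidal {n : ℕ} (H : Fin n → Og (PhaseC n)) : Prop :=
  ∀ m : ℕ, m < n →
    ringKrullDim (Og (PhaseC n) ⧸ (momentIdeal H ⊔ minorsIdeal H (m + 1))) ≤
      (m : WithBot (WithTop ℕ))

/-- Restriction of a germ on `Λ × ℂ^{2n}` to `{0} × ℂ^{2n}`. -/
noncomputable def slice0 {Λ : Type*} [NormedAddCommGroup Λ] [NormedSpace ℂ Λ] {n : ℕ}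
    (G : Og (Λ × PhaseC n)) : Og (PhaseC n) :=
  Og.pull (fun z : PhaseC n => ((0 : Λ), z)) G

/-- `F` is an integrable Lagrangian deformation of the moment map `H` over `(Λ,0)`:
`F(0,·) = H` and the components of `F` Poisson-commute in the `(q,p)`-variables. -/
def IsIntegrableDef {Λ : Type*} [NormedAddCommGroup Λ] [NormedSpace ℂ Λ] {n : ℕ}
    (H : Fin n → Og (PhaseC n)) (F : Fin n → Og (Λ × PhaseC n)) : Prop :=
  (∀ i, slice0 (F i) = H i) ∧ ∀ i j, poisP (F i) (F j) = 0

/-- Pull-back of a germ on the parameter space `Λ` to `Λ × ℂ^{2n}`. -/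
noncomputable def lift1 {Λ : Type*} [NormedAddCommGroup Λ] [NormedSpace ℂ Λ] {n : ℕ}
    (c : Og Λ) : Og (Λ × PhaseC n) :=
  Og.pull (Prod.fst : Λ × PhaseC n → Λ) c

/-- The ideal `(F₁, …, F_n)` of the deformation. -/
noncomputable def defIdeal {Λ : Type*} [NormedAddCommGroup Λ] [NormedSpace ℂ Λ] {n : ℕ}
    (F : Fin n → Og (Λ × PhaseC n)) : Ideal (Og (Λ × PhaseC n)) :=
  Ideal.span (Set.range F)

/-- Degree-one cocycles of the relative Lagrange complex of `F`: tuples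
`(m₁,…,m_n)` with `{m_i,F_j} - {m_j,F_i} = 0` in `𝒪_F = 𝒪/(F₁,…,F_n)`. -/
def lagCocycle1 {Λ : Type*} [NormedAddCommGroup Λ] [NormedSpace ℂ Λ] {n : ℕ}
    (F : Fin n → Og (Λ × PhaseC n)) : Set (Fin n → Og (Λ × PhaseC n)) :=
  {m | ∀ i j, poisP (m i) (F j) - poisP (m j) (F i) ∈ defIdeal F}

/-- Degree-one coboundaries (in `𝒪_F`) of the relative Lagrange complex:
tuples of the form `({h,F₁},…,{h,F_n})` modulo `(F₁,…,F_n)`. -/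
def lagCoboundary1 {Λ : Type*} [NormedAddCommGroup Λ] [NormedSpace ℂ Λ] {n : ℕ}
    (F : Fin n → Og (Λ × PhaseC n)) : Set (Fin n → Og (Λ × PhaseC n)) :=
  {m | ∃ h : Og (Λ × PhaseC n), ∀ i, m i - poisP h (F i) ∈ defIdeal F}

/-- Absolute (`Λ = 0`) degree-one cocycles of the Lagrange complex of a moment map. -/
def lagCocycle1Abs {n : ℕ} (H : Fin n → Og (PhaseC n)) : Set (Fin n → Og (PhaseC n)) :=
  {m | ∀ i j, poisG (m i) (H j) - poisG (m j) (H i) ∈ momentIdeal H}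

/-- Absolute degree-one coboundaries of the Lagrange complex of a moment map. -/
def lagCoboundary1Abs {n : ℕ} (H : Fin n → Og (PhaseC n)) :
    Set (Fin n → Og (PhaseC n)) :=
  {m | ∃ h : Og (PhaseC n), ∀ i, m i - poisG h (H i) ∈ momentIdeal H}

/-- Restriction of a germ on `ℂ^k × ℂ^{2n}` to the line `D = ℂ·v` in the parameter
space: the germ `(t, z) ↦ G (t • v, z)` on `ℂ × ℂ^{2n}`. -/
noncomputable def restrLine {k n : ℕ} (v : Fin k → ℂ) (G : Og ((Fin k → ℂ) × PhaseC n)) :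
    Og (ℂ × PhaseC n) :=
  Og.pull (fun p : ℂ × PhaseC n => (p.1 • v, p.2)) G

set_option linter.unusedSectionVars false

universe u

/-! ### The algebra of germs -/

namespace Og

lemma mk_val {g : E → ℂ} (h : AnalyticAt ℂ g 0) : (mk g).1 = (↑g : Germ (𝓝 (0 : E)) ℂ) := by
  simp [mk, h]

lemma mk_rep (f : Og E) : mk (rep f) = f :=
  Subtype.ext ((mk_val (rep_spec f).1).trans (rep_spec f).2.symm)

lemma mk_eq_mk {g h : E → ℂ} (hg : AnalyticAt ℂ g 0) (hh : AnalyticAt ℂ h 0) :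
    mk g = mk h ↔ g =ᶠ[𝓝 0] h := by
  rw [← Subtype.coe_inj, mk_val hg, mk_val hh, Germ.coe_eq]

lemma rep_mk {g : E → ℂ} (hg : AnalyticAt ℂ g 0) : rep (mk g) =ᶠ[𝓝 0] g :=
  (mk_eq_mk (rep_spec _).1 hg).1 (mk_rep _)

lemma exists_mk (f : Og E) : ∃ g : E → ℂ, AnalyticAt ℂ g 0 ∧ f = mk g :=
  ⟨rep f, (rep_spec f).1, (mk_rep f).symm⟩

lemma mk_add {g h : E → ℂ} (hg : AnalyticAt ℂ g 0) (hh : AnalyticAt ℂ h 0) :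
    mk (fun z => g z + h z) = mk g + mk h :=
  Subtype.ext (by
    rw [mk_val (hg.fun_add hh), Subring.coe_add, mk_val hg, mk_val hh]; rfl)

lemma mk_mul {g h : E → ℂ} (hg : AnalyticAt ℂ g 0) (hh : AnalyticAt ℂ h 0) :
    mk (fun z => g z * h z) = mk g * mk h :=
  Subtype.ext (by
    rw [mk_val (hg.fun_mul hh), Subring.coe_mul, mk_val hg, mk_val hh]; rfl)

lemma mk_one : mk (fun _ : E => (1 : ℂ)) = 1 :=
  Subtype.ext (by rw [mk_val analyticAt_const]; rfl)

lemma mk_zero : mk (fun _ : E => (0 : ℂ)) = 0 :=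
  Subtype.ext (by rw [mk_val analyticAt_const]; rfl)

/-- Evaluation at the origin as a ring homomorphism. -/
noncomputable def ev (E : Type*) [NormedAddCommGroup E] [NormedSpace ℂ E] : Og E →+* ℂ where
  toFun := ev0
  map_one' := by
    rw [← mk_one]; exact (rep_mk analyticAt_const).eq_of_nhds
  map_zero' := by
    rw [← mk_zero]; exact (rep_mk analyticAt_const).eq_of_nhds
  map_add' f g := by
    obtain ⟨f, hf, rfl⟩ := exists_mk f
    obtain ⟨g, hg, rfl⟩ := exists_mk g
    rw [← mk_add hf hg, ev0, ev0, ev0, (rep_mk (hf.fun_add hg)).eq_of_nhds,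
      (rep_mk hf).eq_of_nhds, (rep_mk hg).eq_of_nhds]
  map_mul' f g := by
    obtain ⟨f, hf, rfl⟩ := exists_mk f
    obtain ⟨g, hg, rfl⟩ := exists_mk g
    rw [← mk_mul hf hg, ev0, ev0, ev0, (rep_mk (hf.fun_mul hg)).eq_of_nhds,
      (rep_mk hf).eq_of_nhds, (rep_mk hg).eq_of_nhds]

lemma ev_mk {g : E → ℂ} (hg : AnalyticAt ℂ g 0) : ev E (mk g) = g 0 :=
  (rep_mk hg).eq_of_nhds

/-- The germ of constants as a ring homomorphism. -/
noncomputable def constHom (E : Type*) [NormedAddCommGroup E] [NormedSpace ℂ E] : ℂ →+* Og E where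
  toFun := const
  map_one' := mk_one
  map_zero' := mk_zero
  map_add' _ _ := mk_add analyticAt_const analyticAt_const
  map_mul' _ _ := mk_mul analyticAt_const analyticAt_const

noncomputable instance : Algebra ℂ (Og E) := (constHom E).toAlgebra

lemma algebraMap_eq (c : ℂ) : algebraMap ℂ (Og E) c = mk fun _ => c := rfl

lemma smul_mk (c : ℂ) {g : E → ℂ} (hg : AnalyticAt ℂ g 0) : c • mk g = mk fun z => c * g z := by
  rw [Algebra.smul_def, algebraMap_eq, mk_mul analyticAt_const hg]

@[simp] lemma ev_algebraMap (c : ℂ) : ev E (algebraMap ℂ (Og E) c) = c := ev_mk analyticAt_const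

@[simp] lemma ev_smul (c : ℂ) (f : Og E) : ev E (c • f) = c * ev E f := by
  rw [Algebra.smul_def, map_mul, ev_algebraMap]

instance : Nontrivial (Og E) := (ev E).domain_nontrivial

lemma isUnit_iff {f : Og E} : IsUnit f ↔ ev E f ≠ 0 := by
  refine ⟨fun h => (h.map (ev E)).ne_zero, fun h => ?_⟩
  obtain ⟨f, hf, rfl⟩ := exists_mk f
  rw [ev_mk hf] at h
  refine IsUnit.of_mul_eq_one (mk fun z => (f z)⁻¹) ?_
  rw [← mk_mul hf (hf.fun_inv h), ← mk_one, mk_eq_mk (hf.fun_mul (hf.fun_inv h)) analyticAt_const]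
  filter_upwards [hf.continuousAt.eventually_ne h] with z hz using mul_inv_cancel₀ hz

instance : IsLocalRing (Og E) :=
  IsLocalRing.of_nonunits_add fun a b ha hb => by
    simp only [mem_nonunits_iff, isUnit_iff, not_not] at *
    rw [map_add, ha, hb, add_zero]

lemma mem_max {f : Og E} : f ∈ IsLocalRing.maximalIdeal (Og E) ↔ ev E f = 0 := by
  rw [IsLocalRing.mem_maximalIdeal, mem_nonunits_iff, isUnit_iff, not_not]

instance : IsDomain (Og E) := by
  have : NoZeroDivisors (Og E) := ⟨by
    intro a b hab
    obtain ⟨f, hf, rfl⟩ := exists_mk a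
    obtain ⟨g, hg, rfl⟩ := exists_mk b
    rw [← mk_mul hf hg, ← mk_zero, mk_eq_mk (hf.fun_mul hg) analyticAt_const] at hab
    obtain ⟨r, hr, hfr⟩ := hf.exists_ball_analyticOnNhd
    obtain ⟨s, hs, hgs⟩ := hg.exists_ball_analyticOnNhd
    obtain ⟨t, ht, hfg⟩ := Metric.eventually_nhds_iff_ball.1 hab
    set ρ := min (min r s) t
    have hρ : 0 < ρ := by positivity
    by_cases h0 : ∀ z ∈ Metric.ball (0 : E) ρ, g z = 0
    · right
      rw [← mk_zero, mk_eq_mk hg analyticAt_const]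
      exact Filter.mem_of_superset (Metric.ball_mem_nhds _ hρ) h0
    · left
      push Not at h0
      obtain ⟨z, hz, hgz⟩ := h0
      have h1 : f =ᶠ[𝓝 z] 0 := by
        have h2 : ∀ᶠ w in 𝓝 z, g w ≠ 0 :=
          (hgs z (Metric.ball_subset_ball ((min_le_left _ _).trans (min_le_right _ _))
            hz)).continuousAt.eventually_ne hgz
        filter_upwards [h2, Metric.isOpen_ball.mem_nhds hz] with w hw hwb
        have := hfg w (Metric.ball_subset_ball (min_le_right _ _) hwb)
        exact (mul_eq_zero.1 this).resolve_right hw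
      have h3 := (hfr.mono (Metric.ball_subset_ball
        ((min_le_left _ _).trans (min_le_left _ _)) :
          Metric.ball (0 : E) ρ ⊆ _)).eqOn_zero_of_preconnected_of_eventuallyEq_zero
        (convex_ball _ _).isPreconnected hz h1
      rw [← mk_zero, mk_eq_mk hf analyticAt_const]
      exact Filter.mem_of_superset (Metric.ball_mem_nhds _ hρ) h3⟩
  exact NoZeroDivisors.to_isDomain _

/-! ### Pull-back along linear maps -/

lemma pull_mk {u : E → F} (hu : AnalyticAt ℂ u 0) (hu0 : u 0 = 0) {g : F → ℂ}
    (hg : AnalyticAt ℂ g 0) : pull u (mk g) = mk (fun z => g (u z)) := by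
  have hgu : AnalyticAt ℂ (fun z => g (u z)) 0 :=
    AnalyticAt.comp (g := g) (f := u) (by rwa [hu0]) hu
  refine Subtype.ext ?_
  rw [mk_val hgu, pull, dif_pos ⟨hu, hu0⟩]
  refine Germ.coe_eq.2 ?_
  have : Tendsto u (𝓝 0) (𝓝 0) := by simpa [hu0] using hu.continuousAt.tendsto
  exact this.eventually (rep_mk hg)

/-- Pull-back along a continuous linear map, as an algebra homomorphism. -/
noncomputable def pl (L : E →L[ℂ] F) : Og F →ₐ[ℂ] Og E where
  toFun := pull L
  map_one' := by
    rw [← mk_one, pull_mk (L.analyticAt 0) (map_zero L) analyticAt_const, mk_one]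
  map_zero' := by
    rw [← mk_zero, pull_mk (L.analyticAt 0) (map_zero L) analyticAt_const, mk_zero]
  map_add' f g := by
    obtain ⟨f, hf, rfl⟩ := exists_mk f
    obtain ⟨g, hg, rfl⟩ := exists_mk g
    have hL := L.analyticAt 0
    have h0 := map_zero L
    have h1 : AnalyticAt ℂ (fun z => f (L z)) 0 :=
      AnalyticAt.comp (g := f) (f := L) (by rwa [h0]) hL
    have h2 : AnalyticAt ℂ (fun z => g (L z)) 0 :=
      AnalyticAt.comp (g := g) (f := L) (by rwa [h0]) hL
    rw [← mk_add hf hg, pull_mk hL h0 (hf.fun_add hg), pull_mk hL h0 hf, pull_mk hL h0 hg,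
      ← mk_add h1 h2]
  map_mul' f g := by
    obtain ⟨f, hf, rfl⟩ := exists_mk f
    obtain ⟨g, hg, rfl⟩ := exists_mk g
    have hL := L.analyticAt 0
    have h0 := map_zero L
    have h1 : AnalyticAt ℂ (fun z => f (L z)) 0 :=
      AnalyticAt.comp (g := f) (f := L) (by rwa [h0]) hL
    have h2 : AnalyticAt ℂ (fun z => g (L z)) 0 :=
      AnalyticAt.comp (g := g) (f := L) (by rwa [h0]) hL
    rw [← mk_mul hf hg, pull_mk hL h0 (hf.fun_mul hg), pull_mk hL h0 hf, pull_mk hL h0 hg,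
      ← mk_mul h1 h2]
  commutes' c := pull_mk (L.analyticAt 0) (map_zero L) analyticAt_const

lemma pl_apply (L : E →L[ℂ] F) (f : Og F) : pl L f = pull L f := rfl

lemma comp_analyticAt (L : E →L[ℂ] F) {g : F → ℂ} (hg : AnalyticAt ℂ g 0) :
    AnalyticAt ℂ (fun z => g (L z)) 0 :=
  AnalyticAt.comp (g := g) (f := L) (by rwa [map_zero L]) (L.analyticAt 0)

lemma pl_mk (L : E →L[ℂ] F) {g : F → ℂ} (hg : AnalyticAt ℂ g 0) :
    pl L (mk g) = mk (fun z => g (L z)) := pull_mk (L.analyticAt 0) (map_zero L) hg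

lemma pl_pl (L : E →L[ℂ] F) (M : F →L[ℂ] G) (f : Og G) : pl L (pl M f) = pl (M.comp L) f := by
  obtain ⟨f, hf, rfl⟩ := exists_mk f
  rw [pl_mk M hf, pl_mk L (comp_analyticAt M hf), pl_mk _ hf]; rfl

lemma pl_id (f : Og E) : pl (ContinuousLinearMap.id ℂ E) f = f := by
  obtain ⟨f, hf, rfl⟩ := exists_mk f
  rw [pl_mk _ hf]; rfl

@[simp] lemma ev_pl (L : E →L[ℂ] F) (f : Og F) : ev E (pl L f) = ev F f := by
  obtain ⟨f, hf, rfl⟩ := exists_mk f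
  rw [pl_mk _ hf, ev_mk hf, ev_mk (comp_analyticAt L hf), map_zero]

lemma pl_zero_map (f : Og F) : pl (0 : E →L[ℂ] F) f = algebraMap ℂ _ (ev F f) := by
  obtain ⟨f, hf, rfl⟩ := exists_mk f
  rw [pl_mk _ hf, ev_mk hf]; rfl

/-- The germ of a linear form. -/
noncomputable def lin (l : E →L[ℂ] ℂ) : Og E := mk l

lemma pl_lin (L : E →L[ℂ] F) (l : F →L[ℂ] ℂ) : pl L (lin l) = lin (l.comp L) :=
  pl_mk L (l.analyticAt 0)

@[simp] lemma ev_lin (l : E →L[ℂ] ℂ) : ev E (lin l) = 0 := by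
  rw [lin, ev_mk (l.analyticAt 0), map_zero]

lemma lin_add (l m : E →L[ℂ] ℂ) : lin (l + m) = lin l + lin m :=
  mk_add (l.analyticAt 0) (m.analyticAt 0)

lemma lin_smul (c : ℂ) (l : E →L[ℂ] ℂ) : lin (c • l) = c • lin l :=
  (smul_mk c (l.analyticAt 0)).symm

/-- The linear forms, as a linear map into the ring of germs. -/
noncomputable def linHom (E : Type*) [NormedAddCommGroup E] [NormedSpace ℂ E] :
    (E →L[ℂ] ℂ) →ₗ[ℂ] Og E where
  toFun := lin
  map_add' := lin_add
  map_smul' := lin_smul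

@[simp] lemma linHom_apply (l : E →L[ℂ] ℂ) : linHom E l = lin l := rfl

lemma lin_sum {ι : Type*} (s : Finset ι) (l : ι → E →L[ℂ] ℂ) :
    lin (∑ i ∈ s, l i) = ∑ i ∈ s, lin (l i) := map_sum (linHom E) l s

lemma lin_injective : Function.Injective (lin : (E →L[ℂ] ℂ) → Og E) := by
  intro l m h
  rw [lin, lin, mk_eq_mk (l.analyticAt 0) (m.analyticAt 0)] at h
  have h1 := h.fderiv_eq (𝕜 := ℂ)
  simpa using h1

/-! ### Directional derivatives -/

lemma pd_mk (v : E) {g : E → ℂ} (hg : AnalyticAt ℂ g 0) :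
    pd v (mk g) = mk (fun z => fderiv ℂ g z v) := by
  have h1 : AnalyticAt ℂ (fun z => fderiv ℂ g z v) 0 :=
    ((ContinuousLinearMap.apply ℂ ℂ v).analyticAt _).comp hg.fderiv
  refine Subtype.ext ?_
  rw [mk_val h1, pd]
  refine Germ.coe_eq.2 ?_
  filter_upwards [(rep_mk hg).fderiv (𝕜 := ℂ)] with z hz
  rw [hz]

lemma fderiv_analyticAt (v : E) {g : E → ℂ} (hg : AnalyticAt ℂ g 0) :
    AnalyticAt ℂ (fun z => fderiv ℂ g z v) 0 :=
  ((ContinuousLinearMap.apply ℂ ℂ v).analyticAt _).comp hg.fderiv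

/-- The directional derivative as a derivation. -/
noncomputable def der (v : E) : Derivation ℂ (Og E) (Og E) :=
  Derivation.mk'
    { toFun := pd v
      map_add' := by
        intro f g
        obtain ⟨f, hf, rfl⟩ := exists_mk f
        obtain ⟨g, hg, rfl⟩ := exists_mk g
        rw [← mk_add hf hg, pd_mk v (hf.fun_add hg), pd_mk v hf, pd_mk v hg,
          ← mk_add (fderiv_analyticAt v hf) (fderiv_analyticAt v hg),
          mk_eq_mk (fderiv_analyticAt v (hf.fun_add hg))
            ((fderiv_analyticAt v hf).fun_add (fderiv_analyticAt v hg))]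
        filter_upwards [hf.eventually_analyticAt, hg.eventually_analyticAt] with z h1 h2
        rw [fderiv_fun_add h1.differentiableAt h2.differentiableAt]; rfl
      map_smul' := by
        intro c f
        obtain ⟨f, hf, rfl⟩ := exists_mk f
        rw [RingHom.id_apply, smul_mk c hf, pd_mk v (analyticAt_const.fun_mul hf), pd_mk v hf,
          smul_mk c (fderiv_analyticAt v hf),
          mk_eq_mk (fderiv_analyticAt v (analyticAt_const.fun_mul hf))
            (analyticAt_const.fun_mul (fderiv_analyticAt v hf))]
        filter_upwards [hf.eventually_analyticAt] with z h1
        rw [fderiv_const_mul h1.differentiableAt]; rfl }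
    (by
      intro f g
      obtain ⟨f, hf, rfl⟩ := exists_mk f
      obtain ⟨g, hg, rfl⟩ := exists_mk g
      simp only [LinearMap.coe_mk, AddHom.coe_mk, smul_eq_mul]
      have hf' := fderiv_analyticAt v hf
      have hg' := fderiv_analyticAt v hg
      rw [← mk_mul hf hg, pd_mk v (hf.fun_mul hg), pd_mk v hf, pd_mk v hg, ← mk_mul hf hg',
        ← mk_mul hg hf', ← mk_add (hf.fun_mul hg') (hg.fun_mul hf'),
        mk_eq_mk (fderiv_analyticAt v (hf.fun_mul hg))
          ((hf.fun_mul hg').fun_add (hg.fun_mul hf'))]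
      filter_upwards [hf.eventually_analyticAt, hg.eventually_analyticAt] with z h1 h2
      rw [fderiv_fun_mul h1.differentiableAt h2.differentiableAt]; rfl)

lemma der_apply (v : E) (f : Og E) : der v f = pd v f := rfl

lemma der_mk (v : E) {g : E → ℂ} (hg : AnalyticAt ℂ g 0) :
    der v (mk g) = mk (fun z => fderiv ℂ g z v) := pd_mk v hg

lemma der_lin (v : E) (l : E →L[ℂ] ℂ) : der v (lin l) = algebraMap ℂ _ (l v) := by
  rw [lin, der_mk v (l.analyticAt 0)]
  simp only [ContinuousLinearMap.fderiv]; rfl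

lemma der_add_dir (v w : E) (f : Og E) : der (v + w) f = der v f + der w f := by
  obtain ⟨f, hf, rfl⟩ := exists_mk f
  rw [der_mk _ hf, der_mk _ hf, der_mk _ hf,
    ← mk_add (fderiv_analyticAt v hf) (fderiv_analyticAt w hf)]
  simp only [map_add]

lemma der_smul_dir (c : ℂ) (v : E) (f : Og E) : der (c • v) f = c • der v f := by
  obtain ⟨f, hf, rfl⟩ := exists_mk f
  rw [der_mk _ hf, der_mk _ hf, smul_mk c (fderiv_analyticAt v hf)]
  simp only [map_smul, smul_eq_mul]

lemma der_pl (L : E →L[ℂ] F) (v : E) (f : Og F) : der v (pl L f) = pl L (der (L v) f) := by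
  obtain ⟨f, hf, rfl⟩ := exists_mk f
  rw [pl_mk L hf, der_mk v (comp_analyticAt L hf), der_mk _ hf, pl_mk L (fderiv_analyticAt _ hf),
    mk_eq_mk (fderiv_analyticAt _ (comp_analyticAt L hf))
      (comp_analyticAt L (fderiv_analyticAt _ hf))]
  have hL : Tendsto L (𝓝 0) (𝓝 0) := by simpa using (L.continuous.tendsto 0)
  filter_upwards [hL.eventually hf.eventually_analyticAt] with z hz
  rw [show (fun z => f (L z)) = f ∘ L from rfl,
    fderiv_comp z hz.differentiableAt L.differentiableAt, ContinuousLinearMap.fderiv]; rfl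

lemma der_comm (v w : E) (f : Og E) : der v (der w f) = der w (der v f) := by
  obtain ⟨f, hf, rfl⟩ := exists_mk f
  have hv := fderiv_analyticAt v hf
  have hw := fderiv_analyticAt w hf
  rw [der_mk v hf, der_mk w hf, der_mk v hw, der_mk w hv,
    mk_eq_mk (fderiv_analyticAt v hw) (fderiv_analyticAt w hv)]
  filter_upwards [hf.eventually_analyticAt] with z hz
  have h1 : DifferentiableAt ℂ (fderiv ℂ f) z := hz.fderiv.differentiableAt
  rw [fderiv_clm_apply h1 (differentiableAt_const _), fderiv_clm_apply h1 (differentiableAt_const _)]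
  have h2 := hz.contDiffAt (n := 2) |>.isSymmSndFDerivAt (by simp)
  simpa using h2.eq v w

end Og

/-! ### Absolutely summable sequences -/

/-- Absolutely summable sequences in a normed space. -/
abbrev L1 (X : Type*) [NormedAddCommGroup X] := lp (fun _ : ℕ => X) 1

namespace L1

variable {X X' Z : Type*} [NormedAddCommGroup X] [NormedSpace ℂ X] [CompleteSpace X]
  [NormedAddCommGroup X'] [NormedSpace ℂ X'] [CompleteSpace X']
  [NormedAddCommGroup Z] [NormedSpace ℂ Z] [CompleteSpace Z]

lemma hasSum_norm (b : L1 X) : HasSum (fun k => ‖b k‖) ‖b‖ := by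
  simpa using lp.hasSum_norm (p := 1) (by simp) b

/-- The `k`-th coefficient sequence. -/
noncomputable def single (k : ℕ) : X →L[ℂ] L1 X :=
  LinearMap.mkContinuous (lp.lsingle (𝕜 := ℂ) (E := fun _ : ℕ => X) 1 k) 1 fun x => by
    rw [one_mul]; exact (lp.norm_single (E := fun _ : ℕ => X) (p := 1) (by simp) k x).le

lemma single_apply (k : ℕ) (x : X) (j : ℕ) : single k x j = if j = k then x else 0 := by
  change (Pi.single k x : ℕ → X) j = _
  rw [Pi.single_apply]

lemma norm_single_le (k : ℕ) : ‖(single k : X →L[ℂ] L1 X)‖ ≤ 1 :=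
  LinearMap.mkContinuous_norm_le _ zero_le_one _

lemma hasSum_single (b : L1 X) : HasSum (fun k => single k (b k)) b :=
  lp.hasSum_single (E := fun _ : ℕ => X) (p := 1) (by simp) b

lemma clm_ext {A B : L1 X →L[ℂ] Z} (h : ∀ k x, A (single k x) = B (single k x)) : A = B := by
  ext b
  have h1 := (hasSum_single b).mapL A
  have h2 := (hasSum_single b).mapL B
  simp only [h] at h1
  exact h1.unique h2

/-- The operator given by a bounded sequence of operators. -/
noncomputable def lift (T : ℕ → X →L[ℂ] Z) (K : ℝ) (h : ∀ k, ‖T k‖ ≤ K) : L1 X →L[ℂ] Z :=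
  LinearMap.mkContinuous
    { toFun := fun b => ∑' k, T k (b k)
      map_add' := by
        intro a b
        have hs : ∀ b : L1 X, Summable fun k => T k (b k) := fun b =>
          Summable.of_norm_bounded ((hasSum_norm b).summable.mul_left K)
            fun k => (T k).le_of_opNorm_le (h k) _
        rw [← (hs a).tsum_add (hs b)]
        simp
      map_smul' := by
        intro c b
        rw [RingHom.id_apply, ← tsum_const_smul'']
        simp } K
    (by
      intro b
      have h1 : ∀ k, ‖T k (b k)‖ ≤ K * ‖b k‖ := fun k => (T k).le_of_opNorm_le (h k) _
      exact tsum_of_norm_bounded ((hasSum_norm b).mul_left K) h1)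

lemma lift_apply (T : ℕ → X →L[ℂ] Z) (K : ℝ) (h : ∀ k, ‖T k‖ ≤ K) (b : L1 X) :
    lift T K h b = ∑' k, T k (b k) := rfl

lemma norm_lift_le (T : ℕ → X →L[ℂ] Z) (K : ℝ) (h : ∀ k, ‖T k‖ ≤ K) : ‖lift T K h‖ ≤ K :=
  LinearMap.mkContinuous_norm_le _ ((norm_nonneg _).trans (h 0)) _

@[simp] lemma lift_single (T : ℕ → X →L[ℂ] Z) (K : ℝ) (h : ∀ k, ‖T k‖ ≤ K) (k : ℕ) (x : X) :
    lift T K h (single k x) = T k x := by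
  rw [lift_apply, tsum_eq_single k]
  · simp [single_apply]
  · intro j hj
    simp [single_apply, hj]

/-- The `k`-th coefficient. -/
noncomputable def coef (k : ℕ) : L1 X →L[ℂ] X :=
  lift (fun j => if j = k then ContinuousLinearMap.id ℂ X else 0) 1 fun j => by
    split_ifs
    · exact ContinuousLinearMap.norm_id_le
    · simp

lemma coef_apply (k : ℕ) (b : L1 X) : coef k b = b k := by
  rw [coef, lift_apply, tsum_eq_single k]
  · simp
  · intro j hj
    simp [hj]

/-- The coefficients of the evaluation map as a power series. -/
noncomputable def evSeries (X : Type*) [NormedAddCommGroup X] [NormedSpace ℂ X] [CompleteSpace X] :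
    FormalMultilinearSeries ℂ ℂ (L1 X →L[ℂ] X) :=
  fun k => ContinuousMultilinearMap.mkPiRing ℂ (Fin k) (coef k)

lemma norm_id_smul_le (c : ℂ) : ‖c • ContinuousLinearMap.id ℂ X‖ ≤ ‖c‖ := by
  rw [norm_smul]
  exact mul_le_of_le_one_right (norm_nonneg _) ContinuousLinearMap.norm_id_le

lemma norm_coef_le (k : ℕ) : ‖(coef k : L1 X →L[ℂ] X)‖ ≤ 1 := norm_lift_le _ _ _

lemma one_le_radius : 1 ≤ (evSeries X).radius := by
  have := (evSeries X).le_radius_of_bound 1 (r := 1) fun n => by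
    rw [evSeries, ContinuousMultilinearMap.norm_mkPiRing]
    simpa using norm_coef_le n
  simpa using this

/-- Evaluation of a power series with absolutely summable coefficients. -/
noncomputable def evL (x : ℂ) : L1 X →L[ℂ] X := (evSeries X).sum x

lemma evL_hasFPowerSeriesOnBall :
    HasFPowerSeriesOnBall (evL : ℂ → L1 X →L[ℂ] X) (evSeries X) 0 1 :=
  ((evSeries X).hasFPowerSeriesOnBall (zero_lt_one.trans_le one_le_radius)).mono zero_lt_one
    one_le_radius

lemma evL_analyticAt {x : ℂ} (hx : ‖x‖ < 1) : AnalyticAt ℂ (evL : ℂ → L1 X →L[ℂ] X) x :=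
  evL_hasFPowerSeriesOnBall.analyticAt_of_mem (by
    rw [mem_eball_zero_iff, ← enorm_norm, Real.enorm_eq_ofReal (norm_nonneg _)]
    exact (ENNReal.ofReal_lt_one).2 hx)

lemma evL_hasSum {x : ℂ} (hx : ‖x‖ < 1) (b : L1 X) :
    HasSum (fun k => x ^ k • b k) (evL x b) := by
  have h := evL_hasFPowerSeriesOnBall (X := X) |>.hasSum (y := x) (by
    rw [mem_eball_zero_iff, ← enorm_norm, Real.enorm_eq_ofReal (norm_nonneg _)]
    exact (ENNReal.ofReal_lt_one).2 hx)
  have h2 := h.mapL (ContinuousLinearMap.apply ℂ X b)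
  simpa [evSeries, coef_apply] using h2

@[simp] lemma evL_single {x : ℂ} (hx : ‖x‖ < 1) (k : ℕ) (v : X) :
    evL x (single k v) = x ^ k • v := by
  refine (evL_hasSum hx _).unique ?_
  convert hasSum_ite_eq k (x ^ k • v) using 2 with j
  rw [single_apply]
  split_ifs with h
  · rw [h]
  · simp

lemma norm_single_comp_le (k : ℕ) (T : X →L[ℂ] X') : ‖(single k).comp T‖ ≤ ‖T‖ :=
  (ContinuousLinearMap.opNorm_comp_le _ _).trans
    (mul_le_of_le_one_left (norm_nonneg _) (norm_single_le _))

/-- Shift operator composed with an operator on coefficients. -/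
noncomputable def shiftMap (k : ℕ) : (X →L[ℂ] X') →L[ℂ] (L1 X →L[ℂ] L1 X') :=
  LinearMap.mkContinuous
    { toFun := fun T => lift (fun j => (single (j + k)).comp T) ‖T‖
        fun j => norm_single_comp_le _ T
      map_add' := fun S T => clm_ext fun j x => by simp
      map_smul' := fun c T => clm_ext fun j x => by simp } 1
    fun T => by
      rw [one_mul]
      exact norm_lift_le _ _ fun j => norm_single_comp_le _ T

@[simp] lemma shiftMap_single (k : ℕ) (T : X →L[ℂ] X') (j : ℕ) (x : X) :
    shiftMap k T (single j x) = single (j + k) (T x) :=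
  lift_single _ _ (fun j => norm_single_comp_le (j + k) T) _ _

lemma norm_shiftMap_le (k : ℕ) :
    ‖(shiftMap k : (X →L[ℂ] X') →L[ℂ] (L1 X →L[ℂ] L1 X'))‖ ≤ 1 :=
  LinearMap.mkContinuous_norm_le _ zero_le_one _

/-- Multiplication (convolution) of power series. -/
noncomputable def mulL : L1 (X →L[ℂ] X') →L[ℂ] (L1 X →L[ℂ] L1 X') :=
  lift shiftMap 1 norm_shiftMap_le

@[simp] lemma mulL_single_single (k : ℕ) (T : X →L[ℂ] X') (j : ℕ) (x : X) :
    mulL (single k T) (single j x) = single (j + k) (T x) := by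
  rw [mulL, lift_single, shiftMap_single]

lemma norm_mulL_le (a : L1 (X →L[ℂ] X')) : ‖mulL a‖ ≤ ‖a‖ := by
  have := (mulL (X := X) (X' := X')).le_of_opNorm_le (c := 1) (norm_lift_le _ _ _) a
  simpa using this

lemma evL_mulL {x : ℂ} (hx : ‖x‖ < 1) (a : L1 (X →L[ℂ] X')) (b : L1 X) :
    evL x (mulL a b) = evL x a (evL x b) := by
  have h : ((ContinuousLinearMap.compL ℂ _ _ _ (evL x : L1 X' →L[ℂ] X')).comp mulL) =
      ((ContinuousLinearMap.compL ℂ _ _ _).flip (evL x : L1 X →L[ℂ] X)).comp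
        (evL x : L1 (X →L[ℂ] X') →L[ℂ] (X →L[ℂ] X')) := by
    refine clm_ext fun k T => clm_ext fun j v => ?_
    simp only [ContinuousLinearMap.comp_apply, ContinuousLinearMap.compL_apply, mulL_single_single,
      ContinuousLinearMap.flip_apply, evL_single hx, map_smul, smul_smul, pow_add, smul_apply]
    rw [mul_comm]
  exact congrArg (fun A => A a b) h

/-- Rescaling of the variable. -/
noncomputable def scale (c : ℝ) (h0 : 0 ≤ c) (h1 : c ≤ 1) : L1 X →L[ℂ] L1 X :=
  lift (fun k => ((c : ℂ) ^ k) • single k) 1 fun k => by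
    rw [norm_smul, norm_pow, Complex.norm_real, Real.norm_of_nonneg h0]
    exact mul_le_one₀ (pow_le_one₀ h0 h1) (norm_nonneg _) (norm_single_le _)

lemma evL_scale {x : ℂ} (hx : ‖x‖ < 1) (c : ℝ) (h0 : 0 ≤ c) (h1 : c ≤ 1) (b : L1 X) :
    evL x (scale c h0 h1 b) = evL (x * c) b := by
  have hc : ‖x * c‖ < 1 := by
    rw [norm_mul, Complex.norm_real, Real.norm_of_nonneg h0]
    exact mul_lt_one_of_nonneg_of_lt_one_left (norm_nonneg _) hx h1
  have h : (evL x).comp (scale (X := X) c h0 h1) = evL (x * c) :=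
    clm_ext fun k v => by
      rw [ContinuousLinearMap.comp_apply, scale, lift_single, smul_apply, map_smul,
        evL_single hx, evL_single hc, smul_smul, mul_pow, mul_comm]
  exact congrArg (fun A => A b) h

/-- Termwise integration. -/
noncomputable def integ : L1 X →L[ℂ] L1 X :=
  lift (fun k => ((k + 1 : ℂ)⁻¹) • single (k + 1)) 1 fun k => by
    rw [norm_smul, norm_inv]
    refine mul_le_one₀ (inv_le_one_of_one_le₀ ?_) (norm_nonneg _) (norm_single_le _)
    have : ‖(k + 1 : ℂ)‖ = k + 1 := by
      rw [← Nat.cast_one, ← Nat.cast_add, Complex.norm_natCast]; simp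
    rw [this]; simp

lemma hasDerivAt_evL_integ {x : ℂ} (hx : ‖x‖ < 1) (b : L1 X) :
    HasDerivAt (fun x => evL x (integ b)) (evL x b) x := by
  obtain ⟨D, hD⟩ : ∃ D, HasDerivAt (evL : ℂ → L1 X →L[ℂ] X) D x :=
    ⟨_, (evL_analyticAt hx).differentiableAt.hasDerivAt⟩
  have h1 : ∀ c, HasDerivAt (fun x => evL x c) (D c) x := fun c =>
    hD.clm_apply (hasDerivAt_const x c) |>.congr_deriv (by simp)
  have h2 : D.comp integ = evL x := by
    refine clm_ext fun k v => ?_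
    refine (h1 (integ (single k v))).unique ?_
    have h3 : HasDerivAt (fun x : ℂ => x ^ (k + 1) • (((k + 1 : ℂ)⁻¹) • v)) (x ^ k • v) x := by
      convert ((hasDerivAt_pow (k + 1) x).smul_const (((k + 1 : ℂ)⁻¹) • v)) using 1
      have : (k + 1 : ℂ) ≠ 0 := by exact_mod_cast Nat.succ_ne_zero k
      rw [smul_smul]
      congr 1
      push_cast
      field_simp
    rw [evL_single hx]
    refine h3.congr_of_eventuallyEq ?_
    filter_upwards [(isOpen_lt continuous_norm continuous_const).mem_nhds hx] with z hz
    simp [integ, evL_single (x := z) hz, smul_smul, mul_comm]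
  rw [← h2]
  exact h1 _

/-- Truncation of a power series at order `N`. -/
noncomputable def trunc (N : ℕ) : L1 X →L[ℂ] L1 X :=
  lift (fun k => if k < N then single k else 0) 1 fun k => by
    split_ifs
    · exact norm_single_le _
    · simp

lemma evL_trunc {x : ℂ} (hx : ‖x‖ < 1) (N : ℕ) (b : L1 X) :
    evL x (trunc N b) = ∑ k ∈ Finset.range N, x ^ k • coef k b := by
  have h : (evL x).comp (trunc (X := X) N) = ∑ k ∈ Finset.range N, x ^ k • coef k := by
    refine clm_ext fun k v => ?_
    have : ∀ j, (x ^ j • coef j) (single k v) = if j = k then x ^ k • v else 0 := by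
      intro j
      rw [smul_apply, coef_apply, single_apply]
      split_ifs with h
      · rw [h]
      · simp
    simp only [sum_apply, this, ContinuousLinearMap.comp_apply, trunc,
      lift_single, Finset.sum_ite_eq', Finset.mem_range]
    split_ifs
    · rw [evL_single hx]
    · simp
  have := congrArg (fun A => A b) h
  simpa using this

/-- The backward shift by `k`, killing coefficients of order less than `N + k`. -/
noncomputable def bshift (k N : ℕ) : L1 X →L[ℂ] L1 X :=
  lift (fun j => if N + k ≤ j then single (j - k) else 0) 1 fun j => by
    split_ifs
    · exact norm_single_le _
    · simp

lemma norm_bshift_le (k N : ℕ) : ‖(bshift k N : L1 X →L[ℂ] L1 X)‖ ≤ 1 := norm_lift_le _ _ _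

lemma evL_bshift {x : ℂ} (hx : ‖x‖ < 1) (k N : ℕ) (b : L1 X) :
    x ^ k • evL x (bshift k N b) = evL x b - evL x (trunc (N + k) b) := by
  have h : x ^ k • (evL x).comp (bshift (X := X) k N) = evL x - (evL x).comp (trunc (N + k)) := by
    refine clm_ext fun j v => ?_
    simp only [smul_apply, ContinuousLinearMap.comp_apply, bshift, lift_single,
      sub_apply, trunc]
    split_ifs with h1 h2 h2
    · omega
    · rw [evL_single hx, evL_single hx, smul_smul, ← pow_add, Nat.add_sub_cancel' (by omega)]
      simp
    · simp
    · omega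
  exact congrArg (fun A => A b) h

end L1

namespace L1

variable {X X' : Type*} [NormedAddCommGroup X] [NormedSpace ℂ X] [CompleteSpace X]
  [NormedAddCommGroup X'] [NormedSpace ℂ X'] [CompleteSpace X']

/-- `Φ` represents `f` as a power series in the last variable, with coefficients analytic in the
other variables and absolutely summable with weight `ρ`. -/
def IsRep (ρ : ℝ) (Φ : E → L1 X) (f : E × ℂ → X) : Prop :=
  AnalyticAt ℂ Φ 0 ∧ ∀ᶠ p in 𝓝 (0 : E × ℂ), f p = evL (p.2 / ρ) (Φ p.1)

section Expand

variable (p : FormalMultilinearSeries ℂ (E × ℂ) X) (r : NNReal)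

lemma norm_coe_nnreal : ‖(r : ℂ)‖ = r := by
  simp

/-- The part of a power series of given bidegree. -/
noncomputable def bipart (k l : ℕ) : ContinuousMultilinearMap ℂ (fun _ : Fin k => E) X :=
  ((r : ℂ) ^ l) • ((p.changeOriginSeries k l (fun _ => ((0 : E), (1 : ℂ)))).compContinuousLinearMap
    (fun _ => ContinuousLinearMap.inl ℂ E ℂ))

lemma norm_bipart_le (k l : ℕ) : ‖bipart p r k l‖ ≤ ‖p.changeOriginSeries k l‖ * r ^ l := by
  rw [bipart, norm_smul, norm_pow, mul_comm]
  rw [norm_coe_nnreal]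
  gcongr
  refine (ContinuousMultilinearMap.norm_compContinuousLinearMap_le _ _).trans ?_
  have h2 : ∏ _i : Fin k, ‖ContinuousLinearMap.inl ℂ E ℂ‖ ≤ 1 :=
    Finset.prod_le_one (fun _ _ => norm_nonneg _)
      fun _ _ => ContinuousLinearMap.norm_inl_le_one ℂ E ℂ
  refine (mul_le_of_le_one_right (norm_nonneg _) h2).trans ?_
  refine (ContinuousMultilinearMap.le_opNorm _ _).trans ?_
  simp [Prod.norm_def]

/-- The expansion of a power series along the last variable. -/
noncomputable def expand : FormalMultilinearSeries ℂ E (L1 X) :=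
  fun k => ∑' l, (single l).compContinuousMultilinearMap (bipart p r k l)

lemma norm_single_bipart_le (k l : ℕ) :
    ‖(single l : X →L[ℂ] L1 X).compContinuousMultilinearMap (bipart p r k l)‖ ≤
      ‖p.changeOriginSeries k l‖ * r ^ l :=
  (ContinuousLinearMap.norm_compContinuousMultilinearMap_le _ _).trans
    ((mul_le_of_le_one_left (norm_nonneg _) (norm_single_le l)).trans (norm_bipart_le p r k l))

variable {p r}

lemma summable_bipart (hr : (r : ENNReal) < p.radius) (k : ℕ) :
    Summable fun l => (single l : X →L[ℂ] L1 X).compContinuousMultilinearMap (bipart p r k l) := by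
  refine Summable.of_norm_bounded ?_ (norm_single_bipart_le p r k)
  have := NNReal.summable_coe.2 (p.changeOriginSeries_summable_aux₃ hr k)
  simpa using this

lemma le_radius_expand (hr : (r + r : ENNReal) < p.radius) : r ≤ (expand p r).radius := by
  have hr' : (r : ENNReal) < p.radius := lt_of_le_of_lt le_self_add hr
  refine FormalMultilinearSeries.le_radius_of_summable_nnnorm _ ?_
  refine NNReal.summable_of_le (fun k => ?_)
    (NNReal.summable_sigma.1 (p.changeOriginSeries_summable_aux₁ hr)).2
  have h1 : ‖expand p r k‖₊ ≤ ∑' l, ‖p.changeOriginSeries k l‖₊ * r ^ l :=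
    tsum_of_nnnorm_bounded (p.changeOriginSeries_summable_aux₃ hr' k).hasSum
      fun l => norm_single_bipart_le p r k l
  have h2 := p.changeOriginSeries_summable_aux₂ hr' k
  have h3 : ∑' l, ‖p.changeOriginSeries k l‖₊ * r ^ l ≤
      ∑' s : Σ l : ℕ, { s : Finset (Fin (k + l)) // s.card = l }, ‖p (k + s.1)‖₊ * r ^ s.1 := by
    rw [h2.tsum_sigma' (NNReal.summable_sigma.1 h2).1]
    refine Summable.tsum_le_tsum (fun l => ?_) (p.changeOriginSeries_summable_aux₃ hr' k)
      (NNReal.summable_sigma.1 h2).2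
    simp only [NNReal.tsum_mul_right]
    gcongr
    apply p.nnnorm_changeOriginSeries_le_tsum
  calc ‖expand p r k‖₊ * r ^ k ≤ _ := mul_le_mul_left (h1.trans h3) _
    _ = _ := by rw [← NNReal.tsum_mul_right]

lemma evL_expand (hr : (r + r : ENNReal) < p.radius) (h0 : 0 < r) {y : E} {x : ℂ}
    (hy : ‖y‖₊ < r) (hx : ‖x‖₊ < r) :
    evL (x / r) ((expand p r).sum y) = p.sum (y, x) := by
  have hr' : (r : ENNReal) < p.radius := lt_of_le_of_lt le_self_add hr
  have hx1 : ‖x / r‖ < 1 := by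
    rw [norm_div, norm_coe_nnreal, div_lt_one (by exact_mod_cast h0)]
    exact_mod_cast hx
  have hyr : y ∈ Metric.eball (0 : E) (expand p r).radius := by
    rw [mem_eball_zero_iff]
    exact lt_of_lt_of_le (by exact_mod_cast hy) (le_radius_expand hr)
  have hn : ∀ v : ℂ, ‖((0 : E), v)‖₊ = ‖v‖₊ := fun v => by simp [Prod.nnnorm_def]
  have hn' : ∀ v : E, ‖(v, (0 : ℂ))‖₊ = ‖v‖₊ := fun v => by simp [Prod.nnnorm_def]
  have h1 := ((expand p r).hasSum hyr).mapL (evL (x / r))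
  have h2 : ∀ k, evL (x / r) (expand p r k fun _ => y) =
      p.changeOrigin ((0 : E), x) k (fun _ => (y, (0 : ℂ))) := by
    intro k
    have h3 := ((summable_bipart hr' k).hasSum.mapL
      (ContinuousMultilinearMap.apply ℂ (fun _ : Fin k => E) (L1 X) fun _ => y)).mapL
      (evL (x / r))
    have h4 := (p.hasFPowerSeriesOnBall_changeOrigin k (pos_of_gt hr')).hasSum
      (y := ((0 : E), x)) (by
        rw [mem_eball_zero_iff, enorm_eq_nnnorm, hn]
        exact lt_trans (by exact_mod_cast hx) hr')
    have h5 := h4.mapL (ContinuousMultilinearMap.apply ℂ (fun _ : Fin k => E × ℂ) X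
      fun _ => (y, (0 : ℂ)))
    rw [zero_add] at h5
    refine h3.unique (h5.congr_fun ?_)
    intro l
    have h6 : (fun _ : Fin l => ((0 : E), x)) = fun i => x • ((0 : E), (1 : ℂ)) := by
      funext i; simp
    simp only [ContinuousMultilinearMap.apply_apply,
      ContinuousLinearMap.compContinuousMultilinearMap_coe, Function.comp_apply, evL_single hx1,
      bipart, h6, ContinuousMultilinearMap.map_smul_univ, Finset.prod_const, Finset.card_univ,
      Fintype.card_fin, smul_apply, smul_smul,
      ContinuousMultilinearMap.compContinuousLinearMap_apply, ContinuousLinearMap.inl_apply]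
    congr 1
    have : (r : ℂ) ≠ 0 := by exact_mod_cast h0.ne'
    rw [← mul_pow, div_mul_cancel₀ _ this]
  simp only [h2] at h1
  rw [← h1.tsum_eq]
  have h7 := p.changeOrigin_eval (x := ((0 : E), x)) (y := (y, (0 : ℂ))) (by
    rw [hn, hn']
    refine lt_trans ?_ hr
    exact_mod_cast add_lt_add hx hy)
  rw [Prod.mk_add_mk, zero_add, add_zero] at h7
  exact h7

end Expand

lemma exists_rep {f : E × ℂ → X} (hf : AnalyticAt ℂ f 0) :
    ∃ ρ : ℝ, 0 < ρ ∧ ∃ Φ : E → L1 X, IsRep ρ Φ f := by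
  obtain ⟨p, R, hp⟩ := hf
  obtain ⟨r, h0, hr⟩ : ∃ r : NNReal, 0 < r ∧ (r + r : ENNReal) < R := by
    obtain ⟨s, hs0, hs⟩ := ENNReal.lt_iff_exists_nnreal_btwn.1 hp.r_pos
    refine ⟨s / 2, by simpa using hs0, ?_⟩
    rw [← ENNReal.coe_add, add_halves]
    exact hs
  have hr' := hr.trans_le hp.r_le
  have hrad : 0 < (expand p r).radius :=
    lt_of_lt_of_le (by exact_mod_cast h0) (le_radius_expand hr')
  refine ⟨r, h0, (expand p r).sum,
    ((expand p r).hasFPowerSeriesOnBall hrad).analyticAt, ?_⟩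
  filter_upwards [Metric.ball_mem_nhds (0 : E × ℂ) (NNReal.coe_pos.2 h0)] with z hz
  rw [mem_ball_zero_iff, Prod.norm_def, max_lt_iff] at hz
  have hz1 : ‖z.1‖₊ < r := by exact_mod_cast hz.1
  have hz2 : ‖z.2‖₊ < r := by exact_mod_cast hz.2
  have h1 := hp.sum (y := z) (by
    rw [mem_eball_zero_iff, enorm_eq_nnnorm, Prod.nnnorm_def]
    refine lt_trans ?_ hr
    refine lt_of_lt_of_le (b := (r : ENNReal)) ?_ le_self_add
    exact_mod_cast max_lt hz1 hz2)
  rw [zero_add] at h1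
  rw [h1]
  exact (evL_expand hr' h0 hz1 hz2).symm

lemma eventually_lt (ρ : ℝ) : ∀ᶠ p in 𝓝 (0 : E × ℂ), ‖p.2 / (ρ : ℂ)‖ < 1 := by
  have : ContinuousAt (fun p : E × ℂ => ‖p.2 / (ρ : ℂ)‖) 0 := by fun_prop
  exact this.eventually_lt continuousAt_const (by simp)

lemma evL_comp_analyticAt {ρ : ℝ} {Φ : E → L1 X} (hΦ : AnalyticAt ℂ Φ 0) :
    AnalyticAt ℂ (fun p : E × ℂ => evL (p.2 / ρ) (Φ p.1)) 0 := by
  have h1 : AnalyticAt ℂ (fun p : E × ℂ => p.2 / (ρ : ℂ)) 0 := by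
    simp only [div_eq_mul_inv]
    exact analyticAt_snd.mul analyticAt_const
  have h2 : AnalyticAt ℂ (fun p : E × ℂ => (evL (p.2 / ρ) : L1 X →L[ℂ] X)) 0 :=
    AnalyticAt.comp (g := evL) (f := fun p : E × ℂ => p.2 / (ρ : ℂ))
      (evL_analyticAt (by simp)) h1
  have h3 : AnalyticAt ℂ (fun p : E × ℂ => Φ p.1) 0 :=
    AnalyticAt.comp (g := Φ) (f := Prod.fst) (by simpa using hΦ) analyticAt_fst
  exact ((ContinuousLinearMap.id ℂ (L1 X →L[ℂ] X)).analyticAt_bilinear _).comp (h2.prod h3)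

lemma IsRep.of_analyticAt {ρ : ℝ} {Φ : E → L1 X} (hΦ : AnalyticAt ℂ Φ 0) :
    IsRep ρ Φ (fun p : E × ℂ => evL (p.2 / ρ) (Φ p.1)) :=
  ⟨hΦ, Eventually.of_forall fun _ => rfl⟩

lemma IsRep.rescale {ρ s : ℝ} (hρ : 0 < ρ) (hs : 0 < s) (hs1 : s ≤ 1) {Φ : E → L1 X}
    {f : E × ℂ → X} (h : IsRep ρ Φ f) :
    IsRep (s * ρ) (fun y => scale s hs.le hs1 (Φ y)) f := by
  refine ⟨AnalyticAt.comp (g := scale s hs.le hs1) (f := Φ)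
    (ContinuousLinearMap.analyticAt (scale s hs.le hs1 : L1 X →L[ℂ] L1 X) _) h.1, ?_⟩
  filter_upwards [h.2, eventually_lt (s * ρ)] with p hp hp1
  rw [hp, evL_scale hp1]
  congr 2
  have h1 : (s : ℂ) ≠ 0 := by exact_mod_cast hs.ne'
  have h2 : (ρ : ℂ) ≠ 0 := by exact_mod_cast hρ.ne'
  push_cast
  field_simp

end L1

namespace L1

variable {X X' : Type*} [NormedAddCommGroup X] [NormedSpace ℂ X] [CompleteSpace X]
  [NormedAddCommGroup X'] [NormedSpace ℂ X'] [CompleteSpace X']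

/-- Termwise integration, killing terms of order less than `m`. -/
noncomputable def integFrom (m : ℕ) : L1 X →L[ℂ] L1 X :=
  lift (fun k => if m ≤ k then ((k + 1 : ℂ)⁻¹) • single (k + 1) else 0) (m + 1 : ℝ)⁻¹ fun k => by
    split_ifs with h
    · rw [norm_smul, norm_inv]
      have h1 : ‖(k + 1 : ℂ)‖ = k + 1 := by
        rw [← Nat.cast_one, ← Nat.cast_add, Complex.norm_natCast]; simp
      rw [h1]
      refine (mul_le_of_le_one_right (inv_nonneg.2 (by positivity)) (norm_single_le _)).trans ?_
      gcongr
    · rw [norm_zero]; exact inv_nonneg.2 (by positivity)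

lemma norm_integFrom_le (m : ℕ) : ‖(integFrom m : L1 X →L[ℂ] L1 X)‖ ≤ (m + 1 : ℝ)⁻¹ :=
  norm_lift_le _ _ _

lemma integFrom_mulL_bshift (m k : ℕ) (a : L1 (X →L[ℂ] X)) (u : L1 X) :
    integFrom m (mulL a (bshift k m u)) = integ (mulL a (bshift k m u)) := by
  have h : ∀ b : L1 X, ((integFrom m - integ : L1 X →L[ℂ] L1 X).comp
      ((mulL (X := X) (X' := X)).flip (bshift k m b))) = 0 := by
    intro b
    refine clm_ext fun i T => ?_
    have h1 : (integFrom m - integ : L1 X →L[ℂ] L1 X).comp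
        ((mulL (single i T)).comp (bshift k m)) = 0 := by
      refine clm_ext fun j x => ?_
      simp only [ContinuousLinearMap.comp_apply, bshift, lift_single]
      split_ifs with h
      · simp only [mulL_single_single, sub_apply, integFrom, integ, lift_single]
        rw [if_pos (by omega)]
        simp
      · simp
    exact congrArg (fun A => A b) h1
  have := congrArg (fun A => A a) (h u)
  simp only [ContinuousLinearMap.comp_apply, ContinuousLinearMap.flip_apply, sub_apply,
    zero_apply] at this
  exact sub_eq_zero.1 this

section

variable {ρ : ℝ} {k m : ℕ} {e b p : E → L1 (X →L[ℂ] X)}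

/-- The operator `u ↦ u - P v + B ∫ E v`, with `v` the shifted series `ρ⁻ᵏ x⁻ᵏ u`. -/
noncomputable def odeOp (ρ : ℝ) (k m : ℕ) (e b p : L1 (X →L[ℂ] X)) : L1 X →L[ℂ] L1 X :=
  1 - (mulL p).comp (((ρ : ℂ)⁻¹ ^ k) • bshift k m) +
    (mulL b).comp (((ρ : ℂ) • integFrom m).comp
      ((mulL e).comp (((ρ : ℂ)⁻¹ ^ k) • bshift k m)))

lemma isUnit_odeOp (hρ : 0 < ρ) (k : ℕ) (e b : L1 (X →L[ℂ] X)) :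
    ∃ m, IsUnit (odeOp ρ k m e b 0) := by
  obtain ⟨m, hm⟩ := exists_nat_gt (‖b‖ * (ρ * (‖e‖ * ρ⁻¹ ^ k)))
  refine ⟨m, ?_⟩
  set K : L1 X →L[ℂ] L1 X := (mulL b).comp (((ρ : ℂ) • integFrom m).comp
      ((mulL e).comp (((ρ : ℂ)⁻¹ ^ k) • bshift k m))) with hK
  have h1 : odeOp ρ k m e b 0 = 1 - (-K) := by
    rw [odeOp, map_zero, ContinuousLinearMap.zero_comp, sub_neg_eq_add, sub_zero]
  rw [h1]
  refine isUnit_one_sub_of_norm_lt_one ?_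
  rw [norm_neg]
  have hr : ‖(ρ : ℂ)‖ = ρ := by simp [abs_of_pos hρ]
  have h2 : ‖((ρ : ℂ)⁻¹ ^ k) • (bshift k m : L1 X →L[ℂ] L1 X)‖ ≤ ρ⁻¹ ^ k := by
    rw [norm_smul, norm_pow, norm_inv, hr]
    exact mul_le_of_le_one_right (by positivity) (norm_bshift_le _ _)
  have h3 : ‖(ρ : ℂ) • (integFrom m : L1 X →L[ℂ] L1 X)‖ ≤ ρ * (m + 1 : ℝ)⁻¹ := by
    rw [norm_smul, hr]
    exact mul_le_mul_of_nonneg_left (norm_integFrom_le _) hρ.le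
  have h4 : ‖K‖ ≤ ‖b‖ * ((ρ * (m + 1 : ℝ)⁻¹) * (‖e‖ * ρ⁻¹ ^ k)) := by
    refine (ContinuousLinearMap.opNorm_comp_le _ _).trans ?_
    refine mul_le_mul (norm_mulL_le _) ?_ (norm_nonneg _) (norm_nonneg _)
    refine (ContinuousLinearMap.opNorm_comp_le _ _).trans ?_
    refine mul_le_mul h3 ?_ (norm_nonneg _) (by positivity)
    refine (ContinuousLinearMap.opNorm_comp_le _ _).trans ?_
    exact mul_le_mul (norm_mulL_le _) h2 (norm_nonneg _) (norm_nonneg _)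
  refine h4.trans_lt ?_
  have h5 : ‖b‖ * ((ρ * (m + 1 : ℝ)⁻¹) * (‖e‖ * ρ⁻¹ ^ k)) =
      ‖b‖ * (ρ * (‖e‖ * ρ⁻¹ ^ k)) / (m + 1) := by
    field_simp
  rw [h5, div_lt_one (by positivity)]
  linarith

lemma odeOp_analyticAt (he : AnalyticAt ℂ e 0) (hb : AnalyticAt ℂ b 0) (hp : AnalyticAt ℂ p 0) :
    AnalyticAt ℂ (fun y => odeOp ρ k m (e y) (b y) (p y)) 0 := by
  have hM : ∀ f : E → L1 (X →L[ℂ] X), AnalyticAt ℂ f 0 →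
      AnalyticAt ℂ (fun y => mulL (X := X) (X' := X) (f y)) 0 := fun f hf =>
    AnalyticAt.comp (g := mulL (X := X) (X' := X)) (f := f)
      (ContinuousLinearMap.analyticAt (mulL (X := X) (X' := X)) _) hf
  have h1 := ((hM p hp).mul (analyticAt_const (v := ((ρ : ℂ)⁻¹ ^ k) • bshift k m)))
  have h2 := (hM b hb).mul ((analyticAt_const
    (v := (ρ : ℂ) • (integFrom m : L1 X →L[ℂ] L1 X))).mul
    ((hM e he).mul (analyticAt_const (v := ((ρ : ℂ)⁻¹ ^ k) • (bshift k m : L1 X →L[ℂ] L1 X)))))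
  exact (analyticAt_const.sub h1).add h2

end

lemma IsRep.congr {ρ : ℝ} {Φ : E → L1 X} {f g : E × ℂ → X} (h : IsRep ρ Φ f)
    (hfg : f =ᶠ[𝓝 0] g) : IsRep ρ Φ g :=
  ⟨h.1, by filter_upwards [h.2, hfg] with p h1 h2; rw [← h2, h1]⟩

/-- Evaluation of a family of absolutely summable sequences as a function of two variables. -/
noncomputable def fn (ρ : ℝ) (Φ : E → L1 X) : E × ℂ → X := fun p => evL (p.2 / ρ) (Φ p.1)

theorem ode_reps {ρ : ℝ} (hρ : 0 < ρ) (k : ℕ) {e b p : E → L1 (X →L[ℂ] X)}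
    (he : AnalyticAt ℂ e 0) (hb : AnalyticAt ℂ b 0) (hp : AnalyticAt ℂ p 0) (hp0 : p 0 = 0) :
    ∃ N : ℕ, ∀ Φ : E → L1 X, AnalyticAt ℂ Φ 0 → ∃ v : E → L1 X, AnalyticAt ℂ v 0 ∧
      ∃ a : ℕ → E → X, (∀ j, AnalyticAt ℂ (a j) 0) ∧
        ∀ᶠ z in 𝓝 (0 : E × ℂ), fn ρ Φ z = z.2 ^ k • fn ρ v z - fn ρ p z (fn ρ v z) +
          fn ρ b z (fn ρ (fun y => (ρ : ℂ) • integ (mulL (e y) (v y))) z) +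
          ∑ j ∈ Finset.range N, z.2 ^ j • a j z.1 := by
  obtain ⟨m, hm⟩ := isUnit_odeOp hρ k (e 0) (b 0)
  rw [← hp0] at hm
  have hT := odeOp_analyticAt (ρ := ρ) (k := k) (m := m) he hb hp
  have hinv : AnalyticAt ℂ (fun y => Ring.inverse (odeOp ρ k m (e y) (b y) (p y))) 0 :=
    AnalyticAt.comp (g := Ring.inverse) (f := fun y => odeOp ρ k m (e y) (b y) (p y))
      (by simpa using analyticAt_inverse (𝕜 := ℂ) hm.unit) hT
  have hunit : ∀ᶠ y in 𝓝 (0 : E), IsUnit (odeOp ρ k m (e y) (b y) (p y)) :=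
    hT.continuousAt.eventually (Units.isOpen.mem_nhds hm)
  refine ⟨m + k, fun Φ hΦ => ?_⟩
  set u : E → L1 X := fun y => Ring.inverse (odeOp ρ k m (e y) (b y) (p y)) (Φ y) with hu
  have hua : AnalyticAt ℂ u 0 :=
    ((ContinuousLinearMap.id ℂ (L1 X →L[ℂ] L1 X)).analyticAt_bilinear _).comp (hinv.prod hΦ)
  set S : L1 X →L[ℂ] L1 X := ((ρ : ℂ)⁻¹ ^ k) • bshift k m with hS
  have hlin : ∀ {Z : Type _} [NormedAddCommGroup Z] [NormedSpace ℂ Z] (A : L1 X →L[ℂ] Z),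
      AnalyticAt ℂ (fun y => A (u y)) 0 := fun A =>
    AnalyticAt.comp (g := A) (f := u) (A.analyticAt _) hua
  have hρ' : (ρ : ℂ) ≠ 0 := by exact_mod_cast hρ.ne'
  refine ⟨fun y => S (u y), hlin S, fun j y => ((ρ : ℂ)⁻¹ ^ j) • coef j (u y), fun j =>
    hlin (((ρ : ℂ)⁻¹ ^ j) • coef j), ?_⟩
  have hunit' : ∀ᶠ z in 𝓝 (0 : E × ℂ), IsUnit (odeOp ρ k m (e z.1) (b z.1) (p z.1)) :=
    (continuous_fst.tendsto' (0 : E × ℂ) 0 rfl).eventually hunit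
  filter_upwards [hunit', eventually_lt ρ] with z hz hz1
  have h1 : odeOp ρ k m (e z.1) (b z.1) (p z.1) (u z.1) = Φ z.1 := by
    have := Ring.mul_inverse_cancel _ hz
    exact congrArg (fun A : L1 X →L[ℂ] L1 X => A (Φ z.1)) this
  have h2 : u z.1 - mulL (p z.1) (S (u z.1)) +
      mulL (b z.1) ((ρ : ℂ) • integ (mulL (e z.1) (S (u z.1)))) = Φ z.1 := by
    rw [← h1]
    simp only [odeOp, ← hS, add_apply, sub_apply, ContinuousLinearMap.comp_apply,
      smul_apply]
    congr 3
    rw [hS]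
    simp only [smul_apply, map_smul, integFrom_mulL_bshift]
  have h3 : z.2 ^ k • evL (z.2 / ρ) (S (u z.1)) =
      evL (z.2 / ρ) (u z.1) - evL (z.2 / ρ) (trunc (m + k) (u z.1)) := by
    rw [← evL_bshift hz1, hS, smul_apply, map_smul, smul_smul, div_pow, inv_pow,
      div_eq_mul_inv, div_eq_mul_inv]
  simp only [fn]
  rw [← h2, map_add, map_sub, evL_mulL hz1, evL_mulL hz1, h3, evL_trunc hz1]
  simp only [smul_smul, ← mul_pow, div_eq_mul_inv]
  abel

/-- The derivative in the last variable of the termwise antiderivative. -/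
lemma hasDerivAt_fn_integ {ρ : ℝ} (hρ : 0 < ρ) (w : E → L1 X) {z : E × ℂ}
    (hz : ‖z.2 / (ρ : ℂ)‖ < 1) :
    HasDerivAt (fun s : ℂ => fn ρ (fun y => (ρ : ℂ) • integ (w y)) (z + s • ((0 : E), (1 : ℂ))))
      (fn ρ w z) 0 := by
  have h1 := hasDerivAt_evL_integ hz (w z.1)
  have hρ' : (ρ : ℂ) ≠ 0 := by exact_mod_cast hρ.ne'
  have h2 : HasDerivAt (fun s : ℂ => (z.2 + s) / (ρ : ℂ)) ((ρ : ℂ)⁻¹) 0 := by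
    have := ((hasDerivAt_id (0 : ℂ)).const_add z.2).div_const (ρ : ℂ)
    simpa using this
  have h3 : HasDerivAt (fun s : ℂ => evL ((z.2 + s) / (ρ : ℂ)) (integ (w z.1)))
      (((ρ : ℂ)⁻¹) • evL (z.2 / ρ) (w z.1)) 0 :=
    HasDerivAt.scomp (𝕜 := ℂ) (g₁ := fun x => evL x (integ (w z.1))) (0 : ℂ) (by simpa using h1) h2
  have h4 := h3.const_smul (ρ : ℂ)
  rw [smul_smul, mul_inv_cancel₀ hρ', one_smul] at h4
  have h5 : (fun s : ℂ => fn ρ (fun y => (ρ : ℂ) • integ (w y)) (z + s • ((0 : E), (1 : ℂ)))) =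
      fun s => (ρ : ℂ) • evL ((z.2 + s) / (ρ : ℂ)) (integ (w z.1)) := by
    funext s
    simp [fn]
  rw [h5]
  exact h4

end L1

namespace Og

/-- The analytic function `g` represents the germ `f`. -/
def Rp (f : Og E) (g : E → ℂ) : Prop := AnalyticAt ℂ g 0 ∧ f = mk g

lemma rp_rep (f : Og E) : Rp f (rep f) := ⟨(rep_spec f).1, (mk_rep f).symm⟩

lemma rp_mk {g : E → ℂ} (hg : AnalyticAt ℂ g 0) : Rp (mk g) g := ⟨hg, rfl⟩

namespace Rp

variable {f f' : Og E} {g g' : E → ℂ}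

lemma eq_iff (h : Rp f g) (h' : Rp f' g') : f = f' ↔ g =ᶠ[𝓝 0] g' := by
  rw [h.2, h'.2, mk_eq_mk h.1 h'.1]

lemma add (h : Rp f g) (h' : Rp f' g') : Rp (f + f') (fun z => g z + g' z) :=
  ⟨h.1.add h'.1, by rw [h.2, h'.2, mk_add h.1 h'.1]⟩

lemma mul (h : Rp f g) (h' : Rp f' g') : Rp (f * f') (fun z => g z * g' z) :=
  ⟨h.1.mul h'.1, by rw [h.2, h'.2, mk_mul h.1 h'.1]⟩

lemma const (c : ℂ) : Rp (algebraMap ℂ (Og E) c) (fun _ => c) := ⟨analyticAt_const, rfl⟩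

lemma neg (h : Rp f g) : Rp (-f) (fun z => - g z) := by
  have := (Rp.const (E := E) (-1)).mul h
  simpa using this

lemma sub (h : Rp f g) (h' : Rp f' g') : Rp (f - f') (fun z => g z - g' z) := by
  simpa only [sub_eq_add_neg] using h.add h'.neg

lemma pow (h : Rp f g) (n : ℕ) : Rp (f ^ n) (fun z => g z ^ n) := by
  induction n with
  | zero => simpa using Rp.const (E := E) 1
  | succ n ih => simpa only [pow_succ] using ih.mul h

lemma sum {ι : Type*} (s : Finset ι) {f : ι → Og E} {g : ι → E → ℂ}
    (h : ∀ i ∈ s, Rp (f i) (g i)) : Rp (∑ i ∈ s, f i) (fun z => ∑ i ∈ s, g i z) := by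
  induction s using Finset.induction_on with
  | empty => simpa using Rp.const (E := E) 0
  | insert a s ha ih =>
    simp only [Finset.sum_insert ha]
    exact (h a (by simp)).add (ih fun i hi => h i (by simp [hi]))

lemma pl {f : Og F} {g : F → ℂ} (h : Rp f g) (L : E →L[ℂ] F) :
    Rp (Og.pl L f) (fun z => g (L z)) :=
  ⟨comp_analyticAt L h.1, by rw [h.2, pl_mk L h.1]⟩

lemma lin (l : E →L[ℂ] ℂ) : Rp (Og.lin l) l := ⟨l.analyticAt _, rfl⟩

end Rp

/-- The last coordinate. -/
noncomputable def xl (E : Type*) [NormedAddCommGroup E] [NormedSpace ℂ E] : Og (E × ℂ) :=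
  lin (ContinuousLinearMap.snd ℂ E ℂ)

/-- Germs independent of the last coordinate. -/
noncomputable def up (E : Type*) [NormedAddCommGroup E] [NormedSpace ℂ E] :
    Og E →ₐ[ℂ] Og (E × ℂ) := pl (ContinuousLinearMap.fst ℂ E ℂ)

/-- Restriction to the hyperplane where the last coordinate vanishes. -/
noncomputable def down (E : Type*) [NormedAddCommGroup E] [NormedSpace ℂ E] :
    Og (E × ℂ) →ₐ[ℂ] Og E := pl (ContinuousLinearMap.inl ℂ E ℂ)

/-- Restriction to the last coordinate axis. -/
noncomputable def axis (E : Type*) [NormedAddCommGroup E] [NormedSpace ℂ E] :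
    Og (E × ℂ) →ₐ[ℂ] Og ℂ := pl (ContinuousLinearMap.inr ℂ E ℂ)

/-- The derivative in the last coordinate. -/
noncomputable def dl (E : Type*) [NormedAddCommGroup E] [NormedSpace ℂ E] :
    Derivation ℂ (Og (E × ℂ)) (Og (E × ℂ)) := der ((0 : E), (1 : ℂ))

variable {ι : Type*} [Fintype ι]

/-- The family of germs `g` has a common power series expansion of radius `ρ`
in the last variable. -/
def HasRad (ρ : ℝ) (g : ι → Og (E × ℂ)) : Prop :=
  ∃ Φ : E → L1 (ι → ℂ), L1.IsRep ρ Φ fun p i => rep (g i) p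

lemma analyticAt_rep_pi (g : ι → Og E) : AnalyticAt ℂ (fun p i => rep (g i) p) 0 := by
  refine AnalyticAt.pi fun i => ?_
  exact (rep_spec (g i)).1

lemma exists_hasRad (g : ι → Og (E × ℂ)) : ∃ ρ₁ > 0, ∀ ρ, 0 < ρ → ρ ≤ ρ₁ → HasRad ρ g := by
  obtain ⟨ρ₁, h1, Φ, h⟩ := L1.exists_rep (analyticAt_rep_pi g)
  refine ⟨ρ₁, h1, fun ρ h0 hle => ?_⟩
  have := h.rescale (s := ρ / ρ₁) h1 (div_pos h0 h1) ((div_le_one h1).2 hle)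
  rw [div_mul_cancel₀ _ h1.ne'] at this
  exact ⟨_, this⟩

lemma hasRad_monomial {ρ : ℝ} (hρ : 0 < ρ) (c : ι → ℂ) (n : ℕ) :
    HasRad ρ fun i => (c i) • xl E ^ n := by
  refine ⟨fun _ => ((ρ : ℂ) ^ n) • L1.single n c, analyticAt_const, ?_⟩
  have h1 : ∀ i, Rp ((c i) • xl E ^ n) (fun p => c i * p.2 ^ n) := fun i => by
    rw [Algebra.smul_def]
    exact (Rp.const _).mul ((Rp.lin _).pow n)
  have h2 := fun i => (Rp.eq_iff (rp_rep _) (h1 i)).1 rfl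
  filter_upwards [eventually_all.2 h2, L1.eventually_lt ρ] with p hp hp1
  funext i
  have hρ' : (ρ : ℂ) ≠ 0 := by exact_mod_cast hρ.ne'
  rw [hp i, map_smul, L1.evL_single hp1, smul_smul, div_pow, mul_div_cancel₀ _ (pow_ne_zero _ hρ')]
  simp [mul_comm]

/-- The operator valued function attached to a matrix of germs. -/
noncomputable def matFn (A : Matrix ι ι (Og E)) (z : E) : (ι → ℂ) →L[ℂ] (ι → ℂ) :=
  ∑ i, ∑ j, rep (A i j) z •
    (ContinuousLinearMap.proj (R := ℂ) (φ := fun _ : ι => ℂ) j).smulRight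
      (Pi.single i 1 : ι → ℂ)

lemma matFn_analyticAt (A : Matrix ι ι (Og E)) : AnalyticAt ℂ (matFn A) 0 := by
  have : matFn A = fun z => ∑ i, ∑ j, rep (A i j) z •
    (ContinuousLinearMap.proj (R := ℂ) (φ := fun _ : ι => ℂ) j).smulRight
      (Pi.single i 1 : ι → ℂ) := by funext z; rfl
  rw [this]
  refine Finset.analyticAt_fun_sum _ fun i _ => Finset.analyticAt_fun_sum _ fun j _ => ?_
  exact (rep_spec (A i j)).1.smul analyticAt_const

lemma matFn_apply (A : Matrix ι ι (Og E)) (z : E) (w : ι → ℂ) (i : ι) :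
    matFn A z w i = ∑ j, rep (A i j) z * w j := by
  simp only [matFn, sum_apply, smul_apply, ContinuousLinearMap.smulRight_apply,
    ContinuousLinearMap.proj_apply, Finset.sum_apply, Pi.smul_apply, smul_eq_mul]
  rw [Finset.sum_eq_single i]
  · simp
  · intro b _ hb
    simp [hb.symm]
  · simp

lemma exists_rep_mat (A : Matrix ι ι (Og (E × ℂ))) : ∃ ρ₁ > 0, ∀ ρ, 0 < ρ → ρ ≤ ρ₁ →
    ∃ Φ, L1.IsRep ρ Φ (matFn A) := by
  obtain ⟨ρ₁, h1, Φ, h⟩ := L1.exists_rep (matFn_analyticAt A)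
  refine ⟨ρ₁, h1, fun ρ h0 hle => ?_⟩
  have := h.rescale (s := ρ / ρ₁) h1 (div_pos h0 h1) ((div_le_one h1).2 hle)
  rw [div_mul_cancel₀ _ h1.ne'] at this
  exact ⟨_, this⟩

theorem ode_germ (A B P : Matrix ι ι (Og (E × ℂ))) (hP : ∀ i j, axis E (P i j) = 0) (k : ℕ) :
    ∃ ρ₁ > 0, ∀ ρ, 0 < ρ → ρ ≤ ρ₁ → ∃ N : ℕ, ∀ g : ι → Og (E × ℂ), HasRad ρ g →
      ∃ (v h : ι → Og (E × ℂ)) (a : ℕ → ι → Og E),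
        (∀ i, g i = xl E ^ k * v i - ∑ j, P i j * v j + ∑ j, B i j * h j +
          ∑ j ∈ Finset.range N, xl E ^ j * up E (a j i)) ∧
        ∀ i, dl E (h i) = ∑ j, A i j * v j := by
  obtain ⟨r1, hr1, h1⟩ := exists_rep_mat A
  obtain ⟨r2, hr2, h2⟩ := exists_rep_mat B
  obtain ⟨r3, hr3, h3⟩ := exists_rep_mat P
  refine ⟨min r1 (min r2 r3), by positivity, fun ρ h0 hle => ?_⟩
  obtain ⟨e, he⟩ := h1 ρ h0 (hle.trans (min_le_left _ _))
  obtain ⟨b, hb⟩ := h2 ρ h0 (hle.trans ((min_le_right _ _).trans (min_le_left _ _)))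
  obtain ⟨p, hp⟩ := h3 ρ h0 (hle.trans ((min_le_right _ _).trans (min_le_right _ _)))
  have hp' : ∀ᶠ z in 𝓝 (0 : E × ℂ), matFn P z = L1.fn ρ (fun y => p y - p 0) z := by
    have ht : Tendsto (fun z : E × ℂ => ((0 : E), z.2)) (𝓝 0) (𝓝 0) :=
      Continuous.tendsto' (by fun_prop) _ _ rfl
    have hz : ∀ᶠ x in 𝓝 (0 : E × ℂ), ∀ i j, rep (P i j) (0, x.2) = 0 := by
      refine eventually_all.2 fun i => eventually_all.2 fun j => ?_
      have h4 := (Rp.eq_iff ((rp_rep (P i j)).pl (ContinuousLinearMap.inr ℂ E ℂ))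
        (Rp.const (E := ℂ) 0)).1 ((hP i j).trans (map_zero _).symm)
      exact (continuous_snd.tendsto' (0 : E × ℂ) 0 rfl).eventually h4
    filter_upwards [hp.2, ht.eventually hp.2, hz] with z hz1 hz2 hz3
    have h5 : matFn P (0, z.2) = 0 := by
      ext1 w
      funext i
      simp [matFn_apply, hz3]
    rw [h5] at hz2
    simp only [L1.fn, map_sub]
    rw [← hz1, ← hz2, sub_zero]
  obtain ⟨N, hN⟩ := L1.ode_reps h0 k he.1 hb.1 (p := fun y => p y - p 0)
    (hp.1.sub analyticAt_const) (sub_self _)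
  refine ⟨N, fun g ⟨Φ, hΦ⟩ => ?_⟩
  obtain ⟨v, hv, a, ha, hE⟩ := hN Φ hΦ.1
  have hcomp : ∀ w : E → L1 (ι → ℂ), AnalyticAt ℂ w 0 → ∀ i,
      AnalyticAt ℂ (fun z => L1.fn ρ w z i) 0 := fun w hw i =>
    AnalyticAt.comp (g := ContinuousLinearMap.proj (R := ℂ) (φ := fun _ : ι => ℂ) i)
      (f := L1.fn ρ w) (ContinuousLinearMap.analyticAt
        (ContinuousLinearMap.proj (R := ℂ) (φ := fun _ : ι => ℂ) i) _) (L1.evL_comp_analyticAt hw)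
  have hev : AnalyticAt ℂ (fun y => L1.mulL (e y) (v y)) 0 := by
    have h6 : AnalyticAt ℂ (fun y => L1.mulL (X := ι → ℂ) (X' := ι → ℂ) (e y)) 0 :=
      AnalyticAt.comp (g := L1.mulL (X := ι → ℂ) (X' := ι → ℂ)) (f := e)
        (ContinuousLinearMap.analyticAt (L1.mulL (X := ι → ℂ) (X' := ι → ℂ)) _) he.1
    exact ((ContinuousLinearMap.id ℂ (L1 (ι → ℂ) →L[ℂ] L1 (ι → ℂ))).analyticAt_bilinear _).comp
      (h6.prod hv)
  set w : E → L1 (ι → ℂ) := fun y => (ρ : ℂ) • L1.integ (L1.mulL (e y) (v y)) with hw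
  have hwa : AnalyticAt ℂ w 0 :=
    AnalyticAt.comp (g := (ρ : ℂ) • (L1.integ : L1 (ι → ℂ) →L[ℂ] L1 (ι → ℂ)))
      (f := fun y => L1.mulL (e y) (v y)) (ContinuousLinearMap.analyticAt
        ((ρ : ℂ) • (L1.integ : L1 (ι → ℂ) →L[ℂ] L1 (ι → ℂ))) _) hev
  have haj : ∀ j i, AnalyticAt ℂ (fun y => a j y i) 0 := fun j i =>
    AnalyticAt.comp (g := ContinuousLinearMap.proj (R := ℂ) (φ := fun _ : ι => ℂ) i)
      (f := a j) (ContinuousLinearMap.analyticAt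
        (ContinuousLinearMap.proj (R := ℂ) (φ := fun _ : ι => ℂ) i) _) (ha j)
  refine ⟨fun i => mk fun z => L1.fn ρ v z i, fun i => mk fun z => L1.fn ρ w z i,
    fun j i => mk fun y => a j y i, fun i => ?_, fun i => ?_⟩
  · have hR := (((((Rp.lin (ContinuousLinearMap.snd ℂ E ℂ)).pow k).mul (rp_mk (hcomp v hv i))).sub
      (Rp.sum Finset.univ fun j _ => (rp_rep (P i j)).mul (rp_mk (hcomp v hv j)))).add
      (Rp.sum Finset.univ fun j _ => (rp_rep (B i j)).mul (rp_mk (hcomp w hwa j)))).add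
      (Rp.sum (Finset.range N) fun j _ => ((Rp.lin (ContinuousLinearMap.snd ℂ E ℂ)).pow j).mul
        ((rp_mk (haj j i)).pl (ContinuousLinearMap.fst ℂ E ℂ)))
    refine (Rp.eq_iff (rp_rep (g i)) hR).2 ?_
    filter_upwards [hE, hΦ.2, hp', hb.2] with z hz hz1 hz2 hz3
    have hz1' : rep (g i) z = L1.fn ρ Φ z i := congrFun hz1 i
    rw [hz1', hz, ← hz2]
    have hz3' : L1.fn ρ b z = matFn B z := hz3.symm
    rw [hz3']
    simp [matFn_apply]
  · have hR := Rp.sum Finset.univ fun j _ => (rp_rep (A i j)).mul (rp_mk (hcomp v hv j))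
    have hD : Rp (dl E (mk fun z => L1.fn ρ w z i))
        (fun z => fderiv ℂ (fun z => L1.fn ρ w z i) z ((0 : E), (1 : ℂ))) := by
      rw [dl, der_mk _ (hcomp w hwa i)]
      exact rp_mk (fderiv_analyticAt _ (hcomp w hwa i))
    refine (Rp.eq_iff hD hR).2 ?_
    filter_upwards [(hcomp w hwa i).eventually_analyticAt, L1.eventually_lt ρ, he.2]
      with z hz1 hz2 hz3
    have h7 := L1.hasDerivAt_fn_integ h0 (fun y => L1.mulL (e y) (v y)) hz2
    have h8 := (hasDerivAt_pi.1 h7) i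
    have h9 : HasDerivAt (fun s : ℂ => L1.fn ρ w (z + s • ((0 : E), (1 : ℂ))) i)
        (fderiv ℂ (fun z => L1.fn ρ w z i) z ((0 : E), (1 : ℂ))) 0 := by
      have h10 : HasFDerivAt (fun z => L1.fn ρ w z i) (fderiv ℂ (fun z => L1.fn ρ w z i) z)
        (z + (0 : ℂ) • ((0 : E), (1 : ℂ))) := by
        rw [zero_smul, add_zero]
        exact hz1.differentiableAt.hasFDerivAt
      have h11 : HasDerivAt (fun s : ℂ => z + s • ((0 : E), (1 : ℂ))) ((0 : E), (1 : ℂ)) 0 := by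
        have := ((hasDerivAt_id (0 : ℂ)).smul_const ((0 : E), (1 : ℂ))).const_add z
        simpa using this
      exact h10.comp_hasDerivAt 0 h11
    rw [h9.unique h8, L1.fn, L1.evL_mulL hz2, ← hz3, matFn_apply]
    rfl


/-! ### Weierstrass division -/

lemma isNoetherianRing_of_finite {A B : Type*} [CommRing A] [CommRing B] [IsNoetherianRing A]
    (f : A →+* B) (hf : f.Finite) : IsNoetherianRing B := by
  let := f.toAlgebra
  have : Module.Finite A B := hf
  exact isNoetherian_of_tower A inferInstance

lemma fg_of_mem_of_isNoetherianRing {B : Type*} [CommRing B] {f : B} {I : Ideal B} (hf : f ∈ I)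
    (h : IsNoetherianRing (B ⧸ Ideal.span {f})) : I.FG := by
  have h1 : (I.map (Ideal.Quotient.mk (Ideal.span {f}))).FG := h.noetherian _
  obtain ⟨s, hs⟩ := h1
  obtain ⟨t, ht⟩ : ∃ t : Finset B, t.image (Ideal.Quotient.mk (Ideal.span {f})) = s := by
    refine ⟨s.image (Function.surjInv Ideal.Quotient.mk_surjective), ?_⟩
    rw [Finset.image_image, (Function.rightInverse_surjInv _).comp_eq_id, Finset.image_id]
  have h2 : (Ideal.span (t : Set B)).map (Ideal.Quotient.mk (Ideal.span {f})) =
      I.map (Ideal.Quotient.mk (Ideal.span {f})) := by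
    rw [Ideal.map_span, ← hs, ← ht, Finset.coe_image]
  have h3 := congrArg (Ideal.comap (Ideal.Quotient.mk (Ideal.span {f}))) h2
  rw [Ideal.comap_map_of_surjective _ Ideal.Quotient.mk_surjective,
    Ideal.comap_map_of_surjective _ Ideal.Quotient.mk_surjective, ← RingHom.ker_eq_comap_bot,
    Ideal.mk_ker, sup_eq_left.2 ((Ideal.span_singleton_le_iff_mem _).2 hf)] at h3
  rw [← h3]
  exact Submodule.FG.sup ⟨t, rfl⟩ ⟨{f}, by simp⟩

lemma exists_eq_pow_mul {f : Og ℂ} (hf : f ≠ 0) :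
    ∃ (k : ℕ) (u : Og ℂ), IsUnit u ∧ f = lin (ContinuousLinearMap.id ℂ ℂ) ^ k * u := by
  have h0 : ¬ ∀ᶠ z in 𝓝 (0 : ℂ), rep f z = 0 := fun h => hf <| by
    have := (Rp.eq_iff (rp_rep f) (Rp.const 0)).2 h
    simpa using this
  obtain ⟨k, g, hg, hg0, he⟩ :=
    ((rep_spec f).1.exists_eventuallyEq_pow_smul_nonzero_iff).2 h0
  refine ⟨k, mk g, isUnit_iff.2 (by rwa [ev_mk hg]), ?_⟩
  refine (Rp.eq_iff (rp_rep f) (((Rp.lin _).pow k).mul (rp_mk hg))).2 ?_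
  filter_upwards [he] with z hz
  simpa using hz

lemma axis_pl_snd (u : Og ℂ) : axis E (pl (ContinuousLinearMap.snd ℂ E ℂ) u) = u := by
  rw [axis, pl_pl, ContinuousLinearMap.snd_comp_inr, pl_id]

lemma axis_xl : axis E (xl E) = lin (ContinuousLinearMap.id ℂ ℂ) := by
  rw [axis, xl, pl_lin]; rfl

lemma down_xl : down E (xl E) = 0 := by
  rw [down, xl, pl_lin, ContinuousLinearMap.snd_comp_inl]
  exact map_zero (linHom E)

@[simp] lemma down_up (f : Og E) : down E (up E f) = f := by
  rw [down, up, pl_pl, ContinuousLinearMap.fst_comp_inl, pl_id]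

lemma axis_up (f : Og E) : axis E (up E f) = algebraMap ℂ _ (ev E f) := by
  rw [axis, up, pl_pl, ContinuousLinearMap.fst_comp_inr, pl_zero_map]

lemma dl_xl : dl E (xl E) = 1 := by
  rw [dl, xl, der_lin]; simp

lemma dl_up (f : Og E) : dl E (up E f) = 0 := by
  rw [dl, up, der_pl]
  have : (ContinuousLinearMap.fst ℂ E ℂ) ((0 : E), (1 : ℂ)) = (0 : ℂ) • (0 : E) := by simp
  rw [this, der_smul_dir]; simp

theorem weierstrass {f : Og (E × ℂ)} (hf : axis E f ≠ 0) :
    ∃ N : ℕ, ∀ g : Og (E × ℂ), ∃ (q : Og (E × ℂ)) (a : ℕ → Og E),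
      g = f * q + ∑ j ∈ Finset.range N, xl E ^ j * up E (a j) := by
  obtain ⟨k, u, ⟨u', rfl⟩, hu⟩ := exists_eq_pow_mul hf
  set s := pl (ContinuousLinearMap.snd ℂ E ℂ)
  have hs : s (↑u'⁻¹) * s ↑u' = 1 := by rw [← map_mul]; simp
  obtain ⟨ρ₁, hρ₁, h⟩ := ode_germ (ι := Unit) (E := E) 0 0
    (fun _ _ => xl E ^ k - s ↑u'⁻¹ * f) (fun _ _ => by
      rw [map_sub, map_mul, axis_pl_snd, hu, map_pow, axis_xl, mul_left_comm]; simp) k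
  obtain ⟨N₀, hN₀⟩ := h ρ₁ hρ₁ le_rfl
  have hdiv : ∀ (N : ℕ) (g : Unit → Og (E × ℂ)), (∃ (v h : Unit → Og (E × ℂ))
      (a : ℕ → Unit → Og E), (∀ i, g i = xl E ^ k * v i - ∑ j, (xl E ^ k - s ↑u'⁻¹ * f) * v j +
          ∑ j, (0 : Matrix Unit Unit (Og (E × ℂ))) i j * h j +
          ∑ j ∈ Finset.range N, xl E ^ j * up E (a j i))) →
      ∃ (q : Og (E × ℂ)) (a : ℕ → Og E),
        g () = f * q + ∑ j ∈ Finset.range N, xl E ^ j * up E (a j) := by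
    rintro N g ⟨v, h, a, h3⟩
    refine ⟨s ↑u'⁻¹ * v (), fun j => a j (), ?_⟩
    have := h3 ()
    simp only [Finset.univ_unique, Finset.sum_singleton, Matrix.zero_apply, zero_mul,
      add_zero] at this
    rw [this]
    ring
  have hmono : ∀ n : ℕ, ∃ (q : Og (E × ℂ)) (a : ℕ → Og E),
      xl E ^ n = f * q + ∑ j ∈ Finset.range N₀, xl E ^ j * up E (a j) := fun n => by
    obtain ⟨v, h, a, h3, -⟩ := hN₀ _ (hasRad_monomial hρ₁ (fun _ => 1) n)
    simpa using hdiv N₀ _ ⟨v, h, a, h3⟩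
  refine ⟨N₀, fun g => ?_⟩
  obtain ⟨ρ₂, hρ₂, hr⟩ := exists_hasRad (fun _ : Unit => g)
  obtain ⟨N, hN⟩ := h (min ρ₁ ρ₂) (lt_min hρ₁ hρ₂) (min_le_left _ _)
  obtain ⟨v, h, a, h3, -⟩ := hN _ (hr _ (lt_min hρ₁ hρ₂) (min_le_right _ _))
  obtain ⟨q, a, hq⟩ := hdiv N (fun _ => g) ⟨v, h, a, h3⟩
  choose q' a' hqa using hmono
  refine ⟨q + ∑ n ∈ Finset.range N, q' n * up E (a n),
    fun j => ∑ n ∈ Finset.range N, a' n j * a n, ?_⟩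
  have h4 : ∑ n ∈ Finset.range N, xl E ^ n * up E (a n) = ∑ n ∈ Finset.range N,
      (f * (q' n * up E (a n)) + ∑ j ∈ Finset.range N₀, xl E ^ j * up E (a' n j * a n)) := by
    refine Finset.sum_congr rfl fun n _ => ?_
    conv_lhs => rw [hqa n]
    rw [add_mul, Finset.sum_mul, mul_assoc]
    congr 1
    exact Finset.sum_congr rfl fun j _ => by rw [map_mul, mul_assoc]
  rw [hq, h4, Finset.sum_add_distrib, Finset.sum_comm (γ := ℕ), mul_add, ← Finset.mul_sum,
    add_assoc]
  congr 2
  refine Finset.sum_congr rfl fun j _ => ?_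
  rw [map_sum, Finset.mul_sum]

lemma hadamard (f : Og (E × ℂ)) : ∃ q, f = xl E * q + up E (down E f) := by
  have h1 : axis E (xl E) ≠ 0 := by
    rw [axis_xl]
    intro h
    have := lin_injective (h.trans (map_zero (linHom ℂ)).symm)
    simpa using congrArg (fun l => l (1 : ℂ)) this
  obtain ⟨N, hN⟩ := weierstrass h1
  obtain ⟨q, a, h⟩ := hN f
  obtain ⟨r, hr⟩ : ∃ r b, f = xl E * r + up E b := by
    rw [h]
    cases N with
    | zero => exact ⟨q, 0, by simp⟩
    | succ N =>
      refine ⟨q + ∑ j ∈ Finset.range N, xl E ^ j * up E (a (j + 1)), a 0, ?_⟩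
      rw [Finset.sum_range_succ', mul_add, Finset.mul_sum, pow_zero, one_mul, ← add_assoc]
      congr 2
      exact Finset.sum_congr rfl fun j _ => by ring
  obtain ⟨b, hb⟩ := hr
  refine ⟨r, ?_⟩
  conv_rhs => rw [hb, map_add, map_mul, down_xl, zero_mul, zero_add, down_up]
  exact hb

/-- Existence of antiderivatives in the last variable. -/
lemma exists_dl_eq (f : Og (E × ℂ)) : ∃ h, dl E h = f := by
  obtain ⟨ρ₁, h1, h2⟩ := ode_germ (ι := Unit) (E := E) (fun _ _ => 1) 0 0
    (fun _ _ => map_zero _) 0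
  obtain ⟨ρ₂, h3, h4⟩ := exists_hasRad (fun _ : Unit => f)
  obtain ⟨N, hN⟩ := h2 (min ρ₁ ρ₂) (lt_min h1 h3) (min_le_left _ _)
  obtain ⟨v, h, a, h5, h6⟩ := hN _ (h4 _ (lt_min h1 h3) (min_le_right _ _))
  have h5 := h5 ()
  have h6 := h6 ()
  simp only [pow_zero, one_mul, Matrix.zero_apply, zero_mul, Finset.sum_const_zero, sub_zero,
    add_zero, Finset.univ_unique, Finset.sum_singleton] at h5 h6
  refine ⟨h () + ∑ j ∈ Finset.range N,
    algebraMap ℂ _ ((j + 1 : ℂ)⁻¹) * (xl E ^ (j + 1) * up E (a j ())), ?_⟩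
  rw [map_add, h6, map_sum, h5]
  congr 1
  refine Finset.sum_congr rfl fun j _ => ?_
  rw [← Algebra.smul_def, Derivation.map_smul, Derivation.leibniz, dl_up, Derivation.leibniz_pow,
    dl_xl]
  simp only [smul_eq_mul, mul_one, mul_zero, zero_add, Nat.add_sub_cancel, nsmul_eq_mul]
  rw [Algebra.smul_def]
  have h7 : (algebraMap ℂ (Og (E × ℂ)) ((j + 1 : ℂ)⁻¹)) * ((j + 1 : ℕ) : Og (E × ℂ)) = 1 := by
    rw [← map_natCast (algebraMap ℂ (Og (E × ℂ))), ← map_mul, Nat.cast_add, Nat.cast_one,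
      inv_mul_cancel₀ (by exact_mod_cast Nat.succ_ne_zero j), map_one]
  linear_combination xl E ^ j * up E (a j ()) * h7

section Split

variable (l : E →L[ℂ] ℂ) (v : E)

/-- Coordinates adapted to a linear form. -/
noncomputable def toSplit (h : l v = 1) : E →L[ℂ] l.ker × ℂ :=
  (((ContinuousLinearMap.id ℂ E) - l.smulRight v).codRestrict l.ker fun z => by
    simp [h]).prod l

/-- The inverse of `Og.toSplit`. -/
noncomputable def ofSplit : l.ker × ℂ →L[ℂ] E :=
  l.ker.subtypeL.comp (ContinuousLinearMap.fst ℂ _ _) +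
    (ContinuousLinearMap.snd ℂ l.ker ℂ).smulRight v

variable {l v}

lemma ofSplit_comp_toSplit (h : l v = 1) :
    (ofSplit l v).comp (toSplit l v h) = ContinuousLinearMap.id ℂ E := by
  ext z; simp [ofSplit, toSplit]

lemma toSplit_comp_ofSplit (h : l v = 1) :
    (toSplit l v h).comp (ofSplit l v) = ContinuousLinearMap.id ℂ (l.ker × ℂ) := by
  ext z
  · simp [ofSplit, toSplit]
  · simp [ofSplit, toSplit]
  · simp [ofSplit, toSplit, h]
  · simp [ofSplit, toSplit, h]

end Split

/-- Composition with a pair of mutually inverse linear maps. -/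
noncomputable def plEquiv (L : E →L[ℂ] F) (M : F →L[ℂ] E)
    (h1 : M.comp L = ContinuousLinearMap.id ℂ E) (h2 : L.comp M = ContinuousLinearMap.id ℂ F) :
    Og F ≃ₐ[ℂ] Og E :=
  AlgEquiv.ofAlgHom (pl L) (pl M)
    (by ext1 f; simp [pl_pl, h1, pl_id]) (by ext1 f; simp [pl_pl, h2, pl_id])

/-- A nonzero germ is nonzero on some line through the origin. -/
lemma exists_line {f : Og E} (hf : f ≠ 0) :
    ∃ v : E, pl ((ContinuousLinearMap.id ℂ ℂ).smulRight v) f ≠ 0 := by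
  by_contra! h
  refine hf ?_
  obtain ⟨r, hr, hB⟩ : ∃ r > 0, ∀ z ∈ Metric.ball (0 : E) r, AnalyticAt ℂ (rep f) z :=
    Metric.eventually_nhds_iff_ball.1 (rep_spec f).1.eventually_analyticAt
  have h0 : f = 0 ↔ _ := (map_zero (algebraMap ℂ (Og E))) ▸ (Rp.eq_iff (rp_rep f) (Rp.const 0))
  refine h0.2 ?_
  filter_upwards [Metric.ball_mem_nhds (0 : E) hr] with z hz
  set U : Set ℂ := (fun s : ℂ => s • z) ⁻¹' Metric.ball (0 : E) r with hU
  have hUc : Convex ℝ U := by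
    have : Convex ℝ (Metric.ball (0 : E) r) := convex_ball _ _
    exact this.is_linear_preimage
      ⟨fun a b => add_smul a b z, fun c a => by simp only [smul_assoc]⟩
  have han : AnalyticOnNhd ℂ (fun s : ℂ => rep f (s • z)) U := fun s hs =>
    AnalyticAt.comp (g := rep f) (f := fun s : ℂ => s • z) (hB _ hs)
      (analyticAt_id.smul analyticAt_const)
  have h1 : (fun s : ℂ => rep f (s • z)) =ᶠ[𝓝 0] 0 := by
    have h2 := (Rp.eq_iff ((rp_rep f).pl ((ContinuousLinearMap.id ℂ ℂ).smulRight z))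
      (Rp.const 0)).1 ((h z).trans (map_zero _).symm)
    exact h2
  have h3 := han.eqOn_zero_of_preconnected_of_eventuallyEq_zero hUc.isPreconnected
    (show (0 : ℂ) ∈ U by simp [hU, hr]) h1 (show (1 : ℂ) ∈ U by simpa [hU] using hz)
  simpa using h3

/-- A module generated by the powers of the last coordinate. -/
lemma finite_quotient_span {f : Og (E × ℂ)} (hf : axis E f ≠ 0) {I : Ideal (Og (E × ℂ))}
    (hI : f ∈ I) : ((Ideal.Quotient.mk I).comp (up E).toRingHom).Finite := by
  obtain ⟨N, hN⟩ := weierstrass hf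
  let := ((Ideal.Quotient.mk I).comp (up E).toRingHom).toAlgebra
  change Module.Finite (Og E) (Og (E × ℂ) ⧸ I)
  refine ⟨⟨(Finset.range N).image fun j => Ideal.Quotient.mk I (xl E ^ j), ?_⟩⟩
  rw [eq_top_iff]
  rintro g -
  obtain ⟨g, rfl⟩ := Ideal.Quotient.mk_surjective g
  obtain ⟨q, a, h⟩ := hN g
  rw [h, map_add, Ideal.Quotient.eq_zero_iff_mem.2 (I.mul_mem_right q hI), zero_add, map_sum]
  refine Submodule.sum_mem _ fun j hj => ?_
  have : Ideal.Quotient.mk I (xl E ^ j * up E (a j)) =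
      (a j) • Ideal.Quotient.mk I (xl E ^ j) := by
    rw [Algebra.smul_def, mul_comm, map_mul]; rfl
  rw [this]
  exact Submodule.smul_mem _ _ (Submodule.subset_span (by
    rw [Finset.coe_image]; exact ⟨j, hj, rfl⟩))

lemma fg_of_axis_ne_zero [IsNoetherianRing (Og E)] {f : Og (E × ℂ)} (hf : axis E f ≠ 0)
    {I : Ideal (Og (E × ℂ))} (hI : f ∈ I) : I.FG := by
  exact fg_of_mem_of_isNoetherianRing hI (isNoetherianRing_of_finite _
    (finite_quotient_span hf (Ideal.mem_span_singleton_self f)))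

lemma finrank_ker_form [FiniteDimensional ℂ E] {l : E →L[ℂ] ℂ} {v : E} (h : l v = 1) :
    Module.finrank ℂ l.ker + 1 = Module.finrank ℂ E := by
  refine Module.Dual.finrank_ker_add_one_of_ne_zero (f := (l : E →ₗ[ℂ] ℂ)) fun h0 => ?_
  have := congrArg (fun m : E →ₗ[ℂ] ℂ => m v) h0
  simp [h] at this

lemma isNoetherianRing_aux (n : ℕ) : ∀ (E : Type u) [NormedAddCommGroup E] [NormedSpace ℂ E]
    [FiniteDimensional ℂ E], Module.finrank ℂ E = n → IsNoetherianRing (Og E) := by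
  induction n with
  | zero =>
    intro E _ _ _ h
    have : Subsingleton E := Module.finrank_zero_iff.1 h
    refine isNoetherianRing_of_surjective ℂ (Og E) (algebraMap ℂ (Og E)) fun f => ⟨ev E f, ?_⟩
    rw [← pl_zero_map (E := E), Subsingleton.elim (0 : E →L[ℂ] E) (ContinuousLinearMap.id ℂ E),
      pl_id]
  | succ n ih =>
    intro E _ _ _ h
    refine (isNoetherianRing_iff_ideal_fg _).2 fun I => ?_
    by_cases hI : I = ⊥
    · rw [hI]; exact Submodule.fg_bot
    obtain ⟨f, hfI, hf⟩ := Submodule.exists_mem_ne_zero_of_ne_bot hI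
    obtain ⟨v, hv⟩ := exists_line hf
    by_cases hv0 : v = 0
    · have h1 : IsUnit f := by
        rw [isUnit_iff]
        rintro h0
        refine hv ?_
        rw [hv0, ContinuousLinearMap.smulRight_zero, pl_zero_map, h0, map_zero]
      rw [I.eq_top_of_isUnit_mem hfI h1]
      exact ⟨{1}, by simp⟩
    obtain ⟨l, hl⟩ := SeparatingDual.exists_eq_one (R := ℂ) hv0
    have := ih l.ker (by have := finrank_ker_form hl; omega)
    set e := plEquiv (ofSplit l v) (toSplit l v hl) (toSplit_comp_ofSplit hl)
      (ofSplit_comp_toSplit hl) with he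
    have h1 : (I.map (e : Og E →+* Og (l.ker × ℂ))).FG := by
      refine fg_of_axis_ne_zero (f := e f) ?_ (Ideal.mem_map_of_mem _ hfI)
      have h2 : axis l.ker (e f) = pl ((ContinuousLinearMap.id ℂ ℂ).smulRight v) f := by
        change axis l.ker (pl (ofSplit l v) f) = _
        rw [axis, pl_pl]
        congr 2
        ext
        simp [ofSplit]
      rwa [h2]
    have h3 := h1.map (e.symm : Og (l.ker × ℂ) →+* Og E)
    rw [Ideal.map_map] at h3
    have h4 : ((e.symm : Og (l.ker × ℂ) →+* Og E)).comp (e : Og E →+* Og (l.ker × ℂ)) =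
        RingHom.id _ := by
      ext1 x; exact e.symm_apply_apply x
    rwa [h4, Ideal.map_id] at h3

instance [FiniteDimensional ℂ E] : IsNoetherianRing (Og E) := isNoetherianRing_aux _ E rfl

lemma pl_injective_of_rightInverse {L : E →L[ℂ] F} {M : F →L[ℂ] E}
    (h : L.comp M = ContinuousLinearMap.id ℂ F) : Function.Injective (pl L) := by
  intro f g hfg
  have := congrArg (pl M) hfg
  simpa only [pl_pl, h, pl_id] using this

lemma exists_rightInverse [FiniteDimensional ℂ F] {L : E →L[ℂ] F} (hL : Function.Surjective L) :
    ∃ M : F →L[ℂ] E, L.comp M = ContinuousLinearMap.id ℂ F := by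
  obtain ⟨M, hM⟩ := (L : E →ₗ[ℂ] F).exists_rightInverse_of_surjective (LinearMap.range_eq_top.2 hL)
  refine ⟨LinearMap.toContinuousLinearMap M, ?_⟩
  ext1 x
  exact congrArg (fun A : F →ₗ[ℂ] F => A x) hM

lemma exists_leftInverse [FiniteDimensional ℂ F] {L : E →L[ℂ] F} (hL : Function.Injective L) :
    ∃ M : F →L[ℂ] E, M.comp L = ContinuousLinearMap.id ℂ E := by
  obtain ⟨M, hM⟩ := (L : E →ₗ[ℂ] F).exists_leftInverse_of_injective (LinearMap.ker_eq_bot.2 hL)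
  refine ⟨LinearMap.toContinuousLinearMap M, ?_⟩
  ext1 x
  exact congrArg (fun A : E →ₗ[ℂ] E => A x) hM

/-- The projection along `v` to the kernel of a linear form. -/
noncomputable def projKer (l : E →L[ℂ] ℂ) (v : E) (h : l v = 1) : E →L[ℂ] l.ker :=
  (ContinuousLinearMap.fst ℂ _ _).comp (toSplit l v h)

lemma hadamard_form {l : E →L[ℂ] ℂ} {v : E} (h : l v = 1) (f : Og E) :
    ∃ q, f = lin l * q + pl (projKer l v h) (pl l.ker.subtypeL f) := by
  obtain ⟨q, hq⟩ := hadamard (pl (ofSplit l v) f)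
  refine ⟨pl (toSplit l v h) q, ?_⟩
  have h1 := congrArg (pl (toSplit l v h)) hq
  rw [pl_pl, ofSplit_comp_toSplit, pl_id, map_add, map_mul, xl, pl_lin, up, pl_pl, down,
    pl_pl] at h1
  have e1 : (ContinuousLinearMap.snd ℂ l.ker ℂ).comp (toSplit l v h) = l := by
    ext x; simp [toSplit]
  have e2 : (ofSplit l v).comp (ContinuousLinearMap.inl ℂ l.ker ℂ) = l.ker.subtypeL := by
    ext x; simp [ofSplit]
  rw [e1] at h1
  refine h1.trans ?_
  rw [← e2, projKer, pl_pl, pl_pl]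
  rfl

/-- The germs vanishing on the image of an injective linear map are generated by linear forms. -/
lemma mem_span_lin_aux (n : ℕ) : ∀ (E : Type u) [NormedAddCommGroup E] [NormedSpace ℂ E]
    [FiniteDimensional ℂ E], Module.finrank ℂ E = n →
    ∀ j : F →L[ℂ] E, Function.Injective j → ∀ f : Og E, pl j f = 0 →
      f ∈ Ideal.span (lin '' {l : E →L[ℂ] ℂ | l.comp j = 0}) := by
  induction n with
  | zero =>
    intro E _ _ _ hn j hj f hf
    have : Subsingleton E := Module.finrank_zero_iff.1 hn
    have h1 : (0 : E →L[ℂ] E) = j.comp (0 : E →L[ℂ] F) := Subsingleton.elim _ _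
    have h2 : f = 0 := by
      rw [← pl_id f, Subsingleton.elim (ContinuousLinearMap.id ℂ E) 0, h1, ← pl_pl, hf, map_zero]
    rw [h2]
    exact zero_mem _
  | succ n ih =>
    intro E _ _ _ hn j hj f hf
    by_cases hs : Function.Surjective j
    · obtain ⟨M, hM⟩ := exists_rightInverse hs
      rw [(map_eq_zero_iff _ (pl_injective_of_rightInverse hM)).1 hf]
      exact zero_mem _
    obtain ⟨l, hl0, hl⟩ : ∃ l : E →L[ℂ] ℂ, l ≠ 0 ∧ l.comp j = 0 := by
      obtain ⟨l, hl0, hl⟩ := Submodule.exists_le_ker_of_lt_top (LinearMap.range (j : F →ₗ[ℂ] E))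
        (lt_top_iff_ne_top.2 fun h => hs (LinearMap.range_eq_top.1 h))
      refine ⟨LinearMap.toContinuousLinearMap l, fun h => hl0 ?_, ?_⟩
      · ext x
        exact congrArg (fun A : E →L[ℂ] ℂ => A x) h
      · ext x
        exact hl ⟨x, rfl⟩
    obtain ⟨v, hv⟩ : ∃ v, l v = 1 := by
      obtain ⟨v, hv⟩ : ∃ v, l v ≠ 0 := by
        by_contra! h
        exact hl0 (ContinuousLinearMap.ext h)
      exact ⟨(l v)⁻¹ • v, by simp [hv]⟩
    obtain ⟨q, hq⟩ := hadamard_form hv f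
    have hlj : ∀ x, l (j x) = 0 := fun x => congrArg (fun A : F →L[ℂ] ℂ => A x) hl
    set j' : F →L[ℂ] l.ker := j.codRestrict l.ker hlj
    have hj' : l.ker.subtypeL.comp j' = j := by ext x; rfl
    have h1 := ih l.ker (by have := finrank_ker_form hv; omega) j'
      (fun a b hab => hj (congrArg Subtype.val hab)) (pl l.ker.subtypeL f)
      (by rw [pl_pl, hj', hf])
    have h2 := Ideal.mem_map_of_mem (pl (projKer l v hv) : Og l.ker →+* Og E) h1
    rw [Ideal.map_span, Set.image_image] at h2
    rw [hq]
    refine add_mem (Ideal.mul_mem_right _ _ (Ideal.subset_span ⟨l, hl, rfl⟩)) ?_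
    refine Ideal.span_mono ?_ h2
    rintro _ ⟨m, hm, rfl⟩
    refine ⟨m.comp (projKer l v hv), ?_, (pl_lin _ _).symm⟩
    ext x
    have h3 : projKer l v hv (j x) = j' x := by
      ext; simp [projKer, toSplit, hlj, j']; rfl
    have h4 : m (j' x) = 0 := congrArg (fun A : F →L[ℂ] ℂ => A x) hm
    simp [h3, h4]

lemma mem_span_lin [FiniteDimensional ℂ E] {j : F →L[ℂ] E} (hj : Function.Injective j) {f : Og E}
    (hf : pl j f = 0) : f ∈ Ideal.span (lin '' {l : E →L[ℂ] ℂ | l.comp j = 0}) :=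
  mem_span_lin_aux _ E rfl j hj f hf

lemma maximalIdeal_eq_span [FiniteDimensional ℂ E] :
    IsLocalRing.maximalIdeal (Og E) = Ideal.span (Set.range (lin : (E →L[ℂ] ℂ) → Og E)) := by
  refine le_antisymm (fun f hf => ?_) (Ideal.span_le.2 ?_)
  · have h1 : Function.Injective (0 : PUnit.{1} →L[ℂ] E) := fun a b _ => rfl
    have h2 := mem_span_lin h1 (f := f) (by rw [pl_zero_map, mem_max.1 hf, map_zero])
    exact Ideal.span_mono (Set.image_subset_range _ _) h2
  · rintro _ ⟨l, rfl⟩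
    exact mem_max.2 (ev_lin l)

lemma eq_up_of_dl_eq_zero [FiniteDimensional ℂ E] {f : Og (E × ℂ)} (h : dl E f = 0) :
    f = up E (down E f) := by
  rw [← sub_eq_zero]
  set g := f - up E (down E f) with hg
  have hd : dl E g = 0 := by rw [hg, map_sub, h, dl_up, sub_zero]
  have hx : xl E ∈ IsLocalRing.maximalIdeal (Og (E × ℂ)) := mem_max.2 (ev_lin _)
  have h1 : ∀ n : ℕ, ∃ q, g = xl E ^ (n + 1) * q := by
    intro n
    induction n with
    | zero =>
      obtain ⟨q, hq⟩ := hadamard f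
      exact ⟨q, by rw [hg, zero_add, pow_one]; exact sub_eq_of_eq_add hq⟩
    | succ n ih =>
      obtain ⟨q, hq⟩ := ih
      rw [hq, Derivation.leibniz, Derivation.leibniz_pow, dl_xl] at hd
      simp only [smul_eq_mul, mul_one, Nat.add_sub_cancel, nsmul_eq_mul] at hd
      have hx0 : xl E ≠ 0 := fun h0 => by
        have := congrArg (dl E) h0
        rw [dl_xl, map_zero] at this
        exact one_ne_zero this
      have h2 : xl E * dl E q + ((n + 1 : ℕ) : Og (E × ℂ)) * q = 0 := by
        refine (mul_eq_zero.1 ?_).resolve_left (pow_ne_zero n hx0)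
        linear_combination hd
      have h7 : (algebraMap ℂ (Og (E × ℂ)) ((n + 1 : ℂ)⁻¹)) * ((n + 1 : ℕ) : Og (E × ℂ)) = 1 := by
        rw [← map_natCast (algebraMap ℂ (Og (E × ℂ))), ← map_mul, Nat.cast_add, Nat.cast_one,
          inv_mul_cancel₀ (by exact_mod_cast Nat.succ_ne_zero n), map_one]
      refine ⟨-(algebraMap ℂ (Og (E × ℂ)) ((n + 1 : ℂ)⁻¹)) * dl E q, ?_⟩
      rw [hq]
      linear_combination xl E ^ (n + 1) * ((algebraMap ℂ (Og (E × ℂ)) ((n + 1 : ℂ)⁻¹)) * h2 - q * h7)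
  have h2 : g ∈ ⨅ i : ℕ, IsLocalRing.maximalIdeal (Og (E × ℂ)) ^ i := by
    refine Ideal.mem_iInf.2 fun i => ?_
    obtain ⟨q, hq⟩ := h1 i
    rw [hq]
    exact Ideal.mul_mem_right _ _ (Ideal.pow_le_pow_right (Nat.le_succ i) (Ideal.pow_mem_pow hx _))
  rwa [Ideal.iInf_pow_eq_bot_of_isLocalRing _ (Ideal.IsPrime.ne_top inferInstance)] at h2


/-! ### Derivations into separated rings -/

section Derivation

variable {C : Type*} [CommRing C]

lemma der_eq_zero [FiniteDimensional ℂ E] {M : Type*} [AddCommGroup M] [Module (Og E) M]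
    (hsep : ∀ c : M, (∀ k : ℕ, c ∈ IsLocalRing.maximalIdeal (Og E) ^ k • (⊤ : Submodule (Og E) M)) →
      c = 0)
    (θ : Og E →+ M) (hmul : ∀ a b, θ (a * b) = a • θ b + b • θ a)
    (hc : ∀ c : ℂ, θ (algebraMap ℂ _ c) = 0) (hl : ∀ l, θ (lin l) = 0) (f : Og E) : θ f = 0 := by
  have key : ∀ k : ℕ, ∀ f, θ f ∈ IsLocalRing.maximalIdeal (Og E) ^ k • (⊤ : Submodule (Og E) M) := by
    intro k
    induction k with
    | zero => intro f; simp
    | succ k ih =>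
      have h1 : ∀ g ∈ Ideal.span (Set.range (lin : (E →L[ℂ] ℂ) → Og E)),
          θ g ∈ IsLocalRing.maximalIdeal (Og E) ^ (k + 1) • (⊤ : Submodule (Og E) M) := by
        intro g hg
        induction hg using Submodule.span_induction with
        | mem x hx => obtain ⟨l, rfl⟩ := hx; rw [hl]; exact zero_mem _
        | zero => rw [map_zero]; exact zero_mem _
        | add x y _ _ hx hy => rw [map_add]; exact add_mem hx hy
        | smul a x hx hx' =>
          rw [smul_eq_mul, hmul]
          refine add_mem (Submodule.smul_mem _ _ hx') ?_
          rw [pow_succ', ← smul_eq_mul, Submodule.smul_assoc]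
          refine Submodule.smul_mem_smul ?_ (ih a)
          rw [maximalIdeal_eq_span]
          exact hx
      intro f
      have h2 : f - algebraMap ℂ _ (ev E f) ∈ IsLocalRing.maximalIdeal (Og E) := by
        rw [mem_max, map_sub, ev_algebraMap, sub_self]
      rw [maximalIdeal_eq_span] at h2
      have h3 := h1 _ h2
      rwa [map_sub, hc, sub_zero] at h3
  exact hsep _ fun k => key k f

/-- The chain rule for derivations with values in a separated module. -/
lemma der_eq_sum_smul {ι : Type*} [Fintype ι] [FiniteDimensional ℂ E]
    {M : Type*} [AddCommGroup M] [Module (Og E) M]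
    (hsep : ∀ c : M, (∀ k : ℕ, c ∈ IsLocalRing.maximalIdeal (Og E) ^ k • (⊤ : Submodule (Og E) M)) →
      c = 0)
    (θ : Og E →+ M) (hmul : ∀ a b, θ (a * b) = a • θ b + b • θ a)
    (hc : ∀ c : ℂ, θ (algebraMap ℂ _ c) = 0)
    (v : ι → E) (w : ι → E →L[ℂ] ℂ) (hvw : ∀ x, ∑ i, w i x • v i = x) (f : Og E) :
    θ f = ∑ i, der (v i) f • θ (lin (w i)) := by
  let θ' : Og E →+ M := θ - ∑ i, ((smulAddHom (Og E) M).flip (θ (lin (w i)))).comp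
    (der (v i) : Og E →+ Og E)
  have hθ' : ∀ f, θ' f = θ f - ∑ i, der (v i) f • θ (lin (w i)) := by
    intro f
    simp [θ']
  have hscal : ∀ (c : ℂ) g, θ (c • g) = algebraMap ℂ (Og E) c • θ g := by
    intro c g
    rw [Algebra.smul_def, hmul, hc, smul_zero, add_zero]
  have h0 := der_eq_zero hsep θ' (fun a b => ?_) (fun c => ?_) (fun l => ?_) f
  · rw [hθ', sub_eq_zero] at h0
    exact h0
  · simp only [hθ', hmul, Derivation.leibniz, smul_eq_mul, smul_sub, Finset.smul_sum, add_smul,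
      Finset.sum_add_distrib, smul_smul]
    abel
  · simp [hθ', hc]
  · rw [hθ']
    have h1 : l = ∑ i, l (v i) • w i := by
      ext x
      conv_lhs => rw [← hvw x]
      simp [mul_comm]
    have h2 : lin l = ∑ i, l (v i) • lin (w i) := by
      conv_lhs => rw [h1]
      rw [← linHom_apply, map_sum]
      simp
    have h3 : θ (lin l) = ∑ i, der (v i) (lin l) • θ (lin (w i)) := by
      conv_lhs => rw [h2]
      rw [map_sum]
      refine Finset.sum_congr rfl fun i _ => ?_
      rw [hscal, der_lin]
    rw [h3, sub_self]

/-- The chain rule for derivations along a ring homomorphism. -/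
lemma der_eq_sum {ι : Type*} [Fintype ι] [FiniteDimensional ℂ E] (φ : Og E →+* C)
    (hsep : ∀ c, (∀ k : ℕ, c ∈ (IsLocalRing.maximalIdeal (Og E)).map φ ^ k) → c = 0)
    (θ : Og E →+ C) (hmul : ∀ a b, θ (a * b) = φ a * θ b + φ b * θ a)
    (hc : ∀ c : ℂ, θ (algebraMap ℂ _ c) = 0)
    (v : ι → E) (w : ι → E →L[ℂ] ℂ) (hvw : ∀ x, ∑ i, w i x • v i = x) (f : Og E) :
    θ f = ∑ i, φ (der (v i) f) * θ (lin (w i)) := by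
  let _ : Algebra (Og E) C := φ.toAlgebra
  refine der_eq_sum_smul (fun c h => hsep c fun k => ?_) θ hmul hc v w hvw f
  have h1 := h k
  rw [Ideal.smul_top_eq_map] at h1
  rw [← Ideal.map_pow]
  exact h1

lemma map_maximalIdeal_le {R : Type*} [CommRing R] [IsLocalRing R] [IsLocalRing C] (φ : R →+* C)
    [IsLocalHom φ] :
    (IsLocalRing.maximalIdeal R).map φ ≤ IsLocalRing.maximalIdeal C := by
  rw [Ideal.map_le_iff_le_comap]
  intro f hf h
  exact hf (isUnit_of_map_unit φ f h)

lemma separated_of_isLocalRing {R : Type*} [CommRing R] [IsLocalRing R]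
    [IsLocalRing C] [IsNoetherianRing C] (φ : R →+* C) [IsLocalHom φ] (c : C)
    (h : ∀ k : ℕ, c ∈ (IsLocalRing.maximalIdeal R).map φ ^ k) : c = 0 := by
  have h1 := Ideal.iInf_pow_eq_bot_of_isLocalRing ((IsLocalRing.maximalIdeal R).map φ)
    (fun h => by
      have := map_maximalIdeal_le φ
      rw [h] at this
      exact (IsLocalRing.maximalIdeal.isMaximal C).ne_top (top_le_iff.1 this))
  have h2 : c ∈ (⊥ : Ideal C) := h1 ▸ Ideal.mem_iInf.2 h
  simpa using h2

end Derivation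

/-! ### Finiteness of projections -/

lemma maximalIdeal_map_le [FiniteDimensional ℂ F] (L : E →L[ℂ] F) :
    (IsLocalRing.maximalIdeal (Og F)).map (pl L) ≤ IsLocalRing.maximalIdeal (Og E) := by
  rw [Ideal.map_le_iff_le_comap]
  intro f hf
  rw [Ideal.mem_comap, mem_max, ev_pl]
  exact mem_max.1 hf

lemma finite_of_finite_comp_aux {A B C : Type*} [CommRing A] [CommRing B] [CommRing C]
    [IsLocalRing B] [IsLocalRing C] (p : A →+* B) (u : B →+* C) [IsLocalHom u]
    (𝔪 : Ideal A) (I : Ideal C)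
    (hI : IsLocalRing.maximalIdeal C ≤ (I ⊔ 𝔪.map (u.comp p)).radical)
    (hup : ((Ideal.Quotient.mk I).comp u).Finite)
    (ih : ∀ J : Ideal B, IsLocalRing.maximalIdeal B ≤ (J ⊔ 𝔪.map p).radical →
      ((Ideal.Quotient.mk J).comp p).Finite) :
    ((Ideal.Quotient.mk I).comp (u.comp p)).Finite := by
  set J : Ideal B := I.comap u with hJ
  have hm' : IsLocalRing.maximalIdeal B ≤ (J ⊔ 𝔪.map p).radical := by
    rw [Ideal.radical_eq_sInf]
    refine le_sInf fun Q hQ => ?_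
    obtain ⟨hQ, hQp⟩ := hQ
    let := ((Ideal.Quotient.mk I).comp u).toAlgebra
    have : Module.Finite B (C ⧸ I) := hup
    have hint : Algebra.IsIntegral B (C ⧸ I) := inferInstance
    obtain ⟨P, -, hP, hPQ⟩ := Ideal.exists_ideal_over_prime_of_isIntegral
      (R := B) (S := C ⧸ I) Q ⊥ (fun f hf => by
        exact hQ (Ideal.mem_sup_left (show u f ∈ I from Ideal.Quotient.eq_zero_iff_mem.1 hf)))
    set P₁ := P.comap (Ideal.Quotient.mk I) with hP₁
    have hP₁p : P₁.IsPrime := Ideal.comap_isPrime _ _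
    have hPQ' : P₁.comap u = Q := hPQ
    have h4 : IsLocalRing.maximalIdeal C ≤ P₁ := by
      refine hI.trans ((Ideal.IsPrime.radical_le_iff hP₁p).2 (sup_le ?_ ?_))
      · intro f hf
        change Ideal.Quotient.mk I f ∈ P
        rw [Ideal.Quotient.eq_zero_iff_mem.2 hf]
        exact zero_mem _
      · rw [← Ideal.map_map, Ideal.map_le_iff_le_comap, hPQ']
        exact le_sup_right.trans hQ
    intro f hf
    rw [← hPQ']
    exact h4 (map_maximalIdeal_le u (Ideal.mem_map_of_mem u hf))
  have hfin2 : (Ideal.quotientMap I u (le_refl (I.comap u))).Finite :=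
    RingHom.Finite.of_comp_finite (f := Ideal.Quotient.mk J) hup
  exact hfin2.comp (ih J hm')

lemma finite_of_equiv_aux {A B C : Type*} [CommRing A] [CommRing B] [CommRing C]
    [IsLocalRing B] [IsLocalRing C] (e : B ≃+* C) (p : A →+* B) (𝔪 : Ideal A) (I : Ideal B)
    (hI : IsLocalRing.maximalIdeal B ≤ (I ⊔ 𝔪.map p).radical)
    (ih : ∀ J : Ideal C, IsLocalRing.maximalIdeal C ≤
        (J ⊔ 𝔪.map ((e : B →+* C).comp p)).radical →
      ((Ideal.Quotient.mk J).comp ((e : B →+* C).comp p)).Finite) :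
    ((Ideal.Quotient.mk I).comp p).Finite := by
  have h1 := ih (I.comap (e.symm : C →+* B)) (fun f hf => by
    have h2 : e.symm f ∈ IsLocalRing.maximalIdeal B :=
      map_maximalIdeal_le (e.symm : C →+* B) (Ideal.mem_map_of_mem (e.symm : C →+* B) hf)
    obtain ⟨N, hN⟩ := hI h2
    obtain ⟨a, ha, b, hb, hab⟩ := Submodule.mem_sup.1 hN
    refine ⟨N, Submodule.mem_sup.2 ⟨e a, ?_, e b, ?_, ?_⟩⟩
    · change e.symm (e a) ∈ I
      rwa [e.symm_apply_apply]
    · rw [← Ideal.map_map]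
      exact Ideal.mem_map_of_mem (e : B →+* C) hb
    · rw [← map_add, hab, map_pow, e.apply_symm_apply])
  have h2 : (Ideal.quotientMap I (e.symm : C →+* B) le_rfl).Finite :=
    RingHom.Finite.of_surjective _ (Ideal.quotientMap_surjective e.symm.surjective)
  convert h2.comp h1 using 1
  ext1 f
  change Ideal.Quotient.mk I (p f) = Ideal.Quotient.mk I (e.symm (e (p f)))
  rw [e.symm_apply_apply]

instance isLocalHom_pl (L : E →L[ℂ] F) : IsLocalHom (pl L : Og F →+* Og E) where
  map_nonunit f hf := by
    rw [isUnit_iff] at hf ⊢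
    rwa [← ev_pl L]

lemma finite_proj_aux (n : ℕ) : ∀ (W : Type u) [NormedAddCommGroup W] [NormedSpace ℂ W]
    [FiniteDimensional ℂ W] [FiniteDimensional ℂ E] (π : W →L[ℂ] E), Function.Surjective π →
    Module.finrank ℂ π.ker = n → ∀ I : Ideal (Og W),
    IsLocalRing.maximalIdeal (Og W) ≤
      (I ⊔ (IsLocalRing.maximalIdeal (Og E)).map (pl π)).radical →
    ((Ideal.Quotient.mk I).comp (pl π).toRingHom).Finite := by
  induction n with
  | zero =>
    intro W _ _ _ _ π hπ hn I hI
    have hinj : Function.Injective π := by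
      have : Subsingleton π.ker := Module.finrank_zero_iff.1 hn
      exact LinearMap.ker_eq_bot.1 ((Submodule.subsingleton_iff_eq_bot).1 this)
    obtain ⟨M, hM⟩ := exists_leftInverse hinj
    refine RingHom.Finite.of_surjective _ (Ideal.Quotient.mk_surjective.comp fun f => ⟨pl M f, ?_⟩)
    change pl π (pl M f) = f
    rw [pl_pl, hM, pl_id]
  | succ n ih =>
    intro W _ _ _ _ π hπ hn I hI
    obtain ⟨⟨v, hvπ⟩, hv⟩ : ∃ v : π.ker, v ≠ 0 := by
      have : Nontrivial π.ker := Module.nontrivial_of_finrank_pos (R := ℂ) (by omega)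
      exact exists_ne 0
    have hv0 : v ≠ 0 := fun h => hv (Subtype.ext h)
    obtain ⟨l, hl⟩ := SeparatingDual.exists_eq_one (R := ℂ) hv0
    have hvπ' : π v = 0 := hvπ
    set π' : l.ker →L[ℂ] E := π.comp l.ker.subtypeL with hπ'
    have hππ' : π = (π'.comp (ContinuousLinearMap.fst ℂ _ ℂ)).comp (toSplit l v hl) := by
      ext x
      simp [hπ', toSplit, hvπ']
    have hπ's : Function.Surjective π' := by
      intro y
      obtain ⟨x, rfl⟩ := hπ y
      exact ⟨(toSplit l v hl x).1, (congrArg (fun A : W →L[ℂ] E => A x) hππ').symm⟩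
    have hdim : Module.finrank ℂ π'.ker = n := by
      have h1 := LinearMap.finrank_range_add_finrank_ker (π : W →ₗ[ℂ] E)
      have h2 := LinearMap.finrank_range_add_finrank_ker (π' : l.ker →ₗ[ℂ] E)
      rw [LinearMap.range_eq_top.2 hπ, finrank_top] at h1
      rw [LinearMap.range_eq_top.2 hπ's, finrank_top] at h2
      have h3 := finrank_ker_form hl
      change _ + Module.finrank ℂ π.ker = _ at h1
      change _ + Module.finrank ℂ π'.ker = _ at h2
      omega
    set e := plEquiv (ofSplit l v) (toSplit l v hl) (toSplit_comp_ofSplit hl)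
      (ofSplit_comp_toSplit hl) with he
    have heπ : ∀ f, e (pl π f) = up l.ker (pl π' f) := by
      intro f
      change pl (ofSplit l v) (pl π f) = _
      rw [pl_pl, up, pl_pl, hππ', ContinuousLinearMap.comp_assoc, toSplit_comp_ofSplit,
        ContinuousLinearMap.comp_id]
    refine finite_of_equiv_aux (e : Og W ≃+* Og (l.ker × ℂ)) (pl π : Og E →+* Og W) _ I hI ?_
    have hcomp : (((e : Og W ≃+* Og (l.ker × ℂ)) : Og W →+* Og (l.ker × ℂ)).comp
        (pl π : Og E →+* Og W)) = (up l.ker : Og l.ker →+* _).comp (pl π' : Og E →+* Og l.ker) :=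
      RingHom.ext heπ
    rw [hcomp]
    intro J hJ
    have hloc : IsLocalHom (up l.ker : Og l.ker →+* Og (l.ker × ℂ)) :=
      isLocalHom_pl (ContinuousLinearMap.fst ℂ l.ker ℂ)
    refine finite_of_finite_comp_aux _ _ _ J hJ ?_ (ih l.ker π' hπ's hdim)
    obtain ⟨N, hN⟩ := hJ (mem_max.2 (ev_lin _) : xl l.ker ∈ _)
    obtain ⟨a, ha, b, hb, hab⟩ := Submodule.mem_sup.1 hN
    refine finite_quotient_span (f := a) (fun h0 => ?_) ha
    have hb0 : axis l.ker b = 0 := by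
      rw [← Ideal.map_map] at hb
      have : (((IsLocalRing.maximalIdeal (Og E)).map (pl π' : Og E →+* Og l.ker)).map
          (up l.ker : Og l.ker →+* _)) ≤ RingHom.ker (axis l.ker) := by
        rw [Ideal.map_map, Ideal.map_le_iff_le_comap]
        intro f hf
        change axis l.ker (up l.ker (pl π' f)) = 0
        rw [axis_up, ev_pl, mem_max.1 hf, map_zero]
      exact this hb
    have h3 := congrArg (axis l.ker) hab
    rw [map_add, h0, hb0, map_pow, axis_xl, add_zero] at h3
    refine pow_ne_zero N (fun h => ?_) h3.symm
    have := congrArg (der (1 : ℂ)) h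
    rw [der_lin, map_zero] at this
    simp at this

/-- A germ of an analytic space whose intersection with the kernel of a linear projection `π` is
`{0}` is finite over the target of `π`. -/
theorem finite_proj [FiniteDimensional ℂ E] [FiniteDimensional ℂ F] (π : E →L[ℂ] F)
    (hπ : Function.Surjective π) (I : Ideal (Og E))
    (hI : IsLocalRing.maximalIdeal (Og E) ≤
      (I ⊔ (IsLocalRing.maximalIdeal (Og F)).map (pl π)).radical) :
    ((Ideal.Quotient.mk I).comp (pl π).toRingHom).Finite :=
  finite_proj_aux _ E π hπ rfl I hI

end Og

/-! ### Systems of parameters and generic linear sections -/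

open IsLocalRing in
/-- The ideal `J` defines (at most) the closed point. -/
def Prim {R : Type*} [CommRing R] [IsLocalRing R] (J : Ideal R) : Prop := maximalIdeal R ≤ J.radical

section Prim

open IsLocalRing

variable {R : Type*} [CommRing R] [IsLocalRing R]

lemma Prim.mono {I J : Ideal R} (h : Prim I) (hIJ : I ≤ J) : Prim J :=
  le_trans h (Ideal.radical_mono hIJ)

lemma prim_iff {J : Ideal R} : Prim J ↔ ∀ P : Ideal R, P.IsPrime → J ≤ P → maximalIdeal R ≤ P := by
  rw [Prim, Ideal.radical_eq_sInf, le_sInf_iff]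
  exact ⟨fun h P hP hJ => h P ⟨hJ, hP⟩, fun h P hP => h P hP.2 hP.1⟩

lemma exists_mem_forall_notMem' {V κ : Type*} [AddCommGroup V] [Module ℂ V] [Finite κ]
    (Λ : Submodule ℂ V) (p : κ → Submodule ℂ V)
    (h : ∀ k, ¬ Λ ≤ p k) : ∃ l ∈ Λ, ∀ k, l ∉ p k := by
  have := Fintype.ofFinite κ
  have h1 := Subspace.biUnion_ne_univ_of_top_notMem (k := ℂ) (E := Λ)
    (s := Finset.univ.image fun k => (p k).comap Λ.subtype) (by
      rw [Finset.mem_image]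
      rintro ⟨k, -, hP'⟩
      refine h k fun x hx => ?_
      have : (⟨x, hx⟩ : Λ) ∈ (⊤ : Submodule ℂ Λ) := trivial
      rw [← hP'] at this
      exact this)
  obtain ⟨⟨l, hl⟩, hl'⟩ := (Set.ne_univ_iff_exists_notMem _).1 h1
  refine ⟨l, hl, fun k hk => hl' ?_⟩
  simp only [Set.mem_iUnion, exists_prop]
  exact ⟨_, Finset.mem_image_of_mem _ (Finset.mem_univ k), hk⟩

variable [IsNoetherianRing R]

lemma coheight_le_of_prim {P : PrimeSpectrum R} {s : Finset R} (hs : (s : Set R) ⊆ maximalIdeal R)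
    (h : Prim (P.asIdeal ⊔ Ideal.span s)) : Order.coheight P ≤ s.card := by
  have hloc : IsLocalRing (R ⧸ P.asIdeal) :=
    IsLocalRing.of_surjective' (Ideal.Quotient.mk _) Ideal.Quotient.mk_surjective
  have hm : maximalIdeal (R ⧸ P.asIdeal) ∈
      (Ideal.span (s.image (Ideal.Quotient.mk P.asIdeal) : Finset _) : Ideal _).minimalPrimes := by
    have hlh : IsLocalHom (Ideal.Quotient.mk P.asIdeal) :=
      IsLocalHom.of_surjective _ Ideal.Quotient.mk_surjective
    refine ⟨⟨inferInstance, Ideal.span_le.2 ?_⟩, ?_⟩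
    · intro x hx
      obtain ⟨y, hy, rfl⟩ := Finset.mem_image.1 hx
      exact Og.map_maximalIdeal_le _ (Ideal.mem_map_of_mem _ (hs hy))
    · rintro Q ⟨hQ, hQs⟩ -
      have h2 := prim_iff.1 h (Q.comap (Ideal.Quotient.mk _)) (Ideal.comap_isPrime _ _) (by
        refine sup_le ?_ (Ideal.span_le.2 ?_)
        · intro x hx
          rw [Ideal.mem_comap, Ideal.Quotient.eq_zero_iff_mem.2 hx]
          exact zero_mem _
        · intro x hx
          exact hQs (Ideal.subset_span (Finset.mem_coe.2 (Finset.mem_image_of_mem _ hx))))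
      intro x hx
      obtain ⟨y, rfl⟩ := Ideal.Quotient.mk_surjective x
      exact h2 fun hy => hx (hy.map _)
  have h3 := Ideal.height_le_card_of_mem_minimalPrimes_span_finset hm
  have h4 : ((maximalIdeal (R ⧸ P.asIdeal)).height : WithBot ℕ∞) = ringKrullDim (R ⧸ P.asIdeal) :=
    maximalIdeal_height_eq_ringKrullDim
  have h5 : (PrimeSpectrum.zeroLocus (P.asIdeal : Set R)) = Set.Ici P := by
    ext Q; rfl
  rw [ringKrullDim_quotient, h5, ← Order.coheight_eq_krullDim_Ici, WithBot.coe_inj] at h4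
  rw [← h4]
  exact h3.trans (by exact_mod_cast Finset.card_image_le)

lemma coheight_le_of_ringKrullDim {I : Ideal R} {e : ℕ} (h : ringKrullDim (R ⧸ I) ≤ e)
    (P : PrimeSpectrum R) (hP : I ≤ P.asIdeal) : Order.coheight P ≤ e := by
  have h5 : Set.Ici P ⊆ PrimeSpectrum.zeroLocus (I : Set R) := fun Q hQ => hP.trans hQ
  have h6 : Order.krullDim (Set.Ici P) ≤ ringKrullDim (R ⧸ I) := by
    rw [ringKrullDim_quotient]
    exact Order.krullDim_le_of_strictMono (fun x => ⟨x.1, h5 x.2⟩) fun _ _ h => h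
  rw [← Order.coheight_eq_krullDim_Ici] at h6
  exact_mod_cast h6.trans h

lemma prim_sup_of_avoid {J : Ideal R} {f l : R} (hfm : f ∈ maximalIdeal R)
    (hf : Prim (J ⊔ Ideal.span {f}))
    (hl : ∀ P ∈ J.minimalPrimes, P ≠ maximalIdeal R → l ∉ P) : Prim (J ⊔ Ideal.span {l}) := by
  rw [prim_iff]
  intro Q hQ hJQ
  by_contra hQm
  obtain ⟨P, hP, hPQ⟩ := Ideal.exists_minimalPrimes_le (le_sup_left.trans hJQ)
  have hPp : P.IsPrime := hP.1.1
  have hlQ : l ∈ Q := hJQ (Ideal.mem_sup_right (Ideal.mem_span_singleton_self l))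
  have hlP : l ∉ P := hl P hP fun h => hQm (h ▸ hPQ)
  have hlt : P < Q := lt_of_le_of_ne hPQ fun h => hlP (h ▸ hlQ)
  have hlt2 : Q < maximalIdeal R := lt_of_le_of_ne (le_maximalIdeal hQ.ne_top) fun h => hQm h.ge
  have h1 := coheight_le_of_prim (P := ⟨P, hPp⟩) (s := {f}) (by simpa using hfm)
    (by simpa using hf.mono (sup_le_sup_right hP.1.2 _))
  have h2 : Order.coheight (⟨P, hPp⟩ : PrimeSpectrum R) ≤ (1 : ℕ) := by simpa using h1
  rw [Order.coheight_le_coe_iff] at h2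
  have h3 := h2 ⟨Q, hQ⟩ hlt
  have h4 : Order.coheight (⟨Q, hQ⟩ : PrimeSpectrum R) = 0 := by
    exact Order.lt_one_iff.1 h3
  rw [Order.coheight_eq_zero] at h4
  exact not_lt_of_ge (h4 (b := ⟨maximalIdeal R, inferInstance⟩) hlt2.le) hlt2

open RingTheory.Sequence

omit [IsLocalRing R] [IsNoetherianRing R] in
lemma isWeaklyRegular_iff_mem {rs : List R} : IsWeaklyRegular R rs ↔
    ∀ i (h : i < rs.length), ∀ x, x * rs[i] ∈ Ideal.ofList (rs.take i) →
      x ∈ Ideal.ofList (rs.take i) := by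
  rw [isWeaklyRegular_iff]
  refine forall_congr' fun i => forall_congr' fun h => ?_
  rw [isSMulRegular_quotient_iff_mem_of_smul_mem, smul_eq_mul, Ideal.mul_top]
  simp only [smul_eq_mul, mul_comm]

omit [IsLocalRing R] [IsNoetherianRing R] in
lemma isWeaklyRegular_concat_iff {rs : List R} {r : R} : IsWeaklyRegular R (rs ++ [r]) ↔
    IsWeaklyRegular R rs ∧ ∀ x, x * r ∈ Ideal.ofList rs → x ∈ Ideal.ofList rs := by
  rw [isWeaklyRegular_append_iff, isWeaklyRegular_singleton_iff,
    isSMulRegular_quotient_iff_mem_of_smul_mem, smul_eq_mul, Ideal.mul_top]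
  simp only [smul_eq_mul, mul_comm]

omit [IsLocalRing R] [IsNoetherianRing R] in
lemma ofList_perm {A B : List R} (h : A.Perm B) : Ideal.ofList A = Ideal.ofList B := by
  unfold Ideal.ofList
  congr 1
  ext x
  exact h.mem_iff

lemma isWeaklyRegular_of_prim [Algebra ℂ R] (Λ : Submodule ℂ R)
    (hΛ : Ideal.span (Λ : Set R) = maximalIdeal R) (N : ℕ)
    (base : ∀ B : List R, (∀ b ∈ B, b ∈ Λ) → B.length = N → Prim (Ideal.ofList B) →
      IsWeaklyRegular R B) (A : List R) : ∀ B : List R, (∀ a ∈ A, a ∈ maximalIdeal R) →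
      (∀ b ∈ B, b ∈ Λ) → (A ++ B).length = N → Prim (Ideal.ofList (A ++ B)) →
      IsWeaklyRegular R (A ++ B) := by
  have hΛm : ∀ l ∈ Λ, l ∈ maximalIdeal R := fun l hl => hΛ ▸ Ideal.subset_span hl
  induction A with
  | nil => exact fun B _ hB hN hP => base B hB hN hP
  | cons f A ih =>
    intro B hA hB hN hP
    set J := Ideal.ofList (A ++ B) with hJ
    have hP' : Prim (J ⊔ Ideal.span {f}) := by
      rw [sup_comm]; simpa [hJ] using hP
    have hfin : Finite ↥(J.minimalPrimes \ {maximalIdeal R}) :=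
      ((Ideal.finite_minimalPrimes_of_isNoetherianRing R J).subset Set.sdiff_subset).to_subtype
    obtain ⟨l, hlΛ, hl⟩ := exists_mem_forall_notMem' Λ
      (fun P : ↥(J.minimalPrimes \ {maximalIdeal R}) => P.1.restrictScalars ℂ) (by
        rintro ⟨P, hP, hPm⟩ hΛP
        have : P.IsPrime := hP.1.1
        exact hPm (le_antisymm (le_maximalIdeal this.ne_top) (hΛ ▸ Ideal.span_le.2 hΛP)))
    have hPl : Prim (J ⊔ Ideal.span {l}) := prim_sup_of_avoid (hA f (by simp)) hP'
      fun P hP hPm => hl ⟨P, hP, hPm⟩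
    have h1 := ih (B ++ [l]) (fun a ha => hA a (by simp [ha]))
      (by simpa [or_imp, forall_and] using ⟨hB, hlΛ⟩) (by simp at hN ⊢; omega)
      (by simpa [hJ, sup_assoc] using hPl)
    rw [← List.append_assoc, isWeaklyRegular_concat_iff] at h1
    refine IsLocalRing.isWeaklyRegular_of_perm_of_subset_maximalIdeal
      (rs := A ++ B ++ [f]) (isWeaklyRegular_concat_iff.2 ⟨h1.1, fun x hx => ?_⟩) ?_ ?_
    · obtain ⟨k, hk⟩ := hP' (hΛm l hlΛ)
      have h2 : ∀ k x, x * l ^ k ∈ J → x ∈ J := by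
        intro k
        induction k with
        | zero => simp
        | succ k ih =>
          intro x hx
          exact ih x (h1.2 _ (by rw [mul_assoc, ← pow_succ]; exact hx))
      obtain ⟨j, hj, y, hy, hjy⟩ := Submodule.mem_sup.1 hk
      obtain ⟨a, rfl⟩ := Ideal.mem_span_singleton'.1 hy
      refine h2 k x ?_
      rw [← hjy, mul_add, show x * (a * f) = a * (x * f) by ring]
      exact J.add_mem (J.mul_mem_left _ hj) (J.mul_mem_left _ hx)
    · exact (List.perm_append_singleton _ _)
    · intro r hr
      simp only [List.mem_append, List.mem_singleton] at hr
      rcases hr with (hr | hr) | rfl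
      · exact hA r (by simp [hr])
      · exact hΛm r (hB r hr)
      · exact hA r (by simp)

lemma finrank_span_quotient {K V : Type*} [Field K] [AddCommGroup V] [Module K V]
    [FiniteDimensional K V] (s : Set V) (v : V) {e : ℕ}
    (h : e + 1 ≤ Module.finrank K (Submodule.span K s)) :
    e ≤ Module.finrank K (Submodule.span K ((Submodule.span K {v}).mkQ '' s)) := by
  set W := Submodule.span K s
  set f := (Submodule.span K {v}).mkQ.domRestrict W with hf
  have h1 := f.finrank_range_add_finrank_ker
  have h2 : LinearMap.range f = Submodule.span K ((Submodule.span K {v}).mkQ '' s) := by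
    rw [hf, LinearMap.range_domRestrict, Submodule.map_span]
  have h3 : Module.finrank K (LinearMap.ker f) ≤ 1 := by
    refine le_trans ?_ ((finrank_span_le_card (R := K) ({v} : Set V)).trans (by simp))
    rw [← LinearMap.finrank_range_of_inj
      (f := W.subtype.comp (LinearMap.ker f).subtype) (by
        rw [LinearMap.coe_comp]
        exact Subtype.val_injective.comp Subtype.val_injective)]
    refine Submodule.finrank_mono ?_
    rintro _ ⟨x, rfl⟩
    have := LinearMap.mem_ker.1 x.2
    exact (Submodule.Quotient.mk_eq_zero _).1 this
  rw [← h2]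
  omega

lemma linearIndependent_finCons_of_quotient {K V : Type*} [Field K] [AddCommGroup V] [Module K V]
    {v : V} (hv : v ≠ 0) {e : ℕ} {w : Fin e → V}
    (h : LinearIndependent K fun i => (Submodule.span K {v}).mkQ (w i)) :
    LinearIndependent K (Fin.cons v w : Fin (e + 1) → V) := by
  rw [linearIndependent_finCons]
  refine ⟨LinearIndependent.of_comp _ h, fun h2 => hv ?_⟩
  obtain ⟨c, hc⟩ := (Submodule.mem_span_range_iff_exists_fun _).1 h2
  have h3 := congrArg (Submodule.span K {v}).mkQ hc
  rw [map_sum, Submodule.mkQ_apply _ v, (Submodule.Quotient.mk_eq_zero _).2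
    (Submodule.mem_span_singleton_self v)] at h3
  simp only [map_smul] at h3
  have h4 := Fintype.linearIndependent_iff.1 h c h3
  rw [← hc]
  exact Finset.sum_eq_zero fun i _ => by rw [h4, zero_smul]

set_option maxHeartbeats 1000000 in
lemma exists_generic [Algebra ℂ R] (Λ : Submodule ℂ R)
    {T : Type*} [Finite T] (K : T → Type*)
    [∀ t, Field (K t)] [∀ t, Algebra ℂ (K t)] (e : ℕ) : ∀ (V : T → Type u) [∀ t, AddCommGroup (V t)]
    [∀ t, Module (K t) (V t)] [∀ t, Module ℂ (V t)] [∀ t, IsScalarTower ℂ (K t) (V t)]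
    [∀ t, FiniteDimensional (K t) (V t)]
    (q : ∀ t, R →ₗ[ℂ] V t) (J : Ideal R),
    (∀ P : PrimeSpectrum R, J ≤ P.asIdeal → Order.coheight P ≤ e) →
    Prim (J ⊔ Ideal.span Λ) →
    (∀ t, e ≤ Module.finrank (K t) (Submodule.span (K t) (q t '' Λ))) →
    ∃ L : Fin e → R, (∀ i, L i ∈ Λ) ∧ Prim (J ⊔ Ideal.span (Set.range L)) ∧
      ∀ t, LinearIndependent (K t) fun i => q t (L i) := by
  induction e with
  | zero =>
    intro V _ _ _ _ _ q J hJ _ _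
    refine ⟨fun i => i.elim0, fun i => i.elim0, ?_, fun t => linearIndependent_empty_type⟩
    rw [prim_iff]
    intro P hP hJP
    have h1 := hJ ⟨P, hP⟩ (le_sup_left.trans hJP)
    rw [Nat.cast_zero, nonpos_iff_eq_zero, Order.coheight_eq_zero] at h1
    exact h1 (b := ⟨maximalIdeal R, inferInstance⟩) (le_maximalIdeal hP.ne_top)
  | succ e ih =>
    intro V _ _ _ _ _ q J hJ hP hq
    have hfin : Finite ↥(J.minimalPrimes \ {maximalIdeal R}) :=
      ((Ideal.finite_minimalPrimes_of_isNoetherianRing R J).subset Set.sdiff_subset).to_subtype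
    obtain ⟨l, hlΛ, hl⟩ := exists_mem_forall_notMem' Λ
      (Sum.elim (fun P : ↥(J.minimalPrimes \ {maximalIdeal R}) => P.1.restrictScalars ℂ)
        fun t => LinearMap.ker (q t)) (by
        rintro (⟨P, hPJ, hPm⟩ | t) hΛP
        · have : P.IsPrime := hPJ.1.1
          exact hPm (le_antisymm (le_maximalIdeal this.ne_top) (prim_iff.1 hP P this
            (sup_le hPJ.1.2 (Ideal.span_le.2 hΛP))))
        · have h1 : q t '' Λ ⊆ {0} := by
            rintro _ ⟨x, hx, rfl⟩
            exact hΛP hx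
          have h2 : Submodule.span (K t) (q t '' Λ) = ⊥ := by
            rw [Submodule.span_eq_bot]
            exact fun x hx => h1 hx
          have h3 := hq t
          rw [h2, finrank_bot] at h3
          omega)
    have hih := ih (fun t => V t ⧸ Submodule.span (K t) {q t l})
      (fun t => ((Submodule.span (K t) {q t l}).mkQ.restrictScalars ℂ).comp (q t))
      (J ⊔ Ideal.span {l}) ?_ (hP.mono (sup_le_sup_right le_sup_left _)) ?_
    · obtain ⟨L, hL1, hL2, hL3⟩ := hih
      refine ⟨Fin.cons l L, Fin.cases hlΛ hL1, ?_, fun t => ?_⟩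
      · rw [Fin.range_cons, ← Set.singleton_union, Ideal.span_union, ← sup_assoc]
        exact hL2
      · rw [show (fun i => q t ((Fin.cons l L : Fin (e + 1) → R) i)) =
          Fin.cons (q t l) fun i => q t (L i) from by
            ext i; refine Fin.cases ?_ (fun i => ?_) i <;> rfl]
        exact linearIndependent_finCons_of_quotient (hl (Sum.inr t)) (hL3 t)
    · intro P hJP
      obtain ⟨P₀, hP₀, hPP⟩ := Ideal.exists_minimalPrimes_le (le_sup_left.trans hJP)
      have hP₀p : P₀.IsPrime := hP₀.1.1
      by_cases hm : P₀ = maximalIdeal R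
      · have : Order.coheight P = 0 := by
          rw [Order.coheight_eq_zero]
          exact fun Q _ => (le_maximalIdeal Q.2.ne_top).trans (hm ▸ hPP)
        rw [this]; exact zero_le
      · have hlP : l ∉ P₀ := hl (Sum.inl ⟨P₀, hP₀, hm⟩)
        have hlt : (⟨P₀, hP₀p⟩ : PrimeSpectrum R) < P := lt_of_le_of_ne hPP fun h =>
          hlP (by
            have : l ∈ P.asIdeal := hJP (Ideal.mem_sup_right (Ideal.mem_span_singleton_self l))
            rw [← h] at this
            exact this)
        have h1 := hJ ⟨P₀, hP₀p⟩ hP₀.1.2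
        rw [Order.coheight_le_coe_iff] at h1
        have h2 := h1 P hlt
        rw [Nat.cast_succ] at h2
        exact Order.le_of_lt_add_one h2
    · intro t
      have h1 := finrank_span_quotient (K := K t) (q t '' Λ) (q t l) (hq t)
      rw [Set.image_image] at h1
      exact h1

end Prim

namespace Og

open RingTheory.Sequence IsLocalRing

variable [FiniteDimensional ℂ E]

lemma isWeaklyRegular_lin (B : List (E →L[ℂ] ℂ)) (hB : B.length = Module.finrank ℂ E)
    (hP : Prim (Ideal.ofList (B.map lin))) : IsWeaklyRegular (Og E) (B.map lin) := by
  have hkill : ∀ (L : List (E →L[ℂ] ℂ)) (K : Submodule ℂ E), (∀ l ∈ L, ∀ x ∈ K, l x = 0) →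
      ∀ f ∈ Ideal.ofList (L.map lin), pl K.subtypeL f = 0 := by
    intro L K hLK f hf
    have : Ideal.ofList (L.map lin) ≤ RingHom.ker (pl K.subtypeL).toRingHom := by
      refine Ideal.span_le.2 fun x hx => ?_
      obtain ⟨l, hl, rfl⟩ := List.mem_map.1 hx
      refine (pl_lin _ _).trans ?_
      rw [show l.comp K.subtypeL = 0 from ContinuousLinearMap.ext fun x => hLK l hl x x.2]
      exact (linHom K).map_zero
    exact this hf
  have hinj : ∀ x, (∀ l ∈ B, l x = 0) → x = 0 := by
    intro x hx
    by_contra hx0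
    obtain ⟨l, hl⟩ := SeparatingDual.exists_eq_one (R := ℂ) hx0
    obtain ⟨k, hk⟩ := hP (mem_max.2 (ev_lin l))
    have h1 := hkill B (Submodule.span ℂ {x}) (fun l hl y hy => by
      obtain ⟨c, rfl⟩ := Submodule.mem_span_singleton.1 hy
      simp [hx l hl]) _ hk
    rw [map_pow, pl_lin] at h1
    have h2 : l.comp (Submodule.span ℂ {x}).subtypeL = 0 :=
      lin_injective ((eq_zero_of_pow_eq_zero h1).trans (linHom _).map_zero.symm)
    have h3 := DFunLike.congr_fun h2 ⟨x, Submodule.mem_span_singleton_self x⟩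
    simp [hl] at h3
  have hsurj : ∀ i (hi : i < B.length), ∃ v, B[i] v = 1 ∧ ∀ j (hj : j < B.length), j ≠ i →
      B[j] v = 0 := by
    set Φ : E →ₗ[ℂ] (Fin B.length → ℂ) := LinearMap.pi fun i => (B[i] : E →ₗ[ℂ] ℂ) with hΦ
    have hΦi : Function.Injective Φ := by
      rw [injective_iff_map_eq_zero]
      intro x hx
      refine hinj x fun l hl => ?_
      obtain ⟨i, hi, rfl⟩ := List.mem_iff_getElem.1 hl
      exact congrFun hx ⟨i, hi⟩
    have hΦs := (LinearMap.injective_iff_surjective_of_finrank_eq_finrank (f := Φ)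
      (by simp [hB])).1 hΦi
    intro i hi
    obtain ⟨v, hv⟩ := hΦs (Pi.single ⟨i, hi⟩ 1)
    refine ⟨v, ?_, fun j hj hji => ?_⟩
    · simpa [hΦ] using congrFun hv ⟨i, hi⟩
    · have := congrFun hv ⟨j, hj⟩
      rwa [Pi.single_eq_of_ne (by simpa using hji)] at this
  rw [isWeaklyRegular_iff_mem]
  intro i hi x hx
  rw [List.length_map] at hi
  rw [← List.map_take] at hx ⊢
  rw [List.getElem_map] at hx
  set K : Submodule ℂ E := ⨅ j : Fin i, LinearMap.ker (B[(j : ℕ)]'(j.2.trans hi) : E →ₗ[ℂ] ℂ) with hK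
  have hBK : ∀ l ∈ B.take i, ∀ x ∈ K, l x = 0 := by
    intro l hl x hx
    obtain ⟨j, hj, rfl⟩ := List.mem_take_iff_getElem.1 hl
    rw [hK, Submodule.mem_iInf] at hx
    exact hx ⟨j, by omega⟩
  have h1 := hkill _ K hBK _ hx
  rw [map_mul, pl_lin] at h1
  obtain ⟨v, hv1, hv2⟩ := hsurj i hi
  have hvK : v ∈ K := by
    rw [hK, Submodule.mem_iInf]
    exact fun j => hv2 j _ j.2.ne
  rcases mul_eq_zero.1 h1 with h2 | h2
  · have h3 := mem_span_lin (j := K.subtypeL) Subtype.val_injective h2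
    refine (Ideal.span_le.2 ?_) h3
    rintro _ ⟨l, hl, rfl⟩
    have h4 : (l : E →ₗ[ℂ] ℂ) ∈ Submodule.span ℂ
        (Set.range fun j : Fin i => (B[(j : ℕ)]'(j.2.trans hi) : E →ₗ[ℂ] ℂ)) := by
      refine mem_span_of_iInf_ker_le_ker fun x hx => ?_
      exact DFunLike.congr_fun (show l.comp K.subtypeL = 0 from hl) ⟨x, hx⟩
    rw [Submodule.mem_span_range_iff_exists_fun] at h4
    obtain ⟨c, hc⟩ := h4
    have h5 : l = ∑ j : Fin i, c j • B[(j : ℕ)]'(j.2.trans hi) := by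
      ext x
      have := DFunLike.congr_fun hc x
      simpa using this.symm
    rw [h5, SetLike.mem_coe, ← linHom_apply, map_sum]
    refine Ideal.sum_mem _ fun j _ => ?_
    rw [map_smul, Algebra.smul_def]
    refine Ideal.mul_mem_left _ _ (Ideal.subset_span (List.mem_map.2 ⟨_, ?_, rfl⟩))
    exact List.mem_take_iff_getElem.2 ⟨j, by have := j.2; omega, rfl⟩
  · have h3 := DFunLike.congr_fun
      (lin_injective (h2.trans (linHom _).map_zero.symm)) ⟨v, hvK⟩
    simp [hv1] at h3

lemma isWeaklyRegular_of_prim {A : List (Og E)} (hA : ∀ a ∈ A, a ∈ maximalIdeal (Og E))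
    (hN : A.length = Module.finrank ℂ E) (hP : Prim (Ideal.ofList A)) :
    IsWeaklyRegular (Og E) A := by
  have h := _root_.isWeaklyRegular_of_prim (LinearMap.range (linHom E)) (by
    rw [maximalIdeal_eq_span]; rfl) (Module.finrank ℂ E) (fun B hB hBN hBP => by
      obtain ⟨L, rfl⟩ : ∃ L, B = List.map lin L := by
        choose! g hg using hB
        refine ⟨B.map g, ?_⟩
        rw [List.map_map]
        exact ((List.map_congr_left hg).trans (List.map_id B)).symm
      exact isWeaklyRegular_lin L (by simpa using hBN) hBP) A [] hA (by simp) (by simpa using hN)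
      (by simpa using hP)
  simpa using h

/-- Systems of parameters in a regular ring are regular sequences in any order. -/
lemma mem_span_of_mul_mem_span {ι : Type*} [Fintype ι] {f : ι → Og E}
    (hf : ∀ i, f i ∈ maximalIdeal (Og E)) (hN : Fintype.card ι = Module.finrank ℂ E)
    (hP : Prim (Ideal.span (Set.range f))) (S : Finset ι) {i : ι} (hi : i ∉ S) {x : Og E}
    (hx : x * f i ∈ Ideal.span (f '' S)) : x ∈ Ideal.span (f '' S) := by
  have hA : ∀ L : List ι, Ideal.ofList (L.map f) = Ideal.span (f '' {i | i ∈ L}) := by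
    intro L
    unfold Ideal.ofList
    congr 1
    ext y
    simp
  have h1 := isWeaklyRegular_of_prim
    (A := ((S.toList ++ [i]) ++ (insert i S)ᶜ.toList).map f) (by
      intro a ha
      obtain ⟨j, -, rfl⟩ := List.mem_map.1 ha
      exact hf j)
    (by have h1 := Finset.card_le_univ (insert i S)
        have h2 := Finset.card_compl (insert i S)
        rw [Finset.card_insert_of_notMem hi] at h1 h2
        simp only [List.length_map, List.length_append, Finset.length_toList, List.length_singleton]
        omega) (by
      rw [hA]
      convert hP
      rw [← Set.image_univ]
      congr 1
      ext j
      by_cases hj : j ∈ S <;> by_cases hj' : j = i <;> simp [hj, hj'])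
  rw [List.map_append, isWeaklyRegular_append_iff, List.map_append, List.map_singleton,
    isWeaklyRegular_concat_iff, hA] at h1
  have h2 := h1.1.2 x
  simp only [Finset.mem_toList] at h2
  exact h2 hx

end Og

/-! ### Some commutative algebra -/

section Alg

open IsLocalRing

/-- Linear independence modulo a regular sequence lifts. -/
lemma mem_span_of_regular {A M ι : Type*} [CommRing A] [IsLocalRing A] [IsNoetherianRing A]
    [AddCommGroup M] [Module A M] [Fintype ι] (y : ℕ → A) (k : ℕ)
    (hy : ∀ j < k, y j ∈ maximalIdeal A) (N : ℕ → Submodule A M) (hmono : Monotone N)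
    (hyN : ∀ i j, i < j → ∀ m, y i • m ∈ N j)
    (hreg : ∀ j < k, ∀ m, y j • m ∈ N j → m ∈ N j) (w : ι → M)
    (hbase : ∀ a : ι → A, ∑ i, a i • w i ∈ N k → ∀ i, a i ∈ Ideal.span (y '' Set.Iio k)) :
    ∀ j ≤ k, ∀ a : ι → A, ∑ i, a i • w i ∈ N j → ∀ i, a i ∈ Ideal.span (y '' Set.Iio j) := by
  intro j hj
  induction hj using Nat.decreasingInduction with
  | self => exact hbase
  | of_succ j hj ih =>
    let I : Submodule A (ι → A) := Submodule.pi Set.univ fun _ => Ideal.span (y '' Set.Iio j)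
    let K : Submodule A (ι → A) := (N j).comap (Fintype.linearCombination A w)
    have hKmem : ∀ a, a ∈ K ↔ ∑ i, a i • w i ∈ N j := fun a => Iff.rfl
    have hIN : ∀ b ∈ Ideal.span (y '' Set.Iio j), ∀ m : M, b • m ∈ N j := by
      intro b hb m
      have : Ideal.span (y '' Set.Iio j) ≤ (N j).comap (LinearMap.toSpanSingleton A M m) := by
        refine Ideal.span_le.2 ?_
        rintro _ ⟨i, hi, rfl⟩
        exact hyN i j hi m
      exact this hb
    suffices h : K ≤ I from fun a ha i => (Submodule.mem_pi.1 (h ha)) i trivial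
    refine Submodule.le_of_le_smul_of_le_jacobson_bot (I := Ideal.span {y j})
      (IsNoetherian.noetherian K) ?_ ?_
    · rw [jacobson_eq_maximalIdeal _ bot_ne_top, Ideal.span_le]
      rintro _ rfl
      exact hy j hj
    · intro a ha
      have h1 := ih a (hmono (Nat.le_succ j) ha)
      have h2 : ∀ i, ∃ b ∈ Ideal.span (y '' Set.Iio j), ∃ c, a i = b + y j * c := by
        intro i
        have h3 := h1 i
        rw [show Set.Iio (j + 1) = insert j (Set.Iio j) from by
          ext x; simp [Nat.lt_succ_iff_lt_or_eq, or_comm], Set.image_insert_eq,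
          Ideal.mem_span_insert'] at h3
        obtain ⟨c, hc⟩ := h3
        exact ⟨_, hc, -c, by ring⟩
      choose b hb c hc using h2
      have h3 : c ∈ K := by
        rw [hKmem]
        refine hreg j hj _ ?_
        have h4 : y j • ∑ i, c i • w i = ∑ i, a i • w i - ∑ i, b i • w i := by
          rw [← Finset.sum_sub_distrib, Finset.smul_sum]
          refine Finset.sum_congr rfl fun i _ => ?_
          rw [hc i, add_smul, add_sub_cancel_left, mul_smul]
        rw [h4]
        exact (N j).sub_mem ha ((N j).sum_mem fun i _ => hIN _ (hb i) _)
      rw [show a = b + y j • c from funext hc]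
      exact Submodule.add_mem_sup (Submodule.mem_pi.2 fun i _ => hb i)
        (Submodule.smul_mem_smul (Ideal.mem_span_singleton_self _) h3)

/-- A finite module on which the maximal ideal is generated by a regular sequence is free. -/
lemma exists_basis_of_regular {A M : Type*} [CommRing A] [IsLocalRing A] [IsNoetherianRing A]
    [AddCommGroup M] [Module A M] [Module.Finite A M] (y : ℕ → A) (k : ℕ)
    (hy : Ideal.span (y '' Set.Iio k) = maximalIdeal A)
    (hreg : ∀ j < k, ∀ m : M, y j • m ∈ Ideal.span (y '' Set.Iio j) • (⊤ : Submodule A M) →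
      m ∈ Ideal.span (y '' Set.Iio j) • (⊤ : Submodule A M)) :
    ∃ b, Nonempty (Module.Basis (Fin b) A M) := by
  let Q := M ⧸ (maximalIdeal A • ⊤ : Submodule A M)
  let _ : Field (A ⧸ maximalIdeal A) := Ideal.Quotient.field _
  let β := Module.finBasis (A ⧸ maximalIdeal A) Q
  choose w hw using fun i => Submodule.mkQ_surjective (maximalIdeal A • ⊤ : Submodule A M) (β i)
  have hli : ∀ a : Fin (Module.finrank (A ⧸ maximalIdeal A) Q) → A, ∑ i, a i • w i = 0 → ∀ i, a i = 0 := by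
    intro a ha i
    have := mem_span_of_regular y k
      (fun j hj => hy ▸ Ideal.subset_span (Set.mem_image_of_mem _ hj))
      (fun j => Ideal.span (y '' Set.Iio j) • (⊤ : Submodule A M))
      (fun i j hij => Submodule.smul_mono_left (Ideal.span_mono
        (Set.image_mono (Set.Iio_subset_Iio hij))))
      (fun i j hij m => Submodule.smul_mem_smul
        (Ideal.subset_span (Set.mem_image_of_mem _ hij)) trivial) hreg w (by
        intro a ha i
        rw [hy] at ha ⊢
        have h2 : ∑ i, Ideal.Quotient.mk (maximalIdeal A) (a i) • β i = 0 := by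
          rw [← (Submodule.Quotient.mk_eq_zero _).2 ha, ← Submodule.mkQ_apply, map_sum]
          refine Finset.sum_congr rfl fun i _ => ?_
          rw [map_smul, hw]
          rfl
        exact Ideal.Quotient.eq_zero_iff_mem.1
          (Fintype.linearIndependent_iff.1 β.linearIndependent _ h2 i)) 0 (Nat.zero_le _) a
        (by rw [ha]; exact zero_mem _) i
    simpa using this
  have hsp : ⊤ ≤ Submodule.span A (Set.range w) := by
    refine Submodule.le_of_le_smul_of_le_jacobson_bot (I := maximalIdeal A)
      Module.Finite.fg_top (maximalIdeal_le_jacobson _) ?_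
    intro m _
    have h1 := β.sum_repr (Submodule.mkQ _ m)
    choose a ha using fun i => Ideal.Quotient.mk_surjective (β.repr (Submodule.mkQ _ m) i)
    have h2 : m - ∑ i, a i • w i ∈ maximalIdeal A • (⊤ : Submodule A M) := by
      rw [← Submodule.Quotient.mk_eq_zero, ← Submodule.mkQ_apply, map_sub, ← h1, map_sum,
        sub_eq_zero]
      refine Finset.sum_congr rfl fun i _ => ?_
      rw [map_smul, hw, ← ha]
      rfl
    rw [← sub_add_cancel m (∑ i, a i • w i), add_comm]
    exact Submodule.add_mem_sup (Submodule.sum_mem _ fun i _ =>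
      Submodule.smul_mem _ _ (Submodule.subset_span ⟨i, rfl⟩)) h2
  exact ⟨_, ⟨Module.Basis.mk (Fintype.linearIndependent_iff.2 hli) hsp⟩⟩

/-- Krull's intersection theorem for a finite module. -/
lemma mem_of_forall_mem_pow_smul {A M : Type*} [CommRing A] [IsLocalRing A] [IsNoetherianRing A]
    [AddCommGroup M] [Module A M] [Module.Finite A M] {c : A} (hc : c ∈ maximalIdeal A)
    (N : Submodule A M) {x : M} (h : ∀ k : ℕ, ∃ w, x - c ^ k • w ∈ N) : x ∈ N := by
  have h1 := (maximalIdeal A).iInf_pow_smul_eq_bot_of_isLocalRing (M := M ⧸ N)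
    (maximalIdeal.isMaximal A).ne_top
  rw [← Submodule.Quotient.mk_eq_zero, ← Submodule.mem_bot A, ← h1, Submodule.mem_iInf]
  intro k
  obtain ⟨w, hw⟩ := h k
  rw [(Submodule.Quotient.eq N).2 hw, Submodule.Quotient.mk_smul]
  exact Submodule.smul_mem_smul (Ideal.pow_mem_pow hc k) trivial

/-- Modules over a Noetherian domain with enough functionals and bounded rank are finite. -/
lemma finite_of_separating {R : Type*} [CommRing R] [IsDomain R] [IsNoetherianRing R] (b : ℕ) :
    ∀ (M : Type u) [AddCommGroup M] [Module R M],
      (∀ m : M, m ≠ 0 → ∃ φ : M →ₗ[R] R, φ m ≠ 0) →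
      (∀ v : Fin (b + 1) → M, ∃ r : Fin (b + 1) → R, r ≠ 0 ∧ ∑ i, r i • v i = 0) →
      Module.Finite R M := by
  have key : ∀ (M : Type u) [AddCommGroup M] [Module R M],
      (∀ m : M, m ≠ 0 → ∃ φ : M →ₗ[R] R, φ m ≠ 0) → ∀ (r : R) (m : M), r ≠ 0 → r • m = 0 →
      m = 0 := by
    intro M _ _ h r m hr hm
    by_contra hm0
    obtain ⟨φ, hφ⟩ := h m hm0
    have := congrArg φ hm
    rw [map_smul, map_zero, smul_eq_mul] at this
    exact (mul_ne_zero hr hφ) this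
  induction b with
  | zero =>
    intro M _ _ h hb
    have : Subsingleton M := by
      refine subsingleton_of_forall_eq 0 fun m => ?_
      obtain ⟨r, hr, hr2⟩ := hb fun _ => m
      refine key M h (r 0) m (fun h0 => hr ?_) (by simpa using hr2)
      ext i
      rw [Subsingleton.elim (α := Fin 1) i 0, h0]; rfl
    infer_instance
  | succ b ih =>
    intro M _ _ h hb
    by_cases hM : ∀ m : M, m = 0
    · have : Subsingleton M := subsingleton_of_forall_eq 0 hM
      infer_instance
    · push Not at hM
      obtain ⟨m₀, hm₀⟩ := hM
      obtain ⟨φ, hφ⟩ := h m₀ hm₀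
      have h1 : Module.Finite R (LinearMap.ker φ) := by
        refine ih _ (fun m hm => ?_) fun v => ?_
        · obtain ⟨ψ, hψ⟩ := h m (by simpa using hm)
          exact ⟨ψ.comp (LinearMap.ker φ).subtype, hψ⟩
        · obtain ⟨r, hr, hr2⟩ := hb (Fin.cons m₀ fun i => (v i : M))
          rw [Fin.sum_univ_succ] at hr2
          simp only [Fin.cons_zero, Fin.cons_succ] at hr2
          have h2 := congrArg φ hr2
          rw [map_add, map_sum, map_smul, Finset.sum_eq_zero fun i _ => by
            rw [map_smul, LinearMap.mem_ker.1 (v i).2, smul_zero], add_zero, map_zero,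
            smul_eq_mul, mul_eq_zero, or_iff_left hφ] at h2
          refine ⟨fun i => r i.succ, fun h3 => hr ?_, ?_⟩
          · ext i
            refine Fin.cases h2 (fun i => congrFun h3 i) i
          · rw [h2, zero_smul, zero_add] at hr2
            apply Subtype.ext
            simpa using hr2
      have h2 : Module.Finite R (M ⧸ LinearMap.ker φ) :=
        Module.Finite.equiv φ.quotKerEquivRange.symm
      exact Module.Finite.of_submodule_quotient (LinearMap.ker φ)

/-- A nonzero saturated relation module stable under derivations contains a nonzero element with
constant ratios. -/
lemma exists_relation_constant {A ι : Type*} [CommRing A] [IsDomain A] [Algebra ℂ A] [Fintype ι]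
    (𝒟 : Set (Derivation ℂ A A)) (N : Submodule A (ι → A)) (hN : N ≠ ⊥)
    (hD : ∀ d ∈ 𝒟, ∀ s ∈ N, (fun i => d (s i)) ∈ N) :
    ∃ s ∈ N, s ≠ 0 ∧ ∀ d ∈ 𝒟, ∀ i j, s i * d (s j) = s j * d (s i) := by
  obtain ⟨s₀, hs₀, hs₀'⟩ := Submodule.exists_mem_ne_zero_of_ne_bot hN
  let c : (ι → A) → ℕ := fun s => (Finset.univ.filter fun i => s i ≠ 0).card
  obtain ⟨s, ⟨hsN, hs0⟩, hmin⟩ : ∃ s, (s ∈ N ∧ s ≠ 0) ∧ ∀ t, (t ∈ N ∧ t ≠ 0) → c s ≤ c t := by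
    have hne : ((fun s => c s) '' {s | s ∈ N ∧ s ≠ 0}).Nonempty := ⟨_, s₀, ⟨hs₀, hs₀'⟩, rfl⟩
    obtain ⟨s, hs, hs'⟩ := Nat.sInf_mem hne
    exact ⟨s, hs, fun t ht => le_of_eq_of_le hs' (Nat.sInf_le ⟨t, ht, rfl⟩)⟩
  refine ⟨s, hsN, hs0, fun d hd i j => ?_⟩
  by_cases hi : s i = 0
  · simp [hi]
  let t : ι → A := s i • (fun j => d (s j)) - d (s i) • s
  have ht : t ∈ N := N.sub_mem (N.smul_mem _ (hD d hd s hsN)) (N.smul_mem _ hsN)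
  have ht0 : t = 0 := by
    by_contra ht0
    have h1 := hmin t ⟨ht, ht0⟩
    refine absurd h1 (not_le_of_gt (Finset.card_lt_card ?_))
    refine ⟨fun j hj => ?_, fun h => ?_⟩
    · simp only [Finset.mem_filter, Finset.mem_univ, true_and] at hj ⊢
      intro h0
      exact hj (by simp [t, h0])
    · have := h (show i ∈ _ by simpa using hi)
      simp [t, mul_comm] at this
  have h1 := congrFun ht0 j
  simp only [t, Pi.sub_apply, Pi.smul_apply, smul_eq_mul, Pi.zero_apply] at h1
  rw [sub_eq_zero.1 h1, mul_comm]

end Alg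

/-! ### Constant relations, antiderivatives, the Poincaré lemma -/

namespace Og

@[simp] lemma der_zero_dir (f : Og E) : der (0 : E) f = 0 := by
  have := der_smul_dir (0 : ℂ) (0 : E) f
  simpa using this

lemma exists_section [FiniteDimensional ℂ E] {f : Og E} (hf : f ≠ 0) {π : E →L[ℂ] ℂ} (hπ : π ≠ 0) :
    ∃ σ : ℂ →L[ℂ] E, π.comp σ = ContinuousLinearMap.id ℂ ℂ ∧ pl σ f ≠ 0 := by
  have hl : lin π ≠ 0 := by
    rw [← map_zero (linHom E), ← linHom_apply]
    exact fun h => hπ (lin_injective h)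
  obtain ⟨v, hv⟩ := exists_line (mul_ne_zero hf hl)
  rw [map_mul, pl_lin] at hv
  have hv0 : π v ≠ 0 := by
    intro h0
    apply right_ne_zero_of_mul hv
    rw [show π.comp ((ContinuousLinearMap.id ℂ ℂ).smulRight v) = 0 by ext; simp [h0],
      ← linHom_apply, map_zero]
  refine ⟨(ContinuousLinearMap.id ℂ ℂ).smulRight ((π v)⁻¹ • v), by ext; simp [hv0], fun h0 => ?_⟩
  apply left_ne_zero_of_mul hv
  rw [show (ContinuousLinearMap.id ℂ ℂ).smulRight v =
    ((ContinuousLinearMap.id ℂ ℂ).smulRight ((π v)⁻¹ • v)).comp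
      ((π v) • ContinuousLinearMap.id ℂ ℂ) by ext; simp [hv0], ← pl_pl, h0, map_zero]

lemma dvd_of_wronskian {R : Type*} [CommRing R] [IsDomain R] [Algebra ℂ R] (d : Derivation ℂ R R)
    {x s w : R} {k : ℕ} (hx : d x = 1) (hx0 : x ≠ 0)
    (h : s * d (x ^ (k + 1) * w) = x ^ (k + 1) * w * d s) : x ∣ s * w := by
  rw [Derivation.leibniz, Derivation.leibniz_pow, hx] at h
  simp only [smul_eq_mul, mul_one, Nat.add_sub_cancel, nsmul_eq_mul] at h
  have h2 : s * (x * d w + ((k + 1 : ℕ) : R) * w) - x * w * d s = 0 := by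
    refine (mul_eq_zero.1 ?_).resolve_left (pow_ne_zero k hx0)
    linear_combination h
  have h7 : (algebraMap ℂ R ((k + 1 : ℂ)⁻¹)) * ((k + 1 : ℕ) : R) = 1 := by
    rw [← map_natCast (algebraMap ℂ R), ← map_mul, Nat.cast_add, Nat.cast_one,
      inv_mul_cancel₀ (by exact_mod_cast Nat.succ_ne_zero k), map_one]
  refine ⟨algebraMap ℂ R ((k + 1 : ℂ)⁻¹) * (w * d s - s * d w), ?_⟩
  linear_combination (algebraMap ℂ R ((k + 1 : ℂ)⁻¹)) * h2 - s * w * h7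

lemma xl_ne_zero : xl E ≠ 0 := fun h => one_ne_zero (α := Og (E × ℂ)) <| by
  rw [← dl_xl, h, map_zero]

lemma eq_zero_of_wronskian_dl [FiniteDimensional ℂ E] {s w : Og (E × ℂ)}
    (h : s * dl E w = w * dl E s) (hs : down E s ≠ 0) (hw : down E w = 0) : w = 0 := by
  by_contra hw0
  have hx : ¬ IsUnit (xl E) := by
    intro hu
    have := hu.map (down E)
    rw [down_xl] at this
    exact not_isUnit_zero this
  obtain ⟨w', hw', hnd⟩ := (FiniteMultiplicity.of_not_isUnit hx hw0).exists_eq_pow_mul_and_not_dvd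
  have hdw : down E w' ≠ 0 := by
    intro h0
    obtain ⟨q, hq⟩ := hadamard w'
    rw [h0, map_zero, add_zero] at hq
    exact hnd ⟨q, hq⟩
  have hk : multiplicity (xl E) w ≠ 0 := by
    intro hk
    rw [hw', hk, pow_zero, one_mul] at hw
    exact hdw hw
  obtain ⟨k, hk'⟩ := Nat.exists_eq_succ_of_ne_zero hk
  rw [hk', Nat.succ_eq_add_one] at hw'
  rw [hw'] at h
  have h1 := map_dvd (down E) (dvd_of_wronskian (dl E) dl_xl xl_ne_zero h)
  rw [down_xl, map_mul, zero_dvd_iff] at h1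
  exact mul_ne_zero hs hdw h1

lemma eq_zero_of_wronskian [FiniteDimensional ℂ E] {π : E →L[ℂ] ℂ} {σ : ℂ →L[ℂ] E}
    (hσ : π.comp σ = ContinuousLinearMap.id ℂ ℂ) {s w : Og E}
    (h : ∀ v, π v = 0 → s * der v w = w * der v s) (hs : pl σ s ≠ 0) (hw : pl σ w = 0) :
    w = 0 := by
  by_contra hw0
  obtain ⟨u, hu⟩ := exists_line hw0
  have hσ1 : π (σ 1) = 1 := congrArg (fun A : ℂ →L[ℂ] ℂ => A 1) hσ
  let v := u - π u • σ 1
  have hv : π v = 0 := by simp [v, hσ1]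
  let τ : ℂ × ℂ →L[ℂ] E := σ.comp (ContinuousLinearMap.fst ℂ ℂ ℂ) +
    (ContinuousLinearMap.snd ℂ ℂ ℂ).smulRight v
  have h1 : pl τ w ≠ 0 := by
    intro h0
    apply hu
    have e : (ContinuousLinearMap.id ℂ ℂ).smulRight u = τ.comp
        ((π u • ContinuousLinearMap.id ℂ ℂ).prod (ContinuousLinearMap.id ℂ ℂ)) := by
      ext
      simp only [ContinuousLinearMap.smulRight_apply, ContinuousLinearMap.id_apply, τ, v,
        ContinuousLinearMap.comp_apply, ContinuousLinearMap.prod_apply,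
        add_apply, smul_apply,
        ContinuousLinearMap.coe_fst', ContinuousLinearMap.coe_snd', one_smul, smul_eq_mul, mul_one]
      rw [← mul_one (π u), ← smul_eq_mul, map_smul, smul_eq_mul, mul_one]
      abel
    rw [e, ← pl_pl, h0, map_zero]
  have hτ : τ (0, 1) = v := by simp [τ]
  have hτ' : τ.comp (ContinuousLinearMap.inl ℂ ℂ ℂ) = σ := by
    ext; simp [τ]
  refine h1 (eq_zero_of_wronskian_dl (s := pl τ s) ?_ ?_ ?_)
  · rw [dl, der_pl, der_pl, hτ, ← map_mul, h v hv, map_mul]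
  · rwa [down, pl_pl, hτ']
  · rwa [down, pl_pl, hτ']

/-- A saturated relation module over germs on `E` which is stable under derivations along `ker π`
contains a relation with coefficients pulled back along `π`. -/
lemma exists_const_relation [FiniteDimensional ℂ E] {ι : Type*} [Fintype ι] {π : E →L[ℂ] ℂ}
    (hπ : π ≠ 0) (N : Submodule (Og E) (ι → Og E)) (hN : N ≠ ⊥)
    (hD : ∀ v, π v = 0 → ∀ s ∈ N, (fun i => der v (s i)) ∈ N)
    (hsat : ∀ (c : Og E) s, c ≠ 0 → c • s ∈ N → s ∈ N) :
    ∃ r : ι → Og ℂ, r ≠ 0 ∧ (fun i => pl π (r i)) ∈ N := by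
  obtain ⟨s, hs, hs0, hs1⟩ := exists_relation_constant ((fun v => der v) '' {v | π v = 0}) N hN
    (by rintro _ ⟨v, hv, rfl⟩ s hs; exact hD v hv s hs)
  obtain ⟨j, hj⟩ := Function.ne_iff.1 hs0
  obtain ⟨σ, hσ, hσj⟩ := exists_section hj hπ
  refine ⟨fun i => pl σ (s i), fun h0 => hσj (congrFun h0 j), ?_⟩
  refine hsat (s j) _ hj ?_
  have h1 : ∀ i, pl π (pl σ (s j)) * s i - pl π (pl σ (s i)) * s j = 0 := by
    intro i
    refine eq_zero_of_wronskian hσ (s := s j) (fun v hv => ?_) hσj ?_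
    · have h2 := hs1 (der v) ⟨v, hv, rfl⟩ j i
      have h3 : ∀ f : Og ℂ, der v (pl π f) = 0 := by
        intro f
        rw [der_pl, hv, der_zero_dir, map_zero]
      simp only [map_sub, Derivation.leibniz, h3, smul_eq_mul, mul_zero, add_zero]
      linear_combination (pl π (pl σ (s j))) * h2
    · simp only [map_sub, map_mul, pl_pl]
      rw [ContinuousLinearMap.comp_assoc, hσ, ContinuousLinearMap.comp_id]
      ring
  have h2 : s j • (fun i => pl π (pl σ (s i))) = pl π (pl σ (s j)) • s := by
    ext1 i
    have := h1 i
    simp only [Pi.smul_apply, smul_eq_mul]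
    linear_combination -this
  rw [h2]
  exact N.smul_mem _ hs

instance : IsDiscreteValuationRing (Og ℂ) := by
  refine IsDiscreteValuationRing.ofHasUnitMulPowIrreducibleFactorization
    ⟨lin (ContinuousLinearMap.id ℂ ℂ), ?_, fun {f} hf => ?_⟩
  · have h0 : lin (ContinuousLinearMap.id ℂ ℂ) ≠ 0 := fun h => one_ne_zero (α := Og ℂ) <| by
      have := congrArg (der (1 : ℂ)) h
      rw [der_lin, map_zero] at this
      simp at this
    refine ⟨fun h => ?_, fun a b hab => ?_⟩
    · exact (isUnit_iff.1 h) (ev_lin _)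
    · obtain ⟨k, u, hu, rfl⟩ := exists_eq_pow_mul (left_ne_zero_of_mul (hab ▸ h0))
      obtain ⟨m, v, hv, rfl⟩ := exists_eq_pow_mul (right_ne_zero_of_mul (hab ▸ h0))
      by_contra! h
      have hk : k ≠ 0 := by rintro rfl; exact h.1 (by simpa using hu)
      have hm : m ≠ 0 := by rintro rfl; exact h.2 (by simpa using hv)
      obtain ⟨k, rfl⟩ := Nat.exists_eq_succ_of_ne_zero hk
      obtain ⟨m, rfl⟩ := Nat.exists_eq_succ_of_ne_zero hm
      have h1 : lin (ContinuousLinearMap.id ℂ ℂ) * (1 - lin (ContinuousLinearMap.id ℂ ℂ) *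
          (lin (ContinuousLinearMap.id ℂ ℂ) ^ (k + m) * u * v)) = 0 := by
        rw [pow_succ, pow_succ] at hab
        linear_combination hab
      have h2 := congrArg (ev ℂ) ((mul_eq_zero.1 h1).resolve_left h0)
      simp [ev_lin] at h2
  · obtain ⟨k, u, ⟨u, rfl⟩, rfl⟩ := exists_eq_pow_mul hf
    exact ⟨k, u, rfl⟩

lemma eq_const_of_der_eq_zero {f : Og ℂ} (h : der (1 : ℂ) f = 0) :
    f = algebraMap ℂ _ (ev ℂ f) := by
  by_contra hf
  obtain ⟨k, u, hu, hk⟩ := exists_eq_pow_mul (sub_ne_zero.2 hf)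
  have hk0 : k ≠ 0 := by
    rintro rfl
    have := congrArg (ev ℂ) hk
    rw [map_sub, ev_algebraMap, sub_self, pow_zero, one_mul] at this
    exact isUnit_iff.1 hu this.symm
  obtain ⟨k, rfl⟩ := Nat.exists_eq_succ_of_ne_zero hk0
  have h0 : lin (ContinuousLinearMap.id ℂ ℂ) ≠ 0 := fun h => one_ne_zero (α := Og ℂ) <| by
    have := congrArg (der (1 : ℂ)) h
    rw [der_lin, map_zero] at this
    simpa using this
  have h1 := dvd_of_wronskian (der (1 : ℂ)) (x := lin (ContinuousLinearMap.id ℂ ℂ)) (s := 1)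
    (w := u) (k := k) (by rw [der_lin]; simp) h0 (by
      rw [← Nat.succ_eq_add_one, ← hk, map_sub, h, Derivation.map_algebraMap,
        Derivation.map_one_eq_zero]; simp)
  obtain ⟨q, hq⟩ := h1
  have h2 := congrArg (ev ℂ) hq
  rw [one_mul, map_mul, ev_lin, zero_mul] at h2
  exact isUnit_iff.1 hu h2

/-- A nonzero saturated relation module over `Og ℂ` stable under the derivative contains a
relation with constant coefficients. -/
lemma exists_complex_relation {ι : Type*} [Fintype ι] [Nonempty ι]
    (N : Submodule (Og ℂ) (ι → Og ℂ)) (hN : N ≠ ⊥)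
    (hD : ∀ s ∈ N, (fun i => der (1 : ℂ) (s i)) ∈ N)
    (hsat : ∀ (c : Og ℂ) s, c ≠ 0 → c • s ∈ N → s ∈ N) :
    ∃ r : ι → ℂ, r ≠ 0 ∧ (fun i => algebraMap ℂ _ (r i)) ∈ N := by
  obtain ⟨s, hs, hs0, hs1⟩ := exists_relation_constant {der (1 : ℂ)} N hN
    (by rintro _ rfl s hs; exact hD s hs)
  obtain ⟨j, hj⟩ : ∃ j, ∀ i, s j ∣ s i := by
    have hdir : Directed (fun a b : Og ℂ => b ∣ a) s := by
      intro i j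
      rcases ValuationRing.dvd_total (s i) (s j) with h | h
      · exact ⟨i, dvd_rfl, h⟩
      · exact ⟨j, h, dvd_rfl⟩
    have : IsTrans (Og ℂ) (fun a b : Og ℂ => b ∣ a) := ⟨fun a b c h1 h2 => h2.trans h1⟩
    exact hdir.finite_le id
  choose q hq using hj
  have hj0 : s j ≠ 0 := by
    intro h0
    exact hs0 (funext fun i => by rw [hq i, h0, zero_mul]; rfl)
  have hq' : ∀ i, q i = algebraMap ℂ _ (ev ℂ (q i)) := by
    intro i
    refine eq_const_of_der_eq_zero ?_
    have h1 := hs1 (der (1 : ℂ)) rfl j i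
    rw [hq i, Derivation.leibniz, smul_eq_mul, smul_eq_mul] at h1
    have h2 : s j * (s j * der (1 : ℂ) (q i)) = 0 := by linear_combination h1
    exact (mul_eq_zero.1 ((mul_eq_zero.1 h2).resolve_left hj0)).resolve_left hj0
  refine ⟨fun i => ev ℂ (q i), fun h0 => ?_, hsat (s j) _ hj0 ?_⟩
  · have h1 := hq j
    have h2 : q j = 0 := by rw [hq' j, show ev ℂ (q j) = 0 from congrFun h0 j, map_zero]
    rw [h2, mul_zero] at h1
    exact hj0 h1
  · have : s j • (fun i => algebraMap ℂ (Og ℂ) (ev ℂ (q i))) = s := by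
      ext1 i
      rw [Pi.smul_apply, ← hq' i, smul_eq_mul, ← hq i]
    rwa [this]

lemma exists_dl_eq_of_mem_span {Y : Set (Og E)} {f : Og (E × ℂ)}
    (hf : f ∈ Ideal.span (up E '' Y)) : ∃ h ∈ Ideal.span (up E '' Y), dl E h = f := by
  suffices H : ∀ c, ∃ h ∈ Ideal.span (up E '' Y), dl E h = c * f by simpa using H 1
  induction hf using Submodule.span_induction with
  | mem f hf =>
    intro c
    obtain ⟨y, hy, rfl⟩ := hf
    obtain ⟨h, hh⟩ := exists_dl_eq c
    refine ⟨h * up E y, Ideal.mul_mem_left _ _ (Ideal.subset_span ⟨y, hy, rfl⟩), ?_⟩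
    rw [Derivation.leibniz, dl_up, hh, smul_zero, zero_add, smul_eq_mul, mul_comm]
  | zero => exact fun c => ⟨0, zero_mem _, by simp⟩
  | add f g _ _ hf hg =>
    intro c
    obtain ⟨h, hh, hh'⟩ := hf c
    obtain ⟨k, hk, hk'⟩ := hg c
    exact ⟨h + k, add_mem hh hk, by rw [map_add, hh', hk', mul_add]⟩
  | smul a f _ hf =>
    intro c
    obtain ⟨h, hh, hh'⟩ := hf (c * a)
    exact ⟨h, hh, by rw [hh', smul_eq_mul, mul_assoc]⟩

lemma exists_sub_up_mem_span [FiniteDimensional ℂ E] {Y : Set (Og E)} {s : Og (E × ℂ)}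
    (hs : dl E s ∈ Ideal.span (up E '' Y)) : ∃ a, s - up E a ∈ Ideal.span (up E '' Y) := by
  obtain ⟨h, hh, hd⟩ := exists_dl_eq_of_mem_span hs
  refine ⟨down E (s - h), ?_⟩
  rw [← eq_up_of_dl_eq_zero (by rw [map_sub, hd, sub_self])]
  simpa using hh

lemma eq_zero_of_der_eq_zero [FiniteDimensional ℂ E] {l : E →L[ℂ] ℂ} {v : E} (h : l v = 1)
    {f : Og E} (hd : der v f = 0) (hf : pl l.ker.subtypeL f = 0) : f = 0 := by
  have e2 : (ofSplit l v).comp (ContinuousLinearMap.inl ℂ l.ker ℂ) = l.ker.subtypeL := by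
    ext x; simp [ofSplit]
  have h1 : dl l.ker (pl (ofSplit l v) f) = 0 := by
    rw [dl, der_pl, show ofSplit l v (0, 1) = v by simp [ofSplit], hd, map_zero]
  have h2 := eq_up_of_dl_eq_zero h1
  rw [down, pl_pl, e2, hf, map_zero] at h2
  have := congrArg (pl (toSplit l v h)) h2
  rwa [pl_pl, ofSplit_comp_toSplit, pl_id, map_zero] at this

lemma exists_der_eq {l : E →L[ℂ] ℂ} {v : E} (h : l v = 1) (f : Og E) :
    ∃ g, der v g = f ∧ pl l.ker.subtypeL g = 0 := by
  obtain ⟨g, hg⟩ := exists_dl_eq (pl (ofSplit l v) f)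
  have h1 : der v (pl (toSplit l v h) g) = f := by
    rw [der_pl, show toSplit l v h v = (0, 1) by
      ext <;> simp [toSplit, h], ← dl, hg, pl_pl, ofSplit_comp_toSplit, pl_id]
  set g' := pl (toSplit l v h) g
  refine ⟨g' - pl (projKer l v h) (pl l.ker.subtypeL g'), ?_, ?_⟩
  · rw [map_sub, h1, der_pl, show projKer l v h v = 0 by
      ext; simp [projKer, toSplit, h], der_zero_dir, map_zero, sub_zero]
  · rw [map_sub, pl_pl (L := l.ker.subtypeL) (M := projKer l v h), show (projKer l v h).comp l.ker.subtypeL =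
      ContinuousLinearMap.id ℂ _ by ext x; simp [projKer, toSplit], pl_id, sub_self]

/-- The Poincaré lemma for closed one-forms along a family of coordinate directions. -/
lemma exists_forall_der_eq [FiniteDimensional ℂ E] (v : ℕ → E) (l : ℕ → E →L[ℂ] ℂ) (k : ℕ)
    (hv : ∀ i < k, ∀ j < k, l i (v j) = if i = j then 1 else 0) (b : ℕ → Og E)
    (hb : ∀ i < k, ∀ j < k, der (v i) (b j) = der (v j) (b i)) :
    ∃ g, ∀ i < k, der (v i) g = b i := by
  induction k with
  | zero => exact ⟨0, by simp⟩
  | succ k ih =>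
    obtain ⟨g, hg⟩ := ih (fun i hi j hj => hv i (by omega) j (by omega))
      (fun i hi j hj => hb i (by omega) j (by omega))
    obtain ⟨h, hh, hh0⟩ := exists_der_eq (l := l k) (v := v k)
      (by rw [hv k (by omega) k (by omega), if_pos rfl]) (b k - der (v k) g)
    refine ⟨g + h, fun i hi => ?_⟩
    rcases Nat.lt_succ_iff_lt_or_eq.1 hi with hi | rfl
    · have : der (v i) h = 0 := by
        refine eq_zero_of_der_eq_zero (l := l k) (v := v k)
          (by rw [hv k (by omega) k (by omega), if_pos rfl]) ?_ ?_
        · rw [der_comm, hh, map_sub, hb i (by omega) k (by omega), ← hg i hi, der_comm, sub_self]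
        · have hvi : l k (v i) = 0 := by rw [hv k (by omega) i (by omega), if_neg (by omega)]
          have h1 := der_pl (l k).ker.subtypeL (⟨v i, hvi⟩ : (l k).ker) h
          rw [hh0, map_zero] at h1
          exact h1.symm
      rw [map_add, this, hg i hi, add_zero]
    · rw [map_add, hh]; ring

end Og

/-! ### Algebra of commuting derivations -/

section Core

open IsLocalRing

/-- Krull's theorem for an algebra that is finite modulo an ideal. -/
lemma exists_sub_mem_of_forall_pow {S O : Type*} [CommRing S] [IsLocalRing S] [IsNoetherianRing S]
    [CommRing O] (Ψ : S →+* O) (I : Ideal O) (hfin : ((Ideal.Quotient.mk I).comp Ψ).Finite)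
    {c : S} (hc : c ∈ maximalIdeal S) {z : O}
    (h : ∀ m : ℕ, ∃ s w, z - Ψ s - Ψ c ^ m * w ∈ I) : ∃ s, z - Ψ s ∈ I := by
  let _ : Algebra S (O ⧸ I) := ((Ideal.Quotient.mk I).comp Ψ).toAlgebra
  have hsm : ∀ (s : S) (q : O ⧸ I), s • q = Ideal.Quotient.mk I (Ψ s) * q := fun _ _ => rfl
  have : Module.Finite S (O ⧸ I) := hfin
  have h1 : Ideal.Quotient.mk I z ∈ Submodule.span S {(1 : O ⧸ I)} := by
    refine mem_of_forall_mem_pow_smul hc _ fun m => ?_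
    obtain ⟨s, w, hw⟩ := h m
    refine ⟨Ideal.Quotient.mk I w, Submodule.mem_span_singleton.2 ⟨s, ?_⟩⟩
    rw [hsm, hsm, mul_one, ← map_mul, ← map_sub, map_pow, eq_comm, Ideal.Quotient.eq]
    rwa [sub_right_comm]
  obtain ⟨s, hs⟩ := Submodule.mem_span_singleton.1 h1
  rw [hsm, mul_one, eq_comm, Ideal.Quotient.eq] at hs
  exact ⟨s, hs⟩

/-- The kernel of a derivation modulo the members of a chain of ideals. -/
lemma exists_sub_mem_of_derivation_mem {A S O : Type*} [CommRing A] [CommRing S] [IsLocalRing S]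
    [IsNoetherianRing S] [CommRing O] (up : A →+* S) (Ψ : S →+* O) (D : O →+ O)
    (hD : ∀ a z, D (Ψ (up a) * z) = Ψ (up a) * D z) (hD1 : D 1 = 0) (δ : O) (dS : S → S)
    (hDS : ∀ s, D (Ψ s) = δ * Ψ (dS s)) (y : ℕ → A) (hy : ∀ j, up (y j) ∈ maximalIdeal S)
    (I : ℕ → Ideal O) (hI : ∀ j, I (j + 1) = I j ⊔ Ideal.span {Ψ (up (y j))})
    (hDI : ∀ j, ∀ z ∈ I j, D z ∈ I j) (n : ℕ)
    (hreg : ∀ j < n, ∀ z, Ψ (up (y j)) * z ∈ I j → z ∈ I j)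
    (hδ : ∀ j < n, ∀ z, δ * z ∈ I j → z ∈ I j)
    (hfin : ∀ j < n, ((Ideal.Quotient.mk (I j)).comp Ψ).Finite)
    (hind : ∀ j < n, ∀ s, Ψ s ∈ I j → s ∈ Ideal.span (up '' (y '' Set.Iio j)))
    (hspan : ∀ j, ∀ s ∈ Ideal.span (up '' (y '' Set.Iio j)), Ψ s ∈ I j)
    (hanti : ∀ j < n, ∀ s, dS s ∈ Ideal.span (up '' (y '' Set.Iio j)) →
      ∃ a, s - up a ∈ Ideal.span (up '' (y '' Set.Iio j)))
    (hbase : ∀ z, D z ∈ I n → ∃ a, z - Ψ (up a) ∈ I n) :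
    ∀ j ≤ n, ∀ z, D z ∈ I j → ∃ a, z - Ψ (up a) ∈ I j := by
  intro j hj
  induction hj using Nat.decreasingInduction with
  | self => exact hbase
  | of_succ j hj ih =>
    intro z hz
    have hle : I j ≤ I (j + 1) := (hI j).symm ▸ le_sup_left
    have key : ∀ m : ℕ, ∃ a w, z - Ψ (up a) - Ψ (up (y j)) ^ m * w ∈ I j ∧ D w ∈ I j := by
      intro m
      induction m with
      | zero =>
        refine ⟨0, z, ?_, hz⟩
        rw [map_zero, map_zero, pow_zero, one_mul, sub_zero, sub_self]
        exact zero_mem _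
      | succ m ihm =>
        obtain ⟨a, w, h1, h2⟩ := ihm
        obtain ⟨b, hb⟩ := ih w (hle h2)
        rw [hI] at hb
        obtain ⟨q, g, hg, hq⟩ := Ideal.mem_span_singleton_sup.1 (sup_comm (I j) _ ▸ hb)
        have hDb : D (Ψ (up b)) = 0 := by
          rw [← mul_one (Ψ (up b)), hD, hD1, mul_zero]
        refine ⟨a + y j ^ m * b, q, ?_, hreg j hj _ ?_⟩
        · have : z - Ψ (up (a + y j ^ m * b)) - Ψ (up (y j)) ^ (m + 1) * q =
              (z - Ψ (up a) - Ψ (up (y j)) ^ m * w) + Ψ (up (y j)) ^ m * g := by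
            simp only [map_add, map_mul, map_pow]
            linear_combination -Ψ (up (y j)) ^ m * hq
          rw [this]
          exact add_mem h1 (Ideal.mul_mem_left _ _ hg)
        · have : Ψ (up (y j)) * D q = D w - D g := by
            rw [← hD, show Ψ (up (y j)) * q = w - Ψ (up b) - g by linear_combination hq, map_sub,
              map_sub, hDb, sub_zero]
          rw [this]
          exact sub_mem h2 (hDI j g hg)
    obtain ⟨s, hs⟩ := exists_sub_mem_of_forall_pow Ψ (I j) (hfin j hj) (hy j) (z := z) fun m => by
      obtain ⟨a, w, h1, -⟩ := key m
      exact ⟨up a, w, h1⟩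
    have h1 : D (Ψ s) ∈ I j := by
      have := sub_mem hz (hDI j _ hs)
      rwa [map_sub, sub_sub_cancel] at this
    rw [hDS] at h1
    obtain ⟨a, ha⟩ := hanti j hj s (hind j hj _ (hδ j hj _ h1))
    refine ⟨a, ?_⟩
    have h2 := add_mem hs (hspan j _ ha)
    rwa [map_sub, sub_add_sub_cancel] at h2

/-- The elements of the chain act regularly modulo the image of the derivation. -/
lemma mem_sup_range_of_mul_mem {A S O : Type*} [CommRing A] [CommRing S] [CommRing O]
    (up : A →+* S) (Ψ : S →+* O) (D : O →+ O)
    (hD : ∀ a z, D (Ψ (up a) * z) = Ψ (up a) * D z) (hD1 : D 1 = 0) {I J : Ideal O} {y : A}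
    (hJ : J = I ⊔ Ideal.span {Ψ (up y)}) (hDI : ∀ z ∈ I, D z ∈ I)
    (hreg : ∀ z, Ψ (up y) * z ∈ I → z ∈ I)
    (hker : ∀ z, D z ∈ J → ∃ a, z - Ψ (up a) ∈ J) {z h : O} (hz : Ψ (up y) * z - D h ∈ I) :
    ∃ w, z - D w ∈ I := by
  have h1 : D h ∈ J := by
    have : D h = -(Ψ (up y) * z - D h) + z * Ψ (up y) := by ring
    rw [this, hJ]
    exact add_mem (Ideal.mem_sup_left (neg_mem hz)) (Ideal.mem_sup_right
      (Ideal.mul_mem_left _ _ (Ideal.mem_span_singleton_self _)))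
  obtain ⟨a, ha⟩ := hker h h1
  rw [hJ] at ha
  obtain ⟨w, g, hg, hw⟩ := Ideal.mem_span_singleton_sup.1 (sup_comm I _ ▸ ha)
  refine ⟨w, hreg _ ?_⟩
  have hDa : D (Ψ (up a)) = 0 := by rw [← mul_one (Ψ (up a)), hD, hD1, mul_zero]
  have h2 : Ψ (up y) * D w = D h - D g := by
    rw [← hD, show Ψ (up y) * w = h - Ψ (up a) - g by linear_combination hw, map_sub, map_sub,
      hDa, sub_zero]
  have : Ψ (up y) * (z - D w) = Ψ (up y) * z - D h + D g := by rw [mul_sub, h2]; ring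
  rw [this]
  exact add_mem hz (hDI g hg)

section Frame

open Matrix

variable {O : Type*} [CommRing O] [Algebra ℂ O] {k : ℕ} (X : Fin (k + 1) → Derivation ℂ O O)
  (x : Fin (k + 1) → O)

/-- The matrix of derivatives of a family of functions. -/
def frameMat : Matrix (Fin (k + 1)) (Fin (k + 1)) O := Matrix.of fun j i => X j (x i)

/-- The combinations of the derivations `X` proportional to the partial derivatives along `x`. -/
noncomputable def frameD (p : Fin (k + 1)) : Derivation ℂ O O :=
  ∑ j, (frameMat X x).adjugate p j • X j

lemma frameD_apply (p : Fin (k + 1)) (z : O) :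
    frameD X x p z = ∑ j, (frameMat X x).adjugate p j * X j z := by
  change Derivation.coeFnAddMonoidHom (∑ j, (frameMat X x).adjugate p j • X j) z = _
  rw [map_sum, Finset.sum_apply]
  rfl

lemma frameD_coord (p i : Fin (k + 1)) :
    frameD X x p (x i) = if p = i then (frameMat X x).det else 0 := by
  rw [frameD_apply]
  have h := congrFun (congrFun (adjugate_mul (frameMat X x)) p) i
  rw [mul_apply] at h
  refine Eq.trans ?_ (h.trans ?_)
  · rfl
  · rw [Matrix.smul_apply, one_apply, smul_eq_mul, mul_ite, mul_one, mul_zero]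

lemma frameD_mem {I : Ideal O} (hX : ∀ j, ∀ z ∈ I, X j z ∈ I) (p : Fin (k + 1)) {z : O}
    (hz : z ∈ I) : frameD X x p z ∈ I := by
  rw [frameD_apply]
  exact sum_mem fun j _ => Ideal.mul_mem_left _ _ (hX j z hz)

variable {X x}

lemma exists_coeff_of_contraction_mem {I : Ideal O}
    (hδ : ∀ z, (frameMat X x).det * z ∈ I → z ∈ I)
    (hmin : ∀ a : Fin k → O,
      (∀ j, ∑ i, X j (x i.succ) * a i ∈ I ⊔ Ideal.span {(frameMat X x).det}) →
      ∀ i, a i ∈ I ⊔ Ideal.span {(frameMat X x).det})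
    {m : Fin (k + 1) → O} (hm : ((frameMat X x).adjugate *ᵥ m) 0 ∈ I) :
    ∃ b : Fin (k + 1) → O, b 0 = 0 ∧ ∀ j, m j - (frameMat X x *ᵥ b) j ∈ I := by
  set Q := frameMat X x
  set a := Q.adjugate *ᵥ m with ha
  have hQa : ∀ j, ∑ i, Q j i * a i = Q.det * m j := by
    intro j
    have h1 : Q *ᵥ a = Q.det • m := by
      rw [ha, mulVec_mulVec, mul_adjugate, smul_mulVec, one_mulVec]
    exact congrFun h1 j
  have h2 := hmin (fun i => a i.succ) fun j => by
    have h3 := hQa j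
    rw [Fin.sum_univ_succ] at h3
    have h4 : ∑ i : Fin k, X j (x i.succ) * a i.succ = m j * Q.det + -(Q j 0 * a 0) := by
      change ∑ i : Fin k, Q j i.succ * a i.succ = _
      linear_combination h3
    rw [h4]
    exact add_mem
      (Ideal.mem_sup_right (Ideal.mul_mem_left _ _ (Ideal.mem_span_singleton_self _)))
      (Ideal.mem_sup_left (neg_mem (Ideal.mul_mem_left _ _ hm)))
  have h3 : ∀ i : Fin k, ∃ b, a i.succ - Q.det * b ∈ I := by
    intro i
    obtain ⟨b, g, hg, hb⟩ := Ideal.mem_span_singleton_sup.1 (sup_comm I _ ▸ h2 i)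
    refine ⟨b, ?_⟩
    rwa [← hb, mul_comm b, add_sub_cancel_left]
  choose b hb using h3
  refine ⟨Fin.cons 0 b, rfl, fun j => hδ _ ?_⟩
  have h4 : Q.det * (m j - (Q *ᵥ (Fin.cons 0 b : Fin (k + 1) → O)) j) =
      Q j 0 * a 0 + ∑ i : Fin k, Q j i.succ * (a i.succ - Q.det * b i) := by
    rw [mul_sub, ← hQa j, Fin.sum_univ_succ]
    have : (Q *ᵥ (Fin.cons 0 b : Fin (k + 1) → O)) j = ∑ i : Fin k, Q j i.succ * b i := by
      change ∑ i, Q j i * (Fin.cons 0 b : Fin (k + 1) → O) i = _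
      rw [Fin.sum_univ_succ]
      simp only [Fin.cons_zero, Fin.cons_succ, mul_zero, zero_add]
    rw [this, Finset.mul_sum, add_sub_assoc, ← Finset.sum_sub_distrib]
    congr 1
    exact Finset.sum_congr rfl fun i _ => by ring
  rw [h4]
  exact add_mem (Ideal.mul_mem_left _ _ hm)
    (sum_mem fun i _ => Ideal.mul_mem_left _ _ (hb i))

lemma contraction_sub_mem {I : Ideal O} (hX : ∀ j, ∀ z ∈ I, X j z ∈ I)
    (hXX : ∀ i j z, X i (X j z) = X j (X i z)) {m b : Fin (k + 1) → O}
    (hm : ∀ j, m j - (frameMat X x *ᵥ b) j ∈ I) (p q : Fin (k + 1)) :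
    (∑ j, ∑ i, (frameMat X x).adjugate p j * (frameMat X x).adjugate q i *
      (X j (m i) - X i (m j))) -
      (frameMat X x).det * (frameD X x p (b q) - frameD X x q (b p)) ∈ I := by
  set Q := frameMat X x with hQ
  set r : Fin (k + 1) → O := fun j => m j - (Q *ᵥ b) j
  let R : Matrix (Fin (k + 1)) (Fin (k + 1)) O := Matrix.of fun j i => X j (r i)
  let B : Matrix (Fin (k + 1)) (Fin (k + 1)) O := Matrix.of fun j l => X j (b l)
  let M : Matrix (Fin (k + 1)) (Fin (k + 1)) O := Matrix.of fun j i => X j (m i) - X i (m j)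
  have hM : M = (R - Rᵀ) + (B * Qᵀ - Q * Bᵀ) := by
    ext j i
    have h1 : ∀ j i, X j (m i) = R j i + ((B * Qᵀ) j i + ∑ l, b l * X j (X i (x l))) := by
      intro j i
      have : m i = r i + ∑ l, Q i l * b l := by
        change _ = m i - (∑ l, Q i l * b l) + _
        ring
      rw [this, map_add, map_sum, mul_apply, ← Finset.sum_add_distrib]
      change R j i + _ = _
      congr 1
      refine Finset.sum_congr rfl fun l _ => ?_
      rw [Derivation.leibniz, smul_eq_mul, smul_eq_mul]
      change X i (x l) * X j (b l) + b l * X j (X i (x l)) =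
        X j (b l) * X i (x l) + b l * X j (X i (x l))
      ring
    change X j (m i) - X i (m j) = (R j i - R i j) + ((B * Qᵀ) j i - (Q * Bᵀ) j i)
    rw [h1 j i, h1 i j]
    have h2 : (Q * Bᵀ) j i = (B * Qᵀ) i j := by
      rw [← transpose_apply (B * Qᵀ), transpose_mul, transpose_transpose]
    rw [h2]
    simp only [hXX i j]
    ring
  have hE : Q.adjugate * M * Q.adjugateᵀ = Q.adjugate * (R - Rᵀ) * Q.adjugateᵀ +
      Q.det • (Q.adjugate * B - (Q.adjugate * B)ᵀ) := by
    have h1 : Qᵀ * Q.adjugateᵀ = Q.det • 1 := by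
      rw [← transpose_mul, adjugate_mul, transpose_smul, transpose_one]
    rw [hM, mul_add, add_mul, mul_sub (Q.adjugate) (B * Qᵀ), sub_mul, mul_assoc, mul_assoc,
      mul_assoc B, h1, ← mul_assoc Q.adjugate Q, adjugate_mul, transpose_mul, smul_sub]
    simp only [mul_smul, smul_mul, mul_one, one_mul, Matrix.mul_assoc]
    congr 2
    · simp
  have h1 : (Q.adjugate * M * Q.adjugateᵀ) p q =
      ∑ j, ∑ i, Q.adjugate p j * Q.adjugate q i * (X j (m i) - X i (m j)) := by
    rw [Matrix.mul_assoc, mul_apply]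
    refine Finset.sum_congr rfl fun j _ => ?_
    rw [mul_apply, Finset.mul_sum]
    refine Finset.sum_congr rfl fun i _ => ?_
    rw [transpose_apply]
    change _ * ((X j (m i) - X i (m j)) * _) = _
    ring
  have h2 : ∀ p q, (Q.adjugate * B) p q = frameD X x p (b q) := by
    intro p q
    rw [frameD_apply, mul_apply]
    rfl
  rw [← h1, hE, Matrix.add_apply, Matrix.smul_apply, Matrix.sub_apply, transpose_apply, h2, h2, smul_eq_mul,
    add_sub_cancel_right, Matrix.mul_assoc, mul_apply]
  refine sum_mem fun j _ => Ideal.mul_mem_left _ _ ?_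
  rw [mul_apply]
  exact sum_mem fun i _ => Ideal.mul_mem_right _ _
    (sub_mem (hX j _ (hm i)) (hX i _ (hm j)))

/-- A relation between contracted cocycles can be differentiated. -/
lemma exists_primitive_of_relation {I : Ideal O} (hX : ∀ j, ∀ z ∈ I, X j z ∈ I)
    (hXX : ∀ i j z, X i (X j z) = X j (X i z))
    (hδ : ∀ z, (frameMat X x).det * z ∈ I → z ∈ I)
    (hmin : ∀ a : Fin k → O,
      (∀ j, ∑ i, X j (x i.succ) * a i ∈ I ⊔ Ideal.span {(frameMat X x).det}) →
      ∀ i, a i ∈ I ⊔ Ideal.span {(frameMat X x).det})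
    {ρ : Type*} [Fintype ρ] (m : ρ → Fin (k + 1) → O)
    (hm : ∀ r i j, X j (m r i) - X i (m r j) ∈ I) (s : ρ → O) (s' : Fin (k + 1) → ρ → O)
    (hs : ∀ p r, frameD X x p (s r) = (frameMat X x).det * s' p r) (h : O)
    (hh : ∑ r, s r * ((frameMat X x).adjugate *ᵥ m r) 0 - frameD X x 0 h ∈ I) :
    ∃ b : Fin (k + 1) → O, b 0 = 0 ∧
      (∀ j, ∑ r, s r * m r j - X j h - (frameMat X x *ᵥ b) j ∈ I) ∧
      ∀ p q, frameD X x p (b q) - frameD X x q (b p) -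
        ∑ r, (s' p r * ((frameMat X x).adjugate *ᵥ m r) q -
          s' q r * ((frameMat X x).adjugate *ᵥ m r) p) ∈ I := by
  set Q := frameMat X x with hQ
  set M : Fin (k + 1) → O := fun j => ∑ r, s r * m r j - X j h with hM
  have hM0 : (Q.adjugate *ᵥ M) 0 ∈ I := by
    convert hh using 1
    have h1 : M = ∑ r, s r • m r - fun j => X j h := by
      ext j
      simp [hM]
    rw [h1, mulVec_sub, mulVec_sum, Pi.sub_apply, Finset.sum_apply, frameD_apply]
    congr 1
    exact Finset.sum_congr rfl fun r _ => by rw [mulVec_smul, Pi.smul_apply, smul_eq_mul]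
  obtain ⟨b, hb0, hb⟩ := exists_coeff_of_contraction_mem hδ hmin hM0
  refine ⟨b, hb0, hb, fun p q => hδ _ ?_⟩
  have h1 := contraction_sub_mem hX hXX hb p q
  have h2 : (∑ j, ∑ i, Q.adjugate p j * Q.adjugate q i * (X j (M i) - X i (M j))) -
      Q.det * ∑ r, (s' p r * (Q.adjugate *ᵥ m r) q - s' q r * (Q.adjugate *ᵥ m r) p) ∈ I := by
    have h3 : Q.det * ∑ r, (s' p r * (Q.adjugate *ᵥ m r) q - s' q r * (Q.adjugate *ᵥ m r) p) =
        ∑ j, ∑ i, Q.adjugate p j * Q.adjugate q i *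
          ∑ r, (X j (s r) * m r i - X i (s r) * m r j) := by
      rw [Finset.mul_sum]
      simp only [Finset.mul_sum]
      simp_rw [Finset.sum_comm (t := (Finset.univ : Finset ρ))]
      refine Finset.sum_congr rfl fun r _ => ?_
      rw [mul_sub, ← mul_assoc, ← mul_assoc, ← hs p r, ← hs q r, frameD_apply, frameD_apply,
        mulVec, mulVec, dotProduct, dotProduct, Finset.sum_mul_sum, Finset.sum_mul_sum,
        Finset.sum_comm (f := fun i j => Q.adjugate q i * X i (s r) * (Q.adjugate p j * m r j)),
        ← Finset.sum_sub_distrib]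
      refine Finset.sum_congr rfl fun j _ => ?_
      rw [← Finset.sum_sub_distrib]
      exact Finset.sum_congr rfl fun i _ => by ring
    rw [h3, ← Finset.sum_sub_distrib]
    refine sum_mem fun j _ => ?_
    rw [← Finset.sum_sub_distrib]
    refine sum_mem fun i _ => ?_
    rw [← mul_sub]
    refine Ideal.mul_mem_left _ _ ?_
    have h4 : X j (M i) - X i (M j) - ∑ r, (X j (s r) * m r i - X i (s r) * m r j) =
        ∑ r, s r * (X j (m r i) - X i (m r j)) := by
      simp only [hM, map_sub, map_sum, Derivation.leibniz, smul_eq_mul]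
      rw [hXX j i, sub_sub_sub_cancel_right, ← Finset.sum_sub_distrib, ← Finset.sum_sub_distrib]
      exact Finset.sum_congr rfl fun r _ => by ring
    rw [h4]
    exact sum_mem fun r _ => Ideal.mul_mem_left _ _ (hm r i j)
  have := sub_mem h2 h1
  convert this using 1
  ring

end Frame

end Core

/-- A criterion for a subquotient of a module over a principal ideal domain to be free. -/
lemma exists_basis_of_separating {R : Type*} [CommRing R] [IsDomain R] [IsPrincipalIdealRing R]
    {X : Type u} [AddCommGroup X] [Module R X] (Z B : Submodule R X) (b : ℕ)
    (hsep : ∀ m ∈ Z, m ∉ B → ∃ φ : X →ₗ[R] R, (∀ z ∈ B, φ z = 0) ∧ φ m ≠ 0)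
    (hrel : ∀ v : Fin (b + 1) → X, (∀ i, v i ∈ Z) →
      ∃ r : Fin (b + 1) → R, r ≠ 0 ∧ ∑ i, r i • v i ∈ B) :
    ∃ (ι : Type) (e : ι → X), (∀ a, e a ∈ Z) ∧
      ∀ m ∈ Z, ∃! c : ι →₀ R, m - c.sum (fun a ψ => ψ • e a) ∈ B := by
  let M : Submodule R (X ⧸ B) := Z.map B.mkQ
  have hMs : ∀ m : M, m ≠ 0 → ∃ φ : M →ₗ[R] R, φ m ≠ 0 := by
    rintro ⟨m, hm⟩ h0
    obtain ⟨z, hz, rfl⟩ := hm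
    have hzB : z ∉ B := fun h => h0 (Subtype.ext ((Submodule.Quotient.mk_eq_zero B).2 h))
    obtain ⟨φ, h1, h2⟩ := hsep z hz hzB
    exact ⟨(B.liftQ φ h1).comp M.subtype, h2⟩
  have hMr : ∀ v : Fin (b + 1) → M, ∃ r : Fin (b + 1) → R, r ≠ 0 ∧ ∑ i, r i • v i = 0 := by
    intro v
    have hv : ∀ i, ∃ z ∈ Z, B.mkQ z = v i := fun i => (v i).2
    choose z hz hzv using hv
    obtain ⟨r, h0, hr⟩ := hrel z hz
    refine ⟨r, h0, Subtype.ext ?_⟩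
    rw [← Submodule.Quotient.mk_eq_zero] at hr
    change B.mkQ _ = 0 at hr
    rw [map_sum] at hr
    rw [AddSubmonoidClass.coe_finsetSum]
    refine Eq.trans (Finset.sum_congr rfl fun i _ => ?_) hr
    rw [map_smul, hzv]
    rfl
  have : Module.Finite R M := finite_of_separating b M hMs hMr
  have : Module.IsTorsionFree R M := by
    refine Module.IsTorsionFree.of_smul_eq_zero fun r m h => ?_
    by_contra! h'
    obtain ⟨φ, hφ⟩ := hMs m h'.2
    have := congrArg φ h
    rw [map_smul, map_zero, smul_eq_mul] at this
    exact (mul_ne_zero h'.1 hφ) this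
  let β := Module.finBasis R M
  have hv : ∀ i, ∃ z ∈ Z, B.mkQ z = β i := fun i => (β i).2
  choose e he heβ using hv
  have key : ∀ m (hm : m ∈ Z) (c : Fin (Module.finrank R M) →₀ R),
      m - c.sum (fun a ψ => ψ • e a) ∈ B ↔
        (⟨B.mkQ m, m, hm, rfl⟩ : M) = Finsupp.linearCombination R β c := by
    intro m hm c
    rw [← Submodule.Quotient.mk_eq_zero]
    change B.mkQ _ = 0 ↔ _
    rw [map_sub, sub_eq_zero, ← Subtype.coe_inj, Finsupp.sum, map_sum,
      Finsupp.linearCombination_apply, Finsupp.sum, AddSubmonoidClass.coe_finsetSum]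
    simp only [map_smul, heβ]
    rfl
  refine ⟨_, e, he, fun m hm => ⟨β.repr ⟨B.mkQ m, m, hm, rfl⟩, ?_, fun c hc => ?_⟩⟩
  · exact (key m hm _).2 (β.linearCombination_repr _).symm
  · rw [(key m hm c).1 hc, β.repr_linearCombination]

namespace Og

/-- The cokernel of a singular derivation along a finite projection is finite. -/
theorem finite_quotient_range {O : Type*} [CommRing O] [Algebra (Og E) O] (Ψ : Og (E × ℂ) →+* O)
    (hΨ : ∀ a, algebraMap (Og E) O a = Ψ (up E a)) (D : O →ₗ[Og E] O) (δ : O)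
    (hD : ∀ s z, D (Ψ s * z) = δ * Ψ (dl E s) * z + Ψ s * D z) (I : Ideal O)
    {ι : Type*} [Fintype ι] (c : ι → O)
    (hc : ∀ z, ∃ s : ι → Og (E × ℂ), z - ∑ i, Ψ (s i) * c i ∈ I) (κ : ℕ) (e w : O)
    (hκ : Ψ (xl E) ^ κ - δ * e - w ∈ I)
    (hw : ∀ z, ∃ s : ι → Og (E × ℂ), (∀ i, axis E (s i) = 0) ∧
      w * z - ∑ i, Ψ (s i) * c i ∈ I) :
    Module.Finite (Og E) (O ⧸ (I.restrictScalars (Og E) ⊔ LinearMap.range D)) := by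
  choose A hA using fun l => hc (e * c l)
  choose B hB using fun l => hc (D (c l))
  choose P hP0 hP using fun l => hw (c l)
  obtain ⟨ρ₁, hρ₁, h⟩ := ode_germ (Matrix.of fun i j => A j i) (Matrix.of fun i j => B j i)
    (Matrix.of fun i j => P j i) (fun i j => hP0 j i) κ
  let T := I.restrictScalars (Og E) ⊔ LinearMap.range D
  have hIT : ∀ z ∈ I, z ∈ T := fun z hz => Submodule.mem_sup_left hz
  have hDT : ∀ z, D z ∈ T := fun z => Submodule.mem_sup_right ⟨z, rfl⟩
  have hsm : ∀ (a : Og E) z, a • z = Ψ (up E a) * z := fun a z => by rw [← hΨ, Algebra.smul_def]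
  have hstep : ∀ (N : ℕ) (g v h : ι → Og (E × ℂ)) (a : ℕ → ι → Og E),
      (∀ i, g i = xl E ^ κ * v i - ∑ j, P j i * v j + ∑ j, B j i * h j +
          ∑ j ∈ Finset.range N, xl E ^ j * up E (a j i)) →
      (∀ i, dl E (h i) = ∑ j, A j i * v j) →
      ∑ i, Ψ (g i) * c i - ∑ j ∈ Finset.range N, ∑ i, a j i • (Ψ (xl E) ^ j * c i) ∈ T := by
    intro N g v h a h1 h2
    have e1 : D (∑ i, Ψ (h i) * c i) = ∑ j, Ψ (v j) * (δ * ∑ i, Ψ (A j i) * c i) +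
        ∑ j, Ψ (h j) * D (c j) := by
      rw [map_sum]
      simp only [hD]
      rw [Finset.sum_add_distrib]
      congr 1
      simp only [h2, map_sum, map_mul, Finset.mul_sum, Finset.sum_mul]
      rw [Finset.sum_comm]
      exact Finset.sum_congr rfl fun j _ => Finset.sum_congr rfl fun i _ => by ring
    have e2 : ∑ i, Ψ (g i) * c i - ∑ j ∈ Finset.range N, ∑ i, a j i • (Ψ (xl E) ^ j * c i) =
        ∑ j, Ψ (v j) * (Ψ (xl E) ^ κ * c j - ∑ i, Ψ (P j i) * c i) +
          ∑ j, Ψ (h j) * ∑ i, Ψ (B j i) * c i := by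
      have : ∀ i, Ψ (g i) * c i = Ψ (v i) * (Ψ (xl E) ^ κ * c i) -
          ∑ j, Ψ (v j) * (Ψ (P j i) * c i) + ∑ j, Ψ (h j) * (Ψ (B j i) * c i) +
          ∑ j ∈ Finset.range N, a j i • (Ψ (xl E) ^ j * c i) := by
        intro i
        simp only [h1, map_add, map_sub, map_mul, map_sum, map_pow, add_mul, sub_mul,
          Finset.sum_mul, hsm]
        congr 1
        · congr 1
          · congr 1
            · ring
            · exact Finset.sum_congr rfl fun j _ => by ring
          · exact Finset.sum_congr rfl fun j _ => by ring
        · exact Finset.sum_congr rfl fun j _ => by ring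
      simp only [this, Finset.sum_add_distrib, Finset.sum_sub_distrib, mul_sub, Finset.mul_sum]
      rw [Finset.sum_comm (s := Finset.range N), add_sub_cancel_right,
        Finset.sum_comm (f := fun i j => Ψ (v j) * (Ψ (P j i) * c i)),
        Finset.sum_comm (f := fun i j => Ψ (h j) * (Ψ (B j i) * c i))]
    have e3 : ∑ i, Ψ (g i) * c i - ∑ j ∈ Finset.range N, ∑ i, a j i • (Ψ (xl E) ^ j * c i) -
        D (∑ i, Ψ (h i) * c i) ∈ I := by
      have : ∑ i, Ψ (g i) * c i - ∑ j ∈ Finset.range N, ∑ i, a j i • (Ψ (xl E) ^ j * c i) -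
          D (∑ i, Ψ (h i) * c i) =
          ∑ j, Ψ (v j) * (c j * (Ψ (xl E) ^ κ - δ * e - w) +
            (w * c j - ∑ i, Ψ (P j i) * c i) + δ * (e * c j - ∑ i, Ψ (A j i) * c i)) -
          ∑ j, Ψ (h j) * (D (c j) - ∑ i, Ψ (B j i) * c i) := by
        rw [e1, e2, ← sub_sub, add_sub_right_comm, ← Finset.sum_sub_distrib, add_sub_assoc,
          ← Finset.sum_sub_distrib, sub_eq_add_neg _ (∑ j, Ψ (h j) * _), ← Finset.sum_neg_distrib]
        congr 1
        · exact Finset.sum_congr rfl fun j _ => by ring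
        · exact Finset.sum_congr rfl fun j _ => by ring
      rw [this]
      refine sub_mem (sum_mem fun j _ => Ideal.mul_mem_left _ _ (add_mem (add_mem ?_ (hP j)) ?_))
        (sum_mem fun j _ => Ideal.mul_mem_left _ _ (hB j))
      · exact Ideal.mul_mem_left _ _ hκ
      · exact Ideal.mul_mem_left _ _ (hA j)
    have := add_mem (hIT _ e3) (hDT (∑ i, Ψ (h i) * c i))
    rwa [sub_add_cancel] at this
  obtain ⟨N₀, hN₀⟩ := h ρ₁ hρ₁ le_rfl
  let W : Submodule (Og E) O := Submodule.span (Og E)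
    (Set.range fun q : Fin N₀ × ι => Ψ (xl E) ^ (q.1 : ℕ) * c q.2)
  have hW : ∀ (a : ℕ → ι → Og E),
      ∑ j ∈ Finset.range N₀, ∑ i, a j i • (Ψ (xl E) ^ j * c i) ∈ W := fun a =>
    sum_mem fun j hj => sum_mem fun i _ => W.smul_mem _
      (Submodule.subset_span ⟨(⟨j, Finset.mem_range.1 hj⟩, i), rfl⟩)
  have hmono : ∀ (n : ℕ) (i : ι), Ψ (xl E) ^ n * c i ∈ T ⊔ W := by
    intro n i
    obtain ⟨v, h, a, h1, h2⟩ := hN₀ _ (hasRad_monomial hρ₁ (Pi.single i (1 : ℂ)) n)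
    have := add_mem (Submodule.mem_sup_left (hstep N₀ _ v h a h1 h2))
      (Submodule.mem_sup_right (S := T) (hW a))
    rw [sub_add_cancel, Finset.sum_eq_single i] at this
    · rwa [Pi.single_eq_same, one_smul, map_pow] at this
    · intro j _ hj
      rw [Pi.single_eq_of_ne hj, zero_smul, map_zero, zero_mul]
    · exact fun h => absurd (Finset.mem_univ i) h
  have htop : T ⊔ W = ⊤ := by
    rw [eq_top_iff]
    intro z _
    obtain ⟨g, hg⟩ := hc z
    obtain ⟨ρ₂, hρ₂, hr⟩ := exists_hasRad g
    obtain ⟨N, hN⟩ := h (min ρ₁ ρ₂) (lt_min hρ₁ hρ₂) (min_le_left _ _)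
    obtain ⟨v, h, a, h1, h2⟩ := hN _ (hr _ (lt_min hρ₁ hρ₂) (min_le_right _ _))
    have h3 := add_mem (Submodule.mem_sup_left (T := W) (add_mem (hIT _ hg) (hstep N g v h a h1 h2)))
      (sum_mem fun j (_ : j ∈ Finset.range N) => sum_mem fun i (_ : i ∈ Finset.univ) =>
        (T ⊔ W).smul_mem (a j i) (hmono j i))
    rwa [sub_add_sub_cancel, sub_add_cancel] at h3
  refine ⟨(Submodule.fg_def.2 ⟨T.mkQ '' Set.range fun q : Fin N₀ × ι =>
    Ψ (xl E) ^ (q.1 : ℕ) * c q.2, (Set.finite_range _).image _, ?_⟩)⟩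
  rw [← Submodule.map_span, eq_top_iff]
  intro q _
  obtain ⟨z, rfl⟩ := T.mkQ_surjective q
  obtain ⟨s, hs, r, hr, rfl⟩ := Submodule.mem_sup.1 (htop.ge (Submodule.mem_top (x := z)))
  refine ⟨r, hr, ?_⟩
  rw [map_add, (Submodule.Quotient.mk_eq_zero T).2 hs |> (show T.mkQ s = 0 from ·), zero_add]

end Og

lemma eq_zero_of_mul_eq_one_of_smul {A M : Type*} [CommRing A] [AddCommGroup M] [Module A M]
    {u v : A} (h : v * u = 1) {x : M} (hx : u • x = 0) : x = 0 := by
  rw [← one_smul A x, ← h, mul_smul, hx, smul_zero]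

open TensorProduct in
/-- A finite torsion-free algebra over a domain is reduced when some non-zero-divisor kills
its differentials. -/
lemma isReduced_of_kaehler {S T : Type*} [CommRing S] [IsDomain S] [CommRing T] [Algebra S T]
    [Module.Finite S T] (htf : ∀ (s : S) (z : T), s ≠ 0 → s • z = 0 → z = 0) (d : T)
    (hd : ∀ z, d * z = 0 → z = 0)
    (hΩ : ∀ z : T, d • KaehlerDifferential.D S T z = 0) : IsReduced T := by
  have hmin := minpoly.aeval S d
  obtain ⟨i, hi, hmem⟩ := Ideal.exists_coeff_ne_zero_mem_comap_of_non_zero_divisor_root_mem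
    (f := algebraMap S T) (I := Ideal.span {d}) (fun {z} hz => hd z (by rwa [mul_comm]))
    (Ideal.mem_span_singleton_self d)
    (minpoly.monic (Algebra.IsIntegral.isIntegral (R := S) d)).ne_zero hmin
  obtain ⟨e, he⟩ := Ideal.mem_span_singleton'.1 (Ideal.mem_comap.1 hmem)
  set s := (minpoly S d).coeff i
  have hs : ∀ z : T, s • KaehlerDifferential.D S T z = 0 := fun z => by
    rw [← algebraMap_smul T, ← he, mul_smul, hΩ, smul_zero]
  let L := FractionRing S
  let _ : Algebra T (L ⊗[S] T) := Algebra.TensorProduct.rightAlgebra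
  have hD1 : ∀ t : T, KaehlerDifferential.D L (L ⊗[S] T) (1 ⊗ₜ t) = 0 := by
    intro t
    have h1 := congrArg (KaehlerDifferential.map S L T (L ⊗[S] T)) (hs t)
    rw [map_zero, ← algebraMap_smul T s, map_smul, KaehlerDifferential.map_D] at h1
    change (1 ⊗ₜ[S] algebraMap S T s : L ⊗[S] T) • KaehlerDifferential.D L (L ⊗[S] T) (1 ⊗ₜ t) = 0
      at h1
    have h2 : (1 ⊗ₜ[S] algebraMap S T s : L ⊗[S] T) =
        algebraMap L (L ⊗[S] T) (algebraMap S L s) := by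
      rw [Algebra.TensorProduct.algebraMap_apply, Algebra.algebraMap_eq_smul_one,
        Algebra.algebraMap_eq_smul_one, TensorProduct.tmul_smul, TensorProduct.smul_tmul',
        algebraMap_smul]
    rw [h2] at h1
    refine eq_zero_of_mul_eq_one_of_smul (v := algebraMap L (L ⊗[S] T) (algebraMap S L s)⁻¹) ?_ h1
    rw [← map_mul, inv_mul_cancel₀, map_one]
    rwa [Ne, IsFractionRing.to_map_eq_zero_iff]
  have hD : ∀ x, KaehlerDifferential.D L (L ⊗[S] T) x = 0 := by
    intro x
    induction x using TensorProduct.induction_on with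
    | zero => exact map_zero _
    | tmul l t =>
      rw [show (l ⊗ₜ[S] t : L ⊗[S] T) = algebraMap L _ l * (1 ⊗ₜ t) by
        rw [Algebra.TensorProduct.algebraMap_apply, Algebra.TensorProduct.tmul_mul_tmul, one_mul,
          mul_one]; rfl, Derivation.leibniz, hD1, Derivation.map_algebraMap, smul_zero, smul_zero,
        add_zero]
    | add x y hx hy => rw [map_add, hx, hy, add_zero]
  have : Algebra.FormallyUnramified L (L ⊗[S] T) := by
    refine ⟨⟨fun a b => ?_⟩⟩
    have h : ∀ a : Ω[L ⊗[S] T⁄L], a = 0 := by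
      intro a
      have ha : a ∈ Submodule.span (L ⊗[S] T) (Set.range (KaehlerDifferential.D L (L ⊗[S] T))) := by
        rw [KaehlerDifferential.span_range_derivation]
        exact Submodule.mem_top
      induction ha using Submodule.span_induction with
      | mem x hx => obtain ⟨y, rfl⟩ := hx; exact hD y
      | zero => rfl
      | add x y _ _ hx hy => rw [hx, hy, add_zero]
      | smul a x _ hx => rw [hx, smul_zero]
    rw [h a, h b]
  have hred : IsReduced (L ⊗[S] T) := Algebra.FormallyUnramified.isReduced_of_field L _
  have hfr : ∀ t : T, (1 ⊗ₜ t : L ⊗[S] T) = 0 → t = 0 := by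
    have : IsLocalizedModule (nonZeroDivisors S) (TensorProduct.mk S L T 1) := inferInstance
    intro t ht
    obtain ⟨c, hc⟩ := (IsLocalizedModule.eq_zero_iff (nonZeroDivisors S)
      (TensorProduct.mk S L T 1)).1 ht
    exact htf c t (nonZeroDivisors.ne_zero c.2) hc
  refine ⟨fun t ⟨k, hk⟩ => hfr t ?_⟩
  refine hred.eq_zero _ ⟨k, ?_⟩
  rw [Algebra.TensorProduct.tmul_pow, hk, TensorProduct.tmul_zero]

namespace Og

/-- The constants of a derivation on a reduced finite algebra over `ℂ{x}` that is proportional to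
`d/dx`. -/
lemma exists_const_of_derivation_eq_zero {T : Type*} [CommRing T] [IsLocalRing T] [IsReduced T]
    [Algebra ℂ T] [Algebra (Og ℂ) T] [IsScalarTower ℂ (Og ℂ) T] [Module.Finite (Og ℂ) T]
    (htf : ∀ (s : Og ℂ) (z : T), s ≠ 0 → s • z = 0 → z = 0)
    (hres : ∀ z : T, ∃ c : ℂ, z - algebraMap ℂ T c ∈ IsLocalRing.maximalIdeal T)
    (D : Derivation ℂ T T) (δ : T) (hδ : ∀ z, δ * z = 0 → z = 0)
    (hD : ∀ s : Og ℂ, D (algebraMap _ T s) = δ * algebraMap _ T (der (1 : ℂ) s)) {z : T}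
    (hz : D z = 0) : ∃ c : ℂ, z = algebraMap ℂ T c := by
  have hint := Algebra.IsIntegral.isIntegral (R := Og ℂ) z
  set p := minpoly (Og ℂ) z
  let ι := Fin (p.natDegree + 1)
  let ψ : (ι → Og ℂ) →ₗ[Og ℂ] T :=
    { toFun := fun s => ∑ i, algebraMap _ T (s i) * z ^ (i : ℕ)
      map_add' := fun s t => by
        rw [← Finset.sum_add_distrib]
        exact Finset.sum_congr rfl fun i _ => by rw [Pi.add_apply, map_add, add_mul]
      map_smul' := fun c s => by
        rw [RingHom.id_apply, Finset.smul_sum]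
        exact Finset.sum_congr rfl fun i _ => by
          rw [Pi.smul_apply, smul_eq_mul, map_mul, Algebra.smul_def, mul_assoc] }
  have hψ : ∀ s, ψ s = ∑ i, algebraMap _ T (s i) * z ^ (i : ℕ) := fun _ => rfl
  have hDz : ∀ i : ℕ, D (z ^ i) = 0 := fun i => by
    rw [Derivation.leibniz_pow, hz, smul_zero, smul_zero]
  have hne : LinearMap.ker ψ ≠ ⊥ := by
    intro h
    have h1 : (fun i : ι => p.coeff i) ∈ LinearMap.ker ψ := by
      rw [LinearMap.mem_ker, hψ, Fin.sum_univ_eq_sum_range (fun i => algebraMap _ T (p.coeff i) * z ^ i),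
        ← minpoly.aeval (Og ℂ) z, Polynomial.aeval_eq_sum_range]
      exact Finset.sum_congr rfl fun i _ => by rw [Algebra.smul_def]
    rw [h, Submodule.mem_bot] at h1
    have h2 := congrFun h1 (Fin.last _)
    have h3 : p.coeff p.natDegree = 1 := minpoly.monic hint
    exact one_ne_zero (h3.symm.trans h2)
  obtain ⟨r, hr0, hr⟩ := exists_complex_relation (LinearMap.ker ψ) hne
    (fun s hs => by
      rw [LinearMap.mem_ker, hψ] at hs ⊢
      refine hδ _ ?_
      have h1 := congrArg D hs
      rw [map_zero, map_sum] at h1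
      rw [← h1, Finset.mul_sum]
      exact Finset.sum_congr rfl fun i _ => by
        rw [Derivation.leibniz, hDz, hD, smul_zero, zero_add, smul_eq_mul]; ring)
    (fun c s hc hs => htf c _ hc (by rw [← map_smul]; exact hs))
  obtain ⟨c, hc⟩ := hres z
  let q : Polynomial ℂ := ∑ i : ι, Polynomial.C (r i) * Polynomial.X ^ (i : ℕ)
  have hq0 : q ≠ 0 := by
    intro h
    refine hr0 (funext fun i => ?_)
    have h1 := congrArg (fun q => Polynomial.coeff q i) h
    simp only [q, Polynomial.finsetSum_coeff, Polynomial.coeff_C_mul, Polynomial.coeff_X_pow,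
      Polynomial.coeff_zero, mul_ite, mul_one, mul_zero] at h1
    rw [Finset.sum_eq_single i (fun j _ hj => if_neg fun h => hj (Fin.ext h.symm))
      (fun h => absurd (Finset.mem_univ i) h), if_pos rfl] at h1
    exact h1
  have hqz : Polynomial.aeval z q = 0 := by
    rw [LinearMap.mem_ker, hψ] at hr
    rw [← hr, map_sum]
    refine Finset.sum_congr rfl fun i _ => ?_
    rw [map_mul, Polynomial.aeval_C, map_pow, Polynomial.aeval_X,
      ← IsScalarTower.algebraMap_apply]
  obtain ⟨q₁, h1, h2⟩ := Polynomial.exists_eq_pow_rootMultiplicity_mul_and_not_dvd q hq0 c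
  have hunit : IsUnit (Polynomial.aeval z q₁) := by
    rw [Polynomial.dvd_iff_isRoot, Polynomial.IsRoot] at h2
    obtain ⟨q₂, hq₂⟩ := Polynomial.X_sub_C_dvd_sub_C_eval (a := c) (p := q₁)
    have h3 := congrArg (Polynomial.aeval z) hq₂
    rw [map_sub, map_mul, map_sub, Polynomial.aeval_X, Polynomial.aeval_C,
      Polynomial.aeval_C, sub_eq_iff_eq_add] at h3
    rw [h3]
    by_contra h4
    have h5 := sub_mem ((IsLocalRing.mem_maximalIdeal _).2 h4) (Ideal.mul_mem_right
      (Polynomial.aeval z q₂) _ hc)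
    rw [add_sub_cancel_left] at h5
    exact (IsLocalRing.mem_maximalIdeal _).1 h5 ((isUnit_iff_ne_zero.2 h2).map _)
  rw [h1, map_mul, map_pow, map_sub, Polynomial.aeval_X, Polynomial.aeval_C,
    hunit.mul_left_eq_zero] at hqz
  exact ⟨c, sub_eq_zero.1 (IsReduced.eq_zero _ ⟨_, hqz⟩)⟩


section Poisson

variable {n : ℕ}

/-- The coordinate directions of the phase space, as directions of the total space. -/
noncomputable def sdir (a : Fin n ⊕ Fin n) : ℂ × PhaseC n := (0, phaseDir a)

/-- The coordinates of the phase space, as linear forms on the total space. -/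
noncomputable def scoord : Fin n ⊕ Fin n → ((ℂ × PhaseC n) →L[ℂ] ℂ) :=
  Sum.elim
    (fun i => (ContinuousLinearMap.proj (R := ℂ) (φ := fun _ : Fin n => ℂ) i).comp
      ((ContinuousLinearMap.fst ℂ _ _).comp (ContinuousLinearMap.snd ℂ ℂ (PhaseC n))))
    (fun i => (ContinuousLinearMap.proj (R := ℂ) (φ := fun _ : Fin n => ℂ) i).comp
      ((ContinuousLinearMap.snd ℂ _ _).comp (ContinuousLinearMap.snd ℂ ℂ (PhaseC n))))

lemma sum_scoord (x : ℂ × PhaseC n) : x.1 • ((1, 0) : ℂ × PhaseC n) +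
    ∑ a, scoord a x • sdir a = x := by
  rw [Fintype.sum_sum_type]
  have h1 : ∑ i, scoord (Sum.inl i) x • sdir (n := n) (Sum.inl i) = (0, (x.2.1, 0)) := by
    simp only [scoord, sdir, phaseDir, Sum.elim_inl, qdir]
    refine Prod.ext ?_ (Prod.ext ?_ ?_)
    · simp [Prod.fst_sum]
    · ext j
      simp [Prod.snd_sum, Prod.fst_sum, Pi.single_apply]
    · simp [Prod.snd_sum]
  have h2 : ∑ i, scoord (Sum.inr i) x • sdir (n := n) (Sum.inr i) = (0, (0, x.2.2)) := by
    simp only [scoord, sdir, phaseDir, Sum.elim_inr, pdir]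
    refine Prod.ext ?_ (Prod.ext ?_ ?_)
    · simp [Prod.fst_sum]
    · simp [Prod.snd_sum, Prod.fst_sum]
    · ext j
      simp [Prod.snd_sum, Pi.single_apply]
  rw [h1, h2]
  refine Prod.ext ?_ (Prod.ext ?_ ?_) <;> simp

/-- The parameter. -/
noncomputable def param (n : ℕ) : Og (ℂ × PhaseC n) := lin (ContinuousLinearMap.fst ℂ ℂ (PhaseC n))

/-- The chain rule in the coordinates of the total space. -/
lemma der_eq_sum_coord {M : Type*} [AddCommGroup M] [Module (Og (ℂ × PhaseC n)) M]
    (hsep : ∀ c : M, (∀ k : ℕ, c ∈ IsLocalRing.maximalIdeal (Og (ℂ × PhaseC n)) ^ k •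
      (⊤ : Submodule (Og (ℂ × PhaseC n)) M)) → c = 0)
    (θ : Og (ℂ × PhaseC n) →+ M) (hmul : ∀ a b, θ (a * b) = a • θ b + b • θ a)
    (hc : ∀ c : ℂ, θ (algebraMap ℂ _ c) = 0) (f : Og (ℂ × PhaseC n)) :
    θ f = der ((1, 0) : ℂ × PhaseC n) f • θ (param n) + ∑ a, der (sdir a) f • θ (lin (scoord a)) := by
  rw [der_eq_sum_smul hsep θ hmul hc
    (fun o : Option (Fin n ⊕ Fin n) => o.elim ((1, 0) : ℂ × PhaseC n) sdir)
    (fun o => o.elim (ContinuousLinearMap.fst ℂ ℂ (PhaseC n)) scoord) (fun x => ?_) f,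
    Fintype.sum_option]
  · rfl
  · rw [Fintype.sum_option]
    exact sum_scoord x

/-- The Hamiltonian derivation `{·, g}`. -/
noncomputable def ham (g : Og (ℂ × PhaseC n)) :
    Derivation ℂ (Og (ℂ × PhaseC n)) (Og (ℂ × PhaseC n)) :=
  ∑ i : Fin n, (der (0, pdir i) g • der (0, qdir i) - der (0, qdir i) g • der (0, pdir i))

lemma poisP_eq (g h : Og (ℂ × PhaseC n)) : poisP g h = ∑ i,
    (der (0, qdir i) g * der (0, pdir i) h - der (0, pdir i) g * der (0, qdir i) h) := rfl

lemma ham_apply (g h : Og (ℂ × PhaseC n)) : ham g h = poisP h g := by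
  rw [poisP_eq]
  change Derivation.coeFnAddMonoidHom (ham g) h = _
  rw [ham, map_sum, Finset.sum_apply]
  refine Finset.sum_congr rfl fun i _ => ?_
  change der (0, pdir i) g * der (0, qdir i) h - der (0, qdir i) g * der (0, pdir i) h = _
  ring

lemma poisP_skew (g h : Og (ℂ × PhaseC n)) : poisP g h = -poisP h g := by
  rw [poisP_eq, poisP_eq, ← Finset.sum_neg_distrib]
  exact Finset.sum_congr rfl fun i _ => by ring

lemma der_poisP (u : ℂ × PhaseC n) (g h : Og (ℂ × PhaseC n)) :
    der u (poisP g h) = poisP (der u g) h + poisP g (der u h) := by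
  simp only [poisP_eq, map_sum]
  rw [← Finset.sum_add_distrib]
  refine Finset.sum_congr rfl fun i _ => ?_
  simp only [map_sub, Derivation.leibniz, smul_eq_mul, der_comm u]
  ring

lemma ham_lin (g : Og (ℂ × PhaseC n)) (l : (ℂ × PhaseC n) →L[ℂ] ℂ) :
    ham g (lin l) = ∑ i : Fin n, (l (0, qdir i) • der (0, pdir i) g -
      l (0, pdir i) • der (0, qdir i) g) := by
  rw [ham_apply, poisP_eq]
  refine Finset.sum_congr rfl fun i _ => ?_
  rw [der_lin, der_lin, Algebra.smul_def, Algebra.smul_def]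

lemma ham_lin_eq_der (l : (ℂ × PhaseC n) →L[ℂ] ℂ) :
    ∃ u : ℂ × PhaseC n, ∀ g, ham g (lin l) = der u g := by
  refine ⟨∑ i : Fin n, (l (0, qdir i) • (0, pdir i) + (-l (0, pdir i)) • (0, qdir i)),
    fun g => ?_⟩
  rw [ham_lin]
  have h : ∀ (s : Finset (Fin n)) (v : Fin n → ℂ × PhaseC n),
      der (∑ i ∈ s, v i) g = ∑ i ∈ s, der (v i) g := by
    intro s v
    induction s using Finset.induction_on with
    | empty => simp
    | insert a s ha ih => rw [Finset.sum_insert ha, Finset.sum_insert ha, der_add_dir, ih]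
  rw [h]
  refine Finset.sum_congr rfl fun i _ => ?_
  rw [der_add_dir, der_smul_dir, der_smul_dir, neg_smul, sub_eq_add_neg]

lemma separated_self (c : Og (ℂ × PhaseC n)) (h : ∀ k : ℕ,
    c ∈ IsLocalRing.maximalIdeal (Og (ℂ × PhaseC n)) ^ k •
      (⊤ : Submodule (Og (ℂ × PhaseC n)) (Og (ℂ × PhaseC n)))) : c = 0 := by
  have h1 := Ideal.iInf_pow_smul_eq_bot_of_isLocalRing (M := Og (ℂ × PhaseC n))
    (IsLocalRing.maximalIdeal (Og (ℂ × PhaseC n))) (IsLocalRing.maximalIdeal.isMaximal _).ne_top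
  exact (Submodule.mem_bot (Og (ℂ × PhaseC n))).1 (h1 ▸ Submodule.mem_iInf _ |>.2 h)

/-- The Hamiltonian derivations of commuting functions commute. -/
lemma ham_comm {f g : Og (ℂ × PhaseC n)} (hfg : poisP f g = 0) (z : Og (ℂ × PhaseC n)) :
    ham f (ham g z) = ham g (ham f z) := by
  have h := der_eq_zero separated_self (⁅ham f, ham g⁆ : Derivation ℂ _ _).toLinearMap.toAddMonoidHom
    (fun a b => Derivation.leibniz (⁅ham f, ham g⁆ : Derivation ℂ _ _) a b) (fun c => Derivation.map_algebraMap (⁅ham f, ham g⁆ : Derivation ℂ _ _) c) (fun l => ?_) z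
  · change ⁅ham f, ham g⁆ z = 0 at h
    rwa [Derivation.commutator_apply, sub_eq_zero] at h
  · change ⁅ham f, ham g⁆ (lin l) = 0
    obtain ⟨u, hu⟩ := ham_lin_eq_der l
    rw [Derivation.commutator_apply, hu, hu, ham_apply, ham_apply, poisP_skew (der u f) g,
      sub_neg_eq_add, ← der_poisP, poisP_skew, hfg, neg_zero, map_zero]

end Poisson

end Og

section Symplectic

open Matrix

lemma sq_det_smul_eq_zero {R M ι : Type*} [CommRing R] [AddCommGroup M] [Module R M] [Fintype ι]
    [DecidableEq ι] (A B C D : Matrix ι ι R) (h : A * Bᵀ = B * Aᵀ) (u : ι ⊕ ι → M)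
    (h1 : ∀ i, ∑ j, A i j • u (Sum.inl j) + ∑ j, B i j • u (Sum.inr j) = 0)
    (h2 : ∀ i, ∑ j, C i j • u (Sum.inl j) + ∑ j, D i j • u (Sum.inr j) = 0) (a : ι ⊕ ι) :
    (B * Cᵀ - A * Dᵀ).det ^ 2 • u a = 0 := by
  set J := fromBlocks A B C D with hJ
  set K := fromBlocks Dᵀ Bᵀ (-Cᵀ) (-Aᵀ) with hK
  have hdet : J.det * K.det = (-1) ^ Fintype.card ι * (B * Cᵀ - A * Dᵀ).det ^ 2 := by
    rw [← det_mul, hJ, hK, fromBlocks_multiply]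
    have e1 : A * Bᵀ + B * -Aᵀ = 0 := by rw [h, mul_neg, add_neg_cancel]
    have e2 : A * Dᵀ + B * -Cᵀ = -(B * Cᵀ - A * Dᵀ) := by rw [mul_neg]; abel
    have e3 : C * Bᵀ + D * -Aᵀ = (B * Cᵀ - A * Dᵀ)ᵀ := by
      rw [transpose_sub, transpose_mul, transpose_mul, transpose_transpose, transpose_transpose,
        mul_neg, sub_eq_add_neg]
    rw [e1, e2, e3, det_fromBlocks_zero₁₂, det_transpose, det_neg]
    ring
  have hJu : ∀ r, ∑ b, J r b • u b = 0 := by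
    rintro (i | i)
    · rw [Fintype.sum_sum_type]
      exact h1 i
    · rw [Fintype.sum_sum_type]
      exact h2 i
  have hu : J.det • u a = 0 := by
    have : ∑ r, J.adjugate a r • ∑ b, J r b • u b = J.det • u a := by
      simp_rw [Finset.smul_sum, smul_smul]
      rw [Finset.sum_comm]
      simp_rw [← Finset.sum_smul]
      have : ∀ b, ∑ r, J.adjugate a r * J r b = if a = b then J.det else 0 := by
        intro b
        have := congrFun (congrFun (adjugate_mul J) a) b
        rw [mul_apply, Matrix.smul_apply, one_apply, smul_eq_mul, mul_ite, mul_one, mul_zero] at this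
        exact this
      simp_rw [this, ite_smul, zero_smul]
      rw [Finset.sum_ite_eq Finset.univ a, if_pos (Finset.mem_univ a)]
    rw [← this]
    exact Finset.sum_eq_zero fun r _ => by rw [hJu, smul_zero]
  have h3 : (B * Cᵀ - A * Dᵀ).det ^ 2 = ((-1) ^ Fintype.card ι * K.det) * J.det := by
    have : ((-1 : R) ^ Fintype.card ι) * (-1) ^ Fintype.card ι = 1 := by
      rw [← mul_pow, neg_one_mul, neg_neg, one_pow]
    linear_combination (-(-1) ^ Fintype.card ι) * hdet - (B * Cᵀ - A * Dᵀ).det ^ 2 * this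
  rw [h3, mul_smul, hu, smul_zero]

end Symplectic

namespace Og

variable {n : ℕ}

/-- The square of the determinant of the brackets kills every differential killing the
parameter and both families. -/
lemma sq_det_ham_smul_eq_zero {M : Type*} [AddCommGroup M] [Module (Og (ℂ × PhaseC n)) M]
    (hsep : ∀ c : M, (∀ k : ℕ, c ∈ IsLocalRing.maximalIdeal (Og (ℂ × PhaseC n)) ^ k •
      (⊤ : Submodule (Og (ℂ × PhaseC n)) M)) → c = 0)
    (θ : Og (ℂ × PhaseC n) →+ M) (hmul : ∀ a b, θ (a * b) = a • θ b + b • θ a)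
    (hc : ∀ c : ℂ, θ (algebraMap ℂ _ c) = 0) (ht : θ (param n) = 0)
    {F x : Fin n → Og (ℂ × PhaseC n)} (hF : ∀ i j, poisP (F i) (F j) = 0)
    (hθF : ∀ i, θ (F i) = 0) (hθx : ∀ i, θ (x i) = 0) (z : Og (ℂ × PhaseC n)) :
    (Matrix.of fun j i => ham (F j) (x i)).det ^ 2 • θ z = 0 := by
  have hch : ∀ f, θ f = ∑ i, der (0, qdir i) f • θ (lin (scoord (Sum.inl i))) +
      ∑ i, der (0, pdir i) f • θ (lin (scoord (Sum.inr i))) := fun f => by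
    rw [der_eq_sum_coord hsep θ hmul hc f, ht, smul_zero, zero_add, Fintype.sum_sum_type]
    rfl
  have key := sq_det_smul_eq_zero
    (Matrix.of fun j i => der (0, qdir i) (F j)) (Matrix.of fun j i => der (0, pdir i) (F j))
    (Matrix.of fun j i => der (0, qdir i) (x j)) (Matrix.of fun j i => der (0, pdir i) (x j))
    (by
      refine Matrix.ext fun i j => ?_
      rw [Matrix.mul_apply, Matrix.mul_apply, ← sub_eq_zero, ← Finset.sum_sub_distrib]
      exact hF i j)
    (fun a => θ (lin (scoord a))) (fun i => (hch (F i)).symm.trans (hθF i))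
    (fun i => (hch (x i)).symm.trans (hθx i))
  have hQ : (Matrix.of fun j i => ham (F j) (x i)) =
      (Matrix.of fun j i => der (0, pdir i) (F j)) *
        (Matrix.of fun j i => der (0, qdir i) (x j)).transpose -
      (Matrix.of fun j i => der (0, qdir i) (F j)) *
        (Matrix.of fun j i => der (0, pdir i) (x j)).transpose := by
    refine Matrix.ext fun j i => ?_
    rw [Matrix.sub_apply, Matrix.mul_apply, Matrix.mul_apply, ← Finset.sum_sub_distrib,
      Matrix.of_apply, ham_apply, poisP_eq]
    refine Finset.sum_congr rfl fun l _ => ?_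
    simp only [Matrix.of_apply, Matrix.transpose_apply]
    ring
  rw [hQ, hch z, smul_add, Finset.smul_sum, Finset.smul_sum]
  rw [Finset.sum_eq_zero, Finset.sum_eq_zero, add_zero]
  · intro i _
    rw [smul_comm]
    exact (congrArg _ (key (Sum.inr i))).trans (smul_zero _)
  · intro i _
    rw [smul_comm]
    exact (congrArg _ (key (Sum.inl i))).trans (smul_zero _)

end Og

lemma isReduced_of_forall_derivation {R S T : Type u} [CommRing R] [IsLocalRing R]
    [IsNoetherianRing R] [CommRing S] [IsDomain S] [CommRing T] [Algebra S T] [Module.Finite S T]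
    (f : R →+* T) (hf : Function.Surjective f)
    (htf : ∀ (s : S) (z : T), s ≠ 0 → s • z = 0 → z = 0) (d : R)
    (hd : ∀ z, f d * z = 0 → z = 0)
    (h : ∀ (M : Type u) [AddCommGroup M] [Module R M],
      (∀ c : M, (∀ k : ℕ, c ∈ IsLocalRing.maximalIdeal R ^ k • (⊤ : Submodule R M)) → c = 0) →
      ∀ θ : R →+ M, (∀ a b, θ (a * b) = a • θ b + b • θ a) →
        (∀ r, f r ∈ (algebraMap S T).range → θ r = 0) → ∀ z, d • θ z = 0) : IsReduced T := by
  refine isReduced_of_kaehler htf (f d) hd fun z => ?_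
  let _ : Module R (KaehlerDifferential S T) := Module.compHom _ f
  have hsm : ∀ (r : R) (w : KaehlerDifferential S T), r • w = f r • w := fun _ _ => rfl
  have hfin : Module.Finite R (KaehlerDifferential S T) := by
    obtain ⟨s, hs⟩ := (inferInstance : Module.Finite T (KaehlerDifferential S T)).fg_top
    refine ⟨⟨s, top_le_iff.1 fun w _ => ?_⟩⟩
    have hw : w ∈ Submodule.span T (s : Set (KaehlerDifferential S T)) := hs ▸ Submodule.mem_top
    induction hw using Submodule.span_induction with
    | mem x hx => exact Submodule.subset_span hx
    | zero => exact zero_mem _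
    | add x y _ _ hx hy => exact add_mem (hx trivial) (hy trivial)
    | smul a x _ hx =>
      obtain ⟨r, rfl⟩ := hf a
      exact (Submodule.span R _).smul_mem r (hx trivial)
  obtain ⟨z, rfl⟩ := hf z
  refine h (KaehlerDifferential S T) (fun c hc => ?_)
    ((KaehlerDifferential.D S T).toLinearMap.toAddMonoidHom.comp f.toAddMonoidHom)
    (fun a b => ?_) (fun r hr => ?_) z
  · have h1 := Ideal.iInf_pow_smul_eq_bot_of_isLocalRing (M := KaehlerDifferential S T)
      (IsLocalRing.maximalIdeal R) (IsLocalRing.maximalIdeal.isMaximal _).ne_top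
    exact (Submodule.mem_bot R).1 (h1 ▸ Submodule.mem_iInf _ |>.2 hc)
  · change KaehlerDifferential.D S T (f (a * b)) = f a • _ + f b • _
    rw [map_mul, Derivation.leibniz]
    rfl
  · obtain ⟨s, hs⟩ := hr
    change KaehlerDifferential.D S T (f r) = 0
    rw [← hs, Derivation.map_algebraMap]

namespace Og

lemma eq_zero_of_smul_of_lin {T : Type*} [CommRing T] [Algebra (Og ℂ) T]
    (h : ∀ z : T, algebraMap (Og ℂ) T (lin (ContinuousLinearMap.id ℂ ℂ)) * z = 0 → z = 0)
    (s : Og ℂ) (z : T) (hs : s ≠ 0) (hz : s • z = 0) : z = 0 := by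
  obtain ⟨k, u, hu, rfl⟩ := exists_eq_pow_mul hs
  rw [Algebra.smul_def, map_mul, mul_comm (algebraMap _ _ _), mul_assoc] at hz
  have h1 := (hu.map (algebraMap (Og ℂ) T)).mul_right_eq_zero.1 hz
  clear hz hs
  induction k with
  | zero => simpa using h1
  | succ k ih =>
    refine ih (h _ ?_)
    rw [← mul_assoc, ← map_mul, ← pow_succ']
    exact h1

variable {n k : ℕ}

lemma ham_param (g : Og (ℂ × PhaseC n)) : ham g (param n) = 0 := by
  rw [param, ham_lin]
  simp

/-- On the curve where the parameter and all but one of the coordinates vanish, the functions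
killed by the contracted Hamiltonian derivation are constant. -/
theorem exists_const_of_frameD_mem {F : Fin (k + 1) → Og (ℂ × PhaseC (k + 1))}
    (hF : ∀ i j, poisP (F i) (F j) = 0) (l : Fin (k + 1) → (ℂ × PhaseC (k + 1)) →L[ℂ] ℂ)
    (I : Ideal (Og (ℂ × PhaseC (k + 1))))
    (hIm : I ≤ IsLocalRing.maximalIdeal (Og (ℂ × PhaseC (k + 1))))
    (ht : param (k + 1) ∈ I) (hFI : ∀ j, F j ∈ I) (hlI : ∀ i : Fin k, lin (l i.succ) ∈ I)
    (hDI : ∀ z ∈ I, frameD (fun j => ham (F j)) (fun i => lin (l i)) 0 z ∈ I)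
    (hprim : Prim (I ⊔ Ideal.span {lin (l 0)}))
    (hreg : ∀ z, lin (l 0) * z ∈ I → z ∈ I)
    (hδ : ∀ z, (frameMat (fun j => ham (F j)) (fun i => lin (l i))).det * z ∈ I → z ∈ I)
    {z : Og (ℂ × PhaseC (k + 1))}
    (hz : frameD (fun j => ham (F j)) (fun i => lin (l i)) 0 z ∈ I) :
    ∃ c : ℂ, z - algebraMap ℂ _ c ∈ I := by
  set D := frameD (fun j => ham (F j)) (fun i => lin (l i)) 0 with hDdef
  set δ := (frameMat (fun j => ham (F j)) (fun i => lin (l i))).det with hδdef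
  have hI1 : I ≠ ⊤ := fun h => (IsLocalRing.maximalIdeal.isMaximal _).ne_top
    (top_le_iff.1 (h ▸ hIm))
  have hl0 : l 0 ≠ 0 := fun h => hI1 ((Ideal.eq_top_iff_one I).2 (hreg 1 (by
    rw [mul_one, h, show lin (0 : (ℂ × PhaseC (k + 1)) →L[ℂ] ℂ) = 0 from
      (linHom (ℂ × PhaseC (k + 1))).map_zero]
    exact zero_mem _)))
  have hsurj : Function.Surjective (l 0) := LinearMap.surjective (f := (l 0).toLinearMap)
    (fun h => hl0 (ContinuousLinearMap.coe_injective h))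
  have hpl : pl (l 0) (lin (ContinuousLinearMap.id ℂ ℂ)) = lin (l 0) := by
    rw [pl_lin, ContinuousLinearMap.id_comp]
  obtain ⟨T, _, _, q, hqs, hq0⟩ : ∃ (T : Type) (_ : CommRing T) (_ : Algebra ℂ T)
      (q : Og (ℂ × PhaseC (k + 1)) →ₐ[ℂ] T), Function.Surjective q ∧ ∀ z, q z = 0 ↔ z ∈ I :=
    ⟨_ ⧸ I, inferInstance, inferInstance, Ideal.Quotient.mkₐ ℂ I, Ideal.Quotient.mk_surjective,
      fun z => Ideal.Quotient.eq_zero_iff_mem⟩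
  have hfin := finite_proj (l 0) hsurj I (hprim.trans (Ideal.radical_mono
    (sup_le_sup_left ((Ideal.span_singleton_le_iff_mem _).2 (hpl ▸ Ideal.mem_map_of_mem _
      (mem_max.2 (ev_lin _)))) _)))
  let _ : Algebra (Og ℂ) T := (q.toRingHom.comp (pl (l 0)).toRingHom).toAlgebra
  have hal : ∀ s, algebraMap (Og ℂ) T s = q (pl (l 0) s) := fun _ => rfl
  have hfin' : Module.Finite (Og ℂ) T := by
    let r : (_ ⧸ I) →+* T := Ideal.Quotient.lift I q.toRingHom fun z hz => (hq0 z).2 hz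
    exact RingHom.Finite.comp (g := r) (RingHom.Finite.of_surjective r fun z => by
      obtain ⟨z, rfl⟩ := hqs z
      exact ⟨Ideal.Quotient.mk I z, rfl⟩) hfin
  have hnt : Nontrivial T := ⟨q 1, 0, fun h => hI1 ((Ideal.eq_top_iff_one I).2 ((hq0 1).1 h))⟩
  have hloc : IsLocalRing T := IsLocalRing.of_surjective' q.toRingHom hqs
  have htow : IsScalarTower ℂ (Og ℂ) T := IsScalarTower.of_algebraMap_eq fun c => by
    rw [hal, AlgHom.commutes, AlgHom.commutes]
  have htf : ∀ (s : Og ℂ) (z : T), s ≠ 0 → s • z = 0 → z = 0 :=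
    eq_zero_of_smul_of_lin fun z h => by
      obtain ⟨z, rfl⟩ := hqs z
      rw [hal, hpl, ← map_mul] at h
      exact (hq0 z).2 (hreg z ((hq0 _).1 h))
  have hδT : ∀ z, q δ * z = 0 → z = 0 := fun z h => by
    obtain ⟨z, rfl⟩ := hqs z
    rw [← map_mul] at h
    exact (hq0 z).2 (hδ z ((hq0 _).1 h))
  have hred : IsReduced T := by
    refine isReduced_of_forall_derivation (S := Og ℂ) q.toRingHom hqs htf (δ ^ 2)
      (fun z h => hδT z (hδT (q δ * z) ?_)) fun M _ _ hsep θ hmul hr z => ?_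
    · rw [← mul_assoc, ← pow_two, ← map_pow]
      exact h
    · have h0 : ∀ r ∈ I, θ r = 0 := fun r h => hr r ⟨0, (map_zero _).trans ((hq0 r).2 h).symm⟩
      refine sq_det_ham_smul_eq_zero hsep θ hmul (fun c => hr _ ⟨algebraMap ℂ _ c, ?_⟩)
        (h0 _ ht) (x := fun i => lin (l i)) hF (fun i => h0 _ (hFI i)) (fun i => ?_) z
      · rw [hal, AlgHom.commutes]
        rfl
      · refine Fin.cases (hr _ ⟨lin (ContinuousLinearMap.id ℂ ℂ), ?_⟩) (fun i => h0 _ (hlI i)) i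
        rw [hal, hpl]
        rfl
  let D' : Derivation ℂ T T := Derivation.liftOfSurjective (f := q) hqs (d := D) fun z h =>
    (hq0 _).2 (hDI z ((hq0 z).1 h))
  have hD' : ∀ z, D' (q z) = q (D z) := fun z => Derivation.liftOfSurjective_apply hqs _ z
  have hlpl : IsLocalHom (pl (l 0)).toRingHom := ⟨fun a h => (isLocalHom_pl (l 0)).map_nonunit a h⟩
  have hDpl : ∀ s, D (pl (l 0) s) = δ * pl (l 0) (der (1 : ℂ) s) := fun s => by
    have h := der_eq_sum (pl (l 0)).toRingHom (separated_of_isLocalRing (pl (l 0)).toRingHom)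
      (D.toLinearMap.toAddMonoidHom.comp (pl (l 0)).toRingHom.toAddMonoidHom)
      (fun a b => by
        change D (pl (l 0) (a * b)) = pl (l 0) a * D _ + pl (l 0) b * D _
        rw [map_mul, Derivation.leibniz]
        rfl)
      (fun c => by
        change D (pl (l 0) (algebraMap ℂ _ c)) = 0
        rw [AlgHom.commutes, Derivation.map_algebraMap])
      (fun _ : Unit => (1 : ℂ)) (fun _ => ContinuousLinearMap.id ℂ ℂ) (fun x => by simp) s
    refine h.trans ?_
    rw [Fintype.sum_unique]
    change pl (l 0) (der (1 : ℂ) s) * D (pl (l 0) (lin (ContinuousLinearMap.id ℂ ℂ))) = _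
    rw [hpl, hDdef, frameD_coord (fun j => ham (F j)) (fun i => lin (l i)) 0 0, if_pos rfl, mul_comm]
  have hlq : IsLocalHom q.toRingHom := IsLocalHom.of_surjective _ hqs
  obtain ⟨c, hc⟩ := exists_const_of_derivation_eq_zero (T := T) htf (fun z => by
      obtain ⟨z, rfl⟩ := hqs z
      refine ⟨ev _ z, ?_⟩
      have h1 : z - algebraMap ℂ _ (ev _ z) ∈
          IsLocalRing.maximalIdeal (Og (ℂ × PhaseC (k + 1))) := by
        rw [mem_max, map_sub, ev_algebraMap, sub_self]
      have h2 := map_maximalIdeal_le (C := T) q.toRingHom (Ideal.mem_map_of_mem _ h1)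
      change q _ ∈ _ at h2
      rwa [map_sub, AlgHom.commutes] at h2)
    D' (q δ) hδT (fun s => by rw [hal, hD', hDpl, map_mul, hal]) (z := q z) (by
      rw [hD']
      exact (hq0 _).2 hz)
  refine ⟨c, (hq0 _).1 ?_⟩
  rw [map_sub, hc, AlgHom.commutes, sub_self]


/-- A generating system of the right length of an ideal of definition is a regular sequence. -/
lemma mem_of_mul_mem_of_prim [FiniteDimensional ℂ E] {a b : ℕ} {F : Fin a → Og E} {g : ℕ → Og E}
    {w : Og E} (hF : ∀ i, F i ∈ IsLocalRing.maximalIdeal (Og E))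
    (hg : ∀ i, g i ∈ IsLocalRing.maximalIdeal (Og E)) (hw : w ∈ IsLocalRing.maximalIdeal (Og E))
    (hN : a + b + 1 = Module.finrank ℂ E)
    (hP : Prim (Ideal.span (Set.range F) ⊔ Ideal.span (g '' Set.Iio b) ⊔ Ideal.span {w})) :
    (∀ j < b, ∀ z, g j * z ∈ Ideal.span (Set.range F) ⊔ Ideal.span (g '' Set.Iio j) →
      z ∈ Ideal.span (Set.range F) ⊔ Ideal.span (g '' Set.Iio j)) ∧
    ∀ j ≤ b, ∀ z, w * z ∈ Ideal.span (Set.range F) ⊔ Ideal.span (g '' Set.Iio j) →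
      z ∈ Ideal.span (Set.range F) ⊔ Ideal.span (g '' Set.Iio j) := by
  let f : Fin a ⊕ (Fin b ⊕ Unit) → Og E := Sum.elim F (Sum.elim (fun i => g i) fun _ => w)
  let S : ℕ → Finset (Fin a ⊕ (Fin b ⊕ Unit)) := fun j =>
    Finset.univ.disjSum ((Finset.univ.filter fun i : Fin b => (i : ℕ) < j).disjSum ∅)
  have hS : ∀ j ≤ b, f '' (S j : Set (Fin a ⊕ (Fin b ⊕ Unit))) =
      Set.range F ∪ g '' Set.Iio j := by
    intro j hj
    ext z
    constructor
    · rintro ⟨i | i | i, hi, rfl⟩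
      · exact Or.inl ⟨i, rfl⟩
      · refine Or.inr ⟨i, ?_, rfl⟩
        simpa [S] using hi
      · simp [S] at hi
    · rintro (⟨i, rfl⟩ | ⟨i, hi, rfl⟩)
      · exact ⟨Sum.inl i, by simp [S], rfl⟩
      · exact ⟨Sum.inr (Sum.inl ⟨i, lt_of_lt_of_le hi hj⟩), by simpa [S] using hi, rfl⟩
  have hfm : ∀ i, f i ∈ IsLocalRing.maximalIdeal (Og E) := by
    rintro (i | i | i)
    · exact hF i
    · exact hg i
    · exact hw
  have hcard : Fintype.card (Fin a ⊕ (Fin b ⊕ Unit)) = Module.finrank ℂ E := by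
    rw [← hN]
    simp [add_assoc]
  have hPf : Prim (Ideal.span (Set.range f)) := by
    refine hP.mono ?_
    refine sup_le (sup_le (Ideal.span_mono ?_) (Ideal.span_mono ?_)) (Ideal.span_mono ?_)
    · rintro _ ⟨i, rfl⟩
      exact ⟨Sum.inl i, rfl⟩
    · rintro _ ⟨i, hi, rfl⟩
      exact ⟨Sum.inr (Sum.inl ⟨i, hi⟩), rfl⟩
    · rintro _ rfl
      exact ⟨Sum.inr (Sum.inr ()), rfl⟩
  refine ⟨fun j hj z hz => ?_, fun j hj z hz => ?_⟩
  · rw [← Ideal.span_union, ← hS j hj.le] at hz ⊢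
    refine mem_span_of_mul_mem_span hfm hcard hPf (S j) (i := Sum.inr (Sum.inl ⟨j, hj⟩))
      (by simp [S]) ?_
    rw [mul_comm]
    exact hz
  · rw [← Ideal.span_union, ← hS j hj] at hz ⊢
    refine mem_span_of_mul_mem_span hfm hcard hPf (S j) (i := Sum.inr (Sum.inr ()))
      (by simp [S]) ?_
    rw [mul_comm]
    exact hz

variable {n k : ℕ}

/-- The space of the parameter and of all the base coordinates but the last one. -/
abbrev BaseC (k : ℕ) := ℂ × (Fin k → ℂ)

/-- The coordinate directions of the base, the distinguished one first. -/
noncomputable def edir (k : ℕ) : Fin (k + 1) → BaseC k × ℂ :=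
  Fin.cons ((0, 0), 1) fun i => ((0, Pi.single i 1), 0)

/-- The coordinates of the base, the distinguished one first. -/
noncomputable def ecoord (k : ℕ) : Fin (k + 1) → ((BaseC k × ℂ) →L[ℂ] ℂ) :=
  Fin.cons (ContinuousLinearMap.snd ℂ _ ℂ) fun i =>
    (ContinuousLinearMap.proj (R := ℂ) (φ := fun _ : Fin k => ℂ) i).comp
      ((ContinuousLinearMap.snd ℂ _ _).comp (ContinuousLinearMap.fst ℂ (BaseC k) ℂ))

/-- The parameter, as a coordinate of the base. -/
noncomputable def tcoord (k : ℕ) : (BaseC k × ℂ) →L[ℂ] ℂ :=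
  (ContinuousLinearMap.fst ℂ _ _).comp (ContinuousLinearMap.fst ℂ (BaseC k) ℂ)

lemma sum_ecoord (x : BaseC k × ℂ) : tcoord k x • (((1, 0), 0) : BaseC k × ℂ) +
    ∑ i, ecoord k i x • edir k i = x := by
  rw [Fin.sum_univ_succ]
  have h1 : ∑ i : Fin k, ecoord k i.succ x • edir k i.succ = ((0, x.1.2), 0) := by
    refine Prod.ext (Prod.ext ?_ ?_) ?_
    · simp [Prod.fst_sum, edir]
    · ext j
      simp [Prod.snd_sum, Prod.fst_sum, edir, ecoord, Pi.single_apply]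
    · simp [Prod.snd_sum, edir]
  rw [h1]
  refine Prod.ext (Prod.ext ?_ ?_) ?_ <;> simp [edir, ecoord, tcoord]

/-- The parameter and the base coordinates but the distinguished one, as a sequence. -/
noncomputable def bseq (k : ℕ) : ℕ → Og (BaseC k)
  | 0 => lin (ContinuousLinearMap.fst ℂ ℂ (Fin k → ℂ))
  | i + 1 => if h : i < k then
      lin ((ContinuousLinearMap.proj (R := ℂ) (φ := fun _ : Fin k => ℂ) ⟨i, h⟩).comp
        (ContinuousLinearMap.snd ℂ _ _)) else 0

lemma bseq_mem (i : ℕ) : bseq k i ∈ IsLocalRing.maximalIdeal (Og (BaseC k)) := by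
  rw [mem_max]
  cases i with
  | zero => exact ev_lin _
  | succ i =>
    rw [bseq]
    split_ifs
    · exact ev_lin _
    · exact map_zero _

lemma span_bseq : Ideal.span (bseq k '' Set.Iio (k + 1)) = IsLocalRing.maximalIdeal (Og (BaseC k)) := by
  refine le_antisymm (Ideal.span_le.2 ?_) ?_
  · rintro _ ⟨i, -, rfl⟩
    exact bseq_mem i
  · rw [maximalIdeal_eq_span]
    refine Ideal.span_le.2 ?_
    rintro _ ⟨l, rfl⟩
    have hl : l = l (1, 0) • ContinuousLinearMap.fst ℂ ℂ (Fin k → ℂ) +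
        ∑ i : Fin k, l (0, Pi.single i 1) •
          (ContinuousLinearMap.proj (R := ℂ) (φ := fun _ : Fin k => ℂ) i).comp
            (ContinuousLinearMap.snd ℂ ℂ (Fin k → ℂ)) := by
      ext x
      · simp
      · have hx : ((0, x) : BaseC k) = ∑ i, x i • ((0, Pi.single i 1) : BaseC k) := by
          refine Prod.ext ?_ ?_
          · simp [Prod.fst_sum]
          · ext j
            simp [Prod.snd_sum, Pi.single_apply]
        have h1 : l (0, x) = ∑ i, l (0, Pi.single i 1) * x i := by
          rw [hx, map_sum]
          exact Finset.sum_congr rfl fun i _ => by rw [map_smul, smul_eq_mul, mul_comm]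
        simpa using h1
    rw [hl, lin_add, lin_smul, lin_sum]
    refine add_mem ?_ (sum_mem fun i _ => ?_)
    · rw [Algebra.smul_def]
      exact Ideal.mul_mem_left _ _ (Ideal.subset_span ⟨0, Nat.succ_pos k, rfl⟩)
    · rw [lin_smul, Algebra.smul_def]
      refine Ideal.mul_mem_left _ _ (Ideal.subset_span ⟨i + 1, Nat.succ_lt_succ i.2, ?_⟩)
      rw [bseq, dif_pos i.2]

/-- All the coordinates of the base as a sequence, the distinguished one last. -/
noncomputable def sseq (k j : ℕ) : Og (BaseC k × ℂ) :=
  if j = k + 1 then xl (BaseC k) else up (BaseC k) (bseq k j)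

lemma sseq_mem (j : ℕ) : sseq k j ∈ IsLocalRing.maximalIdeal (Og (BaseC k × ℂ)) := by
  rw [sseq]
  split_ifs
  · exact mem_max.2 (ev_lin _)
  · rw [mem_max, up, ev_pl]
    exact mem_max.1 (bseq_mem j)

lemma sseq_image {j : ℕ} (hj : j ≤ k + 1) :
    sseq k '' Set.Iio j = up (BaseC k) '' (bseq k '' Set.Iio j) := by
  rw [Set.image_image]
  refine Set.image_congr fun i hi => ?_
  rw [sseq, if_neg]
  exact (lt_of_lt_of_le hi hj).ne

lemma span_sseq : Ideal.span (sseq k '' Set.Iio (k + 2)) =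
    IsLocalRing.maximalIdeal (Og (BaseC k × ℂ)) := by
  refine le_antisymm (Ideal.span_le.2 ?_) ?_
  · rintro _ ⟨i, -, rfl⟩
    exact sseq_mem i
  · rw [maximalIdeal_eq_span]
    refine Ideal.span_le.2 ?_
    rintro _ ⟨l, rfl⟩
    have hl : l = (l.comp (ContinuousLinearMap.inl ℂ (BaseC k) ℂ)).comp
        (ContinuousLinearMap.fst ℂ (BaseC k) ℂ) + l (0, 1) • ContinuousLinearMap.snd ℂ (BaseC k) ℂ := by
      ext x
      · simp
      · simp
      · have h0 : l (0, 0) = 0 := map_zero l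
        simpa using h0
    have h1 : lin (l.comp (ContinuousLinearMap.inl ℂ (BaseC k) ℂ)) ∈
        Ideal.span (bseq k '' Set.Iio (k + 1)) := by
      rw [span_bseq]
      exact mem_max.2 (ev_lin _)
    have h2 := Ideal.mem_map_of_mem (up (BaseC k)) h1
    rw [Ideal.map_span, ← sseq_image le_rfl] at h2
    rw [hl, lin_add, lin_smul]
    refine add_mem ?_ ?_
    · rw [← pl_lin]
      exact Ideal.span_mono (Set.image_mono (Set.Iio_subset_Iio (Nat.le_succ _))) h2
    · rw [Algebra.smul_def]
      refine Ideal.mul_mem_left _ _ (Ideal.subset_span ⟨k + 1, Nat.lt_succ_self _, ?_⟩)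
      rw [sseq, if_pos rfl]
      rfl


section Core

variable {n k : ℕ}

/-- The projection to the base given by linear coordinates on the total space. -/
noncomputable def prj (l : Fin (k + 1) → (ℂ × PhaseC n) →L[ℂ] ℂ) :
    (ℂ × PhaseC n) →L[ℂ] BaseC k × ℂ :=
  ((ContinuousLinearMap.fst ℂ ℂ (PhaseC n)).prod
    (ContinuousLinearMap.pi fun i : Fin k => l i.succ)).prod (l 0)

/-- The germ on the total space of a germ on the base. -/
noncomputable def plb (l : Fin (k + 1) → (ℂ × PhaseC n) →L[ℂ] ℂ) :
    Og (BaseC k × ℂ) →ₐ[ℂ] Og (ℂ × PhaseC n) := pl (prj l)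

lemma plb_tcoord (l : Fin (k + 1) → (ℂ × PhaseC n) →L[ℂ] ℂ) :
    plb l (lin (tcoord k)) = param n := by
  rw [plb, pl_lin]
  rfl

lemma plb_ecoord (l : Fin (k + 1) → (ℂ × PhaseC n) →L[ℂ] ℂ) (p : Fin (k + 1)) :
    plb l (lin (ecoord k p)) = lin (l p) := by
  rw [plb, pl_lin]
  congr 1
  refine Fin.cases ?_ (fun i => ?_) p <;> rfl

lemma plb_bseq_zero (l : Fin (k + 1) → (ℂ × PhaseC n) →L[ℂ] ℂ) :
    plb l (up _ (bseq k 0)) = param n := by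
  rw [bseq, up, pl_lin]
  exact plb_tcoord l

lemma plb_bseq_succ (l : Fin (k + 1) → (ℂ × PhaseC n) →L[ℂ] ℂ) (i : Fin k) :
    plb l (up _ (bseq k (i + 1))) = lin (l i.succ) := by
  rw [bseq, dif_pos i.2, up, pl_lin]
  exact plb_ecoord l i.succ

lemma plb_xl (l : Fin (k + 1) → (ℂ × PhaseC n) →L[ℂ] ℂ) : plb l (xl _) = lin (l 0) :=
  plb_ecoord l 0

/-- The fibre ideals of the base coordinates on the zero locus of `F`. -/
noncomputable def gI (F : Fin (k + 1) → Og (ℂ × PhaseC (k + 1)))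
    (l : Fin (k + 1) → (ℂ × PhaseC (k + 1)) →L[ℂ] ℂ) (j : ℕ) : Ideal (Og (ℂ × PhaseC (k + 1))) :=
  Ideal.span (Set.range F) ⊔ Ideal.span ((fun i => plb l (up _ (bseq k i))) '' Set.Iio j)

/-- Linear coordinates in sufficiently general position with respect to `F`. -/
structure IsGeneral (F : Fin (k + 1) → Og (ℂ × PhaseC (k + 1)))
    (l : Fin (k + 1) → (ℂ × PhaseC (k + 1)) →L[ℂ] ℂ) : Prop where
  comm : ∀ i j, poisP (F i) (F j) = 0
  mem : ∀ i, F i ∈ IsLocalRing.maximalIdeal (Og (ℂ × PhaseC (k + 1)))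
  prim : Prim (gI F l (k + 1) ⊔ Ideal.span {lin (l 0)})
  prim_det : Prim (gI F l (k + 1) ⊔
    Ideal.span {(frameMat (fun j => ham (F j)) (fun i => lin (l i))).det})
  minor : ∀ a : Fin k → Og (ℂ × PhaseC (k + 1)),
    (∀ j, ∑ i, ham (F j) (lin (l i.succ)) * a i ∈ Ideal.span (Set.range F) ⊔
      Ideal.span {(frameMat (fun j => ham (F j)) (fun i => lin (l i))).det}) →
    ∀ i, a i ∈ Ideal.span (Set.range F) ⊔
      Ideal.span {(frameMat (fun j => ham (F j)) (fun i => lin (l i))).det}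

variable {F : Fin (k + 1) → Og (ℂ × PhaseC (k + 1))}
  {l : Fin (k + 1) → (ℂ × PhaseC (k + 1)) →L[ℂ] ℂ}

lemma frameD_plb (p : Fin (k + 1)) (s : Og (BaseC k × ℂ)) :
    frameD (fun j => ham (F j)) (fun i => lin (l i)) p (plb l s) =
      (frameMat (fun j => ham (F j)) (fun i => lin (l i))).det * plb l (der (edir k p) s) := by
  set D := frameD (fun j => ham (F j)) (fun i => lin (l i)) p with hD
  have hloc : IsLocalHom (plb l).toRingHom :=
    ⟨fun a h => (isLocalHom_pl (prj l)).map_nonunit a h⟩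
  have h := der_eq_sum (plb l).toRingHom (separated_of_isLocalRing (plb l).toRingHom)
    (D.toLinearMap.toAddMonoidHom.comp (plb l).toRingHom.toAddMonoidHom)
    (fun a b => by
      change D (plb l (a * b)) = plb l a * D _ + plb l b * D _
      rw [map_mul, Derivation.leibniz]
      rfl)
    (fun c => by
      change D (plb l (algebraMap ℂ _ c)) = 0
      rw [AlgHom.commutes, Derivation.map_algebraMap])
    (fun o : Option (Fin (k + 1)) => o.elim (((1, 0), 0) : BaseC k × ℂ) (edir k))
    (fun o => o.elim (tcoord k) (ecoord k)) (fun x => by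
      rw [Fintype.sum_option]
      exact sum_ecoord x) s
  refine h.trans ?_
  rw [Fintype.sum_option]
  change plb l (der _ s) * D (plb l (lin (tcoord k))) +
    ∑ i, plb l (der (edir k i) s) * D (plb l (lin (ecoord k i))) = _
  have h1 : D (param (k + 1)) = 0 := by
    rw [hD, frameD_apply]
    exact Finset.sum_eq_zero fun j _ => by rw [ham_param, mul_zero]
  rw [plb_tcoord, h1, mul_zero, zero_add, Finset.sum_eq_single p]
  · rw [plb_ecoord, hD, frameD_coord (fun j => ham (F j)) (fun i => lin (l i)) p p, if_pos rfl,
      mul_comm]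
  · intro b _ hb
    rw [plb_ecoord, hD, frameD_coord (fun j => ham (F j)) (fun i => lin (l i)) p b,
      if_neg hb.symm, mul_zero]
  · exact fun h => absurd (Finset.mem_univ p) h

lemma gI_zero : gI F l 0 = Ideal.span (Set.range F) := by
  simp [gI]

lemma gI_succ (j : ℕ) : gI F l (j + 1) = gI F l j ⊔ Ideal.span {plb l (up _ (bseq k j))} := by
  have h : (fun i => plb l (up _ (bseq k i))) '' Set.Iio (j + 1) =
      (fun i => plb l (up _ (bseq k i))) '' Set.Iio j ∪ {plb l (up _ (bseq k j))} := by
    rw [← Set.image_singleton (f := fun i => plb l (up _ (bseq k i))), ← Set.image_union]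
    congr 1
    ext i
    simp
  rw [gI, gI, h, Ideal.span_union, sup_assoc]

lemma gI_mono : Monotone (gI F l) := fun _ _ h =>
  sup_le_sup_left (Ideal.span_mono (Set.image_mono (Set.Iio_subset_Iio h))) _

lemma mem_gI (i : Fin (k + 1)) (j : ℕ) : F i ∈ gI F l j :=
  Ideal.mem_sup_left (Ideal.subset_span ⟨i, rfl⟩)

lemma dl_up_eq (a : Og (BaseC k)) : der (edir k 0) (up (BaseC k) a) = 0 := dl_up a

lemma derivation_mem_span {R : Type*} [CommRing R] [Algebra ℂ R] (D : Derivation ℂ R R) {s : Set R}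
    {I : Ideal R} (hs : s ⊆ I) (h : ∀ z ∈ s, D z ∈ I) {z : R} (hz : z ∈ Ideal.span s) :
    D z ∈ I := by
  induction hz using Submodule.span_induction with
  | mem x hx => exact h x hx
  | zero => simp
  | add x y _ _ hx hy => rw [map_add]; exact add_mem hx hy
  | smul a x hx ih =>
    rw [smul_eq_mul, Derivation.leibniz]
    exact add_mem (I.mul_mem_left a ih) (I.mul_mem_right _ (Ideal.span_le.2 hs hx))

lemma ham_mem (hF : ∀ i j, poisP (F i) (F j) = 0) (j : Fin (k + 1)) {z : Og (ℂ × PhaseC (k + 1))}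
    (hz : z ∈ Ideal.span (Set.range F)) : ham (F j) z ∈ Ideal.span (Set.range F) := by
  refine derivation_mem_span _ Ideal.subset_span ?_ hz
  rintro _ ⟨i, rfl⟩
  rw [ham_apply, hF]
  exact zero_mem _

lemma frameD_mem_gI (hF : ∀ i j, poisP (F i) (F j) = 0) (j : ℕ) {z : Og (ℂ × PhaseC (k + 1))}
    (hz : z ∈ gI F l j) : frameD (fun j => ham (F j)) (fun i => lin (l i)) 0 z ∈ gI F l j := by
  rw [gI, ← Ideal.span_union] at hz ⊢
  refine derivation_mem_span _ Ideal.subset_span ?_ hz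
  rintro _ (⟨i, rfl⟩ | ⟨i, hi, rfl⟩)
  · rw [frameD_apply]
    refine sum_mem fun j _ => Ideal.mul_mem_left _ _ ?_
    rw [ham_apply, hF]
    exact zero_mem _
  · change frameD _ _ 0 (plb l _) ∈ _
    rw [frameD_plb, dl_up_eq, map_zero, mul_zero]
    exact zero_mem _

end Core


section Core

variable {k : ℕ} {F : Fin (k + 1) → Og (ℂ × PhaseC (k + 1))}
  {l : Fin (k + 1) → (ℂ × PhaseC (k + 1)) →L[ℂ] ℂ}

lemma plb_mem {s : Og (BaseC k × ℂ)} (h : s ∈ IsLocalRing.maximalIdeal (Og (BaseC k × ℂ))) :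
    plb l s ∈ IsLocalRing.maximalIdeal (Og (ℂ × PhaseC (k + 1))) := by
  rw [mem_max] at h ⊢
  rwa [plb, ev_pl]

lemma up_mem {a : Og (BaseC k)} (h : a ∈ IsLocalRing.maximalIdeal (Og (BaseC k))) :
    up _ a ∈ IsLocalRing.maximalIdeal (Og (BaseC k × ℂ)) := by
  rw [mem_max] at h ⊢
  rwa [up, ev_pl]

lemma plb_bseq_mem (i : ℕ) : plb l (up _ (bseq k i)) ∈
    IsLocalRing.maximalIdeal (Og (ℂ × PhaseC (k + 1))) := plb_mem (up_mem (bseq_mem i))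

namespace IsGeneral

lemma gI_le (h : IsGeneral F l) (j : ℕ) :
    gI F l j ≤ IsLocalRing.maximalIdeal (Og (ℂ × PhaseC (k + 1))) := by
  refine sup_le (Ideal.span_le.2 ?_) (Ideal.span_le.2 ?_)
  · rintro _ ⟨i, rfl⟩
    exact h.mem i
  · rintro _ ⟨i, -, rfl⟩
    exact plb_bseq_mem i

lemma reg_aux (h : IsGeneral F l) {w : Og (ℂ × PhaseC (k + 1))}
    (hw : w ∈ IsLocalRing.maximalIdeal (Og (ℂ × PhaseC (k + 1))))
    (hP : Prim (gI F l (k + 1) ⊔ Ideal.span {w})) :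
    (∀ j < k + 1, ∀ z, plb l (up _ (bseq k j)) * z ∈ gI F l j → z ∈ gI F l j) ∧
      ∀ j ≤ k + 1, ∀ z, w * z ∈ gI F l j → z ∈ gI F l j :=
  mem_of_mul_mem_of_prim (g := fun i => plb l (up _ (bseq k i))) h.mem plb_bseq_mem hw
    (by simp; ring) hP

lemma reg (h : IsGeneral F l) {j : ℕ} (hj : j < k + 1) {z : Og (ℂ × PhaseC (k + 1))}
    (hz : plb l (up _ (bseq k j)) * z ∈ gI F l j) : z ∈ gI F l j :=
  (h.reg_aux (mem_max.2 (ev_lin _)) h.prim).1 j hj z hz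

lemma reg_lin (h : IsGeneral F l) {j : ℕ} (hj : j ≤ k + 1) {z : Og (ℂ × PhaseC (k + 1))}
    (hz : lin (l 0) * z ∈ gI F l j) : z ∈ gI F l j :=
  (h.reg_aux (mem_max.2 (ev_lin _)) h.prim).2 j hj z hz

lemma reg_det (h : IsGeneral F l) {j : ℕ} (hj : j ≤ k + 1) {z : Og (ℂ × PhaseC (k + 1))}
    (hz : (frameMat (fun j => ham (F j)) (fun i => lin (l i))).det * z ∈ gI F l j) :
    z ∈ gI F l j := by
  by_cases hu : IsUnit (frameMat (fun j => ham (F j)) (fun i => lin (l i))).det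
  · exact (Ideal.unit_mul_mem_iff_mem _ hu).1 hz
  · exact (h.reg_aux ((IsLocalRing.mem_maximalIdeal _).2 hu) h.prim_det).2 j hj z hz

/-- The base is embedded in the fibre ideals in the only possible way. -/
lemma mem_of_plb_mem (h : IsGeneral F l) {j : ℕ} (hj : j ≤ k + 1) {s : Og (BaseC k × ℂ)}
    (hs : plb l s ∈ gI F l j) : s ∈ Ideal.span (up _ '' (bseq k '' Set.Iio j)) := by
  let _ : Algebra (Og (BaseC k × ℂ)) (Og (ℂ × PhaseC (k + 1))) := (plb l).toRingHom.toAlgebra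
  have hsm : ∀ (a : Og (BaseC k × ℂ)) (z : Og (ℂ × PhaseC (k + 1))), a • z = plb l a * z :=
    fun a z => Algebra.smul_def a z
  let J : ℕ → Ideal (Og (ℂ × PhaseC (k + 1))) := fun j =>
    Ideal.span (Set.range F) ⊔ Ideal.span (plb l '' (sseq k '' Set.Iio j))
  have hJ : ∀ j ≤ k + 1, J j = gI F l j := fun j hj => by
    change _ ⊔ Ideal.span (plb l '' (sseq k '' Set.Iio j)) = _
    rw [sseq_image hj, gI, Set.image_image, Set.image_image]
  have hmem : ∀ (z : Og (ℂ × PhaseC (k + 1))) j,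
      z ∈ (J j).restrictScalars (Og (BaseC k × ℂ)) ↔ z ∈ J j := fun _ _ => Iff.rfl
  have key := mem_span_of_regular (A := Og (BaseC k × ℂ)) (M := Og (ℂ × PhaseC (k + 1)))
    (ι := Unit) (sseq k) (k + 2) (fun j _ => sseq_mem j)
    (fun j => (J j).restrictScalars (Og (BaseC k × ℂ)))
    (fun i j hij z hz => (sup_le_sup_left (Ideal.span_mono (Set.image_mono
      (Set.image_mono (Set.Iio_subset_Iio hij)))) _ : J i ≤ J j) hz)
    (fun i j hij m => by
      rw [hmem, hsm]
      exact Ideal.mul_mem_right _ _ (Ideal.mem_sup_right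
        (Ideal.subset_span ⟨_, ⟨i, hij, rfl⟩, rfl⟩)))
    (fun j hj m hm => by
      rw [hmem, hsm] at hm
      rw [hmem]
      rw [hJ j (Nat.lt_succ_iff.1 hj)] at hm ⊢
      rcases (Nat.lt_succ_iff.1 hj).lt_or_eq with h1 | rfl
      · rw [sseq, if_neg h1.ne] at hm
        exact h.reg h1 hm
      · rw [sseq, if_pos rfl, plb_xl] at hm
        exact h.reg_lin le_rfl hm)
    (fun _ => 1) (fun a ha i => by
      rw [span_sseq]
      rw [hmem, Fintype.sum_unique, hsm, mul_one] at ha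
      have h1 : J (k + 2) ≤ IsLocalRing.maximalIdeal (Og (ℂ × PhaseC (k + 1))) := by
        refine sup_le (Ideal.span_le.2 ?_) (Ideal.span_le.2 ?_)
        · rintro _ ⟨i, rfl⟩
          exact h.mem i
        · rintro _ ⟨_, ⟨i, -, rfl⟩, rfl⟩
          exact plb_mem (sseq_mem i)
      have h2 := mem_max.1 (h1 ha)
      rw [plb, ev_pl] at h2
      exact mem_max.2 h2) j (hj.trans (Nat.le_succ _)) (fun _ => s) (by
      rw [hmem, Fintype.sum_unique, hsm, mul_one, hJ j hj]
      exact hs) ()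
  rwa [sseq_image hj] at key

lemma plb_mem_gI {j : ℕ} {s : Og (BaseC k × ℂ)}
    (hs : s ∈ Ideal.span (up _ '' (bseq k '' Set.Iio j))) : plb l s ∈ gI F l j := by
  have h := Ideal.mem_map_of_mem (plb l) hs
  rw [Ideal.map_span, Set.image_image, Set.image_image] at h
  exact Ideal.mem_sup_right h

lemma eq_zero_of_plb_mem (h : IsGeneral F l) {s : Og (BaseC k × ℂ)}
    (hs : plb l s ∈ Ideal.span (Set.range F)) : s = 0 := by
  rw [← gI_zero (l := l)] at hs
  have := h.mem_of_plb_mem (Nat.zero_le _) hs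
  simpa using this

lemma prj_surjective (h : IsGeneral F l) : Function.Surjective (prj l) := by
  refine LinearMap.range_eq_top.1 (?_ : LinearMap.range (prj l).toLinearMap = ⊤)
  by_contra hne
  obtain ⟨f, hf, hf0⟩ := Submodule.exists_dual_map_eq_bot_of_lt_top (lt_top_iff_ne_top.2 hne)
    inferInstance
  refine hf ?_
  let f' : (BaseC k × ℂ) →L[ℂ] ℂ := LinearMap.toContinuousLinearMap f
  have h1 : f'.comp (prj l) = 0 := by
    refine ContinuousLinearMap.ext fun x => ?_
    have : f (prj l x) ∈ (LinearMap.range (prj l).toLinearMap).map f :=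
      Submodule.mem_map_of_mem ⟨x, rfl⟩
    rw [hf0] at this
    exact (Submodule.mem_bot ℂ).1 this
  have h2 : lin f' = 0 := h.eq_zero_of_plb_mem (by
    rw [plb, pl_lin, h1, ← linHom_apply, map_zero]
    exact zero_mem _)
  have h3 : f' = 0 := lin_injective (h2.trans (map_zero (linHom _)).symm)
  exact LinearMap.ext fun x => congrArg (fun g : (BaseC k × ℂ) →L[ℂ] ℂ => g x) h3

lemma finite (h : IsGeneral F l) (j : ℕ) :
    ((Ideal.Quotient.mk (gI F l j)).comp (plb l).toRingHom).Finite := by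
  refine finite_proj (prj l) h.prj_surjective (gI F l j) (h.prim.mono ?_)
  refine sup_le (sup_le ?_ (Ideal.span_le.2 ?_)) (Ideal.span_le.2 ?_)
  · exact le_sup_of_le_left le_sup_left
  · rintro _ ⟨i, -, rfl⟩
    exact Ideal.mem_sup_right (Ideal.mem_map_of_mem _ (up_mem (bseq_mem i)))
  · rintro _ rfl
    rw [← plb_xl]
    exact Ideal.mem_sup_right (Ideal.mem_map_of_mem _ (mem_max.2 (ev_lin _)))

end IsGeneral

end Core


section Core

variable {k : ℕ} {F : Fin (k + 1) → Og (ℂ × PhaseC (k + 1))}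
  {l : Fin (k + 1) → (ℂ × PhaseC (k + 1)) →L[ℂ] ℂ}

lemma frameD_plb_up (a : Og (BaseC k)) :
    frameD (fun j => ham (F j)) (fun i => lin (l i)) 0 (plb l (up _ a)) = 0 := by
  rw [frameD_plb, dl_up_eq, map_zero, mul_zero]

lemma frameD_plb_up_mul (a : Og (BaseC k)) (z : Og (ℂ × PhaseC (k + 1))) :
    frameD (fun j => ham (F j)) (fun i => lin (l i)) 0 (plb l (up _ a) * z) =
      plb l (up _ a) * frameD (fun j => ham (F j)) (fun i => lin (l i)) 0 z := by
  rw [Derivation.leibniz, frameD_plb_up, smul_zero, add_zero, smul_eq_mul]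

namespace IsGeneral

lemma exists_sub_mem_of_frameD_mem_fibre (h : IsGeneral F l) {z : Og (ℂ × PhaseC (k + 1))}
    (hz : frameD (fun j => ham (F j)) (fun i => lin (l i)) 0 z ∈ gI F l (k + 1)) :
    ∃ a, z - plb l (up _ a) ∈ gI F l (k + 1) := by
  have hbase : ∀ i < k + 1, plb l (up _ (bseq k i)) ∈ gI F l (k + 1) := fun i hi =>
    Ideal.mem_sup_right (Ideal.subset_span ⟨i, hi, rfl⟩)
  obtain ⟨c, hc⟩ := exists_const_of_frameD_mem h.comm l (gI F l (k + 1)) (h.gI_le _)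
    (by rw [← plb_bseq_zero l]; exact hbase 0 (Nat.succ_pos k))
    (fun j => mem_gI j _)
    (fun i => by rw [← plb_bseq_succ l i]; exact hbase _ (by omega))
    (fun z hz => frameD_mem_gI h.comm _ hz) h.prim (fun z => h.reg_lin le_rfl)
    (fun z => h.reg_det le_rfl) hz
  refine ⟨algebraMap ℂ _ c, ?_⟩
  rwa [AlgHom.commutes, AlgHom.commutes]

/-- The kernel of the vertical derivation consists of the functions on the base. -/
lemma exists_sub_mem_of_frameD_mem (h : IsGeneral F l) {j : ℕ} (hj : j ≤ k + 1)
    {z : Og (ℂ × PhaseC (k + 1))}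
    (hz : frameD (fun j => ham (F j)) (fun i => lin (l i)) 0 z ∈ gI F l j) :
    ∃ a, z - plb l (up _ a) ∈ gI F l j :=
  exists_sub_mem_of_derivation_mem (up (BaseC k)).toRingHom (plb l).toRingHom
    (frameD (fun j => ham (F j)) (fun i => lin (l i)) 0).toLinearMap.toAddMonoidHom
    (fun a z => frameD_plb_up_mul a z) (Derivation.map_one_eq_zero _)
    (frameMat (fun j => ham (F j)) (fun i => lin (l i))).det
    (fun s => der (edir k 0) s) (fun s => frameD_plb 0 s) (bseq k)
    (fun j => up_mem (bseq_mem j)) (gI F l) gI_succ (fun j _ hz => frameD_mem_gI h.comm j hz)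
    (k + 1) (fun _ hj _ => h.reg hj) (fun _ hj _ => h.reg_det hj.le) (fun j _ => h.finite j)
    (fun _ hj _ => h.mem_of_plb_mem hj.le) (fun _ _ => plb_mem_gI)
    (fun _ _ _ hs => exists_sub_up_mem_span hs)
    (fun _ => h.exists_sub_mem_of_frameD_mem_fibre) j hj z hz

lemma exists_sub_frameD_mem (h : IsGeneral F l) {j : ℕ} (hj : j < k + 1)
    {z w : Og (ℂ × PhaseC (k + 1))}
    (hz : plb l (up _ (bseq k j)) * z - frameD (fun j => ham (F j)) (fun i => lin (l i)) 0 w ∈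
      gI F l j) :
    ∃ w, z - frameD (fun j => ham (F j)) (fun i => lin (l i)) 0 w ∈ gI F l j :=
  mem_sup_range_of_mul_mem (up (BaseC k)).toRingHom (plb l).toRingHom
    (frameD (fun j => ham (F j)) (fun i => lin (l i)) 0).toLinearMap.toAddMonoidHom
    (fun a z => frameD_plb_up_mul a z) (Derivation.map_one_eq_zero _) (gI_succ j)
    (fun _ hz => frameD_mem_gI h.comm j hz) (fun _ => h.reg hj)
    (fun _ => h.exists_sub_mem_of_frameD_mem hj) hz

end IsGeneral

end Core

end Og

/-- A quotient of an algebra by an ideal and the image of a linear map is free over the base if it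
is finite and has depth equal to the number of parameters of the base. -/
lemma exists_coordinates_of_regular {A O : Type*} [CommRing A] [IsLocalRing A] [IsNoetherianRing A]
    [CommRing O] [Algebra A O] (D : O →ₗ[A] O) (I : ℕ → Ideal O) (y : ℕ → A) (k : ℕ)
    (hy : Ideal.span (y '' Set.Iio k) = IsLocalRing.maximalIdeal A)
    (hI : ∀ j, I j = I 0 ⊔ Ideal.span ((fun i => algebraMap A O (y i)) '' Set.Iio j))
    (hfin : Module.Finite A (O ⧸ ((I 0).restrictScalars A ⊔ LinearMap.range D)))
    (hreg : ∀ j < k, ∀ z w, algebraMap A O (y j) * z - D w ∈ I j → ∃ w, z - D w ∈ I j) :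
    ∃ (b : ℕ) (φ : O →ₗ[A] (Fin b → A)), ∀ z, φ z = 0 ↔ ∃ w, z - D w ∈ I 0 := by
  have hmem : ∀ j z, z ∈ (I j).restrictScalars A ⊔ LinearMap.range D ↔ ∃ w, z - D w ∈ I j := by
    intro j z
    rw [Submodule.mem_sup]
    constructor
    · rintro ⟨u, hu, _, ⟨w, rfl⟩, rfl⟩
      exact ⟨w, by rwa [add_sub_cancel_right]⟩
    · rintro ⟨w, hw⟩
      exact ⟨_, hw, _, ⟨w, rfl⟩, sub_add_cancel _ _⟩
  set K := (I 0).restrictScalars A ⊔ LinearMap.range D with hK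
  have hKI : ∀ j, K ≤ (I j).restrictScalars A ⊔ LinearMap.range D := fun j =>
    sup_le_sup_right (fun z hz => by
      rw [Submodule.restrictScalars_mem] at hz ⊢
      rw [hI]
      exact Ideal.mem_sup_left hz) _
  have key : ∀ j z, K.mkQ z ∈ Ideal.span (y '' Set.Iio j) • (⊤ : Submodule A (O ⧸ K)) ↔
      ∃ w, z - D w ∈ I j := by
    intro j z
    rw [← hmem]
    constructor
    · intro hz
      have h1 : Ideal.span (y '' Set.Iio j) • (⊤ : Submodule A (O ⧸ K)) ≤
          ((I j).restrictScalars A ⊔ LinearMap.range D).map K.mkQ := by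
        refine Submodule.smul_le.2 fun r hr n _ => ?_
        obtain ⟨x, rfl⟩ := K.mkQ_surjective n
        rw [← map_smul]
        refine Submodule.mem_map_of_mem (Submodule.mem_sup_left ?_)
        rw [Submodule.restrictScalars_mem, Algebra.smul_def, hI]
        refine Ideal.mul_mem_right _ _ (Ideal.mem_sup_right ?_)
        have := Ideal.mem_map_of_mem (algebraMap A O) hr
        rwa [Ideal.map_span, Set.image_image] at this
      obtain ⟨x, hx, hxz⟩ := h1 hz
      have h2 : z - x ∈ K := (Submodule.Quotient.eq K).1 hxz.symm
      rw [← sub_add_cancel z x]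
      exact add_mem (hKI j h2) hx
    · intro hz
      obtain ⟨u, hu, _, ⟨w, rfl⟩, rfl⟩ := Submodule.mem_sup.1 hz
      have h0 : ∀ x ∈ K, K.mkQ x = 0 := fun x hx => (Submodule.Quotient.mk_eq_zero K).2 hx
      rw [map_add, h0 (D w) (Submodule.mem_sup_right ⟨w, rfl⟩), add_zero]
      rw [Submodule.restrictScalars_mem, hI] at hu
      obtain ⟨u₀, hu₀, u₁, hu₁, rfl⟩ := Submodule.mem_sup.1 hu
      rw [map_add, h0 u₀ (Submodule.mem_sup_left hu₀), zero_add]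
      clear hu hz
      suffices h : ∀ a, K.mkQ (a * u₁) ∈ Ideal.span (y '' Set.Iio j) • (⊤ : Submodule A (O ⧸ K)) by
        simpa only [one_mul] using h 1
      induction hu₁ using Submodule.span_induction with
      | mem x hx =>
        obtain ⟨i, hi, rfl⟩ := hx
        intro a
        change K.mkQ (a * algebraMap A O (y i)) ∈ _
        rw [mul_comm, ← Algebra.smul_def, map_smul]
        exact Submodule.smul_mem_smul (Ideal.subset_span ⟨i, hi, rfl⟩) trivial
      | zero => simp
      | add x x' _ _ hx hx' =>
        intro a
        rw [mul_add, map_add]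
        exact add_mem (hx a) (hx' a)
      | smul b x hx ih =>
        intro a
        rw [smul_eq_mul, ← mul_assoc]
        exact ih _
  obtain ⟨b, ⟨B⟩⟩ := exists_basis_of_regular y k hy (M := O ⧸ K) fun j hj m hm => by
    obtain ⟨z, rfl⟩ := K.mkQ_surjective m
    rw [← map_smul, key, Algebra.smul_def] at hm
    obtain ⟨w, hw⟩ := hm
    exact (key j z).2 (hreg j hj z w hw)
  refine ⟨b, B.equivFun.toLinearMap ∘ₗ K.mkQ, fun z => ?_⟩
  rw [LinearMap.comp_apply, LinearEquiv.coe_coe, LinearEquiv.map_eq_zero_iff, ← hmem]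
  exact Submodule.Quotient.mk_eq_zero K


lemma exists_sum_sub_mem_of_finite {S O : Type*} [CommRing S] [CommRing O] (Ψ : S →+* O)
    (I : Ideal O) (h : ((Ideal.Quotient.mk I).comp Ψ).Finite) :
    ∃ (r : ℕ) (c : Fin r → O), ∀ z, ∃ s : Fin r → S, z - ∑ i, Ψ (s i) * c i ∈ I := by
  let _ : Algebra S (O ⧸ I) := ((Ideal.Quotient.mk I).comp Ψ).toAlgebra
  have hfin : Module.Finite S (O ⧸ I) := h
  obtain ⟨r, c, hc⟩ := Module.Finite.exists_fin (R := S) (M := O ⧸ I)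
  choose d hd using fun i => Ideal.Quotient.mk_surjective (c i)
  refine ⟨r, d, fun z => ?_⟩
  have hz : Ideal.Quotient.mk I z ∈ Submodule.span S (Set.range c) := hc ▸ Submodule.mem_top
  obtain ⟨s, hs⟩ := (Submodule.mem_span_range_iff_exists_fun _).1 hz
  refine ⟨s, Ideal.Quotient.eq.1 ?_⟩
  rw [← hs, map_sum]
  refine Finset.sum_congr rfl fun i _ => ?_
  rw [map_mul, hd, Algebra.smul_def]
  rfl

lemma exists_sum_sub_mem_of_mem_span {S O R : Type*} [CommRing S] [CommRing O] [CommRing R]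
    (Ψ : S →+* O) (I : Ideal O) {ι : Type*} [Fintype ι] (c : ι → O)
    (hc : ∀ z, ∃ s : ι → S, z - ∑ i, Ψ (s i) * c i ∈ I) (ax : S →+* R) {T : Set S}
    (hT : ∀ t ∈ T, ax t = 0) {w : O} (hw : w ∈ Ideal.span (Ψ '' T)) (z : O) :
    ∃ s : ι → S, (∀ i, ax (s i) = 0) ∧ w * z - ∑ i, Ψ (s i) * c i ∈ I := by
  induction hw using Submodule.span_induction generalizing z with
  | mem x hx =>
    obtain ⟨t, ht, rfl⟩ := hx
    obtain ⟨s, hs⟩ := hc z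
    refine ⟨fun j => t * s j, fun j => ?_, ?_⟩
    · rw [map_mul, hT t ht, zero_mul]
    · have := Ideal.mul_mem_left _ (Ψ t) hs
      rw [mul_sub, Finset.mul_sum] at this
      simpa only [map_mul, mul_assoc] using this
  | zero => exact ⟨0, fun i => map_zero _, by simp⟩
  | add x x' _ _ hx hx' =>
    obtain ⟨s, hs, hs'⟩ := hx z
    obtain ⟨s₁, hs₁, hs₁'⟩ := hx' z
    refine ⟨s + s₁, fun i => ?_, ?_⟩
    · rw [Pi.add_apply, map_add, hs, hs₁, add_zero]
    · have := add_mem hs' hs₁'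
      convert this using 1
      simp only [Pi.add_apply, map_add, add_mul, Finset.sum_add_distrib]
      ring
  | smul a x _ ih =>
    obtain ⟨s, hs⟩ := ih (a * z)
    refine ⟨s, hs.1, ?_⟩
    have := hs.2
    rwa [← mul_assoc, mul_comm x a] at this

namespace Og

section Core

variable {k : ℕ} {F : Fin (k + 1) → Og (ℂ × PhaseC (k + 1))}
  {l : Fin (k + 1) → (ℂ × PhaseC (k + 1)) →L[ℂ] ℂ}

namespace IsGeneral

lemma exists_pow_sub_mem (h : IsGeneral F l) : ∃ (κ : ℕ) (e w : Og (ℂ × PhaseC (k + 1))),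
    w ∈ Ideal.span ((fun i => plb l (up _ (bseq k i))) '' Set.Iio (k + 1)) ∧
    plb l (xl _) ^ κ - (frameMat (fun j => ham (F j)) (fun i => lin (l i))).det * e - w ∈
      gI F l 0 := by
  have h1 := h.prim_det (plb_mem (mem_max.2 (ev_lin _)) : plb l (xl _) ∈ _)
  obtain ⟨κ, hκ⟩ := h1
  obtain ⟨u, hu, v, hv, huv⟩ := Submodule.mem_sup.1 hκ
  obtain ⟨f, hf, w, hw, rfl⟩ := Submodule.mem_sup.1 hu
  obtain ⟨e, rfl⟩ := Ideal.mem_span_singleton'.1 hv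
  refine ⟨κ, e, w, hw, ?_⟩
  rw [← huv, gI_zero]
  convert hf using 1
  ring

lemma exists_coordinates (h : IsGeneral F l) :
    ∃ (b : ℕ) (φ : Og (ℂ × PhaseC (k + 1)) →+ (Fin b → Og (BaseC k))),
      (∀ a z, φ (plb l (up _ a) * z) = a • φ z) ∧
      ∀ z, φ z = 0 ↔ ∃ w, z - frameD (fun j => ham (F j)) (fun i => lin (l i)) 0 w ∈
        Ideal.span (Set.range F) := by
  let _ : Algebra (Og (BaseC k)) (Og (ℂ × PhaseC (k + 1))) :=
    ((plb l).toRingHom.comp (up _).toRingHom).toAlgebra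
  let D : Og (ℂ × PhaseC (k + 1)) →ₗ[Og (BaseC k)] Og (ℂ × PhaseC (k + 1)) :=
    { toFun := frameD (fun j => ham (F j)) (fun i => lin (l i)) 0
      map_add' := map_add _
      map_smul' := fun a z => by
        rw [Algebra.smul_def, Algebra.smul_def]
        exact frameD_plb_up_mul a z }
  obtain ⟨r, c, hc⟩ := exists_sum_sub_mem_of_finite _ _ (h.finite 0)
  obtain ⟨κ, e, w, hw, hκ⟩ := h.exists_pow_sub_mem
  have hfin := finite_quotient_range (plb l).toRingHom (fun _ => rfl) D
    (frameMat (fun j => ham (F j)) (fun i => lin (l i))).det (fun s z => by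
      change frameD (fun j => ham (F j)) (fun i => lin (l i)) 0 (plb l s * z) = _
      refine (Derivation.leibniz _ _ _).trans ?_
      rw [frameD_plb, smul_eq_mul, smul_eq_mul]
      exact (add_comm _ _).trans (congrArg (· + _) (mul_comm _ _))) (gI F l 0) c hc κ e w hκ
    (exists_sum_sub_mem_of_mem_span _ _ c hc (axis _).toRingHom
      (T := (fun i => up _ (bseq k i)) '' Set.Iio (k + 1)) (by
        rintro _ ⟨i, -, rfl⟩
        change axis _ (up _ _) = 0
        rw [axis_up, mem_max.1 (bseq_mem i), map_zero]) (by
        rw [Set.image_image]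
        exact hw))
  obtain ⟨b, φ, hφ⟩ := exists_coordinates_of_regular D (gI F l) (bseq k) (k + 1) span_bseq
    (fun j => by rw [gI_zero]; rfl) hfin (fun _ hj _ _ hz => h.exists_sub_frameD_mem hj hz)
  refine ⟨b, φ.toAddMonoidHom, fun a z => ?_, fun z => ?_⟩
  · have := φ.map_smul a z
    rw [Algebra.smul_def] at this
    exact this
  · rw [← gI_zero (l := l)]
    exact hφ z

end IsGeneral

end Core

end Og

lemma mulVec_apply_of_zero {R : Type*} [CommRing R] {k : ℕ}
    (Q : Matrix (Fin (k + 1)) (Fin (k + 1)) R) {b : Fin (k + 1) → R} (hb : b 0 = 0)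
    (j : Fin (k + 1)) : (Q.mulVec b) j = ∑ i : Fin k, Q j i.succ * b i.succ := by
  rw [Matrix.mulVec, dotProduct, Fin.sum_univ_succ, hb, mul_zero, zero_add]

namespace Og

section Core

open Matrix

variable {k : ℕ} {F : Fin (k + 1) → Og (ℂ × PhaseC (k + 1))}
  {l : Fin (k + 1) → (ℂ × PhaseC (k + 1)) →L[ℂ] ℂ}

lemma der_edir_succ_up (i : Fin k) (a : Og (BaseC k)) :
    der (edir k i.succ) (up _ a) = up _ (der (0, Pi.single i 1) a) := by
  rw [up, der_pl]
  rfl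

lemma sum_frameMat_mul_frameD (j : Fin (k + 1)) (z : Og (ℂ × PhaseC (k + 1))) :
    ∑ p, frameMat (fun j => ham (F j)) (fun i => lin (l i)) j p *
      frameD (fun j => ham (F j)) (fun i => lin (l i)) p z =
    (frameMat (fun j => ham (F j)) (fun i => lin (l i))).det * ham (F j) z := by
  have h : frameMat (fun j => ham (F j)) (fun i => lin (l i)) *ᵥ
      ((frameMat (fun j => ham (F j)) (fun i => lin (l i))).adjugate *ᵥ fun i => ham (F i) z) =
      (frameMat (fun j => ham (F j)) (fun i => lin (l i))).det • fun i => ham (F i) z := by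
    rw [mulVec_mulVec, mul_adjugate, smul_mulVec, one_mulVec]
  have := congrFun h j
  rw [Pi.smul_apply, smul_eq_mul] at this
  rw [← this]
  refine Finset.sum_congr rfl fun p _ => ?_
  rw [frameD_apply]
  rfl

lemma exists_forall_der_single_eq (β : Fin k → Og (BaseC k))
    (hβ : ∀ i j, der (0, Pi.single i 1) (β j) = der (0, Pi.single j 1) (β i)) :
    ∃ g, ∀ i, der (0, Pi.single i 1) g = β i := by
  obtain ⟨g, hg⟩ := exists_forall_der_eq (E := BaseC k)
    (fun i => if hi : i < k then (0, Pi.single ⟨i, hi⟩ 1) else 0)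
    (fun i => if hi : i < k then (ContinuousLinearMap.proj ⟨i, hi⟩).comp
      (ContinuousLinearMap.snd ℂ ℂ (Fin k → ℂ)) else 0) k
    (fun i hi j hj => by
      rw [dif_pos hi, dif_pos hj, ContinuousLinearMap.comp_apply]
      change (Pi.single (⟨j, hj⟩ : Fin k) (1 : ℂ) : Fin k → ℂ) ⟨i, hi⟩ = _
      rw [Pi.single_apply]
      simp only [Fin.mk.injEq])
    (fun i => if hi : i < k then β ⟨i, hi⟩ else 0)
    (fun i hi j hj => by
      rw [dif_pos hi, dif_pos hj, dif_pos hi, dif_pos hj]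
      exact hβ _ _)
  refine ⟨g, fun i => ?_⟩
  have := hg i i.2
  rwa [dif_pos i.2, dif_pos i.2] at this

namespace IsGeneral

/-- A function on the base satisfies the chain rule along the Hamiltonian fields. -/
lemma ham_plb_up_sub_mem (h : IsGeneral F l) (j : Fin (k + 1)) (g : Og (BaseC k)) :
    ham (F j) (plb l (up _ g)) - ∑ i : Fin k, ham (F j) (lin (l i.succ)) *
      plb l (up _ (der (0, Pi.single i 1) g)) ∈ Ideal.span (Set.range F) := by
  rw [← gI_zero (l := l)]
  refine h.reg_det (Nat.zero_le _) ?_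
  rw [mul_sub, ← sum_frameMat_mul_frameD, Fin.sum_univ_succ, frameD_plb_up, mul_zero, zero_add,
    Finset.mul_sum, ← Finset.sum_sub_distrib]
  refine sum_mem fun i _ => ?_
  rw [frameD_plb, der_edir_succ_up]
  convert (gI F l 0).zero_mem using 1
  rw [mul_left_comm, sub_eq_zero]
  rfl

lemma exists_primitive (h : IsGeneral F l) {ρ : Type*} [Fintype ρ]
    (m : ρ → Fin (k + 1) → Og (ℂ × PhaseC (k + 1)))
    (hm : ∀ r i j, ham (F j) (m r i) - ham (F i) (m r j) ∈ Ideal.span (Set.range F))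
    (s : ρ → Og (BaseC k)) (w : Og (ℂ × PhaseC (k + 1)))
    (hw : ∑ r, plb l (up _ (s r)) *
        ((frameMat (fun j => ham (F j)) (fun i => lin (l i))).adjugate *ᵥ m r) 0 -
      frameD (fun j => ham (F j)) (fun i => lin (l i)) 0 w ∈ Ideal.span (Set.range F)) :
    ∃ b : Fin (k + 1) → Og (ℂ × PhaseC (k + 1)), b 0 = 0 ∧
      (∀ j, ∑ r, plb l (up _ (s r)) * m r j - ham (F j) w -
        (frameMat (fun j => ham (F j)) (fun i => lin (l i)) *ᵥ b) j ∈ Ideal.span (Set.range F)) ∧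
      ∀ p q, frameD (fun j => ham (F j)) (fun i => lin (l i)) p (b q) -
          frameD (fun j => ham (F j)) (fun i => lin (l i)) q (b p) -
        ∑ r, (plb l (der (edir k p) (up _ (s r))) *
            ((frameMat (fun j => ham (F j)) (fun i => lin (l i))).adjugate *ᵥ m r) q -
          plb l (der (edir k q) (up _ (s r))) *
            ((frameMat (fun j => ham (F j)) (fun i => lin (l i))).adjugate *ᵥ m r) p) ∈
        Ideal.span (Set.range F) := by
  refine exists_primitive_of_relation (fun j z hz => ham_mem h.comm j hz)
    (fun i j z => ham_comm (h.comm i j) z) (fun z hz => ?_) h.minor m hm _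
    (fun p r => plb l (der (edir k p) (up _ (s r)))) (fun p r => frameD_plb p _) w hw
  rw [← gI_zero (l := l)] at hz ⊢
  exact h.reg_det (Nat.zero_le _) hz

lemma exists_relation_der (h : IsGeneral F l) {ρ : Type*} [Fintype ρ]
    (m : ρ → Fin (k + 1) → Og (ℂ × PhaseC (k + 1)))
    (hm : ∀ r i j, ham (F j) (m r i) - ham (F i) (m r j) ∈ Ideal.span (Set.range F))
    (s : ρ → Og (BaseC k)) (w : Og (ℂ × PhaseC (k + 1)))
    (hw : ∑ r, plb l (up _ (s r)) *
        ((frameMat (fun j => ham (F j)) (fun i => lin (l i))).adjugate *ᵥ m r) 0 -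
      frameD (fun j => ham (F j)) (fun i => lin (l i)) 0 w ∈ Ideal.span (Set.range F))
    (i : Fin k) :
    ∃ w, ∑ r, plb l (up _ (der (0, Pi.single i 1) (s r))) *
        ((frameMat (fun j => ham (F j)) (fun i => lin (l i))).adjugate *ᵥ m r) 0 -
      frameD (fun j => ham (F j)) (fun i => lin (l i)) 0 w ∈ Ideal.span (Set.range F) := by
  obtain ⟨b, hb0, -, hb⟩ := h.exists_primitive m hm s w hw
  refine ⟨-b i.succ, ?_⟩
  have := neg_mem (hb i.succ 0)
  convert this using 1
  rw [hb0, map_zero, map_neg, zero_sub, sub_neg_eq_add, neg_sub, sub_neg_eq_add]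
  congr 1
  refine Finset.sum_congr rfl fun r _ => ?_
  rw [der_edir_succ_up, dl_up_eq, map_zero, zero_mul, sub_zero]

set_option maxHeartbeats 800000 in
/-- A cocycle is determined by its contraction up to coboundaries. -/
lemma exists_sub_ham_mem (h : IsGeneral F l) (m : Fin (k + 1) → Og (ℂ × PhaseC (k + 1)))
    (hm : ∀ i j, ham (F j) (m i) - ham (F i) (m j) ∈ Ideal.span (Set.range F))
    (w : Og (ℂ × PhaseC (k + 1)))
    (hw : ((frameMat (fun j => ham (F j)) (fun i => lin (l i))).adjugate *ᵥ m) 0 -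
      frameD (fun j => ham (F j)) (fun i => lin (l i)) 0 w ∈ Ideal.span (Set.range F)) :
    ∃ g, ∀ j, m j - ham (F j) g ∈ Ideal.span (Set.range F) := by
  obtain ⟨b, hb0, hbm, hb⟩ := h.exists_primitive (ρ := Unit) (fun _ => m) (fun _ => hm)
    (fun _ => 1) w (by simpa only [Finset.univ_unique, Finset.sum_singleton, map_one, one_mul])
  simp only [Finset.univ_unique, Finset.sum_singleton, map_one, one_mul,
    Derivation.map_one_eq_zero, map_zero, zero_mul, sub_zero] at hbm hb
  have h1 : ∀ i : Fin k, ∃ β, b i.succ - plb l (up _ β) ∈ Ideal.span (Set.range F) := fun i => by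
    have := hb 0 i.succ
    rw [hb0, map_zero, sub_zero, ← gI_zero (l := l)] at this
    rw [← gI_zero (l := l)]
    exact h.exists_sub_mem_of_frameD_mem (Nat.zero_le _) this
  choose β hβ using h1
  have hD : ∀ p z, z ∈ Ideal.span (Set.range F) →
      frameD (fun j => ham (F j)) (fun i => lin (l i)) p z ∈ Ideal.span (Set.range F) :=
    fun p z hz => frameD_mem _ _ (fun j z hz => ham_mem h.comm j hz) p hz
  have h2 : ∀ i j, der (0, Pi.single i 1) (β j) = der (0, Pi.single j 1) (β i) := fun i j => by
    have h3 := sub_mem (sub_mem (hb i.succ j.succ) (hD i.succ _ (hβ j)))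
      (neg_mem (hD j.succ _ (hβ i)))
    have h4 : (frameMat (fun j => ham (F j)) (fun i => lin (l i))).det *
        (plb l (up _ (der (0, Pi.single i 1) (β j) - der (0, Pi.single j 1) (β i)))) ∈
        Ideal.span (Set.range F) := by
      convert h3 using 1
      rw [map_sub, map_sub, map_sub, map_sub, frameD_plb, frameD_plb, der_edir_succ_up,
        der_edir_succ_up]
      ring
    rw [← gI_zero (l := l)] at h4
    have h5 := h.reg_det (Nat.zero_le _) h4
    rw [gI_zero] at h5
    have h6 := congrArg (down (BaseC k)) (h.eq_zero_of_plb_mem h5)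
    rw [down_up, map_zero] at h6
    exact sub_eq_zero.1 h6
  obtain ⟨g, hg'⟩ := exists_forall_der_single_eq β h2
  refine ⟨w + plb l (up _ g), fun j => ?_⟩
  have h8 : ∑ i : Fin k, ham (F j) (lin (l i.succ)) * (b i.succ - plb l (up _ (β i))) ∈
      Ideal.span (Set.range F) :=
    Ideal.sum_mem _ fun i _ =>
      (Ideal.span (Set.range F)).mul_mem_left (ham (F j) (lin (l i.succ))) (hβ i)
  have h9 : (frameMat (fun j => ham (F j)) (fun i => lin (l i)) *ᵥ b) j =
      ∑ i : Fin k, ham (F j) (lin (l i.succ)) * b i.succ := mulVec_apply_of_zero _ hb0 j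
  have h7 := hbm j
  have h10 := h.ham_plb_up_sub_mem j g
  rw [h9] at h7
  simp only [hg'] at h10
  simp only [mul_sub, Finset.sum_sub_distrib] at h8
  rw [map_add]
  have h11 := add_mem (sub_mem h7 h10) h8
  generalize m j = a₁ at *
  generalize ham (F j) w = a₂ at *
  generalize ham (F j) (plb l (up _ g)) = a₃ at *
  generalize ∑ i : Fin k, ham (F j) (lin (l i.succ)) * b i.succ = a₄ at *
  generalize ∑ i : Fin k, ham (F j) (lin (l i.succ)) * plb l (up _ (β i)) = a₅ at *
  have h12 : a₁ - (a₂ + a₃) = a₁ - a₂ - a₄ - (a₃ - a₅) + (a₄ - a₅) := by ring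
  rw [h12]
  exact h11

end IsGeneral

end Core

end Og

lemma exists_cohomology_basis {R A O : Type*} [CommRing R] [IsDomain R] [IsPrincipalIdealRing R]
    [CommRing A] [CommRing O] {κ : Type*} (π : R →+* O) (X : κ → O →+ O)
    (hX : ∀ i c z, X i (π c * z) = π c * X i z) (I : Ideal O) (C : (κ → O) →+ O)
    (hC : ∀ c m, C (fun i => π c * m i) = π c * C m) {b : ℕ} (φ : O →+ (Fin b → A)) (ψ : R →+* A)
    (hφ : ∀ c z, φ (π c * z) = ψ c • φ z) (hI : ∀ m, (∀ i, m i ∈ I) → φ (C m) = 0)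
    (hCX : ∀ g, φ (C fun i => X i g) = 0)
    (hinj : ∀ m, (∀ i j, X j (m i) - X i (m j) ∈ I) → φ (C m) = 0 →
      ∃ g, ∀ i, m i - X i g ∈ I)
    (hsec : ∀ f : A, f ≠ 0 → ∃ σ : A →+* R, (∀ c, σ (ψ c) = c) ∧ σ f ≠ 0)
    (hrel : ∀ v : Fin (b + 1) → κ → O, (∀ r i j, X j (v r i) - X i (v r j) ∈ I) →
      ∃ r : Fin (b + 1) → R, r ≠ 0 ∧ φ (∑ i, π (r i) * C (v i)) = 0) :
    ∃ (ι : Type) (e : ι → κ → O), (∀ a i j, X j (e a i) - X i (e a j) ∈ I) ∧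
      ∀ m : κ → O, (∀ i j, X j (m i) - X i (m j) ∈ I) →
        ∃! c : ι →₀ R, ∃ g, ∀ i, (m - c.sum fun a r => fun i => π r * e a i) i - X i g ∈ I := by
  let _ : Module R (κ → O) := Module.compHom _ π
  have hsm : ∀ (c : R) (m : κ → O), c • m = fun i => π c * m i := fun _ _ => rfl
  let Z : Submodule R (κ → O) :=
    { carrier := {m | ∀ i j, X j (m i) - X i (m j) ∈ I}
      zero_mem' := fun i j => by simp
      add_mem' := fun {m m'} hm hm' i j => by
        rw [Pi.add_apply, Pi.add_apply, map_add, map_add, add_sub_add_comm]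
        exact add_mem (hm i j) (hm' i j)
      smul_mem' := fun c m hm i j => by
        rw [hsm, hX, hX, ← mul_sub]
        exact Ideal.mul_mem_left _ _ (hm i j) }
  let B : Submodule R (κ → O) :=
    { carrier := {m | ∃ g, ∀ i, m i - X i g ∈ I}
      zero_mem' := ⟨0, fun i => by simp⟩
      add_mem' := fun {m m'} ⟨g, hg⟩ ⟨g', hg'⟩ => ⟨g + g', fun i => by
        rw [Pi.add_apply, map_add, add_sub_add_comm]
        exact add_mem (hg i) (hg' i)⟩
      smul_mem' := fun c m ⟨g, hg⟩ => ⟨π c * g, fun i => by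
        rw [hsm, hX, ← mul_sub]
        exact Ideal.mul_mem_left _ _ (hg i)⟩ }
  obtain ⟨ι, e, he, hu⟩ := exists_basis_of_separating Z B b (fun m hm hmB => by
      have h1 : φ (C m) ≠ 0 := fun h0 => hmB (hinj m hm h0)
      obtain ⟨i, hi⟩ := Function.ne_iff.1 h1
      obtain ⟨σ, hσ, hσi⟩ := hsec _ hi
      refine ⟨{ toFun := fun m => σ (φ (C m) i)
                map_add' := fun m m' => by
                  rw [map_add, map_add, Pi.add_apply, map_add]
                map_smul' := fun c m => by
                  rw [hsm, hC, hφ, Pi.smul_apply, smul_eq_mul, map_mul, hσ]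
                  rfl }, fun m ⟨g, hg⟩ => ?_, hσi⟩
      have h2 := hI (m - fun i => X i g) hg
      rw [map_sub, map_sub, hCX, sub_zero] at h2
      change σ (φ (C m) i) = 0
      rw [h2, Pi.zero_apply, map_zero])
    (fun v hv => by
      obtain ⟨r, hr, hw⟩ := hrel v hv
      refine ⟨r, hr, hinj _ (sum_mem fun i _ => Z.smul_mem _ (hv i) : _ ∈ Z) ?_⟩
      rw [map_sum]
      simpa only [hsm, hC] using hw)
  exact ⟨ι, e, he, hu⟩

namespace Og

section Core

open Matrix

variable {k : ℕ} {F : Fin (k + 1) → Og (ℂ × PhaseC (k + 1))}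
  {l : Fin (k + 1) → (ℂ × PhaseC (k + 1)) →L[ℂ] ℂ}

lemma plb_up_fst (c : Og ℂ) :
    plb l (up _ (pl (ContinuousLinearMap.fst ℂ ℂ (Fin k → ℂ)) c)) =
      pl (ContinuousLinearMap.fst ℂ ℂ (PhaseC (k + 1))) c := by
  rw [plb, up, pl_pl, pl_pl]
  rfl

lemma ham_pl_fst {n : ℕ} (f : Og (ℂ × PhaseC n)) (c : Og ℂ) :
    ham f (pl (ContinuousLinearMap.fst ℂ ℂ (PhaseC n)) c) = 0 := by
  rw [ham_apply]
  have h : ∀ v : PhaseC n, pd (0, v) (pl (ContinuousLinearMap.fst ℂ ℂ (PhaseC n)) c) = 0 :=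
    fun v => by
      change der _ _ = 0
      rw [der_pl]
      change pl _ (der (0 : ℂ) c) = 0
      rw [der_zero_dir, map_zero]
  rw [poisP]
  exact Finset.sum_eq_zero fun i _ => by rw [h, h, zero_mul, zero_mul, sub_zero]

lemma ham_pl_fst_mul {n : ℕ} (f : Og (ℂ × PhaseC n)) (c : Og ℂ) (z : Og (ℂ × PhaseC n)) :
    ham f (pl (ContinuousLinearMap.fst ℂ ℂ (PhaseC n)) c * z) =
      pl (ContinuousLinearMap.fst ℂ ℂ (PhaseC n)) c * ham f z := by
  rw [Derivation.leibniz, ham_pl_fst, smul_zero, add_zero, smul_eq_mul]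

lemma der_sum_dir {ι : Type*} (s : Finset ι) (v : ι → E) (f : Og E) :
    der (∑ i ∈ s, v i) f = ∑ i ∈ s, der (v i) f := by
  induction s using Finset.induction_on with
  | empty => rw [Finset.sum_empty, Finset.sum_empty, der_zero_dir]
  | insert i s hi ih => rw [Finset.sum_insert hi, Finset.sum_insert hi, der_add_dir, ih]

lemma der_base_mem {c : ℕ} (N : Submodule (Og (BaseC k)) (Fin c → Og (BaseC k)))
    (h : ∀ i : Fin k, ∀ s ∈ N, (fun j => der (0, Pi.single i 1) (s j)) ∈ N) (v : BaseC k)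
    (hv : v.1 = 0) (s) (hs : s ∈ N) : (fun j => der v (s j)) ∈ N := by
  have h1 : (fun j => der v (s j)) =
      ∑ i : Fin k, algebraMap ℂ (Og (BaseC k)) (v.2 i) •
        fun j => der ((0, Pi.single i 1) : BaseC k) (s j) := by
    have h2 : v = ∑ i : Fin k, v.2 i • ((0, Pi.single i 1) : BaseC k) := by
      refine Prod.ext ?_ ?_
      · rw [hv, Prod.fst_sum]
        simp
      · rw [Prod.snd_sum]
        funext j
        simp [Finset.sum_apply, Pi.single_apply]
    funext j
    rw [Finset.sum_apply]
    conv_lhs => rw [h2]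
    rw [der_sum_dir]
    refine Finset.sum_congr rfl fun i _ => ?_
    rw [der_smul_dir, Pi.smul_apply, smul_eq_mul, Algebra.smul_def]
  rw [h1]
  exact sum_mem fun i _ => N.smul_mem _ (h i s hs)

namespace IsGeneral

/-- A finite family of more cocycles than the rank is linearly dependent modulo coboundaries with
coefficients in the parameter. -/
lemma exists_relation (h : IsGeneral F l) {b : ℕ}
    (φ : Og (ℂ × PhaseC (k + 1)) →+ (Fin b → Og (BaseC k)))
    (hφ : ∀ a z, φ (plb l (up _ a) * z) = a • φ z)
    (hφ0 : ∀ z, φ z = 0 ↔ ∃ w, z - frameD (fun j => ham (F j)) (fun i => lin (l i)) 0 w ∈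
        Ideal.span (Set.range F))
    (m : Fin (b + 1) → Fin (k + 1) → Og (ℂ × PhaseC (k + 1)))
    (hm : ∀ r i j, ham (F j) (m r i) - ham (F i) (m r j) ∈ Ideal.span (Set.range F)) :
    ∃ r : Fin (b + 1) → Og ℂ, r ≠ 0 ∧ ∃ w,
      ∑ i, pl (ContinuousLinearMap.fst ℂ ℂ (PhaseC (k + 1))) (r i) *
        ((frameMat (fun j => ham (F j)) (fun i => lin (l i))).adjugate *ᵥ m i) 0 -
      frameD (fun j => ham (F j)) (fun i => lin (l i)) 0 w ∈ Ideal.span (Set.range F) := by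
  set z : Fin (b + 1) → Og (ℂ × PhaseC (k + 1)) := fun i =>
    ((frameMat (fun j => ham (F j)) (fun i => lin (l i))).adjugate *ᵥ m i) 0 with hz
  let f : (Fin (b + 1) → Og (BaseC k)) →ₗ[Og (BaseC k)] (Fin b → Og (BaseC k)) :=
    Fintype.linearCombination (Og (BaseC k)) (fun i => φ (z i))
  have hf : ∀ s, f s = 0 ↔ ∃ w, ∑ i, plb l (up _ (s i)) * z i -
      frameD (fun j => ham (F j)) (fun i => lin (l i)) 0 w ∈ Ideal.span (Set.range F) := by
    intro s
    rw [← hφ0, map_sum, Fintype.linearCombination_apply]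
    simp only [hφ]
  obtain ⟨r, hr, hrN⟩ := exists_const_relation (E := BaseC k)
    (π := ContinuousLinearMap.fst ℂ ℂ (Fin k → ℂ))
    (fun h0 => one_ne_zero (congrArg (fun L : BaseC k →L[ℂ] ℂ => L (1, 0)) h0))
    (LinearMap.ker f) (fun hker => by
      have := le_of_fin_injective (Og (BaseC k)) f (LinearMap.ker_eq_bot.1 hker)
      omega)
    (fun v hv s hs => der_base_mem _ (fun i s hs => by
      rw [LinearMap.mem_ker, hf] at hs ⊢
      obtain ⟨w, hw⟩ := hs
      exact h.exists_relation_der m hm s w hw i) v hv s hs)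
    (fun c s hc hs => by
      rw [LinearMap.mem_ker, map_smul] at hs
      exact (smul_eq_zero.1 hs).resolve_left hc)
  refine ⟨r, hr, ?_⟩
  have := (hf _).1 hrN
  simpa only [plb_up_fst] using this

theorem exists_basis (h : IsGeneral F l) :
    ∃ (ι : Type) (e : ι → (Fin (k + 1) → Og (ℂ × PhaseC (k + 1)))),
      (∀ a i j, ham (F j) (e a i) - ham (F i) (e a j) ∈ Ideal.span (Set.range F)) ∧
      ∀ m : Fin (k + 1) → Og (ℂ × PhaseC (k + 1)),
        (∀ i j, ham (F j) (m i) - ham (F i) (m j) ∈ Ideal.span (Set.range F)) →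
        ∃! c : ι →₀ Og ℂ, ∃ g, ∀ i, (m - c.sum fun a ψ => fun i =>
          pl (ContinuousLinearMap.fst ℂ ℂ (PhaseC (k + 1))) ψ * e a i) i - ham (F i) g ∈
          Ideal.span (Set.range F) := by
  obtain ⟨b, φ, hφ, hφ0⟩ := h.exists_coordinates
  have hfst : ContinuousLinearMap.fst ℂ ℂ (Fin k → ℂ) ≠ 0 := fun h0 =>
    one_ne_zero (congrArg (fun L : BaseC k →L[ℂ] ℂ => L (1, 0)) h0)
  refine exists_cohomology_basis
    (pl (ContinuousLinearMap.fst ℂ ℂ (PhaseC (k + 1)))).toRingHom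
    (fun i => (ham (F i)).toLinearMap.toAddMonoidHom)
    (fun i c z => ham_pl_fst_mul (F i) c z) (Ideal.span (Set.range F))
    (AddMonoidHom.mk' (fun m =>
      ((frameMat (fun j => ham (F j)) (fun i => lin (l i))).adjugate *ᵥ m) 0) fun m m' => by
        rw [mulVec_add, Pi.add_apply])
    (fun c m => ?_) φ (pl (ContinuousLinearMap.fst ℂ ℂ (Fin k → ℂ))).toRingHom
    (fun c z => ?_) (fun m hm => ?_) (fun g => ?_) (fun m hm h0 => ?_) (fun f hf => ?_)
    (fun v hv => ?_)
  · exact congrFun (mulVec_smul _ (pl (ContinuousLinearMap.fst ℂ ℂ (PhaseC (k + 1))) c) m) 0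
  · exact (congrArg (fun w => φ (w * z)) (plb_up_fst c).symm).trans
      (hφ (pl (ContinuousLinearMap.fst ℂ ℂ (Fin k → ℂ)) c) z)
  · refine (hφ0 _).2 ⟨0, ?_⟩
    rw [map_zero, sub_zero]
    change ∑ i, (frameMat (fun j => ham (F j)) (fun i => lin (l i))).adjugate 0 i * m i ∈ _
    exact sum_mem fun i _ => (Ideal.span (Set.range F)).mul_mem_left
      ((frameMat (fun j => ham (F j)) (fun i => lin (l i))).adjugate 0 i) (hm i)
  · refine (hφ0 _).2 ⟨g, ?_⟩
    rw [frameD_apply]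
    convert (Ideal.span (Set.range F)).zero_mem using 1
    exact sub_self _
  · obtain ⟨w, hw⟩ := (hφ0 _).1 h0
    exact h.exists_sub_ham_mem m hm w hw
  · obtain ⟨σ, hσ, hσf⟩ := exists_section hf hfst
    refine ⟨(pl σ).toRingHom, fun c => ?_, hσf⟩
    change pl σ (pl _ c) = c
    rw [pl_pl, hσ, pl_id]
  · obtain ⟨r, hr, hw⟩ := h.exists_relation φ hφ hφ0 v hv
    exact ⟨r, hr, (hφ0 _).2 hw⟩

end IsGeneral

end Core

end Og

/-- Derivations extend uniquely to algebraic extensions in characteristic zero. -/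
lemma exists_derivation_extension {A K : Type*} [CommRing A] [IsDomain A] [Algebra ℂ A] [Field K]
    [Algebra ℂ K] [Algebra A K] [IsScalarTower ℂ A K] [FaithfulSMul A K]
    [Algebra.IsAlgebraic A K] (D : Derivation ℂ A A) :
    ∃ θ : Derivation ℂ K K, ∀ a, θ (algebraMap A K a) = algebraMap A K (D a) := by
  let _ : Algebra (FractionRing A) K := FractionRing.liftAlgebra A K
  have _ : IsScalarTower A (FractionRing A) K := FractionRing.isScalarTower_liftAlgebra A K
  have _ : CharZero (FractionRing A) :=
    charZero_of_injective_algebraMap (R := ℂ) (algebraMap ℂ (FractionRing A)).injective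
  have _ : Algebra.IsAlgebraic (FractionRing A) K :=
    (IsFractionRing.comap_isAlgebraic_iff (A := A) (K := FractionRing A) (C := K)).1 inferInstance
  have _ : Algebra.FormallyEtale (FractionRing A) K := Algebra.FormallyEtale.of_isSeparable _ _
  have _ : Algebra.FormallyEtale A (FractionRing A) :=
    Algebra.FormallyEtale.of_isLocalization (nonZeroDivisors A)
  have _ : Algebra.FormallyEtale A K := Algebra.FormallyEtale.comp A (FractionRing A) K
  let L : KaehlerDifferential ℂ A →ₗ[A] K :=
    (Algebra.linearMap A K).comp D.liftKaehlerDifferential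
  let e := KaehlerDifferential.tensorKaehlerEquivOfFormallyEtale ℂ A K
  refine ⟨((L.liftBaseChange K).comp e.symm.toLinearMap).compDer (KaehlerDifferential.D ℂ K),
    fun a => ?_⟩
  change L.liftBaseChange K (e.symm (KaehlerDifferential.D ℂ K (algebraMap A K a))) = _
  rw [KaehlerDifferential.tensorKaehlerEquivOfFormallyEtale_symm_D_algebraMap,
    LinearMap.liftBaseChange_tmul, one_smul]
  change algebraMap A K (D.liftKaehlerDifferential (KaehlerDifferential.D ℂ A a)) = _
  rw [Derivation.liftKaehlerDifferential_comp_D]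

/-- The values of a derivation on a finite algebra span a finite submodule. -/
lemma exists_fg_forall_mem {R A B K : Type*} [CommRing R] [CommRing A] [CommRing B] [Algebra A B]
    [Module.Finite A B] [CommRing K] [Algebra B K] (f : R →+* B) (hf : Function.Surjective f)
    [Module R K] (hsm : ∀ (r : R) (z : K), r • z = algebraMap B K (f r) * z)
    (D : A → A) (θ : B →+ K)
    (hmul : ∀ a b, θ (a * b) = algebraMap B K a * θ b + algebraMap B K b * θ a)
    (hD : ∀ a, θ (algebraMap A B a) = algebraMap B K (algebraMap A B (D a))) :
    ∃ N : Submodule R K, N.FG ∧ ∀ b, θ b ∈ N := by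
  obtain ⟨s, hs⟩ := (inferInstance : Module.Finite A B).fg_top
  refine ⟨Submodule.span R ((insert 1 (s.image θ) : Finset K) : Set K), ⟨_, rfl⟩, fun b => ?_⟩
  have hone : ∀ b, algebraMap B K b ∈
      Submodule.span R ((insert 1 (s.image θ) : Finset K) : Set K) := fun b => by
    obtain ⟨r, rfl⟩ := hf b
    have := Submodule.smul_mem (Submodule.span R ((insert 1 (s.image θ) : Finset K) : Set K)) r
      (Submodule.subset_span (Finset.mem_coe.2 (Finset.mem_insert_self 1 (s.image θ))))
    rwa [hsm, mul_one] at this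
  have hsmul : ∀ b, ∀ z ∈ Submodule.span R ((insert 1 (s.image θ) : Finset K) : Set K),
      algebraMap B K b * z ∈ Submodule.span R ((insert 1 (s.image θ) : Finset K) : Set K) := by
    intro b z hz
    obtain ⟨r, rfl⟩ := hf b
    rw [← hsm]
    exact Submodule.smul_mem _ r hz
  have hb : b ∈ Submodule.span A (s : Set B) := hs ▸ Submodule.mem_top
  induction hb using Submodule.span_induction with
  | mem x hx =>
    exact Submodule.subset_span (Finset.mem_coe.2
      (Finset.mem_insert_of_mem (Finset.mem_image_of_mem θ hx)))
  | zero => rw [map_zero]; exact zero_mem _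
  | add x y _ _ hx hy => rw [map_add]; exact add_mem hx hy
  | smul a x _ hx =>
    rw [Algebra.smul_def, hmul, hD, ← map_mul]
    refine add_mem (hsmul _ _ hx) ?_
    rw [map_mul]
    exact hsmul _ _ (hone _)

section Rank

open Matrix

/-- Vectors in the kernel of a matrix of independent rows are combinations of independent
vectors of the kernel, when the numbers fit. -/
lemma exists_sum_smul_of_mulVec_eq_zero {K : Type*} [Field K] {n : ℕ}
    {M : Matrix (Fin n) (Fin n ⊕ Fin n) K} (hM : LinearIndependent K M)
    {v : Fin n → Fin n ⊕ Fin n → K} (hv : LinearIndependent K v) (hMv : ∀ i, M *ᵥ v i = 0)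
    {u : Fin n ⊕ Fin n → K} (hu : M *ᵥ u = 0) : ∃ c : Fin n → K, u = ∑ i, c i • v i := by
  have h1 : Module.finrank K (LinearMap.ker M.mulVecLin) = n := by
    have h2 := M.mulVecLin.finrank_range_add_finrank_ker
    have h3 : M.rank = n := by simpa using hM.rank_matrix
    have h4 : Module.finrank K (LinearMap.range M.mulVecLin) = n := h3
    rw [h4, Module.finrank_fintype_fun_eq_card, Fintype.card_sum, Fintype.card_fin] at h2
    omega
  have h2 : Submodule.span K (Set.range v) = LinearMap.ker M.mulVecLin := by
    refine Submodule.eq_of_le_of_finrank_eq (Submodule.span_le.2 ?_) ?_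
    · rintro _ ⟨i, rfl⟩
      exact hMv i
    · rw [finrank_span_eq_card hv, Fintype.card_fin, h1]
  have h3 : u ∈ Submodule.span K (Set.range v) := h2 ▸ hu
  obtain ⟨c, hc⟩ := (Submodule.mem_span_range_iff_exists_fun K).1 h3
  exact ⟨c, hc.symm⟩

lemma linearIndependent_of_det_ne_zero {K ι κ : Type*} [Field K] [Fintype ι] [DecidableEq ι]
    (v : ι → κ → K) (ρ : ι → κ) (h : (Matrix.of fun a b => v b (ρ a)).det ≠ 0) :
    LinearIndependent K v := by
  refine LinearIndependent.of_comp (LinearMap.funLeft K K ρ) ?_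
  have h1 := Matrix.linearIndependent_cols_of_det_ne_zero h
  exact h1

lemma exists_det_ne_zero {K : Type*} [Field K] {k : ℕ} {v : Fin k → Fin (k + 1) → K}
    (h : LinearIndependent K v) :
    ∃ j : Fin (k + 1), (Matrix.of fun a b => v b (j.succAbove a)).det ≠ 0 := by
  by_contra hcon
  push Not at hcon
  have hrank : ∃ w, w ∉ Submodule.span K (Set.range v) := by
    by_contra hw
    push Not at hw
    have h1 : Submodule.span K (Set.range v) = ⊤ := top_le_iff.1 fun w _ => hw w
    have h2 := finrank_span_eq_card h
    rw [h1, finrank_top, Module.finrank_fintype_fun_eq_card, Fintype.card_fin,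
      Fintype.card_fin] at h2
    omega
  obtain ⟨w, hw⟩ := hrank
  have h1 : LinearIndependent K (Fin.cons w v : Fin (k + 1) → Fin (k + 1) → K) :=
    linearIndependent_finCons.2 ⟨h, hw⟩
  have h2 : IsUnit (Matrix.of (Fin.cons w v : Fin (k + 1) → Fin (k + 1) → K)) :=
    Matrix.linearIndependent_rows_iff_isUnit.1 h1
  have h3 := (Matrix.isUnit_iff_isUnit_det _).1 h2
  refine h3.ne_zero ?_
  rw [Matrix.det_succ_row_zero]
  refine Finset.sum_eq_zero fun j _ => ?_
  have h4 : ((Matrix.of (Fin.cons w v : Fin (k + 1) → Fin (k + 1) → K)).submatrix Fin.succ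
      j.succAbove).det = 0 := by
    rw [← Matrix.det_transpose]
    exact hcon j
  rw [h4, mul_zero]

/-- A linear map whose rank is almost that of its target factors through a space of the dimension
of the target. -/
lemma exists_le_ker_finrank_quotient {K A : Type*} [Field K] [AddCommGroup A] [Module K A]
    [FiniteDimensional K A] {n : ℕ} (hA : Module.finrank K A = n + n) (f : A →ₗ[K] (Fin n → K)) :
    ∃ S ≤ LinearMap.ker f, Module.finrank K (A ⧸ S) = n := by
  have h1 := f.finrank_range_add_finrank_ker
  have h2 := Submodule.finrank_le (LinearMap.range f)
  rw [Module.finrank_fintype_fun_eq_card, Fintype.card_fin] at h2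
  obtain ⟨v, hv⟩ := exists_linearIndependent_of_le_finrank (R := K) (M := LinearMap.ker f) (n := n)
    (by omega)
  have hv' : LinearIndependent K fun i => (v i : A) := hv.map' _ (Submodule.ker_subtype _)
  refine ⟨Submodule.span K (Set.range fun i => (v i : A)), Submodule.span_le.2 ?_, ?_⟩
  · rintro _ ⟨i, rfl⟩
    exact (v i).2
  · have h3 := finrank_span_eq_card hv'
    rw [Fintype.card_fin] at h3
    have h4 := Submodule.finrank_quotient_add_finrank (Submodule.span K (Set.range fun i => (v i : A)))
    omega

end Rank

namespace Og

lemma coheight_le_card (e : ℕ) (P : PrimeSpectrum (Og (Fin e → ℂ))) : Order.coheight P ≤ e := by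
  let s : Finset (Og (Fin e → ℂ)) := Finset.univ.image fun i =>
    lin (ContinuousLinearMap.proj (R := ℂ) (φ := fun _ : Fin e => ℂ) i)
  have hs : (s : Set (Og (Fin e → ℂ))) ⊆ IsLocalRing.maximalIdeal (Og (Fin e → ℂ)) := by
    intro x hx
    obtain ⟨i, -, rfl⟩ := Finset.mem_image.1 hx
    exact mem_max.2 (ev_lin _)
  have h : Prim (P.asIdeal ⊔ Ideal.span (s : Set (Og (Fin e → ℂ)))) := by
    refine le_trans ?_ Ideal.le_radical
    refine le_trans ?_ le_sup_right
    rw [maximalIdeal_eq_span]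
    refine Ideal.span_le.2 ?_
    rintro _ ⟨l, rfl⟩
    have hl : l = ∑ i, l (Pi.single i 1) •
        ContinuousLinearMap.proj (R := ℂ) (φ := fun _ : Fin e => ℂ) i := by
      refine ContinuousLinearMap.ext fun x => ?_
      conv_lhs => rw [pi_eq_sum_univ' x, map_sum]
      simp [mul_comm]
    rw [hl, lin_sum]
    refine sum_mem fun i _ => ?_
    rw [lin_smul, Algebra.smul_def]
    exact Ideal.mul_mem_left _ _ (Ideal.subset_span
      (Finset.mem_coe.2 (Finset.mem_image_of_mem _ (Finset.mem_univ i))))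
  refine (coheight_le_of_prim hs h).trans ?_
  exact_mod_cast Finset.card_image_le.trans (Finset.card_univ.trans (Fintype.card_fin e)).le

section Normalization

variable {E : Type} [NormedAddCommGroup E] [NormedSpace ℂ E] [FiniteDimensional ℂ E]

lemma comap_pl_pi_eq_bot (P : PrimeSpectrum (Og E)) {e : ℕ} (he : Order.coheight P = e)
    (l : Fin e → E →L[ℂ] ℂ) (hl : Prim (P.asIdeal ⊔ Ideal.span (Set.range fun i => lin (l i))))
    {f : Og (Fin e → ℂ)} (hf : pl (ContinuousLinearMap.pi l) f ∈ P.asIdeal) : f = 0 := by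
  by_contra hf0
  have hfm : f ∈ IsLocalRing.maximalIdeal (Og (Fin e → ℂ)) := by
    rw [mem_max, ← ev_pl (ContinuousLinearMap.pi l)]
    exact mem_max.1 (IsLocalRing.le_maximalIdeal P.isPrime.ne_top hf)
  have hlt : ∀ Q : PrimeSpectrum (Og (Fin e → ℂ)), Ideal.span {f} ≤ Q.asIdeal →
      Order.coheight Q < e := by
    intro Q hQ
    refine lt_of_lt_of_le (Order.coheight_strictAnti ?_ ?_) (coheight_le_card e ⊥)
    · refine lt_of_le_of_ne bot_le fun h => hf0 ?_
      have : f ∈ (⊥ : PrimeSpectrum (Og (Fin e → ℂ))).asIdeal :=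
        h ▸ hQ (Ideal.mem_span_singleton_self f)
      exact this
    · exact lt_of_le_of_lt (coheight_le_card e Q) (ENat.natCast_lt_top e)
  obtain ⟨e', rfl⟩ : ∃ e', e = e' + 1 := by
    refine Nat.exists_eq_succ_of_ne_zero fun h0 => ?_
    have := hlt (IsLocalRing.closedPoint _) ((Ideal.span_singleton_le_iff_mem _).2 hfm)
    rw [h0] at this
    exact not_lt_bot this
  have hprim : Prim (Ideal.span {f} ⊔
      Ideal.span ((LinearMap.range (linHom (Fin (e' + 1) → ℂ)) : Submodule ℂ _) : Set _)) := by
    refine le_trans ?_ (le_sup_right.trans Ideal.le_radical)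
    rw [maximalIdeal_eq_span]
    refine Ideal.span_mono ?_
    rintro _ ⟨m, rfl⟩
    exact ⟨m, rfl⟩
  obtain ⟨y, hy, hyP, -⟩ := exists_generic
    (LinearMap.range (linHom (Fin (e' + 1) → ℂ))) (T := PEmpty.{1}) (fun _ => ℂ) e'
    (fun _ => ℂ) (fun t => t.elim) (Ideal.span {f})
    (fun Q hQ => by
      have := hlt Q hQ
      rw [Nat.cast_add, Nat.cast_one] at this
      exact Order.le_of_lt_add_one this) hprim (fun t => t.elim)
  have hym : ∀ i, y i ∈ IsLocalRing.maximalIdeal (Og (Fin (e' + 1) → ℂ)) := by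
    intro i
    obtain ⟨m, hm⟩ := hy i
    rw [← hm]
    exact mem_max.2 (ev_lin _)
  let s : Finset (Og E) := Finset.univ.image fun i => pl (ContinuousLinearMap.pi l) (y i)
  have hsm : (s : Set (Og E)) ⊆ IsLocalRing.maximalIdeal (Og E) := by
    intro x hx
    obtain ⟨i, -, rfl⟩ := Finset.mem_image.1 hx
    rw [SetLike.mem_coe, mem_max, ev_pl]
    exact mem_max.1 (hym i)
  have hs : Prim (P.asIdeal ⊔ Ideal.span (s : Set (Og E))) := by
    rw [prim_iff]
    intro Q hQ hPQ
    have hc : IsLocalRing.maximalIdeal (Og (Fin (e' + 1) → ℂ)) ≤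
        Q.comap (pl (ContinuousLinearMap.pi l)) := by
      refine prim_iff.1 hyP _ (hQ.comap _) (sup_le ?_ (Ideal.span_le.2 ?_))
      · rw [Ideal.span_singleton_le_iff_mem]
        exact hPQ (Ideal.mem_sup_left hf)
      · rintro _ ⟨i, rfl⟩
        exact hPQ (Ideal.mem_sup_right (Ideal.subset_span
          (Finset.mem_coe.2 (Finset.mem_image_of_mem _ (Finset.mem_univ i)))))
    refine prim_iff.1 hl Q hQ (sup_le (le_sup_left.trans hPQ) (Ideal.span_le.2 ?_))
    rintro _ ⟨i, rfl⟩
    have h1 : lin (ContinuousLinearMap.proj (R := ℂ) (φ := fun _ : Fin (e' + 1) => ℂ) i) ∈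
        Q.comap (pl (ContinuousLinearMap.pi l)) := hc (mem_max.2 (ev_lin _))
    have h2 : pl (ContinuousLinearMap.pi l)
        (lin (ContinuousLinearMap.proj (R := ℂ) (φ := fun _ : Fin (e' + 1) => ℂ) i)) =
        lin (l i) := by
      rw [pl_lin]
      rfl
    change lin (l i) ∈ Q
    rw [← h2]
    exact h1
  have h3 := coheight_le_of_prim hsm hs
  rw [he] at h3
  have h4 : s.card ≤ e' := Finset.card_image_le.trans (Finset.card_univ.trans (Fintype.card_fin e')).le
  have h5 : e' + 1 ≤ s.card := by exact_mod_cast h3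
  omega

/-- Noether normalization of a quotient by a prime, with coordinates in a prescribed space of linear
forms. -/
lemma exists_normalization (P : PrimeSpectrum (Og E)) {e : ℕ} (he : Order.coheight P = e)
    (Λ : Submodule ℂ (E →L[ℂ] ℂ)) (hΛ : Prim (P.asIdeal ⊔ Ideal.span (lin '' (Λ : Set _)))) :
    ∃ l : Fin e → E →L[ℂ] ℂ, (∀ i, l i ∈ Λ) ∧
      (∀ f, pl (ContinuousLinearMap.pi l) f ∈ P.asIdeal → f = 0) ∧
      ((Ideal.Quotient.mk P.asIdeal).comp (pl (ContinuousLinearMap.pi l)).toRingHom).Finite := by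
  obtain ⟨L, hL, hLP, -⟩ := exists_generic (Λ.map (linHom E)) (T := PEmpty.{1}) (fun _ => ℂ) e
    (fun _ => ℂ) (fun t => t.elim) P.asIdeal
    (fun Q hQ => he ▸ Order.coheight_anti (a := P) (b := Q) hQ) (by
      convert hΛ
      rfl) (fun t => t.elim)
  choose l hlΛ hl using hL
  have hl' : L = fun i => lin (l i) := funext fun i => (hl i).symm
  subst hl'
  have hinj := fun f => comap_pl_pi_eq_bot P he l hLP (f := f)
  refine ⟨l, hlΛ, hinj, finite_proj _ ?_ _ ?_⟩
  · by_contra hns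
    have h1 : LinearMap.range (ContinuousLinearMap.pi l : E →ₗ[ℂ] (Fin e → ℂ)) ≠ ⊤ := fun h =>
      hns (LinearMap.range_eq_top.1 h)
    obtain ⟨ξ, hξ, hξ0⟩ := Submodule.exists_le_ker_of_lt_top _ (lt_top_iff_ne_top.2 h1)
    refine hξ (LinearMap.ext fun v => ?_)
    have h2 : lin (LinearMap.toContinuousLinearMap ξ) = 0 := by
      refine hinj _ ?_
      have h3 : (LinearMap.toContinuousLinearMap ξ).comp (ContinuousLinearMap.pi l) = 0 :=
        ContinuousLinearMap.ext fun x => hξ0 ⟨x, rfl⟩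
      have h4 : lin (0 : E →L[ℂ] ℂ) = 0 := (linHom _).map_zero
      rw [pl_lin, h3, h4]
      exact zero_mem _
    have h5 : LinearMap.toContinuousLinearMap ξ = 0 :=
      lin_injective (h2.trans ((linHom _).map_zero).symm)
    exact congrArg (fun m : (Fin e → ℂ) →L[ℂ] ℂ => m v) h5
  · refine hLP.trans (Ideal.radical_mono (sup_le le_sup_left (Ideal.span_le.2 ?_)))
    rintro _ ⟨i, rfl⟩
    refine Ideal.mem_sup_right ?_
    have h2 : pl (ContinuousLinearMap.pi l)
        (lin (ContinuousLinearMap.proj (R := ℂ) (φ := fun _ : Fin e => ℂ) i)) =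
        lin (l i) := by
      rw [pl_lin]
      rfl
    change lin (l i) ∈ _
    rw [← h2]
    exact Ideal.mem_map_of_mem _ (mem_max.2 (ev_lin _))

end Normalization

end Og

/-- Lifting a derivation along a Noether normalization, with values in the field of fractions. -/
lemma exists_derivation_of_normalization {R A B K : Type*} [CommRing R] [Algebra ℂ R]
    [CommRing A] [IsDomain A] [Algebra ℂ A] [CommRing B] [IsDomain B] [Field K] [Algebra B K]
    [IsFractionRing B K] [Algebra R K] (q : R →+* B) (hq : Function.Surjective q)
    (hqK : ∀ r, algebraMap R K r = algebraMap B K (q r)) (ψ : A →ₐ[ℂ] R)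
    (hfin : (q.comp ψ.toRingHom).Finite) (hinj : ∀ a, q (ψ a) = 0 → a = 0)
    (D : Derivation ℂ A A) :
    ∃ θ : R →+ K, (∀ a b, θ (a * b) = a • θ b + b • θ a) ∧ (∀ c, θ (algebraMap ℂ R c) = 0) ∧
      (∀ r, q r = 0 → θ r = 0) ∧ (∀ a, θ (ψ a) = algebraMap R K (ψ (D a))) ∧
      ∃ N : Submodule R K, N.FG ∧ ∀ r, θ r ∈ N := by
  let _ : Algebra A B := (q.comp ψ.toRingHom).toAlgebra
  let _ : Algebra A K := ((algebraMap B K).comp (q.comp ψ.toRingHom)).toAlgebra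
  let _ : Algebra ℂ K := ((algebraMap R K).comp (algebraMap ℂ R)).toAlgebra
  have _ : Module.Finite A B := hfin
  have _ : IsScalarTower A B K := IsScalarTower.of_algebraMap_eq fun _ => rfl
  have _ : IsScalarTower ℂ A K := IsScalarTower.of_algebraMap_eq fun c => by
    change algebraMap R K (algebraMap ℂ R c) = algebraMap B K (q (ψ (algebraMap ℂ A c)))
    rw [hqK, AlgHom.commutes]
  have hAK : ∀ a, algebraMap A K a = algebraMap R K (ψ a) := fun a => (hqK _).symm
  have hBK : Function.Injective (algebraMap B K) := IsFractionRing.injective B K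
  have _ : FaithfulSMul A K := (faithfulSMul_iff_algebraMap_injective A K).2
    ((injective_iff_map_eq_zero _).2 fun a ha => hinj a
      ((injective_iff_map_eq_zero _).1 hBK _ ha))
  have _ : Algebra.IsAlgebraic A K := (IsFractionRing.isAlgebraic_iff' A B K).1 inferInstance
  obtain ⟨θ, hθ⟩ := exists_derivation_extension (K := K) D
  have hsm : ∀ (r : R) (z : K), r • z = algebraMap B K (q r) * z := fun r z => by
    rw [Algebra.smul_def, hqK]
  obtain ⟨N, hN, hθN⟩ := exists_fg_forall_mem q hq hsm D
    (θ.toLinearMap.toAddMonoidHom.comp (algebraMap B K).toAddMonoidHom)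
    (fun a b => by
      change θ (algebraMap B K (a * b)) = _
      rw [map_mul, Derivation.leibniz]
      rfl) (fun a => hθ a)
  refine ⟨(θ.toLinearMap.toAddMonoidHom.comp (algebraMap B K).toAddMonoidHom).comp
    q.toAddMonoidHom, fun a b => ?_, fun c => ?_, fun r hr => ?_, fun a => ?_, N, hN,
    fun r => hθN (q r)⟩
  · change θ (algebraMap B K (q (a * b))) = a • θ (algebraMap B K (q b)) + b • θ (algebraMap B K (q a))
    rw [map_mul, map_mul, Derivation.leibniz, hsm, hsm]
    rfl
  · change θ (algebraMap B K (q (algebraMap ℂ R c))) = 0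
    rw [← hqK]
    exact θ.map_algebraMap c
  · change θ (algebraMap B K (q r)) = 0
    rw [hr, map_zero, map_zero]
  · change θ (algebraMap B K (q (ψ a))) = _
    rw [← hAK]
    exact hθ a

namespace Og

variable {n : ℕ} {K : Type} [Field K] [Algebra (Og (ℂ × PhaseC n)) K]

/-- The derivations of a prime quotient along a Noether normalization satisfy the chain rule. -/
lemma exists_tangent (P : PrimeSpectrum (Og (ℂ × PhaseC n)))
    [Algebra (Og (ℂ × PhaseC n) ⧸ P.asIdeal) K]
    [IsScalarTower (Og (ℂ × PhaseC n)) (Og (ℂ × PhaseC n) ⧸ P.asIdeal) K]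
    [IsFractionRing (Og (ℂ × PhaseC n) ⧸ P.asIdeal) K] (ht : param n ∈ P.asIdeal)
    {e : ℕ} (he : Order.coheight P = e)
    (Λ : Submodule ℂ ((ℂ × PhaseC n) →L[ℂ] ℂ))
    (hΛ : Prim (P.asIdeal ⊔ Ideal.span (lin '' (Λ : Set _)))) :
    ∃ (l : Fin e → (ℂ × PhaseC n) →L[ℂ] ℂ) (θ : Fin e → Og (ℂ × PhaseC n) → K),
      (∀ i, l i ∈ Λ) ∧ (∀ i f, f ∈ P.asIdeal → θ i f = 0) ∧
      (∀ i f, θ i f = ∑ a, algebraMap _ K (der (sdir a) f) * θ i (lin (scoord a))) ∧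
      ∀ i j, θ i (lin (l j)) = if i = j then 1 else 0 := by
  obtain ⟨l, hl, hinj, hfin⟩ := exists_normalization P he Λ hΛ
  have hθ := fun i : Fin e => exists_derivation_of_normalization (K := K)
    (Ideal.Quotient.mk P.asIdeal) Ideal.Quotient.mk_surjective
    (fun r => IsScalarTower.algebraMap_apply _ _ K r) (pl (ContinuousLinearMap.pi l)) hfin
    (fun a ha => hinj a (Ideal.Quotient.eq_zero_iff_mem.1 ha))
    (der (Pi.single i (1 : ℂ) : Fin e → ℂ))
  choose θ hmul hc hP hψ N hN hθN using hθ
  have hP' : ∀ i f, f ∈ P.asIdeal → θ i f = 0 := fun i f hf =>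
    hP i f (Ideal.Quotient.eq_zero_iff_mem.2 hf)
  refine ⟨l, fun i => θ i, hl, hP', fun i f => ?_, fun i j => ?_⟩
  · have _ : Module.Finite (Og (ℂ × PhaseC n)) (N i) := Module.Finite.iff_fg.2 (hN i)
    have hsep : ∀ c : N i, (∀ k : ℕ, c ∈ IsLocalRing.maximalIdeal (Og (ℂ × PhaseC n)) ^ k •
        (⊤ : Submodule (Og (ℂ × PhaseC n)) (N i))) → c = 0 := by
      intro c hc
      have h1 := Ideal.iInf_pow_smul_eq_bot_of_isLocalRing (M := N i)
        (IsLocalRing.maximalIdeal (Og (ℂ × PhaseC n))) (IsLocalRing.maximalIdeal.isMaximal _).ne_top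
      exact (Submodule.mem_bot (Og (ℂ × PhaseC n))).1 (h1 ▸ Submodule.mem_iInf _ |>.2 hc)
    have h2 := der_eq_sum_coord hsep
      (AddMonoidHom.mk' (fun f => (⟨θ i f, hθN i f⟩ : N i)) fun a b => Subtype.ext ((θ i).map_add a b))
      (fun a b => Subtype.ext (hmul i a b)) (fun c => Subtype.ext (hc i c)) f
    have h3 := congrArg (N i).subtype h2
    rw [map_add, map_smul, map_sum] at h3
    have h4 : (N i).subtype ((AddMonoidHom.mk' (fun f => (⟨θ i f, hθN i f⟩ : N i))
        fun a b => Subtype.ext ((θ i).map_add a b)) (param n)) = 0 := hP' i _ ht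
    rw [h4, smul_zero, zero_add] at h3
    refine h3.trans (Finset.sum_congr rfl fun a _ => ?_)
    rw [map_smul, Algebra.smul_def]
    rfl
  · have h1 := hψ i (lin (ContinuousLinearMap.proj (R := ℂ) (φ := fun _ : Fin e => ℂ) j))
    rw [pl_lin, der_lin, AlgHom.commutes] at h1
    refine (show θ i (lin (l j)) = _ from h1).trans ?_
    rw [ContinuousLinearMap.proj_apply, Pi.single_apply]
    split_ifs with h h' h'
    · rw [map_one, map_one]
    · exact absurd h.symm h'
    · exact absurd h'.symm h
    · rw [map_zero, map_zero]


variable {n : ℕ}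

lemma ham_eq_sum (g f : Og (ℂ × PhaseC n)) :
    ham g f = ∑ a, der (sdir a) f * ham g (lin (scoord a)) := by
  have h := der_eq_sum_coord separated_self (ham g).toLinearMap.toAddMonoidHom
    (fun a b => Derivation.leibniz (ham g) a b) (fun c => Derivation.map_algebraMap (ham g) c) f
  have h0 : ham g (param n) = 0 := ham_param g
  refine h.trans ?_
  change _ • ham g (param n) + _ = _
  rw [h0, smul_zero, zero_add]
  rfl

lemma exists_ham_lin_eq_der_sdir (a : Fin n ⊕ Fin n) : ∃ l : (ℂ × PhaseC n) →L[ℂ] ℂ,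
    l (1, 0) = 0 ∧ ∀ g, ham g (lin l) = der (sdir a) g := by
  rcases a with i | i
  · refine ⟨-scoord (Sum.inr i), by simp [scoord], fun g => ?_⟩
    rw [ham_lin]
    simp [scoord, sdir, phaseDir, qdir, pdir, Pi.single_apply]
  · refine ⟨scoord (Sum.inl i), by simp [scoord], fun g => ?_⟩
    rw [ham_lin]
    simp [scoord, sdir, phaseDir, qdir, pdir, Pi.single_apply]

variable {K : Type} [Field K] [Algebra (Og (ℂ × PhaseC n)) K]

lemma algebraMap_ham_lin (g : Og (ℂ × PhaseC n)) (l : (ℂ × PhaseC n) →L[ℂ] ℂ) :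
    algebraMap (Og (ℂ × PhaseC n)) K (ham g (lin l)) =
      ∑ a, algebraMap (Og (ℂ × PhaseC n)) K (algebraMap ℂ (Og (ℂ × PhaseC n)) (l (sdir a))) *
        algebraMap (Og (ℂ × PhaseC n)) K (ham g (lin (scoord a))) := by
  rw [ham_eq_sum, map_sum]
  refine Finset.sum_congr rfl fun a _ => ?_
  rw [der_lin, map_mul]

/-- Along a prime where the differentials of the family are independent, the brackets with the
coordinates of a Noether normalization are independent. -/
lemma exists_linearIndependent_of_minor {F : Fin n → Og (ℂ × PhaseC n)}
    (hF : ∀ i j, poisP (F i) (F j) = 0) (P : PrimeSpectrum (Og (ℂ × PhaseC n)))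
    [Algebra (Og (ℂ × PhaseC n) ⧸ P.asIdeal) K]
    [IsScalarTower (Og (ℂ × PhaseC n)) (Og (ℂ × PhaseC n) ⧸ P.asIdeal) K]
    [IsFractionRing (Og (ℂ × PhaseC n) ⧸ P.asIdeal) K] (ht : param n ∈ P.asIdeal)
    (hFP : ∀ j, F j ∈ P.asIdeal) {e : ℕ} (he : Order.coheight P = e)
    (Λ : Submodule ℂ ((ℂ × PhaseC n) →L[ℂ] ℂ))
    (hΛ : Prim (P.asIdeal ⊔ Ideal.span (lin '' (Λ : Set _))))
    (ρ : Fin n → Fin n) (c : Fin n → Fin n ⊕ Fin n)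
    (hdet : (Matrix.of fun a b => der (sdir (c b)) (F (ρ a))).det ∉ P.asIdeal) :
    ∃ l : Fin e → (ℂ × PhaseC n) →L[ℂ] ℂ, (∀ i, l i ∈ Λ) ∧
      LinearIndependent K fun i j => algebraMap (Og (ℂ × PhaseC n)) K (ham (F j) (lin (l i))) := by
  obtain ⟨l, θ, hl, hθP, hθ, hθl⟩ := exists_tangent (K := K) P ht he Λ hΛ
  have hker : ∀ f, algebraMap (Og (ℂ × PhaseC n)) K f = 0 → f ∈ P.asIdeal := by
    intro f hf
    rw [IsScalarTower.algebraMap_apply _ (Og (ℂ × PhaseC n) ⧸ P.asIdeal) K] at hf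
    exact Ideal.Quotient.eq_zero_iff_mem.1 ((injective_iff_map_eq_zero _).1
      (IsFractionRing.injective (Og (ℂ × PhaseC n) ⧸ P.asIdeal) K) _ hf)
  set M : Matrix (Fin n) (Fin n ⊕ Fin n) K :=
    Matrix.of fun j a => algebraMap _ K (der (sdir a) (F j)) with hMdef
  set v : Fin n → Fin n ⊕ Fin n → K :=
    fun j a => algebraMap _ K (ham (F j) (lin (scoord a))) with hvdef
  have hM : LinearIndependent K M := by
    have h1 : LinearIndependent K fun b => M (ρ b) := by
      refine linearIndependent_of_det_ne_zero _ c fun h0 => hdet (hker _ ?_)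
      rw [← h0, RingHom.map_det, ← Matrix.det_transpose]
      rfl
    have h2 : Function.Bijective ρ :=
      Finite.injective_iff_bijective.1 fun a b hab => h1.injective (congrArg M hab)
    exact (linearIndependent_equiv (Equiv.ofBijective ρ h2)).1 h1
  have hv : LinearIndependent K v := by
    have hM' := Fintype.linearIndependent_iff.1 hM
    refine Fintype.linearIndependent_iff.2 fun g hg => ?_
    refine hM' g (funext fun a => ?_)
    obtain ⟨m, -, hm⟩ := exists_ham_lin_eq_der_sdir a
    rw [Finset.sum_apply]
    have h1 : ∀ j, (g j • M j) a =
        ∑ b, algebraMap (Og (ℂ × PhaseC n)) K (algebraMap ℂ (Og (ℂ × PhaseC n)) (m (sdir b))) * (g j • v j) b := by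
      intro j
      change g j * algebraMap _ K (der (sdir a) (F j)) = _
      rw [← hm, algebraMap_ham_lin, Finset.mul_sum]
      exact Finset.sum_congr rfl fun b _ => mul_left_comm _ _ _
    rw [Finset.sum_congr rfl fun j _ => h1 j, Finset.sum_comm]
    refine Finset.sum_eq_zero fun b _ => ?_
    rw [← Finset.mul_sum, ← Finset.sum_apply, hg]
    exact mul_zero _
  have hMv : ∀ i, Matrix.mulVec M (v i) = 0 := by
    intro i
    funext j
    change ∑ a, algebraMap _ K (der (sdir a) (F j)) *
      algebraMap _ K (ham (F i) (lin (scoord a))) = 0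
    simp_rw [← map_mul]
    rw [← map_sum, ← ham_eq_sum, ham_apply, hF, map_zero]
  have hMθ : ∀ i, Matrix.mulVec M (fun a => θ i (lin (scoord a))) = 0 := by
    intro i
    funext j
    exact (hθ i (F j)).symm.trans (hθP i _ (hFP j))
  choose d hd using fun i => exists_sum_smul_of_mulVec_eq_zero hM hv hMv (hMθ i)
  have hθlin : ∀ i m, θ i (lin m) = ∑ j, d i j * algebraMap _ K (ham (F j) (lin m)) := by
    intro i m
    rw [hθ]
    have h1 : ∀ a, θ i (lin (scoord a)) = ∑ j, d i j * v j a := fun a => by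
      have := congrFun (hd i) a
      rw [Finset.sum_apply] at this
      exact this
    simp_rw [algebraMap_ham_lin (K := K) _ m, h1, Finset.mul_sum]
    rw [Finset.sum_comm]
    refine Finset.sum_congr rfl fun j _ => Finset.sum_congr rfl fun a _ => ?_
    rw [der_lin]
    exact mul_left_comm _ _ _
  refine ⟨l, hl, Fintype.linearIndependent_iff.2 fun g hg i => ?_⟩
  have h1 : ∑ m, g m * θ i (lin (l m)) = g i := by
    simp_rw [hθl, mul_ite, mul_one, mul_zero]
    rw [Finset.sum_ite_eq, if_pos (Finset.mem_univ i)]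
  rw [← h1]
  simp_rw [hθlin, Finset.mul_sum]
  rw [Finset.sum_comm]
  refine Finset.sum_eq_zero fun j _ => ?_
  have h2 := congrFun hg j
  rw [Finset.sum_apply] at h2
  have h3 : ∑ m, g m * algebraMap _ K (ham (F j) (lin (l m))) = 0 := h2
  have h4 : ∀ m, g m * (d i j * algebraMap _ K (ham (F j) (lin (l m)))) =
      d i j * (g m * algebraMap _ K (ham (F j) (lin (l m)))) := fun m => mul_left_comm _ _ _
  rw [Finset.sum_congr rfl fun m _ => h4 m, ← Finset.mul_sum, h3, mul_zero]


variable {n : ℕ}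

lemma slice0_eq (f : Og (ℂ × PhaseC n)) :
    slice0 f = pl (ContinuousLinearMap.inr ℂ ℂ (PhaseC n)) f := rfl

/-- Dimension bounds on the special fibre bound the dimension of the primes containing the
parameter. -/
lemma coheight_le_of_slice {e : ℕ} {I : Ideal (Og (PhaseC n))}
    (hI : ringKrullDim (Og (PhaseC n) ⧸ I) ≤ e) (P : PrimeSpectrum (Og (ℂ × PhaseC n)))
    (ht : param n ∈ P.asIdeal)
    (hIP : I ≤ P.asIdeal.map (pl (ContinuousLinearMap.inr ℂ ℂ (PhaseC n))).toRingHom) :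
    Order.coheight P ≤ e := by
  set s : Og (ℂ × PhaseC n) →+* Og (PhaseC n) :=
    (pl (ContinuousLinearMap.inr ℂ ℂ (PhaseC n))).toRingHom with hs
  have hsurj : Function.Surjective s := fun f =>
    ⟨pl (ContinuousLinearMap.snd ℂ ℂ (PhaseC n)) f, by
      change pl _ (pl _ f) = f
      rw [pl_pl]
      exact pl_id f⟩
  have hker : RingHom.ker s ≤ P.asIdeal := by
    intro f hf
    have hinj : Function.Injective (ContinuousLinearMap.inr ℂ ℂ (PhaseC n)) := fun a b h =>
      congrArg Prod.snd h
    have h1 := mem_span_lin hinj (f := f) hf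
    refine (Ideal.span_le.2 ?_ : _ ≤ P.asIdeal) h1
    rintro _ ⟨l, hl, rfl⟩
    have h2 : l = l (1, 0) • ContinuousLinearMap.fst ℂ ℂ (PhaseC n) := by
      refine ContinuousLinearMap.ext fun x => ?_
      have h3 : l (0, x.2) = 0 := congrArg (fun m : PhaseC n →L[ℂ] ℂ => m x.2) hl
      have h4 : x = x.1 • ((1, 0) : ℂ × PhaseC n) + (0, x.2) := by
        refine Prod.ext ?_ ?_ <;> simp
      conv_lhs => rw [h4, map_add, map_smul, h3, add_zero]
      simp [mul_comm]
    change lin l ∈ P.asIdeal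
    rw [h2, lin_smul, Algebra.smul_def]
    exact P.asIdeal.mul_mem_left (algebraMap ℂ _ (l (1, 0))) ht
  have h1 : I.comap s ≤ P.asIdeal := by
    refine (Ideal.comap_mono hIP).trans ?_
    rw [Ideal.comap_map_of_surjective s hsurj]
    exact sup_le le_rfl hker
  refine coheight_le_of_ringKrullDim (I := I.comap s) ?_ P h1
  rw [ringKrullDim_eq_of_ringEquiv (RingEquiv.ofBijective (Ideal.quotientMap I s le_rfl)
    ⟨Ideal.quotientMap_injective, Ideal.quotientMap_surjective hsurj⟩)]
  exact hI

variable {H : Fin n → Og (PhaseC n)} {F : Fin n → Og (ℂ × PhaseC n)}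

lemma momentIdeal_le_map (hFH : ∀ i, slice0 (F i) = H i) (P : Ideal (Og (ℂ × PhaseC n)))
    (hFP : ∀ i, F i ∈ P) :
    momentIdeal H ≤ P.map (pl (ContinuousLinearMap.inr ℂ ℂ (PhaseC n))).toRingHom := by
  refine Ideal.span_le.2 ?_
  rintro _ ⟨i, rfl⟩
  rw [← hFH i]
  exact Ideal.mem_map_of_mem _ (hFP i)

lemma coheight_le_of_isReducedLagrangianCI (hred : IsReducedLagrangianCI H)
    (hFH : ∀ i, slice0 (F i) = H i) (P : PrimeSpectrum (Og (ℂ × PhaseC n)))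
    (ht : param n ∈ P.asIdeal) (hFP : ∀ i, F i ∈ P.asIdeal) : Order.coheight P ≤ n :=
  coheight_le_of_slice (I := momentIdeal H) hred.2.le P ht (momentIdeal_le_map hFH _ hFP)

lemma coheight_le_of_isPyramidal (hpyr : IsPyramidal H)
    (hFH : ∀ i, slice0 (F i) = H i) (P : PrimeSpectrum (Og (ℂ × PhaseC n)))
    (ht : param n ∈ P.asIdeal) (hFP : ∀ i, F i ∈ P.asIdeal) {r : ℕ} (hr : r < n)
    (hdet : ∀ (ρ : Fin (r + 1) → Fin n) (c : Fin (r + 1) → Fin n ⊕ Fin n),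
      (Matrix.of fun a b => der (sdir (c b)) (F (ρ a))).det ∈ P.asIdeal) :
    Order.coheight P ≤ r := by
  refine coheight_le_of_slice (hpyr r hr) P ht
    (sup_le (momentIdeal_le_map hFH _ hFP) (Ideal.span_le.2 ?_))
  rintro _ ⟨ρ, c, rfl⟩
  have h1 : (Matrix.of fun a b => pd (phaseDir (c b)) (H (ρ a))).det =
      (pl (ContinuousLinearMap.inr ℂ ℂ (PhaseC n))).toRingHom
        (Matrix.of fun a b => der (sdir (c b)) (F (ρ a))).det := by
    rw [RingHom.map_det]
    refine congrArg Matrix.det (Matrix.ext fun a b => ?_)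
    change der (phaseDir (c b)) (H (ρ a)) =
      pl (ContinuousLinearMap.inr ℂ ℂ (PhaseC n)) (der (sdir (c b)) (F (ρ a)))
    rw [← hFH, slice0_eq, der_pl]
    rfl
  rw [h1]
  exact Ideal.mem_map_of_mem _ (hdet ρ c)

end Og

/-- Generic choice of elements, moreover independent over the ground field. -/
lemma exists_generic_linearIndependent {R : Type} [CommRing R] [IsLocalRing R] [IsNoetherianRing R]
    [Algebra ℂ R] (Λ : Submodule ℂ R) [FiniteDimensional ℂ Λ] {T : Type} [Finite T]
    (K : T → Type) [∀ t, Field (K t)] [∀ t, Algebra ℂ (K t)] (e : ℕ) (V : T → Type)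
    [∀ t, AddCommGroup (V t)] [∀ t, Module (K t) (V t)] [∀ t, Module ℂ (V t)]
    [∀ t, IsScalarTower ℂ (K t) (V t)] [∀ t, FiniteDimensional (K t) (V t)]
    (q : ∀ t, R →ₗ[ℂ] V t) (J : Ideal R)
    (hJ : ∀ P : PrimeSpectrum R, J ≤ P.asIdeal → Order.coheight P ≤ e)
    (hΛ : Prim (J ⊔ Ideal.span Λ)) (he : e ≤ Module.finrank ℂ Λ)
    (hq : ∀ t, e ≤ Module.finrank (K t) (Submodule.span (K t) (q t '' Λ))) :
    ∃ L : Fin e → R, (∀ i, L i ∈ Λ) ∧ LinearIndependent ℂ L ∧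
      Prim (J ⊔ Ideal.span (Set.range L)) ∧
      ∀ t, LinearIndependent (K t) fun i => q t (L i) := by
  obtain ⟨p, hp⟩ := Λ.subtype.exists_leftInverse_of_injective Λ.ker_subtype
  let K' : Option T → Type := fun o => o.elim ℂ K
  let V' : Option T → Type := fun o => o.elim Λ V
  let i1 : ∀ o, Field (K' o) := fun o => match o with
    | none => (inferInstance : Field ℂ)
    | some t => (inferInstance : Field (K t))
  let i2 : ∀ o, Algebra ℂ (K' o) := fun o => match o with
    | none => (inferInstance : Algebra ℂ ℂ)
    | some t => (inferInstance : Algebra ℂ (K t))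
  let i3 : ∀ o, AddCommGroup (V' o) := fun o => match o with
    | none => (inferInstance : AddCommGroup Λ)
    | some t => (inferInstance : AddCommGroup (V t))
  let i4 : ∀ o, Module (K' o) (V' o) := fun o => match o with
    | none => (inferInstance : Module ℂ Λ)
    | some t => (inferInstance : Module (K t) (V t))
  let i5 : ∀ o, Module ℂ (V' o) := fun o => match o with
    | none => (inferInstance : Module ℂ Λ)
    | some t => (inferInstance : Module ℂ (V t))
  let i6 : ∀ o, IsScalarTower ℂ (K' o) (V' o) := fun o => match o with
    | none => (inferInstance : IsScalarTower ℂ ℂ Λ)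
    | some t => (inferInstance : IsScalarTower ℂ (K t) (V t))
  let i7 : ∀ o, FiniteDimensional (K' o) (V' o) := fun o => match o with
    | none => (inferInstance : FiniteDimensional ℂ Λ)
    | some t => (inferInstance : FiniteDimensional (K t) (V t))
  let q' : ∀ o, R →ₗ[ℂ] V' o := fun o => match o with
    | none => p
    | some t => q t
  obtain ⟨L, hL, hP, hli⟩ := exists_generic Λ K' e V' q' J hJ hΛ (by
    rintro (_ | t)
    · have h1 : p '' Λ = Set.univ := Set.eq_univ_of_forall fun x =>
        ⟨x, x.2, LinearMap.congr_fun hp x⟩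
      change e ≤ Module.finrank ℂ (Submodule.span ℂ (p '' Λ))
      rw [h1, Submodule.span_univ, finrank_top]
      exact he
    · exact hq t)
  refine ⟨L, hL, ?_, hP, fun t => hli (some t)⟩
  have h0 : LinearIndependent ℂ fun i => p (L i) := hli none
  exact LinearIndependent.of_comp p h0

lemma range_le_span_of_linearIndependent_mkQ {K A B : Type*} [Field K] [AddCommGroup A] [Module K A]
    [FiniteDimensional K A] [AddCommGroup B] [Module K B] (f : A →ₗ[K] B) {S : Submodule K A}
    (hS : S ≤ LinearMap.ker f) {n : ℕ} (hn : Module.finrank K (A ⧸ S) = n) (v : Fin n → A)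
    (hv : LinearIndependent K fun i => S.mkQ (v i)) :
    LinearMap.range f ≤ Submodule.span K (Set.range fun i => f (v i)) := by
  have h1 : Submodule.span K (Set.range fun i => S.mkQ (v i)) = ⊤ :=
    hv.span_eq_top_of_card_eq_finrank' (by rw [hn, Fintype.card_fin])
  rintro _ ⟨a, rfl⟩
  have h2 : S.mkQ a ∈ Submodule.span K (Set.range fun i => S.mkQ (v i)) := h1 ▸ Submodule.mem_top
  obtain ⟨c, hc⟩ := (Submodule.mem_span_range_iff_exists_fun K).1 h2
  have h3 : a - ∑ i, c i • v i ∈ S := by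
    rw [← Submodule.ker_mkQ S, LinearMap.mem_ker, map_sub, map_sum, ← hc, sub_eq_zero]
    simp only [map_smul]
  have h4 : f a = ∑ i, c i • f (v i) := by
    have := LinearMap.mem_ker.1 (hS h3)
    rw [map_sub, map_sum, sub_eq_zero] at this
    simpa only [map_smul] using this
  exact (Submodule.mem_span_range_iff_exists_fun K).2 ⟨c, h4.symm⟩

namespace Og

variable {n : ℕ}

/-- The Hamiltonian derivatives of a function along the components of `F`, evaluated in `K`. -/
noncomputable def hamVec (F : Fin n → Og (ℂ × PhaseC n)) (K : Type) [Field K]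
    [Algebra (Og (ℂ × PhaseC n)) K] [Algebra ℂ K] [IsScalarTower ℂ (Og (ℂ × PhaseC n)) K] :
    Og (ℂ × PhaseC n) →ₗ[ℂ] (Fin n → K) :=
  LinearMap.pi fun j =>
    (IsScalarTower.toAlgHom ℂ (Og (ℂ × PhaseC n)) K).toLinearMap ∘ₗ (ham (F j)).toLinearMap

/-- The fibrewise differential, evaluated in `K`. -/
noncomputable def diffVec (n : ℕ) (K : Type) [Field K]
    [Algebra (Og (ℂ × PhaseC n)) K] [Algebra ℂ K] [IsScalarTower ℂ (Og (ℂ × PhaseC n)) K] :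
    Og (ℂ × PhaseC n) →ₗ[ℂ] (Fin n ⊕ Fin n → K) :=
  LinearMap.pi fun a =>
    (IsScalarTower.toAlgHom ℂ (Og (ℂ × PhaseC n)) K).toLinearMap ∘ₗ
      (der (sdir (n := n) a)).toLinearMap

/-- The linear map expressing Hamiltonian derivatives through the differential. -/
noncomputable def hamMap (F : Fin n → Og (ℂ × PhaseC n)) (K : Type) [Field K]
    [Algebra (Og (ℂ × PhaseC n)) K] : (Fin n ⊕ Fin n → K) →ₗ[K] (Fin n → K) :=
  Matrix.mulVecLin
    (Matrix.of fun j a => algebraMap (Og (ℂ × PhaseC n)) K (ham (F j) (lin (scoord a))))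

variable {F : Fin n → Og (ℂ × PhaseC n)} {K : Type} [Field K]
    [Algebra (Og (ℂ × PhaseC n)) K] [Algebra ℂ K] [IsScalarTower ℂ (Og (ℂ × PhaseC n)) K]

lemma hamVec_apply (z : Og (ℂ × PhaseC n)) (j : Fin n) :
    hamVec F K z j = algebraMap (Og (ℂ × PhaseC n)) K (ham (F j) z) := rfl

lemma diffVec_apply (z : Og (ℂ × PhaseC n)) (a : Fin n ⊕ Fin n) :
    diffVec n K z a = algebraMap (Og (ℂ × PhaseC n)) K (der (sdir a) z) := rfl

lemma hamMap_diffVec (z : Og (ℂ × PhaseC n)) : hamMap F K (diffVec n K z) = hamVec F K z := by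
  funext j
  rw [hamVec_apply, ham_eq_sum, map_sum]
  change ∑ a, algebraMap (Og (ℂ × PhaseC n)) K (ham (F j) (lin (scoord a))) *
    algebraMap (Og (ℂ × PhaseC n)) K (der (sdir a) z) = _
  refine Finset.sum_congr rfl fun a _ => ?_
  rw [map_mul, mul_comm]

lemma span_diffVec_lin :
    Submodule.span K (diffVec n K '' LinearMap.range (linHom (ℂ × PhaseC n))) = ⊤ := by
  rw [eq_top_iff, ← (Pi.basisFun K (Fin n ⊕ Fin n)).span_eq, Submodule.span_le]
  rintro _ ⟨a, rfl⟩
  refine Submodule.subset_span ⟨lin (scoord a), ⟨scoord a, rfl⟩, ?_⟩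
  funext b
  rw [diffVec_apply, der_lin, Pi.basisFun_apply]
  have h : scoord a (sdir b) = if b = a then (1 : ℂ) else 0 := by
    rcases a with a | a <;> rcases b with b | b <;>
      simp [scoord, sdir, phaseDir, qdir, pdir, Pi.single_apply, eq_comm]
  rw [h, Pi.single_apply]
  split_ifs
  · rw [map_one, map_one]
  · rw [map_zero, map_zero]

lemma le_finrank_range_hamMap {r : ℕ} (ρ : Fin r → Fin n) (c : Fin r → Fin n ⊕ Fin n)
    (h : algebraMap (Og (ℂ × PhaseC n)) K
      (Matrix.of fun a b => der (sdir (c b)) (F (ρ a))).det ≠ 0) :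
    r ≤ Module.finrank K (LinearMap.range (hamMap F K)) := by
  choose m hm0 hm using exists_ham_lin_eq_der_sdir (n := n)
  have h1 : LinearIndependent K fun b => hamVec F K (lin (m (c b))) := by
    refine linearIndependent_of_det_ne_zero _ ρ fun h0 => h ?_
    rw [← h0, RingHom.map_det]
    refine congrArg Matrix.det (Matrix.ext fun a b => ?_)
    change algebraMap _ K (der (sdir (c b)) (F (ρ a))) =
      algebraMap _ K (ham (F (ρ a)) (lin (m (c b))))
    rw [hm]
  have h2 := finrank_span_eq_card h1
  rw [Fintype.card_fin] at h2
  rw [← h2]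
  refine Submodule.finrank_mono (Submodule.span_le.2 ?_)
  rintro _ ⟨b, rfl⟩
  exact ⟨_, hamMap_diffVec _⟩


variable {n : ℕ}

lemma prim_sup_span_lin (J : Ideal (Og (ℂ × PhaseC n))) :
    Prim (J ⊔ Ideal.span (LinearMap.range (linHom (ℂ × PhaseC n)) : Set (Og (ℂ × PhaseC n)))) := by
  refine le_trans ?_ Ideal.le_radical
  refine le_trans ?_ le_sup_right
  rw [maximalIdeal_eq_span]
  refine Ideal.span_mono ?_
  rintro _ ⟨l, rfl⟩
  exact ⟨l, rfl⟩

lemma finrank_phase (n : ℕ) : Module.finrank ℂ (ℂ × PhaseC n) = n + n + 1 := by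
  simp only [Module.finrank_prod, Module.finrank_self, Module.finrank_pi, Fintype.card_fin]
  exact add_comm _ _

lemma finrank_range_linHom :
    Module.finrank ℂ (LinearMap.range (linHom (ℂ × PhaseC n))) = n + n + 1 := by
  rw [LinearMap.finrank_range_of_inj lin_injective, ← finrank_phase n]
  rw [← LinearMap.toContinuousLinearMap.finrank_eq, Module.finrank_linearMap,
    Module.finrank_self, mul_one]

/-- Generic linear functions span the Hamiltonian directions along finitely many given primes. -/
lemma exists_lin_range_hamMap_le (F : Fin n → Og (ℂ × PhaseC n)) {T : Type} [Finite T]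
    (K : T → Type) [∀ t, Field (K t)] [∀ t, Algebra (Og (ℂ × PhaseC n)) (K t)]
    [∀ t, Algebra ℂ (K t)] [∀ t, IsScalarTower ℂ (Og (ℂ × PhaseC n)) (K t)]
    (J : Ideal (Og (ℂ × PhaseC n)))
    (hJ : ∀ P : PrimeSpectrum (Og (ℂ × PhaseC n)), J ≤ P.asIdeal → Order.coheight P ≤ n) :
    ∃ x : Fin n → (ℂ × PhaseC n) →L[ℂ] ℂ, LinearIndependent ℂ x ∧
      Prim (J ⊔ Ideal.span (Set.range fun i => lin (x i))) ∧
      ∀ t, LinearMap.range (hamMap F (K t)) ≤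
        Submodule.span (K t) (Set.range fun i => hamVec F (K t) (lin (x i))) := by
  choose S hS hSn using fun t => exists_le_ker_finrank_quotient (n := n)
    (by simp : Module.finrank (K t) (Fin n ⊕ Fin n → K t) = n + n) (hamMap F (K t))
  obtain ⟨L, hL, hLi, hP, hli⟩ := exists_generic_linearIndependent
    (LinearMap.range (linHom (ℂ × PhaseC n))) K n (fun t => (Fin n ⊕ Fin n → K t) ⧸ S t)
    (fun t => ((S t).mkQ.restrictScalars ℂ) ∘ₗ diffVec n (K t)) J hJ (prim_sup_span_lin J)
    (by rw [finrank_range_linHom]; omega) (by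
      intro t
      have h1 : (((S t).mkQ.restrictScalars ℂ) ∘ₗ diffVec n (K t)) ''
          (LinearMap.range (linHom (ℂ × PhaseC n))) =
          (S t).mkQ '' (diffVec n (K t) '' LinearMap.range (linHom (ℂ × PhaseC n))) := by
        rw [Set.image_image]
        rfl
      rw [h1, ← Submodule.map_span, span_diffVec_lin, Submodule.map_top, Submodule.range_mkQ,
        finrank_top, hSn])
  choose x hx using hL
  have hx' : L = fun i => lin (x i) := funext fun i => (hx i).symm
  refine ⟨x, LinearIndependent.of_comp (linHom (ℂ × PhaseC n)) ?_, ?_, fun t => ?_⟩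
  · rw [hx'] at hLi
    exact hLi
  · rw [hx'] at hP
    exact hP
  · have h1 := range_le_span_of_linearIndependent_mkQ (hamMap F (K t)) (hS t) (hSn t)
      (fun i => diffVec n (K t) (L i)) (hli t)
    simp_rw [hamMap_diffVec, hx'] at h1
    exact h1

end Og

section MinimalPrimes

variable {R : Type*} [CommRing R]

lemma mem_minimalPrimes_of_coheight {J : Ideal R} {k : ℕ}
    (hJ : ∀ P : PrimeSpectrum R, J ≤ P.asIdeal → Order.coheight P ≤ k) {P : PrimeSpectrum R}
    (hP : J ≤ P.asIdeal) (hPk : Order.coheight P = k) : P.asIdeal ∈ J.minimalPrimes := by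
  obtain ⟨Q, hQ, hQP⟩ := Ideal.exists_minimalPrimes_le hP
  have h3 : (⟨Q, hQ.1.1⟩ : PrimeSpectrum R) ≤ P := hQP
  rcases h3.eq_or_lt with h4 | h4
  · rw [← h4]
    exact hQ
  · have h5 := Order.coheight_strictAnti h4 (by rw [hPk]; exact ENat.natCast_lt_top k)
    rw [hPk] at h5
    exact absurd (hJ ⟨Q, hQ.1.1⟩ hQ.1.2) (not_le.2 h5)

instance finite_minimalPrimes_subtype [IsNoetherianRing R] (J : Ideal R) :
    Finite {P : PrimeSpectrum R // P.asIdeal ∈ J.minimalPrimes} := by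
  have h1 := (Ideal.finite_minimalPrimes_of_isNoetherianRing R J).to_subtype
  refine Finite.of_injective (β := J.minimalPrimes) (fun P => ⟨P.1.asIdeal, P.2⟩) ?_
  intro P Q hPQ
  exact Subtype.ext (PrimeSpectrum.ext (congrArg Subtype.val hPQ))

end MinimalPrimes

namespace Og

variable {n k : ℕ}

/-- The ideal of the special fibre. -/
noncomputable def fibI (F : Fin n → Og (ℂ × PhaseC n)) : Ideal (Og (ℂ × PhaseC n)) :=
  Ideal.span (Set.range F) ⊔ Ideal.span {param n}

lemma fibI_le {F : Fin n → Og (ℂ × PhaseC n)} {P : Ideal (Og (ℂ × PhaseC n))} :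
    fibI F ≤ P ↔ (∀ i, F i ∈ P) ∧ param n ∈ P := by
  rw [fibI, sup_le_iff, Ideal.span_le, Ideal.span_singleton_le_iff_mem, Set.range_subset_iff]
  rfl

/-- The dimension conditions satisfied by deformations of pyramidal mappings. -/
structure IsPyr (F : Fin n → Og (ℂ × PhaseC n)) : Prop where
  comm : ∀ i j, poisP (F i) (F j) = 0
  coheight_le : ∀ P : PrimeSpectrum (Og (ℂ × PhaseC n)), fibI F ≤ P.asIdeal → Order.coheight P ≤ n
  coheight_le_of_minors : ∀ P : PrimeSpectrum (Og (ℂ × PhaseC n)), fibI F ≤ P.asIdeal →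
    ∀ r < n, (∀ (ρ : Fin (r + 1) → Fin n) (c : Fin (r + 1) → Fin n ⊕ Fin n),
      (Matrix.of fun a b => der (sdir (c b)) (F (ρ a))).det ∈ P.asIdeal) → Order.coheight P ≤ r

variable {F : Fin (k + 1) → Og (ℂ × PhaseC (k + 1))}

/-- The ideal of the locus in the special fibre where the differentials are dependent. -/
noncomputable def critI (F : Fin n → Og (ℂ × PhaseC n)) : Ideal (Og (ℂ × PhaseC n)) :=
  fibI F ⊔ Ideal.span (Set.range fun s : (Fin n → Fin n) × (Fin n → Fin n ⊕ Fin n) =>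
    (Matrix.of fun a b => der (sdir (s.2 b)) (F (s.1 a))).det)

lemma IsPyr.coheight_le_of_critI (h : IsPyr F) (P : PrimeSpectrum (Og (ℂ × PhaseC (k + 1))))
    (hP : critI F ≤ P.asIdeal) : Order.coheight P ≤ k :=
  h.coheight_le_of_minors P (le_sup_left.trans hP) k (Nat.lt_succ_self k) fun ρ c =>
    (le_sup_right.trans hP) (Ideal.subset_span ⟨(ρ, c), rfl⟩)

lemma hamVec_lin_mem_span {K : Type} [Field K]
    [Algebra (Og (ℂ × PhaseC n)) K] [Algebra ℂ K] [IsScalarTower ℂ (Og (ℂ × PhaseC n)) K]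
    {F : Fin n → Og (ℂ × PhaseC n)} {ι : Type*} (x : ι → (ℂ × PhaseC n) →L[ℂ] ℂ)
    {l : (ℂ × PhaseC n) →L[ℂ] ℂ} (hl : l ∈ Submodule.span ℂ (Set.range x)) :
    hamVec F K (lin l) ∈ Submodule.span K (Set.range fun i => hamVec F K (lin (x i))) := by
  have h1 : Submodule.span ℂ (Set.range x) ≤
      ((Submodule.span K (Set.range fun i => hamVec F K (lin (x i)))).restrictScalars ℂ).comap
        (hamVec F K ∘ₗ linHom (ℂ × PhaseC n)) := by
    refine Submodule.span_le.2 ?_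
    rintro _ ⟨i, rfl⟩
    exact Submodule.subset_span (s := Set.range fun i => hamVec F K (lin (x i))) ⟨i, rfl⟩
  exact h1 hl

variable (κ : PrimeSpectrum (Og (ℂ × PhaseC (k + 1))) → Type) [∀ P, Field (κ P)]
  [∀ P, Algebra (Og (ℂ × PhaseC (k + 1))) (κ P)]
  [∀ P, Algebra (Og (ℂ × PhaseC (k + 1)) ⧸ P.asIdeal) (κ P)]
  [∀ P, IsScalarTower (Og (ℂ × PhaseC (k + 1))) (Og (ℂ × PhaseC (k + 1)) ⧸ P.asIdeal) (κ P)]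
  [∀ P, IsFractionRing (Og (ℂ × PhaseC (k + 1)) ⧸ P.asIdeal) (κ P)]

lemma mem_of_algebraMap_eq_zero (P : PrimeSpectrum (Og (ℂ × PhaseC (k + 1))))
    {f : Og (ℂ × PhaseC (k + 1))} (hf : algebraMap (Og (ℂ × PhaseC (k + 1))) (κ P) f = 0) :
    f ∈ P.asIdeal := by
  rw [IsScalarTower.algebraMap_apply _ (Og (ℂ × PhaseC (k + 1)) ⧸ P.asIdeal) (κ P)] at hf
  exact Ideal.Quotient.eq_zero_iff_mem.1 ((injective_iff_map_eq_zero _).1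
    (IsFractionRing.injective (Og (ℂ × PhaseC (k + 1)) ⧸ P.asIdeal) (κ P)) _ hf)

variable [∀ P, Algebra ℂ (κ P)] [∀ P, IsScalarTower ℂ (Og (ℂ × PhaseC (k + 1))) (κ P)]

/-- In general position, the linear functions have independent Hamiltonian derivatives along all
primes of large dimension. -/
lemma IsPyr.exists_lin (h : IsPyr F) :
    ∃ x : Fin (k + 1) → (ℂ × PhaseC (k + 1)) →L[ℂ] ℂ, LinearIndependent ℂ x ∧
      Prim (fibI F ⊔ Ideal.span (Set.range fun i => lin (x i))) ∧
      ∀ P : PrimeSpectrum (Og (ℂ × PhaseC (k + 1))), fibI F ≤ P.asIdeal →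
        ∀ e : ℕ, Order.coheight P = e → k ≤ e → e ≤ Module.finrank (κ P)
          (Submodule.span (κ P)
            (Set.range fun i => hamVec F (κ P) (lin (x i)))) := by
  obtain ⟨x, hx, hxP, hxr⟩ := exists_lin_range_hamMap_le F
    (T := {P : PrimeSpectrum (Og (ℂ × PhaseC (k + 1))) // P.asIdeal ∈ (critI F).minimalPrimes})
    (fun P => κ P.1) (fibI F) h.coheight_le
  refine ⟨x, hx, hxP, fun P hP e he hke => ?_⟩
  have hker : ∀ f, f ∉ P.asIdeal →
      algebraMap (Og (ℂ × PhaseC (k + 1))) (κ P) f ≠ 0 := fun f hf h0 =>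
    hf (mem_of_algebraMap_eq_zero κ P h0)
  by_cases hc : critI F ≤ P.asIdeal
  · have h1 := h.coheight_le_of_critI P hc
    rw [he] at h1
    have hek : e = k := le_antisymm (by exact_mod_cast h1) hke
    have hmin := mem_minimalPrimes_of_coheight h.coheight_le_of_critI hc (hek ▸ he)
    refine le_trans ?_ (Submodule.finrank_mono (hxr ⟨P, hmin⟩))
    rcases k with _ | r
    · exact hek.le.trans (Nat.zero_le _)
    · rw [hek]
      by_contra hlt
      have h2 := h.coheight_le_of_minors P hP r (by omega) fun ρ c => by
        by_contra hdet
        exact hlt (le_finrank_range_hamMap ρ c (hker _ hdet))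
      rw [he, hek] at h2
      have h3 : r + 1 ≤ r := by exact_mod_cast h2
      omega
  · obtain ⟨ρ, c, hdet⟩ : ∃ (ρ : Fin (k + 1) → Fin (k + 1))
        (c : Fin (k + 1) → Fin (k + 1) ⊕ Fin (k + 1)),
        (Matrix.of fun a b => der (sdir (c b)) (F (ρ a))).det ∉ P.asIdeal := by
      by_contra hcon
      push Not at hcon
      refine hc (sup_le hP (Ideal.span_le.2 ?_))
      rintro _ ⟨s, rfl⟩
      exact hcon s.1 s.2
    obtain ⟨l, hl, hli⟩ := exists_linearIndependent_of_minor (K := (κ P))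
      h.comm P (fibI_le.1 hP).2 (fibI_le.1 hP).1 he (Submodule.span ℂ (Set.range x))
      (hxP.mono (sup_le_sup hP (Ideal.span_mono (by
        rintro _ ⟨i, rfl⟩
        exact ⟨x i, Submodule.subset_span ⟨i, rfl⟩, rfl⟩)))) ρ c hdet
    have h2 := finrank_span_eq_card hli
    rw [Fintype.card_fin] at h2
    rw [← h2]
    refine Submodule.finrank_mono (Submodule.span_le.2 ?_)
    rintro _ ⟨i, rfl⟩
    exact hamVec_lin_mem_span x (hl i)


variable {k n : ℕ}

/-- The determinant of the Hamiltonian derivatives of linear functions. -/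
noncomputable def linDet (F : Fin (k + 1) → Og (ℂ × PhaseC (k + 1)))
    (l : Fin (k + 1) → (ℂ × PhaseC (k + 1)) →L[ℂ] ℂ) : Og (ℂ × PhaseC (k + 1)) :=
  (frameMat (fun j => ham (F j)) (fun i => lin (l i))).det

lemma algebraMap_linDet_ne_zero {K : Type} [Field K]
    [Algebra (Og (ℂ × PhaseC (k + 1))) K] [Algebra ℂ K] [IsScalarTower ℂ (Og (ℂ × PhaseC (k + 1))) K]
    {F : Fin (k + 1) → Og (ℂ × PhaseC (k + 1))} {l : Fin (k + 1) → (ℂ × PhaseC (k + 1)) →L[ℂ] ℂ}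
    (h : k + 1 ≤ Module.finrank K (Submodule.span K (Set.range fun i => hamVec F K (lin (l i))))) :
    algebraMap (Og (ℂ × PhaseC (k + 1))) K (linDet F l) ≠ 0 := by
  have h1 : LinearIndependent K (Matrix.of fun i => hamVec F K (lin (l i))) := by
    refine linearIndependent_iff_card_le_finrank_span.2 ?_
    rw [Fintype.card_fin]
    exact h
  have h2 := (Matrix.isUnit_iff_isUnit_det _).1 (Matrix.linearIndependent_rows_iff_isUnit.1 h1)
  have h3 : algebraMap (Og (ℂ × PhaseC (k + 1))) K (linDet F l) =
      (Matrix.of fun i => hamVec F K (lin (l i))).det := by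
    rw [linDet, RingHom.map_det, ← Matrix.det_transpose]
    rfl
  rw [h3]
  exact h2.ne_zero

lemma linDet_mem_span {F : Fin (k + 1) → Og (ℂ × PhaseC (k + 1))} {x l : Fin (k + 1) → (ℂ × PhaseC (k + 1)) →L[ℂ] ℂ}
    (h : ∀ i, x i ∈ Submodule.span ℂ (Set.range l)) :
    linDet F x ∈ Ideal.span {linDet F l} := by
  choose N hN using fun i => (Submodule.mem_span_range_iff_exists_fun ℂ).1 (h i)
  have h1 : frameMat (fun j => ham (F j)) (fun i => lin (x i)) =
      frameMat (fun j => ham (F j)) (fun i => lin (l i)) *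
        Matrix.of fun a i => algebraMap ℂ (Og (ℂ × PhaseC (k + 1))) (N i a) := by
    refine Matrix.ext fun j i => ?_
    change ham (F j) (lin (x i)) = ∑ a, ham (F j) (lin (l a)) * algebraMap ℂ _ (N i a)
    rw [← hN i, lin_sum, map_sum]
    refine Finset.sum_congr rfl fun a _ => ?_
    rw [lin_smul, Derivation.map_smul, Algebra.smul_def, mul_comm]
  rw [linDet, linDet, h1, Matrix.det_mul]
  exact Ideal.mul_mem_right _ _ (Ideal.mem_span_singleton_self _)

lemma lin_mem_of_mem_span {x : (ℂ × PhaseC n) →L[ℂ] ℂ} {ι : Type*}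
    {l : ι → (ℂ × PhaseC n) →L[ℂ] ℂ} (h : x ∈ Submodule.span ℂ (Set.range l)) :
    lin x ∈ Ideal.span (Set.range fun i => lin (l i)) := by
  have h1 : Submodule.span ℂ (Set.range l) ≤
      ((Ideal.span (Set.range fun i => lin (l i))).restrictScalars ℂ).comap
        (linHom (ℂ × PhaseC n)) := by
    refine Submodule.span_le.2 ?_
    rintro _ ⟨i, rfl⟩
    exact Ideal.subset_span (s := Set.range fun i => lin (l i)) ⟨i, rfl⟩
  exact h1 h

variable {F : Fin (k + 1) → Og (ℂ × PhaseC (k + 1))}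
  (κ : PrimeSpectrum (Og (ℂ × PhaseC (k + 1))) → Type) [∀ P, Field (κ P)]
  [∀ P, Algebra (Og (ℂ × PhaseC (k + 1))) (κ P)]
  [∀ P, Algebra (Og (ℂ × PhaseC (k + 1)) ⧸ P.asIdeal) (κ P)]
  [∀ P, IsScalarTower (Og (ℂ × PhaseC (k + 1))) (Og (ℂ × PhaseC (k + 1)) ⧸ P.asIdeal) (κ P)]
  [∀ P, IsFractionRing (Og (ℂ × PhaseC (k + 1)) ⧸ P.asIdeal) (κ P)]
  [∀ P, Algebra ℂ (κ P)] [∀ P, IsScalarTower ℂ (Og (ℂ × PhaseC (k + 1))) (κ P)]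

set_option maxHeartbeats 1000000 in
/-- Linear coordinates in general position. -/
lemma IsPyr.exists_coords (h : IsPyr F) :
    ∃ l : Fin (k + 1) → (ℂ × PhaseC (k + 1)) →L[ℂ] ℂ,
      Prim (fibI F ⊔ Ideal.span (Set.range fun i => lin (l i))) ∧
      Prim (fibI F ⊔ Ideal.span {linDet F l} ⊔
        Ideal.span (Set.range fun i : Fin k => lin (l i.succ))) ∧
      ∀ P : PrimeSpectrum (Og (ℂ × PhaseC (k + 1))), fibI F ⊔ Ideal.span {linDet F l} ≤ P.asIdeal →
        Order.coheight P ≤ k ∧ (Order.coheight P = k →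
          LinearIndependent (κ P) fun i : Fin k => hamVec F (κ P) (lin (l i.succ))) := by
  obtain ⟨x, hx, hxP, hxr⟩ := h.exists_lin κ
  have hco : ∀ P : PrimeSpectrum (Og (ℂ × PhaseC (k + 1))),
      fibI F ⊔ Ideal.span {linDet F x} ≤ P.asIdeal → Order.coheight P ≤ k := by
    intro P hP
    have h1 := h.coheight_le P (le_sup_left.trans hP)
    obtain ⟨e, he⟩ := ENat.ne_top_iff_exists.1 (ne_top_of_le_ne_top (ENat.natCast_ne_top _) h1)
    rw [← he] at h1 ⊢
    have h2 : e ≤ k + 1 := by exact_mod_cast h1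
    have h3 : e ≠ k + 1 := by
      rintro rfl
      refine algebraMap_linDet_ne_zero
        (hxr P (le_sup_left.trans hP) (k + 1) he.symm (Nat.le_succ k)) ?_
      have h4 : linDet F x ∈ P.asIdeal :=
        (le_sup_right.trans hP) (Ideal.mem_span_singleton_self _)
      rw [IsScalarTower.algebraMap_apply _ (Og (ℂ × PhaseC (k + 1)) ⧸ P.asIdeal) (κ P)]
      refine (congrArg _ (Ideal.Quotient.eq_zero_iff_mem.2 h4)).trans (map_zero _)
    exact_mod_cast (by omega : e ≤ k)
  set J := fibI F ⊔ Ideal.span {linDet F x} with hJ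
  have hLI : LinearIndependent ℂ fun i => lin (x i) :=
    hx.map' (linHom (ℂ × PhaseC (k + 1))) (LinearMap.ker_eq_bot.2 lin_injective)
  have hfd : FiniteDimensional ℂ (Submodule.span ℂ (Set.range fun i => lin (x i))) :=
    FiniteDimensional.span_of_finite ℂ (Set.finite_range _)
  let T := {P : {P : PrimeSpectrum (Og (ℂ × PhaseC (k + 1))) // P.asIdeal ∈ J.minimalPrimes} //
    Order.coheight P.1 = k}
  obtain ⟨L, hL, hLi, hP, hli⟩ := exists_generic_linearIndependent
    (Submodule.span ℂ (Set.range fun i => lin (x i))) (T := T) (fun P => κ P.1.1) k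
    (fun P => Fin (k + 1) → κ P.1.1) (fun P => hamVec F (κ P.1.1)) J hco
    (hxP.mono (sup_le_sup le_sup_left (Ideal.span_mono Submodule.subset_span)))
    (by rw [finrank_span_eq_card hLI, Fintype.card_fin]; exact Nat.le_succ k) (by
      intro P
      refine (hxr P.1.1 (le_sup_left.trans P.1.2.1.2) k P.2 le_rfl).trans
        (Submodule.finrank_mono (Submodule.span_mono ?_))
      rintro _ ⟨i, rfl⟩
      exact ⟨_, Submodule.subset_span ⟨i, rfl⟩, rfl⟩)
  have hmap : Submodule.span ℂ (Set.range fun i => lin (x i)) =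
      (Submodule.span ℂ (Set.range x)).map (linHom (ℂ × PhaseC (k + 1))) := by
    rw [Submodule.map_span, ← Set.range_comp]
    rfl
  simp_rw [hmap] at hL
  choose y hyx hy using hL
  have hy' : L = fun i => lin (y i) := funext fun i => (hy i).symm
  have hyli : LinearIndependent ℂ y :=
    LinearIndependent.of_comp (linHom (ℂ × PhaseC (k + 1))) (by rw [hy'] at hLi; exact hLi)
  obtain ⟨y0, hy0, hy0n⟩ : ∃ y0 ∈ Submodule.span ℂ (Set.range x),
      y0 ∉ Submodule.span ℂ (Set.range y) := by
    by_contra hcon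
    push Not at hcon
    have h1 := Submodule.finrank_mono (show Submodule.span ℂ (Set.range x) ≤ _ from hcon)
    rw [finrank_span_eq_card hx, finrank_span_eq_card hyli, Fintype.card_fin,
      Fintype.card_fin] at h1
    omega
  set l : Fin (k + 1) → (ℂ × PhaseC (k + 1)) →L[ℂ] ℂ := Fin.cons y0 y with hl
  have hlli : LinearIndependent ℂ l := linearIndependent_finCons.2 ⟨hyli, hy0n⟩
  have hspan : Submodule.span ℂ (Set.range l) = Submodule.span ℂ (Set.range x) := by
    refine Submodule.eq_of_le_of_finrank_eq (Submodule.span_le.2 ?_) ?_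
    · rintro _ ⟨i, rfl⟩
      refine Fin.cases ?_ (fun i => ?_) i
      · exact hy0
      · exact hyx i
    · rw [finrank_span_eq_card hx, finrank_span_eq_card hlli]
  have hxl : ∀ i, x i ∈ Submodule.span ℂ (Set.range l) := fun i => by
    rw [hspan]
    exact Submodule.subset_span ⟨i, rfl⟩
  have hJle : J ≤ fibI F ⊔ Ideal.span {linDet F l} :=
    sup_le_sup le_rfl ((Ideal.span_singleton_le_iff_mem _).2 (linDet_mem_span hxl))
  refine ⟨l, hxP.mono (sup_le_sup le_rfl (Ideal.span_le.2 ?_)), ?_, fun P hPl => ?_⟩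
  · rintro _ ⟨i, rfl⟩
    exact lin_mem_of_mem_span (hxl i)
  · rw [hy'] at hP
    exact hP.mono (sup_le_sup hJle le_rfl)
  · have hPJ := hJle.trans hPl
    refine ⟨hco P hPJ, fun hPk => ?_⟩
    have h1 := hli ⟨⟨P, mem_minimalPrimes_of_coheight hco hPJ hPk⟩, hPk⟩
    rw [hy'] at h1
    exact h1

end Og

section Minors

variable {R : Type*} [CommRing R]

lemma det_mul_mem_of_mulVec_mem {m : Type*} [Fintype m] [DecidableEq m] {I : Ideal R}
    (M : Matrix m m R) (a : m → R) (h : ∀ j, M.mulVec a j ∈ I) (i : m) : M.det * a i ∈ I := by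
  have h1 : M.adjugate.mulVec (M.mulVec a) i = M.det * a i := by
    rw [Matrix.mulVec_mulVec, Matrix.adjugate_mul, Matrix.smul_mulVec, Matrix.one_mulVec]
    rfl
  rw [← h1]
  exact sum_mem fun j _ => I.mul_mem_left (M.adjugate i j) (h j)

lemma exists_mem_forall_notMem_minimalPrimes [IsNoetherianRing R] (J I : Ideal R)
    (p : PrimeSpectrum R → Prop)
    (h : ∀ P : PrimeSpectrum R, P.asIdeal ∈ J.minimalPrimes → p P → ¬ I ≤ P.asIdeal) :
    ∃ d ∈ I, ∀ P : PrimeSpectrum R, P.asIdeal ∈ J.minimalPrimes → p P → d ∉ P.asIdeal := by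
  by_contra hcon
  push Not at hcon
  have hfin : {Q : Ideal R | ∃ P : PrimeSpectrum R, P.asIdeal = Q ∧ Q ∈ J.minimalPrimes ∧ p P}.Finite :=
    (Ideal.finite_minimalPrimes_of_isNoetherianRing R J).subset fun Q hQ => hQ.choose_spec.2.1
  have h1 : (I : Set R) ⊆ ⋃ i ∈ (hfin.toFinset : Set (Ideal R)), ((id i : Ideal R) : Set R) := by
    intro d hd
    obtain ⟨P, hP, hp, hdP⟩ := hcon d hd
    refine Set.mem_biUnion (x := P.asIdeal) ?_ hdP
    rw [Set.Finite.coe_toFinset]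
    exact ⟨P, rfl, hP, hp⟩
  obtain ⟨Q, hQ, hIQ⟩ := (Ideal.subset_union_prime ⊤ ⊤ (by
    intro Q hQ _ _
    obtain ⟨P, rfl, -, -⟩ := hfin.mem_toFinset.1 hQ
    exact P.2)).1 h1
  obtain ⟨P, rfl, hP, hp⟩ := hfin.mem_toFinset.1 hQ
  exact h P hP hp hIQ

end Minors

namespace Og

variable {k : ℕ} {F : Fin (k + 1) → Og (ℂ × PhaseC (k + 1))}

/-- A function cutting down the dimension of the zero locus of `F` and `δ` is a nonzerodivisor
modulo `F` and `δ`. -/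
lemma mem_of_mul_mem_sup {r : ℕ} (hr : k = r + 1)
    (hF : ∀ i, F i ∈ IsLocalRing.maximalIdeal (Og (ℂ × PhaseC (k + 1))))
    {δ d w : Og (ℂ × PhaseC (k + 1))}
    (hd : ∀ P : PrimeSpectrum (Og (ℂ × PhaseC (k + 1))),
      fibI F ⊔ Ideal.span {δ} ⊔ Ideal.span {d} ≤ P.asIdeal → Order.coheight P ≤ r)
    (hw : d * w ∈ Ideal.span (Set.range F) ⊔ Ideal.span {δ}) :
    w ∈ Ideal.span (Set.range F) ⊔ Ideal.span {δ} := by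
  by_cases hδu : IsUnit δ
  · rw [Ideal.span_singleton_eq_top.2 hδu, sup_top_eq]
    exact Submodule.mem_top
  by_cases hdu : IsUnit d
  · exact (Ideal.unit_mul_mem_iff_mem _ hdu).1 hw
  obtain ⟨z, hz, hP, -⟩ := exists_generic (LinearMap.range (linHom (ℂ × PhaseC (k + 1))))
    (T := PEmpty.{1}) (fun _ => ℂ) r (fun _ => ℂ) (fun t => t.elim)
    (fibI F ⊔ Ideal.span {δ} ⊔ Ideal.span {d}) hd (prim_sup_span_lin _) (fun t => t.elim)
  let g : ℕ → Og (ℂ × PhaseC (k + 1)) := fun j => match j with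
    | 0 => δ
    | 1 => param (k + 1)
    | j + 2 => if h : j < r then z ⟨j, h⟩ else 0
  have hgm : ∀ i, g i ∈ IsLocalRing.maximalIdeal (Og (ℂ × PhaseC (k + 1))) := by
    rintro (_ | _ | j)
    · exact (IsLocalRing.mem_maximalIdeal _).2 hδu
    · exact mem_max.2 (ev_lin _)
    · change (if h : j < r then z ⟨j, h⟩ else 0) ∈ _
      split_ifs with h
      · obtain ⟨m, hm⟩ := hz ⟨j, h⟩
        rw [← hm]
        exact mem_max.2 (ev_lin _)
      · exact Submodule.zero_mem _
  have h1 : g '' Set.Iio 1 = {δ} := by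
    ext y
    constructor
    · rintro ⟨i, hi, rfl⟩
      obtain rfl : i = 0 := Nat.lt_one_iff.1 hi
      rfl
    · rintro rfl
      exact ⟨0, Nat.one_pos, rfl⟩
  have h2 := (mem_of_mul_mem_of_prim (a := k + 1) (b := k + 1) (F := F) (g := g) (w := d) hF hgm
    ((IsLocalRing.mem_maximalIdeal _).2 hdu) (finrank_phase (k + 1)).symm (hP.mono ?_)).2 1
    (Nat.succ_le_succ (Nat.zero_le k)) w
  · rw [h1] at h2
    exact h2 hw
  · have hg : ∀ i < k + 1, g i ∈ Ideal.span (g '' Set.Iio (k + 1)) := fun i hi =>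
      Ideal.subset_span ⟨i, hi, rfl⟩
    refine sup_le (sup_le (sup_le (sup_le ?_ ?_) ?_) ?_) ?_
    · exact le_sup_left.trans le_sup_left
    · refine le_trans ?_ (le_sup_right.trans le_sup_left)
      exact (Ideal.span_singleton_le_iff_mem _).2 (hg 1 (by omega))
    · refine le_trans ?_ (le_sup_right.trans le_sup_left)
      exact (Ideal.span_singleton_le_iff_mem _).2 (hg 0 (by omega))
    · exact le_sup_right
    · refine le_trans (Ideal.span_le.2 ?_) (le_sup_right.trans le_sup_left)
      rintro _ ⟨i, rfl⟩
      have h3 : g (i + 2) = z i := dif_pos i.2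
      rw [← h3]
      exact hg ((i : ℕ) + 2) (by have := i.2; omega)

end Og

/-- The residue field at a point of the spectrum of a complex algebra. -/
def PointField {R : Type} [CommRing R] (P : PrimeSpectrum R) : Type := P.asIdeal.ResidueField

namespace PointField

variable {R : Type} [CommRing R] (P : PrimeSpectrum R)

noncomputable instance : Field (PointField P) := inferInstanceAs (Field P.asIdeal.ResidueField)

noncomputable instance : Algebra R (PointField P) :=
  inferInstanceAs (Algebra R P.asIdeal.ResidueField)

noncomputable instance : Algebra (R ⧸ P.asIdeal) (PointField P) :=
  inferInstanceAs (Algebra (R ⧸ P.asIdeal) P.asIdeal.ResidueField)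

instance : IsScalarTower R (R ⧸ P.asIdeal) (PointField P) :=
  inferInstanceAs (IsScalarTower R (R ⧸ P.asIdeal) P.asIdeal.ResidueField)

instance : IsFractionRing (R ⧸ P.asIdeal) (PointField P) :=
  inferInstanceAs (IsFractionRing (R ⧸ P.asIdeal) P.asIdeal.ResidueField)

noncomputable instance [Algebra ℂ R] : Algebra ℂ (PointField P) :=
  inferInstanceAs (Algebra ℂ P.asIdeal.ResidueField)

instance [Algebra ℂ R] : IsScalarTower ℂ R (PointField P) :=
  inferInstanceAs (IsScalarTower ℂ R P.asIdeal.ResidueField)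

end PointField

namespace Og

variable {k : ℕ} {F : Fin (k + 1) → Og (ℂ × PhaseC (k + 1))}
  (κ : PrimeSpectrum (Og (ℂ × PhaseC (k + 1))) → Type) [∀ P, Field (κ P)]
  [∀ P, Algebra (Og (ℂ × PhaseC (k + 1))) (κ P)]
  [∀ P, Algebra (Og (ℂ × PhaseC (k + 1)) ⧸ P.asIdeal) (κ P)]
  [∀ P, IsScalarTower (Og (ℂ × PhaseC (k + 1))) (Og (ℂ × PhaseC (k + 1)) ⧸ P.asIdeal) (κ P)]
  [∀ P, IsFractionRing (Og (ℂ × PhaseC (k + 1)) ⧸ P.asIdeal) (κ P)]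
  [∀ P, Algebra ℂ (κ P)] [∀ P, IsScalarTower ℂ (Og (ℂ × PhaseC (k + 1))) (κ P)]

/-- The maximal minors of the Hamiltonian derivatives of the base coordinates. -/
noncomputable def subDet (F : Fin (k + 1) → Og (ℂ × PhaseC (k + 1)))
    (l : Fin (k + 1) → (ℂ × PhaseC (k + 1)) →L[ℂ] ℂ) (j : Fin (k + 1)) :
    Og (ℂ × PhaseC (k + 1)) :=
  (Matrix.of fun a b : Fin k => ham (F (j.succAbove a)) (lin (l b.succ))).det

lemma exists_subDet_notMem (P : PrimeSpectrum (Og (ℂ × PhaseC (k + 1))))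
    {l : Fin (k + 1) → (ℂ × PhaseC (k + 1)) →L[ℂ] ℂ}
    (h : LinearIndependent (κ P) fun i : Fin k => hamVec F (κ P) (lin (l i.succ))) :
    ∃ j, subDet F l j ∉ P.asIdeal := by
  obtain ⟨j, hj⟩ := exists_det_ne_zero h
  refine ⟨j, fun hmem => hj ?_⟩
  have h1 : algebraMap (Og (ℂ × PhaseC (k + 1))) (κ P) (subDet F l j) = 0 := by
    rw [IsScalarTower.algebraMap_apply _ (Og (ℂ × PhaseC (k + 1)) ⧸ P.asIdeal) (κ P)]
    exact (congrArg _ (Ideal.Quotient.eq_zero_iff_mem.2 hmem)).trans (map_zero _)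
  rw [subDet, RingHom.map_det] at h1
  exact h1

lemma minor_of_linearIndependent
    (hF : ∀ i, F i ∈ IsLocalRing.maximalIdeal (Og (ℂ × PhaseC (k + 1))))
    (l : Fin (k + 1) → (ℂ × PhaseC (k + 1)) →L[ℂ] ℂ) (δ : Og (ℂ × PhaseC (k + 1)))
    (h : ∀ P : PrimeSpectrum (Og (ℂ × PhaseC (k + 1))), fibI F ⊔ Ideal.span {δ} ≤ P.asIdeal →
        Order.coheight P ≤ k ∧ (Order.coheight P = k →
          LinearIndependent (κ P) fun i : Fin k => hamVec F (κ P) (lin (l i.succ))))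
    (a : Fin k → Og (ℂ × PhaseC (k + 1)))
    (ha : ∀ j, ∑ i, ham (F j) (lin (l i.succ)) * a i ∈
      Ideal.span (Set.range F) ⊔ Ideal.span {δ}) (i : Fin k) :
    a i ∈ Ideal.span (Set.range F) ⊔ Ideal.span {δ} := by
  obtain ⟨r, hr⟩ : ∃ r, k = r + 1 := ⟨k - 1, by have := i.2; omega⟩
  obtain ⟨d, hd, hdP⟩ := exists_mem_forall_notMem_minimalPrimes (fibI F ⊔ Ideal.span {δ})
    (Ideal.span (Set.range (subDet F l))) (fun P => Order.coheight P = k) (by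
      intro P hP hPk hle
      obtain ⟨j, hj⟩ := exists_subDet_notMem κ P ((h P hP.1.2).2 hPk)
      exact hj (hle (Ideal.subset_span ⟨j, rfl⟩)))
  refine mem_of_mul_mem_sup hr hF (d := d) (fun P hP => ?_) ?_
  · have h1 := (h P (le_sup_left.trans hP)).1
    have h2 : Order.coheight P ≠ k := fun h2 =>
      hdP P (mem_minimalPrimes_of_coheight (fun Q hQ => (h Q hQ).1) (le_sup_left.trans hP) h2) h2
        ((le_sup_right.trans hP) (Ideal.mem_span_singleton_self d))
    refine Order.le_of_lt_add_one ?_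
    have h3 := lt_of_le_of_ne h1 h2
    have h4 : (k : ℕ∞) = r + 1 := by exact_mod_cast hr
    exact h4 ▸ h3
  · obtain ⟨c, rfl⟩ := (Ideal.mem_span_range_iff_exists_fun).1 hd
    rw [Finset.sum_mul]
    refine sum_mem fun j _ => ?_
    rw [mul_assoc]
    exact (Ideal.span (Set.range F) ⊔ Ideal.span {δ}).mul_mem_left (c j)
      (det_mul_mem_of_mulVec_mem _ a (fun b => ha (j.succAbove b)) i)

/-- Linear coordinates in general position exist. -/
theorem IsPyr.exists_isGeneral (h : IsPyr F)
    (hF : ∀ i, F i ∈ IsLocalRing.maximalIdeal (Og (ℂ × PhaseC (k + 1)))) :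
    ∃ l, IsGeneral F l := by
  obtain ⟨l, h1, h2, h3⟩ := h.exists_coords PointField
  have hg : ∀ i < k + 1, plb l (up _ (bseq k i)) ∈ gI F l (k + 1) := fun i hi =>
    le_sup_right (a := Ideal.span (Set.range F)) (Ideal.subset_span ⟨i, hi, rfl⟩)
  have hfib : fibI F ≤ gI F l (k + 1) := by
    refine sup_le le_sup_left ((Ideal.span_singleton_le_iff_mem _).2 ?_)
    rw [← plb_bseq_zero l]
    exact hg 0 (Nat.succ_pos k)
  have hl : ∀ i : Fin k, lin (l i.succ) ∈ gI F l (k + 1) := fun i => by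
    rw [← plb_bseq_succ l i]
    exact hg _ (Nat.succ_lt_succ i.2)
  refine ⟨l, h.comm, hF, h1.mono ?_, h2.mono ?_,
    minor_of_linearIndependent (PointField) hF l (linDet F l) h3⟩
  · refine sup_le (hfib.trans le_sup_left) (Ideal.span_le.2 ?_)
    rintro _ ⟨i, rfl⟩
    refine Fin.cases ?_ (fun i => ?_) i
    · exact le_sup_right (a := gI F l (k + 1)) (Ideal.mem_span_singleton_self _)
    · exact le_sup_left (b := Ideal.span {lin (l 0)}) (hl i)
  · refine sup_le (sup_le (hfib.trans le_sup_left) le_sup_right) (Ideal.span_le.2 ?_)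
    rintro _ ⟨i, rfl⟩
    exact le_sup_left (b := Ideal.span {linDet F l}) (hl i)

end Og

/-- Deformations of pyramidal reduced Lagrangian complete intersections satisfy the dimension
conditions. -/
lemma Og.isPyr_of_isIntegrableDef {n : ℕ} {H : Fin n → Og (PhaseC n)}
    (hred : IsReducedLagrangianCI H) (hpyr : IsPyramidal H) {F : Fin n → Og (ℂ × PhaseC n)}
    (hF : IsIntegrableDef H F) : Og.IsPyr F where
  comm := hF.2
  coheight_le P hP := coheight_le_of_isReducedLagrangianCI hred hF.1 P (fibI_le.1 hP).2
    (fibI_le.1 hP).1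
  coheight_le_of_minors P hP _ hr hdet := coheight_le_of_isPyramidal hpyr hF.1 P (fibI_le.1 hP).2
    (fibI_le.1 hP).1 hr hdet

/-- **Freeness over a one-dimensional base.**  For any integrable Lagrangian
deformation `F`, over `(ℂ,0)`, of a moment map germ defining a pyramidal reduced
Lagrangian complete intersection, the first Lagrangian cohomology `H¹(C_F)` is a free
`𝒪₁ = ℂ{t}`-module: there is a family of cocycles whose classes form a basis. -/
theorem lagrangian_H1_free_one_dim_base {n : ℕ}
    (H : Fin n → Og (PhaseC n)) (hH : IsMomentMap H)
    (hred : IsReducedLagrangianCI H) (hpyr : IsPyramidal H)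
    (F : Fin n → Og (ℂ × PhaseC n)) (hF : IsIntegrableDef H F) :
    ∃ (ι : Type) (e : ι → (Fin n → Og (ℂ × PhaseC n))),
      (∀ a, e a ∈ lagCocycle1 F) ∧
      ∀ m ∈ lagCocycle1 F, ∃! c : ι →₀ Og ℂ,
        (m - c.sum fun a ψ => fun i => lift1 ψ * e a i) ∈ lagCoboundary1 F := by
  rcases n with _ | k
  · exact ⟨Empty, fun a => a.elim, fun a => a.elim, fun m _ =>
      ⟨0, ⟨0, fun i => i.elim0⟩, fun c _ => Subsingleton.elim _ _⟩⟩
  · have hFm : ∀ i, F i ∈ IsLocalRing.maximalIdeal (Og (ℂ × PhaseC (k + 1))) := fun i => by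
      have h1 : Og.ev _ (slice0 (F i)) = 0 := by
        rw [hF.1 i]
        exact hH.1 i
      rw [Og.slice0_eq, Og.ev_pl] at h1
      exact Og.mem_max.2 h1
    obtain ⟨l, hl⟩ := (Og.isPyr_of_isIntegrableDef hred hpyr hF).exists_isGeneral hFm
    obtain ⟨ι, e, he, hm⟩ := hl.exists_basis
    refine ⟨ι, e, fun a i j => ?_, fun m hmc => ?_⟩
    · rw [← Og.ham_apply, ← Og.ham_apply]
      exact he a i j
    · obtain ⟨c, ⟨g, hg⟩, huniq⟩ := hm m fun i j => by
        rw [Og.ham_apply, Og.ham_apply]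
        exact hmc i j
      refine ⟨c, ⟨g, fun i => ?_⟩, fun c' hc' => huniq c' ?_⟩
      · rw [← Og.ham_apply]
        exact hg i
      · obtain ⟨g', hg'⟩ := hc'
        refine ⟨g', fun i => ?_⟩
        rw [Og.ham_apply]
        exact hg' i
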